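/- Let p be a prime with p ≡ 9 (mod 16) such that 2 is a fourth power residue modulo p, and let r ≥ 0 be the integer with 2^r = h₂(-2p). Then for every integer n ≥ 1, the 2-class group of L_{n,p} is isomorphic to (ℤ/2^{n+r-2}ℤ) × (ℤ/2ℤ). -/

import Mathlib

open IntermediateField NumberField

/-- The quadratic field `ℚ(√m)` realized inside `ℂ` (for `m` of either sign). -/
noncomputable def quadField (m : ℤ) : IntermediateField ℚ ℂ :=
  IntermediateField.adjoin ℚ {z : ℂ | z ^ 2 = (m : ℂ)}

/-- The 2-class group of a number field `K ⊆ ℂ`: the 2-primary component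
(= 2-Sylow subgroup) of the ideal class group of its ring of integers. -/
noncomputable def twoClassGroup (K : IntermediateField ℚ ℂ) :
    Subgroup (ClassGroup (𝓞 K)) :=
  CommGroup.primaryComponent _ 2

/-- `h₂(m)`: the 2-class number of the quadratic field `ℚ(√m)`. -/
noncomputable def h2 (m : ℤ) : ℕ := Nat.card (twoClassGroup (quadField m))

/-- `L_{n,d} = ℚ(ζ_{2^{n+2}}, √d)`, the `n`-th layer of the cyclotomic
`ℤ₂`-extension of `ℚ(√d, √-1)`. -/
noncomputable def Lfield (n : ℕ) (d : ℤ) : IntermediateField ℚ ℂ :=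
  IntermediateField.adjoin ℚ
    ({z : ℂ | z ^ 2 ^ (n + 2) = 1} ∪ {z : ℂ | z ^ 2 = (d : ℂ)})

/-- `ℚ(ζ_{2^{n+2}} + ζ_{2^{n+2}}⁻¹, √d) = ℚ(2cos(2π/2^{n+2}), √d)`.
For `d > 0` this is the maximal real subfield `L_{n,d}⁺` of `L_{n,d}`;
for `d < 0` it is the `n`-th layer `K_{n,|d|}` of the cyclotomic
`ℤ₂`-extension of the imaginary quadratic field `ℚ(√d)`. -/
noncomputable def LplusField (n : ℕ) (d : ℤ) : IntermediateField ℚ ℂ :=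
  IntermediateField.adjoin ℚ
    ({((2 * Real.cos (2 * Real.pi / 2 ^ (n + 2)) : ℝ) : ℂ)} ∪ {z : ℂ | z ^ 2 = (d : ℂ)})



/-! ### Abstract index computations -/

theorem index_range_two_prod {X Y : Type*} [AddCommGroup X] [AddCommGroup Y] :
    (nsmulAddMonoidHom (α := X × Y) 2).range.index =
      (nsmulAddMonoidHom (α := X) 2).range.index * (nsmulAddMonoidHom (α := Y) 2).range.index := by
  rw [← AddSubgroup.index_prod]
  congr 1
  ext ⟨x, y⟩
  simp only [AddMonoidHom.mem_range, nsmulAddMonoidHom_apply, AddSubgroup.mem_prod, Prod.exists,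
    Prod.smul_mk, Prod.mk.injEq]
  constructor
  · rintro ⟨a, b, h1, h2⟩; exact ⟨⟨a, h1⟩, ⟨b, h2⟩⟩
  · rintro ⟨⟨a, h1⟩, ⟨b, h2⟩⟩; exact ⟨a, b, h1, h2⟩

theorem index_range_two_equiv {X Y : Type*} [AddCommGroup X] [AddCommGroup Y] (e : X ≃+ Y) :
    (nsmulAddMonoidHom (α := X) 2).range.index = (nsmulAddMonoidHom (α := Y) 2).range.index := by
  rw [← AddSubgroup.index_map_equiv _ e]
  congr 1
  ext y
  simp only [AddSubgroup.mem_map, AddMonoidHom.mem_range, nsmulAddMonoidHom_apply]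
  constructor
  · rintro ⟨_, ⟨a, rfl⟩, rfl⟩; exact ⟨e a, by simp⟩
  · rintro ⟨a, rfl⟩; exact ⟨2 • e.symm a, ⟨_, rfl⟩, by simp⟩

theorem index_range_two_free (n : ℕ) :
    (nsmulAddMonoidHom (α := Fin n → ℤ) 2).range.index = 2 ^ n := by
  let f : (Fin n → ℤ) →+ (Fin n → ZMod 2) :=
    { toFun := fun v i => (v i : ZMod 2)
      map_zero' := by ext; simp
      map_add' := by intros; ext; simp }
  have hf : Function.Surjective f := by
    intro w
    choose g hg using fun i => ZMod.intCast_surjective (w i)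
    exact ⟨g, by ext i; simp [f, hg]⟩
  have : (nsmulAddMonoidHom (α := Fin n → ℤ) 2).range = f.ker := by
    ext v
    simp only [AddMonoidHom.mem_range, nsmulAddMonoidHom_apply, AddMonoidHom.mem_ker]
    constructor
    · rintro ⟨a, rfl⟩
      ext i
      have : (2 : ZMod 2) = 0 := by decide
      simp [f, this]
    · intro h
      have : ∀ i, ∃ k, v i = 2 * k := by
        intro i
        have := congrFun h i
        simp only [f, AddMonoidHom.coe_mk, ZeroHom.coe_mk, Pi.zero_apply] at this
        exact (ZMod.intCast_zmod_eq_zero_iff_dvd _ 2).1 this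
      choose k hk using this
      exact ⟨k, by ext i; simp [hk]⟩
  rw [this, AddSubgroup.index_ker, AddMonoidHom.range_eq_top.2 hf]
  simp

theorem index_range_two_finite (X : Type*) [AddCommGroup X] [Finite X] :
    (nsmulAddMonoidHom (α := X) 2).range.index = Nat.card {x : X // 2 • x = 0} := by
  have h1 := AddSubgroup.index_mul_card (nsmulAddMonoidHom (α := X) 2).range
  have h2 := AddSubgroup.index_mul_card (nsmulAddMonoidHom (α := X) 2).ker
  rw [AddSubgroup.index_ker] at h2
  have h3 : Nat.card (nsmulAddMonoidHom (α := X) 2).ker = Nat.card {x : X // 2 • x = 0} :=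
    Nat.card_congr (Equiv.refl _)
  rw [← h3]
  have : 0 < Nat.card (nsmulAddMonoidHom (α := X) 2).range := Nat.card_pos
  refine Nat.eq_of_mul_eq_mul_left this ?_
  rw [h2, mul_comm, h1]

theorem finrank_range_add_ker_int {V W : Type*} [AddCommGroup V] [AddCommGroup W]
    [Module.Finite ℤ V] (f : V →ₗ[ℤ] W) :
    Module.finrank ℤ (LinearMap.range f) + Module.finrank ℤ (LinearMap.ker f) =
      Module.finrank ℤ V := by
  rw [← (f.quotKerEquivRange).finrank_eq]
  exact Submodule.finrank_quotient_add_finrank _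

theorem index_range_two (A : Type*) [AddCommGroup A] [Module.Finite ℤ A] :
    (nsmulAddMonoidHom (α := A) 2).range.index =
      2 ^ (Module.finrank ℤ A) * Nat.card {x : A // 2 • x = 0} := by
  classical
  obtain ⟨n, ι, _, p, hp, e, ⟨f⟩⟩ := Module.equiv_free_prod_directSum (R := ℤ) (M := A)
  set D := (DirectSum ι fun i => ℤ ⧸ Submodule.span ℤ {p i ^ e i}) with hD
  have hfin : ∀ i, Finite (ℤ ⧸ Submodule.span ℤ {p i ^ e i}) := fun i => by
    have : p i ^ e i ≠ 0 := pow_ne_zero _ (hp i).ne_zero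
    have := Int.quotientSpanEquivZMod (p i ^ e i)
    have h0 : NeZero (p i ^ e i).natAbs := ⟨by simpa using fun h => absurd h (hp i).ne_zero⟩
    exact Finite.of_equiv (ZMod (p i ^ e i).natAbs) (Int.quotientSpanEquivZMod (p i ^ e i)).symm.toEquiv
  have hDfin : Finite D :=
    Finite.of_equiv (∀ i, (ℤ ⧸ Submodule.span ℤ {p i ^ e i})) 
      (DirectSum.addEquivProd (fun i => ℤ ⧸ Submodule.span ℤ {p i ^ e i})).symm.toEquiv
  have g : A ≃ₗ[ℤ] ((Fin n → ℤ) × D) :=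
    f.trans (LinearEquiv.prodCongr (Finsupp.linearEquivFunOnFinite ℤ ℤ (Fin n)) (LinearEquiv.refl ℤ D))
  rw [index_range_two_equiv g.toAddEquiv, index_range_two_prod, index_range_two_free,
    index_range_two_finite]
  have hDt : Module.finrank ℤ D = 0 := by
    apply Module.finrank_eq_zero_of_rank_eq_zero
    rw [rank_eq_zero_iff]
    intro x
    have : 0 < Nat.card D := Nat.card_pos
    refine ⟨(Nat.card D : ℤ), by exact_mod_cast this.ne', ?_⟩
    rw [natCast_zsmul]; exact card_nsmul_eq_zero'
  have hr : Module.finrank ℤ A = n := by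
    rw [g.finrank_eq]
    have h1 := finrank_range_add_ker_int (LinearMap.snd ℤ (Fin n → ℤ) D)
    rw [LinearMap.range_eq_top.2 Prod.snd_surjective, finrank_top, hDt, zero_add] at h1
    rw [← h1]
    rw [LinearMap.ker_snd, LinearMap.finrank_range_of_inj LinearMap.inl_injective]
    simp
  rw [hr]
  congr 1
  refine Nat.card_congr ?_
  refine (Equiv.symm ?_)
  refine (g.toEquiv.subtypeEquiv (q := fun y => 2 • y = 0) (by
      intro a
      change 2 • a = 0 ↔ 2 • g a = 0
      rw [← map_nsmul, LinearEquiv.map_eq_zero_iff])).trans ?_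
  refine ⟨fun y => ⟨y.1.2, congrArg Prod.snd y.2⟩, fun d => ⟨(0, d.1), ?_⟩, ?_, ?_⟩
  · exact Prod.ext (by simp) (by simpa using d.2)
  · rintro ⟨⟨v, d⟩, h⟩
    have hv : v = 0 := by
      have h' : (2:ℕ) • v = 0 := congrArg Prod.fst h
      ext i
      have := congrFun h' i
      simpa using this
    subst hv; rfl
  · rintro ⟨d, h⟩; rfl

/-- Herbrand quotient computation for an involution on a finitely generated abelian group.
`V` plays the role of the units upstairs, `W` the units downstairs. -/
theorem herbrand_index {V W : Type*} [AddCommGroup V] [AddCommGroup W]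
    [Module.Finite ℤ V] [Module.Finite ℤ W]
    (i : W →ₗ[ℤ] V) (N : V →ₗ[ℤ] W) (s : V →ₗ[ℤ] V) (hi : Function.Injective i)
    (hN : ∀ v, i (N v) = v + s v) (hs : ∀ v, s (s v) = v)
    (hfix : ∀ v, s v = v ↔ v ∈ LinearMap.range i) :
    N.toAddMonoidHom.range.index * 2 ^ (Module.finrank ℤ V) *
        Nat.card {x : LinearMap.ker N // 2 • x = 0} =
      ((LinearMap.id - s).toAddMonoidHom.range.relIndex N.toAddMonoidHom.ker) *
        2 ^ (2 * Module.finrank ℤ W) * Nat.card {x : W // 2 • x = 0} := by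
  set D : V →ₗ[ℤ] V := LinearMap.id - s with hD
  have hDa : ∀ v, D v = v - s v := fun v => by simp [hD]
  have hkerD : ∀ v, D v = 0 ↔ v ∈ LinearMap.range i := fun v => by
    rw [hDa, sub_eq_zero, eq_comm, hfix]
  have hkerN : ∀ v, N v = 0 ↔ v + s v = 0 := fun v => by
    rw [← hN]; constructor
    · intro h; simp [h]
    · intro h; exact hi (by simpa using h)
  have hsi : ∀ w, s (i w) = i w := fun w => (hfix _).2 ⟨w, rfl⟩
  have hNi : ∀ w, N (i w) = 2 • w := fun w => hi (by rw [hN, hsi, map_nsmul, two_nsmul])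
  have hDN : ∀ v, N (D v) = 0 := fun v => by
    rw [hkerN, hDa, map_sub, hs]; abel
  have hDk : ∀ v, N v = 0 → D v = 2 • v := fun v hv => by
    rw [hkerN] at hv
    rw [hDa, two_nsmul, ← sub_eq_zero]
    have : v - s v - (v + v) = -(v + s v) := by abel
    rw [this, hv, neg_zero]
  -- the common group
  let C : AddSubgroup V := i.toAddMonoidHom.range ⊔ N.toAddMonoidHom.ker
  -- ranks
  have hrk : Module.finrank ℤ V = Module.finrank ℤ W + Module.finrank ℤ (LinearMap.ker N) := by
    rw [← finrank_range_add_ker_int N]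
    congr 1
    apply le_antisymm
    · exact Submodule.finrank_le _
    · rw [← finrank_range_add_ker_int (N ∘ₗ i)]
      have : LinearMap.ker (N ∘ₗ i) = (LinearMap.lsmul ℤ W 2).ker := by
        ext w; simp [hNi, ← natCast_zsmul]
      have h0 : Module.finrank ℤ (LinearMap.ker (N ∘ₗ i)) = 0 := by
        apply Module.finrank_eq_zero_of_rank_eq_zero
        rw [rank_eq_zero_iff]
        rintro ⟨x, hx⟩
        refine ⟨2, two_ne_zero, ?_⟩
        rw [this] at hx
        ext
        simpa using hx
      rw [h0, add_zero]
      exact Submodule.finrank_mono (LinearMap.range_comp_le_range i N)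
  have hW := index_range_two W
  have hK := index_range_two (LinearMap.ker N)
  -- [W : 2W] = [W : N V] [N V : 2 W]
  have e1 : (nsmulAddMonoidHom (α := W) 2).range = C.map N.toAddMonoidHom := by
    ext w
    simp only [AddMonoidHom.mem_range, nsmulAddMonoidHom_apply, AddSubgroup.mem_map, C]
    constructor
    · rintro ⟨x, rfl⟩
      exact ⟨i x, AddSubgroup.mem_sup_left ⟨x, rfl⟩, hNi x⟩
    · rintro ⟨v, hv, rfl⟩
      obtain ⟨_, ⟨x, rfl⟩, z, hz, rfl⟩ := AddSubgroup.mem_sup.1 hv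
      refine ⟨x, ?_⟩
      rw [map_add, (AddMonoidHom.mem_ker.1 hz), add_zero]
      exact (hNi x).symm
  have f1 : (C.map N.toAddMonoidHom).index = C.index * N.toAddMonoidHom.range.index := by
    rw [AddSubgroup.index_map, sup_eq_left.2]
    exact le_sup_right
  have e2 : ((nsmulAddMonoidHom (α := LinearMap.ker N) 2).range.map
      (LinearMap.ker N).toAddSubgroup.subtype) = C.map D.toAddMonoidHom := by
    ext v
    simp only [AddSubgroup.mem_map, C]
    constructor
    · rintro ⟨_, ⟨x, rfl⟩, rfl⟩
      exact ⟨x.1, AddSubgroup.mem_sup_right x.2, hDk _ x.2⟩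
    · rintro ⟨v, hv, rfl⟩
      obtain ⟨_, ⟨x, rfl⟩, z, hz, rfl⟩ := AddSubgroup.mem_sup.1 hv
      refine ⟨2 • ⟨z, hz⟩, ⟨⟨z, hz⟩, rfl⟩, ?_⟩
      rw [map_add]
      have : D.toAddMonoidHom (i.toAddMonoidHom x) = 0 := (hkerD _).2 ⟨x, rfl⟩
      rw [this, zero_add]
      exact (hDk _ hz).symm
  have f2 : (nsmulAddMonoidHom (α := LinearMap.ker N) 2).range.index =
      C.index * D.toAddMonoidHom.range.relIndex N.toAddMonoidHom.ker := by
    have a1 : (nsmulAddMonoidHom (α := LinearMap.ker N) 2).range.index =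
        (C.map D.toAddMonoidHom).relIndex N.toAddMonoidHom.ker := by
      rw [← e2, AddSubgroup.relIndex, AddSubgroup.addSubgroupOf]
      congr 1
      exact (AddSubgroup.comap_map_eq_self_of_injective
        (AddSubgroup.subtype_injective (LinearMap.ker N).toAddSubgroup) _).symm
    have a2 : C.map D.toAddMonoidHom ≤ D.toAddMonoidHom.range := by
      rintro _ ⟨x, -, rfl⟩; exact ⟨x, rfl⟩
    have a3 : D.toAddMonoidHom.range ≤ N.toAddMonoidHom.ker := by
      rintro _ ⟨x, rfl⟩; exact hDN x
    rw [a1, ← AddSubgroup.relIndex_mul_relIndex _ _ _ a2 a3]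
    congr 1
    have := AddSubgroup.relIndex_map_map D.toAddMonoidHom C ⊤
    rw [← AddMonoidHom.range_eq_map] at this
    rw [this, top_sup_eq, sup_eq_left.2, AddSubgroup.relIndex_top_right]
    intro x hx
    obtain ⟨w, rfl⟩ := (hkerD x).1 hx
    exact AddSubgroup.mem_sup_left ⟨w, rfl⟩
  rw [e1, f1] at hW
  rw [f2] at hK
  have hC : C.index ≠ 0 := by
    intro h
    rw [h, zero_mul] at hW
    have : Finite {x : W // 2 • x = 0} := by
      have := Module.finite_of_fg_torsion (LinearMap.lsmul ℤ W 2).ker (by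
        rintro ⟨x, hx⟩
        refine ⟨⟨2, by simp⟩, ?_⟩
        ext; simpa using hx)
      refine Finite.of_injective (β := (LinearMap.lsmul ℤ W 2).ker) (fun x => ⟨x.1, ?_⟩) ?_
      · have := x.2; simpa [← natCast_zsmul] using this
      · rintro ⟨x, _⟩ ⟨y, _⟩ h; simpa using h
    have h1 : 0 < Nat.card {x : W // 2 • x = 0} := by
      have : Nonempty {x : W // 2 • x = 0} := ⟨0, by simp⟩
      exact Nat.card_pos
    have : 0 < 2 ^ (Module.finrank ℤ W) := by positivity
    nlinarith
  set a := N.toAddMonoidHom.range.index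
  set b := D.toAddMonoidHom.range.relIndex N.toAddMonoidHom.ker
  set k2 := Nat.card {x : LinearMap.ker N // 2 • x = 0}
  set w2 := Nat.card {x : W // 2 • x = 0}
  set rk := Module.finrank ℤ (LinearMap.ker N)
  set rw' := Module.finrank ℤ W
  rw [hrk, pow_add, two_mul, pow_add]
  have hCp : 0 < C.index := Nat.pos_of_ne_zero hC
  apply Nat.eq_of_mul_eq_mul_left hCp
  calc C.index * (a * (2 ^ rw' * 2 ^ rk) * k2) = (C.index * a) * 2 ^ rw' * (2 ^ rk * k2) := by ring
    _ = (C.index * b) * (2 ^ rw') * (2 ^ rw' * w2) := by rw [hW, ← hK]; ring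
    _ = _ := by ring


open NumberField

set_option linter.unusedSectionVars false

/-! ### Ideals and class groups: functoriality -/

section ClassGroups

open scoped nonZeroDivisors

/-- the class of a nonzero ideal (and `1` for the zero ideal) -/
noncomputable def cl {R : Type*} [CommRing R] [IsDedekindDomain R] (I : Ideal R) : ClassGroup R := by
  classical
  exact if h : I ≠ ⊥ then ClassGroup.mk0 ⟨I, mem_nonZeroDivisors_of_ne_zero h⟩ else 1

variable {R : Type*} [CommRing R] [IsDedekindDomain R]

theorem cl_of_ne {I : Ideal R} (h : I ≠ ⊥) :
    cl I = ClassGroup.mk0 ⟨I, mem_nonZeroDivisors_of_ne_zero h⟩ := by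
  simp [cl, h]

theorem cl_surj (c : ClassGroup R) : ∃ I : Ideal R, I ≠ ⊥ ∧ cl I = c := by
  obtain ⟨⟨I, hI⟩, rfl⟩ := ClassGroup.mk0_surjective c
  have h0 : I ≠ ⊥ := nonZeroDivisors.ne_zero hI
  exact ⟨I, h0, cl_of_ne h0⟩

theorem cl_mul {I J : Ideal R} (hI : I ≠ ⊥) (hJ : J ≠ ⊥) : cl (I * J) = cl I * cl J := by
  rw [cl_of_ne hI, cl_of_ne hJ, ← map_mul, cl_of_ne (mul_ne_zero hI hJ)]
  rfl

theorem cl_pow {I : Ideal R} (hI : I ≠ ⊥) (n : ℕ) : cl (I ^ n) = cl I ^ n := by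
  rw [cl_of_ne hI, ← map_pow, cl_of_ne (pow_ne_zero n hI)]
  rfl

theorem cl_eq_one_iff {I : Ideal R} (hI : I ≠ ⊥) : cl I = 1 ↔ ∃ x, x ≠ 0 ∧ I = Ideal.span {x} := by
  rw [cl_of_ne hI, ClassGroup.mk0_eq_one_iff]
  constructor
  · rintro ⟨x, hx⟩
    refine ⟨x, ?_, hx⟩
    rintro rfl
    exact hI (by rw [hx]; simp)
  · rintro ⟨x, -, hx⟩; exact ⟨x, hx⟩

theorem cl_span {x : R} (hx : x ≠ 0) : cl (Ideal.span {x}) = 1 :=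
  (cl_eq_one_iff (by simpa using hx)).2 ⟨x, hx, rfl⟩

theorem cl_eq_iff {I J : Ideal R} (hI : I ≠ ⊥) (hJ : J ≠ ⊥) :
    cl I = cl J ↔ ∃ x y : R, x ≠ 0 ∧ y ≠ 0 ∧ Ideal.span {x} * I = Ideal.span {y} * J := by
  rw [cl_of_ne hI, cl_of_ne hJ, ClassGroup.mk0_eq_mk0_iff]
  constructor
  · rintro ⟨x, y, hx, hy, h⟩; exact ⟨x, y, hx, hy, h⟩
  · rintro ⟨x, y, hx, hy, h⟩; exact ⟨x, y, hx, hy, h⟩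

theorem cl_one : cl (1 : Ideal R) = 1 := by
  rw [Ideal.one_eq_top, ← Ideal.span_singleton_one]; exact cl_span one_ne_zero

theorem span_ne_bot {x : R} (hx : x ≠ 0) : Ideal.span {x} ≠ ⊥ := by simpa using hx

/-- a homomorphism on ideals killing principal ideals descends to the class group -/
noncomputable def liftCl {G : Type*} [CommGroup G] (f : Ideal R → G)
    (hmul : ∀ I J, I ≠ ⊥ → J ≠ ⊥ → f (I * J) = f I * f J)
    (hpr : ∀ x : R, x ≠ 0 → f (Ideal.span {x}) = 1) : ClassGroup R →* G where
  toFun c := f (cl_surj c).choose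
  map_one' := by
    obtain ⟨h1, h2⟩ := (cl_surj (1 : ClassGroup R)).choose_spec
    obtain ⟨x, hx, h⟩ := (cl_eq_one_iff h1).1 h2
    rw [h, hpr _ hx]
  map_mul' a b := by
    obtain ⟨h1, h2⟩ := (cl_surj a).choose_spec
    obtain ⟨h3, h4⟩ := (cl_surj b).choose_spec
    obtain ⟨h5, h6⟩ := (cl_surj (a * b)).choose_spec
    have : cl (cl_surj (a * b)).choose = cl ((cl_surj a).choose * (cl_surj b).choose) := by
      rw [h6, cl_mul h1 h3, h2, h4]
    obtain ⟨x, y, hx, hy, h⟩ := (cl_eq_iff h5 (mul_ne_zero h1 h3)).1 this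
    have := congrArg f h
    rw [hmul _ _ (span_ne_bot hx) h5, hmul _ _ (span_ne_bot hy) (mul_ne_zero h1 h3),
      hpr _ hx, hpr _ hy, one_mul, one_mul, hmul _ _ h1 h3] at this
    exact this

theorem liftCl_cl {G : Type*} [CommGroup G] (f : Ideal R → G)
    (hmul : ∀ I J, I ≠ ⊥ → J ≠ ⊥ → f (I * J) = f I * f J)
    (hpr : ∀ x : R, x ≠ 0 → f (Ideal.span {x}) = 1) {I : Ideal R} (hI : I ≠ ⊥) :
    liftCl f hmul hpr (cl I) = f I := by
  obtain ⟨h5, h6⟩ := (cl_surj (cl I)).choose_spec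
  obtain ⟨x, y, hx, hy, h⟩ := (cl_eq_iff h5 hI).1 h6
  have := congrArg f h
  rw [hmul _ _ (span_ne_bot hx) h5, hmul _ _ (span_ne_bot hy) hI,
      hpr _ hx, hpr _ hy, one_mul, one_mul] at this
  exact this

theorem ideal_pow_inj {I J : Ideal R} {n : ℕ} (hn : n ≠ 0) (h : I ^ n = J ^ n) : I = J := by
  classical
  by_cases hI : I = ⊥
  · subst hI
    rw [← Ideal.zero_eq_bot, zero_pow hn] at h
    exact (pow_eq_zero_iff hn).1 h.symm |>.symm
  by_cases hJ : J = ⊥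
  · subst hJ
    rw [← Ideal.zero_eq_bot, zero_pow hn] at h
    exact (pow_eq_zero_iff hn).1 h
  have h2 := congrArg UniqueFactorizationMonoid.normalizedFactors h
  rw [UniqueFactorizationMonoid.normalizedFactors_pow,
    UniqueFactorizationMonoid.normalizedFactors_pow] at h2
  have h3 : UniqueFactorizationMonoid.normalizedFactors I =
      UniqueFactorizationMonoid.normalizedFactors J := by
    ext P
    have := congrArg (Multiset.count P) h2
    rw [Multiset.count_nsmul, Multiset.count_nsmul] at this
    exact Nat.eq_of_mul_eq_mul_left (Nat.pos_of_ne_zero hn) this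
  have := (UniqueFactorizationMonoid.associated_iff_normalizedFactors_eq_normalizedFactors
    (x := I) (y := J) hI hJ).2 h3
  exact associated_iff_eq.1 this

end ClassGroups

section Fields

variable (K L M : Type*) [Field K] [Field L] [Field M] [NumberField K] [NumberField L]
  [NumberField M] [Algebra K L] [Algebra L M] [Algebra K M] [IsScalarTower K L M]

instance instFiniteOO : Module.Finite (𝓞 K) (𝓞 L) :=
  Module.Finite.of_restrictScalars_finite ℤ (𝓞 K) (𝓞 L)

instance instFDKL : FiniteDimensional K L :=
  Module.Finite.of_restrictScalars_finite ℚ K L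

instance instTowerOO : IsScalarTower (𝓞 K) (𝓞 L) (𝓞 M) := by
  refine IsScalarTower.of_algebraMap_eq fun x => ?_
  apply RingOfIntegers.ext
  exact IsScalarTower.algebraMap_apply K L M x

/-- relative norm of ideals -/
noncomputable def rN : Ideal (𝓞 L) →*₀ Ideal (𝓞 K) := Ideal.relNorm (𝓞 K)

/-- norm of integers -/
noncomputable def nI : 𝓞 L →* 𝓞 K := Algebra.intNorm (𝓞 K) (𝓞 L)

/-- extension of ideals -/
noncomputable def jI (I : Ideal (𝓞 K)) : Ideal (𝓞 L) := I.map (algebraMap (𝓞 K) (𝓞 L))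

variable {L} in
/-- conjugate ideal -/
noncomputable def sI (σ : L ≃+* L) (I : Ideal (𝓞 L)) : Ideal (𝓞 L) :=
  I.map (RingOfIntegers.mapRingEquiv σ : 𝓞 L →+* 𝓞 L)

variable {K L M}

theorem nI_coe (x : 𝓞 L) : ((nI K L x : 𝓞 K) : K) = Algebra.norm K (x : L) :=
  Algebra.algebraMap_intNorm (A := 𝓞 K) (K := K) (L := L) (B := 𝓞 L) x

theorem nI_ne_zero {x : 𝓞 L} (hx : x ≠ 0) : nI K L x ≠ 0 := by
  intro h
  have := nI_coe (K := K) x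
  rw [h] at this
  have h2 : Algebra.norm K (x : L) = 0 := by simpa using this.symm
  rw [Algebra.norm_eq_zero_iff] at h2
  exact hx (by exact_mod_cast h2)

theorem rN_span (x : 𝓞 L) : rN K L (Ideal.span {x}) = Ideal.span {nI K L x} :=
  Ideal.relNorm_singleton (𝓞 K) x

theorem rN_ne_bot {I : Ideal (𝓞 L)} (hI : I ≠ ⊥) : rN K L I ≠ ⊥ := fun h =>
  hI (Ideal.relNorm_eq_bot_iff.1 h)

theorem finrank_OO : Module.finrank (𝓞 K) (𝓞 L) = Module.finrank K L :=
  (IsFractionRing.finrank_eq (𝓞 K) K (𝓞 L) L).symm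

theorem rN_jI (I : Ideal (𝓞 K)) : rN K L (jI K L I) = I ^ Module.finrank K L := by
  rw [← finrank_OO]
  exact Ideal.relNorm_algebraMap (𝓞 L) I

theorem rN_rN (I : Ideal (𝓞 M)) : rN K L (rN L M I) = rN K M I :=
  Ideal.relNorm_relNorm (𝓞 K) (𝓞 L) I

theorem absNorm_rN (I : Ideal (𝓞 L)) : Ideal.absNorm (rN K L I) = Ideal.absNorm I :=
  Ideal.absNorm_relNorm (𝓞 K) (𝓞 L) I

theorem jI_mul (I J : Ideal (𝓞 K)) : jI K L (I * J) = jI K L I * jI K L J := Ideal.map_mul _ _ _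

theorem jI_pow (I : Ideal (𝓞 K)) (n : ℕ) : jI K L (I ^ n) = jI K L I ^ n := Ideal.map_pow _ _ _

theorem jI_span (x : 𝓞 K) : jI K L (Ideal.span {x}) = Ideal.span {algebraMap (𝓞 K) (𝓞 L) x} := by
  rw [jI, Ideal.map_span, Set.image_singleton]

theorem jI_ne_bot {I : Ideal (𝓞 K)} (hI : I ≠ ⊥) : jI K L I ≠ ⊥ := fun h =>
  hI ((Ideal.map_eq_bot_iff_of_injective (FaithfulSMul.algebraMap_injective (𝓞 K) (𝓞 L))).1 h)

theorem jI_jI (I : Ideal (𝓞 K)) : jI L M (jI K L I) = jI K M I := by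
  rw [jI, jI, jI, Ideal.map_map, ← IsScalarTower.algebraMap_eq]

theorem jI_inj {I J : Ideal (𝓞 K)} (h : jI K L I = jI K L J) : I = J := by
  have := congrArg (rN K L) h
  rw [rN_jI, rN_jI] at this
  exact ideal_pow_inj (Module.finrank_pos).ne' this

theorem sI_mul (σ : L ≃+* L) (I J : Ideal (𝓞 L)) : sI σ (I * J) = sI σ I * sI σ J :=
  Ideal.map_mul _ _ _

theorem sI_pow (σ : L ≃+* L) (I : Ideal (𝓞 L)) (n : ℕ) : sI σ (I ^ n) = sI σ I ^ n :=
  Ideal.map_pow _ _ _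

/-- action on integers -/
noncomputable abbrev sO (σ : L ≃+* L) : 𝓞 L ≃+* 𝓞 L := RingOfIntegers.mapRingEquiv σ

theorem sO_coe (σ : L ≃+* L) (x : 𝓞 L) : ((sO σ x : 𝓞 L) : L) = σ x := rfl

theorem sI_span (σ : L ≃+* L) (x : 𝓞 L) : sI σ (Ideal.span {x}) = Ideal.span {sO σ x} := by
  rw [sI, Ideal.map_span, Set.image_singleton]; rfl

theorem mem_sI (σ : L ≃+* L) (I : Ideal (𝓞 L)) (x : 𝓞 L) : sO σ x ∈ sI σ I ↔ x ∈ I := by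
  change sO σ x ∈ Ideal.map (sO σ) I ↔ _
  rw [Ideal.mem_map_of_equiv]
  constructor
  · rintro ⟨y, hy, h⟩; rwa [← (sO σ).injective h]
  · intro h; exact ⟨x, h, rfl⟩

theorem sI_sI (σ τ : L ≃+* L) (I : Ideal (𝓞 L)) : sI σ (sI τ I) = sI (τ.trans σ) I := by
  rw [sI, sI, sI, Ideal.map_map]; rfl

theorem sI_refl (I : Ideal (𝓞 L)) : sI (RingEquiv.refl L) I = I := by
  ext x
  exact mem_sI (RingEquiv.refl L) I x

theorem sI_inj (σ : L ≃+* L) {I J : Ideal (𝓞 L)} (h : sI σ I = sI σ J) : I = J := by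
  ext x
  rw [← mem_sI σ, h, mem_sI]

theorem sI_ne_bot (σ : L ≃+* L) {I : Ideal (𝓞 L)} (hI : I ≠ ⊥) : sI σ I ≠ ⊥ := by
  intro h
  refine hI (sI_inj σ ?_)
  rw [h, sI, Ideal.map_bot]

theorem sI_isPrime (σ : L ≃+* L) {I : Ideal (𝓞 L)} (hI : I.IsPrime) : (sI σ I).IsPrime :=
  Ideal.map_isPrime_of_equiv (sO σ)

theorem sI_jI (σ : L ≃ₐ[K] L) (I : Ideal (𝓞 K)) : sI σ.toRingEquiv (jI K L I) = jI K L I := by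
  rw [sI, jI, Ideal.map_map]
  congr 1
  ext x
  exact σ.commutes x

theorem rN_sI (σ : L ≃ₐ[K] L) (I : Ideal (𝓞 L)) : rN K L (sI σ.toRingEquiv I) = rN K L I :=
  Ideal.relNorm_map_algEquiv (RingOfIntegers.mapAlgEquiv σ) I

theorem absNorm_sI (σ : L ≃+* L) (I : Ideal (𝓞 L)) : Ideal.absNorm (sI σ I) = Ideal.absNorm I := by
  rw [Ideal.absNorm_apply, Ideal.absNorm_apply, Submodule.cardQuot_apply, Submodule.cardQuot_apply]
  exact (Nat.card_congr (Ideal.quotientEquiv I (sI σ I) (sO σ) rfl).toEquiv).symm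

/-- some positive power of every ideal is principal -/
theorem exists_pow_span (I : Ideal (𝓞 L)) (hI : I ≠ ⊥) :
    ∃ x, x ≠ 0 ∧ I ^ (Nat.card (ClassGroup (𝓞 L))) = Ideal.span {x} := by
  rw [← cl_eq_one_iff (pow_ne_zero _ hI), cl_pow hI]
  exact pow_card_eq_one'

/-- quadratic extensions: data of the nontrivial automorphism -/
structure Quad (K L : Type*) [Field K] [Field L] [Algebra K L] (σ : L ≃ₐ[K] L) : Prop where
  two : Module.finrank K L = 2
  ne : σ ≠ 1

theorem Quad.sq {σ : L ≃ₐ[K] L} (h : Quad K L σ) (x : L) : σ (σ x) = x := by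
  have hc : Fintype.card (L ≃ₐ[K] L) ≤ 2 := by
    rw [← h.two]; exact AlgEquiv.card_le
  by_contra hx
  have h1 : σ * σ ≠ 1 := fun h' => hx (by
    have := AlgEquiv.congr_fun h' x; simpa using this)
  have h2 : σ * σ ≠ σ := fun h' => h.ne (by simpa using h')
  have : 2 < Fintype.card (L ≃ₐ[K] L) := by
    classical
    have h3 : ({1, σ, σ * σ} : Finset (L ≃ₐ[K] L)).card = 3 := by
      rw [Finset.card_insert_of_notMem, Finset.card_pair h2.symm]
      simp only [Finset.mem_insert, Finset.mem_singleton, not_or]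
      exact ⟨h.ne.symm, h1.symm⟩
    calc 2 < 3 := by norm_num
      _ = _ := h3.symm
      _ ≤ _ := Finset.card_le_univ _
  omega

theorem Quad.univ {σ : L ≃ₐ[K] L} (h : Quad K L σ) [DecidableEq (L ≃ₐ[K] L)] :
    (Finset.univ : Finset (L ≃ₐ[K] L)) = {1, σ} := by
  have hc : Fintype.card (L ≃ₐ[K] L) ≤ 2 := by
    rw [← h.two]; exact AlgEquiv.card_le
  symm
  apply Finset.eq_univ_of_card
  rw [Finset.card_pair h.ne.symm]
  refine le_antisymm ?_ hc
  rw [← Finset.card_pair h.ne.symm]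
  exact Finset.card_le_univ _

theorem Quad.isGalois {σ : L ≃ₐ[K] L} (h : Quad K L σ) : IsGalois K L := by
  classical
  apply IsGalois.of_card_aut_eq_finrank
  rw [h.two, Nat.card_eq_fintype_card, ← Finset.card_univ, h.univ, Finset.card_pair h.ne.symm]

theorem Quad.norm {σ : L ≃ₐ[K] L} (h : Quad K L σ) (x : L) :
    algebraMap K L (Algebra.norm K x) = x * σ x := by
  classical
  have := h.isGalois
  rw [Algebra.norm_eq_prod_automorphisms, h.univ, Finset.prod_pair h.ne.symm]
  rfl

theorem Quad.fixed {σ : L ≃ₐ[K] L} (h : Quad K L σ) {x : L} (hx : σ x = x) :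
    ∃ y, algebraMap K L y = x := by
  classical
  have := h.isGalois
  have := (IsGalois.mem_bot_iff_fixed (F := K) (E := L) x).2 (by
    intro f
    have : f ∈ (Finset.univ : Finset (L ≃ₐ[K] L)) := Finset.mem_univ f
    rw [h.univ] at this
    simp only [Finset.mem_insert, Finset.mem_singleton] at this
    rcases this with rfl | rfl
    · rfl
    · exact hx)
  simpa [IntermediateField.mem_bot] using this

theorem Quad.nI {σ : L ≃ₐ[K] L} (h : Quad K L σ) (x : 𝓞 L) :
    algebraMap (𝓞 K) (𝓞 L) (nI K L x) = x * sO σ.toRingEquiv x := by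
  apply RingOfIntegers.ext
  have := h.norm (x : L)
  rw [← nI_coe] at this
  exact this

theorem Quad.jI_rN {σ : L ≃ₐ[K] L} (h : Quad K L σ) (I : Ideal (𝓞 L)) :
    jI K L (rN K L I) = I * sI σ.toRingEquiv I := by
  by_cases hI : I = ⊥
  · subst hI
    rw [← Ideal.zero_eq_bot, map_zero, zero_mul, Ideal.zero_eq_bot, jI, Ideal.map_bot]; rfl
  obtain ⟨x, hx, e⟩ := exists_pow_span I hI
  refine ideal_pow_inj (n := Nat.card (ClassGroup (𝓞 L))) Nat.card_pos.ne' ?_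
  rw [← jI_pow, ← map_pow, mul_pow, ← sI_pow, e, rN_span, sI_span, jI_span, h.nI,
    Ideal.span_singleton_mul_span_singleton]

/-- Hilbert 90 for quadratic extensions -/
theorem Quad.hilbert90 {σ : L ≃ₐ[K] L} (h : Quad K L σ) {x : L} (hx : x * σ x = 1) :
    ∃ y, y ≠ 0 ∧ x = y / σ y := by
  by_cases h1 : x = -1
  · obtain ⟨z, hz⟩ : ∃ z, σ z ≠ z := by
      by_contra! H
      exact h.ne (by ext z; exact H z)
    refine ⟨z - σ z, sub_ne_zero.2 hz.symm, ?_⟩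
    rw [map_sub, h.sq, h1, eq_div_iff (sub_ne_zero.2 hz)]; ring
  · have h0 : 1 + x ≠ 0 := fun h' => h1 (by linear_combination h')
    have h2 : σ (1 + x) ≠ 0 := (map_ne_zero σ).2 h0
    refine ⟨1 + x, h0, ?_⟩
    rw [eq_div_iff h2, map_add, map_one, mul_add, hx]; ring

variable (K L)

/-- norm map on class groups -/
noncomputable def nm : ClassGroup (𝓞 L) →* ClassGroup (𝓞 K) :=
  liftCl (fun I => cl (rN K L I))
    (fun I J hI hJ => by rw [map_mul, cl_mul (rN_ne_bot hI) (rN_ne_bot hJ)])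
    (fun x hx => by rw [rN_span, cl_span (nI_ne_zero hx)])

/-- extension map on class groups -/
noncomputable def jj : ClassGroup (𝓞 K) →* ClassGroup (𝓞 L) :=
  liftCl (fun I => cl (jI K L I))
    (fun I J hI hJ => by rw [jI_mul, cl_mul (jI_ne_bot hI) (jI_ne_bot hJ)])
    (fun x hx => by
      rw [jI_span, cl_span]
      simpa using hx)

variable {K L}

/-- automorphism action on class groups -/
noncomputable def act (σ : L ≃+* L) : ClassGroup (𝓞 L) →* ClassGroup (𝓞 L) :=
  liftCl (fun I => cl (sI σ I))
    (fun I J hI hJ => by rw [sI_mul, cl_mul (sI_ne_bot σ hI) (sI_ne_bot σ hJ)])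
    (fun x hx => by
      rw [sI_span, cl_span]
      simpa using hx)

theorem nm_cl {I : Ideal (𝓞 L)} (hI : I ≠ ⊥) : nm K L (cl I) = cl (rN K L I) := liftCl_cl _ _ _ hI

theorem jj_cl {I : Ideal (𝓞 K)} (hI : I ≠ ⊥) : jj K L (cl I) = cl (jI K L I) := liftCl_cl _ _ _ hI

theorem act_cl (σ : L ≃+* L) {I : Ideal (𝓞 L)} (hI : I ≠ ⊥) : act σ (cl I) = cl (sI σ I) :=
  liftCl_cl _ _ _ hI

theorem nm_jj (c : ClassGroup (𝓞 K)) : nm K L (jj K L c) = c ^ Module.finrank K L := by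
  obtain ⟨I, hI, rfl⟩ := cl_surj c
  rw [jj_cl hI, nm_cl (jI_ne_bot hI), rN_jI, cl_pow hI]

theorem Quad.jj_nm {σ : L ≃ₐ[K] L} (h : Quad K L σ) (c : ClassGroup (𝓞 L)) :
    jj K L (nm K L c) = c * act σ.toRingEquiv c := by
  obtain ⟨I, hI, rfl⟩ := cl_surj c
  rw [nm_cl hI, jj_cl (rN_ne_bot hI), act_cl _ hI, h.jI_rN, cl_mul hI (sI_ne_bot _ hI)]

theorem nm_nm (c : ClassGroup (𝓞 M)) : nm K L (nm L M c) = nm K M c := by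
  obtain ⟨I, hI, rfl⟩ := cl_surj c
  rw [nm_cl hI, nm_cl (rN_ne_bot hI), nm_cl hI, rN_rN]

theorem nm_act (σ : L ≃ₐ[K] L) (c : ClassGroup (𝓞 L)) :
    nm K L (act σ.toRingEquiv c) = nm K L c := by
  obtain ⟨I, hI, rfl⟩ := cl_surj c
  rw [act_cl _ hI, nm_cl hI, nm_cl (sI_ne_bot _ hI), rN_sI]

theorem act_act (σ τ : L ≃+* L) (c : ClassGroup (𝓞 L)) :
    act σ (act τ c) = act (τ.trans σ) c := by
  obtain ⟨I, hI, rfl⟩ := cl_surj c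
  rw [act_cl _ hI, act_cl _ hI, act_cl _ (sI_ne_bot _ hI), sI_sI]

end Fields


open NumberField

set_option linter.unusedSectionVars false

section HerbrandUnits

theorem finrank_units (K : Type*) [Field K] [NumberField K] :
    Module.finrank ℤ (Additive (𝓞 K)ˣ) = Units.rank K := Units.finrank_eq K

variable {K L : Type*} [Field K] [Field L] [NumberField K] [NumberField L] [Algebra K L]

variable (K L) in
/-- norm on units -/
noncomputable def nU : (𝓞 L)ˣ →* (𝓞 K)ˣ := Units.map (nI K L)

variable (K L) in
/-- inclusion on units -/
noncomputable def iU : (𝓞 K)ˣ →* (𝓞 L)ˣ := Units.map (algebraMap (𝓞 K) (𝓞 L)).toMonoidHom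

/-- conjugation on units -/
noncomputable def sU (σ : L ≃+* L) : (𝓞 L)ˣ →* (𝓞 L)ˣ :=
  Units.map ((sO σ : 𝓞 L →+* 𝓞 L).toMonoidHom)

/-- `ε ↦ ε / σ ε` -/
noncomputable def dU (σ : L ≃+* L) : (𝓞 L)ˣ →* (𝓞 L)ˣ := MonoidHom.id _ / sU σ

theorem iU_inj : Function.Injective (iU K L) := by
  apply Units.map_injective
  exact FaithfulSMul.algebraMap_injective (𝓞 K) (𝓞 L)

theorem Quad.iU_nU {σ : L ≃ₐ[K] L} (h : Quad K L σ) (u : (𝓞 L)ˣ) :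
    iU K L (nU K L u) = u * sU σ.toRingEquiv u := by
  ext1
  exact h.nI u.1

theorem Quad.sU_sU {σ : L ≃ₐ[K] L} (h : Quad K L σ) (u : (𝓞 L)ˣ) :
    sU σ.toRingEquiv (sU σ.toRingEquiv u) = u := by
  ext1
  apply RingOfIntegers.ext
  exact h.sq _

theorem isIntegral_of_algebraMap {y : K} (h : IsIntegral ℤ (algebraMap K L y)) : IsIntegral ℤ y :=
  (isIntegral_algHom_iff ((algebraMap K L).toIntAlgHom) (algebraMap K L).injective).1 h

theorem Quad.fixedO {σ : L ≃ₐ[K] L} (h : Quad K L σ) {x : 𝓞 L} (hx : sO σ.toRingEquiv x = x) :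
    ∃ y, algebraMap (𝓞 K) (𝓞 L) y = x := by
  obtain ⟨y, hy⟩ := h.fixed (x := (x : L)) (congrArg (fun z : 𝓞 L => (z : L)) hx)
  refine ⟨⟨y, isIntegral_of_algebraMap (L := L) (by rw [hy]; exact x.2)⟩, ?_⟩
  apply RingOfIntegers.ext
  exact hy

theorem Quad.fixedU {σ : L ≃ₐ[K] L} (h : Quad K L σ) (u : (𝓞 L)ˣ) :
    sU σ.toRingEquiv u = u ↔ u ∈ (iU K L).range := by
  constructor
  · intro hu
    have hu2 : sU σ.toRingEquiv u⁻¹ = u⁻¹ := by rw [map_inv, hu]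
    obtain ⟨y, hy⟩ := h.fixedO (x := u.1) (congrArg Units.val hu)
    obtain ⟨z, hz⟩ := h.fixedO (x := (u⁻¹).1) (congrArg Units.val hu2)
    have hyz : y * z = 1 := by
      apply FaithfulSMul.algebraMap_injective (𝓞 K) (𝓞 L)
      rw [map_mul, hy, hz]; simp
    refine ⟨⟨y, z, hyz, by rw [mul_comm, hyz]⟩, ?_⟩
    ext1
    exact hy
  · rintro ⟨v, rfl⟩
    ext1
    apply RingOfIntegers.ext
    exact σ.commutes _

theorem two_torsion_units (u : (𝓞 L)ˣ) : u ^ 2 = 1 ↔ u = 1 ∨ u = -1 := by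
  rw [Units.ext_iff, Units.ext_iff, Units.ext_iff]
  push_cast
  exact sq_eq_one_iff

theorem Quad.herbrand {σ : L ≃ₐ[K] L} (h : Quad K L σ) :
    (nU K L).range.index * 2 ^ (Units.rank L) =
      ((dU σ.toRingEquiv).range.relIndex (nU K L).ker) * 2 ^ (2 * Units.rank K) := by
  have key := herbrand_index (V := Additive (𝓞 L)ˣ) (W := Additive (𝓞 K)ˣ)
    (MonoidHom.toAdditive (iU K L)).toIntLinearMap
    (MonoidHom.toAdditive (nU K L)).toIntLinearMap
    (MonoidHom.toAdditive (sU σ.toRingEquiv)).toIntLinearMap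
    (fun a b hab => iU_inj (L := L) hab)
    (fun v => h.iU_nU v) (fun v => h.sU_sU v) (fun v => h.fixedU v)
  rw [finrank_units, finrank_units] at key
  have hne : (-1 : 𝓞 L) ≠ 1 := by
    intro h'
    have : (2 : 𝓞 L) = 0 := by linear_combination -h'
    exact two_ne_zero this
  have c1 : Nat.card {x : Additive (𝓞 K)ˣ // 2 • x = 0} = 2 := by
    have : {x : Additive (𝓞 K)ˣ | 2 • x = 0} = {Additive.ofMul 1, Additive.ofMul (-1)} := by
      ext x
      exact two_torsion_units (L := K) x.toMul
    change Nat.card ({x : Additive (𝓞 K)ˣ | 2 • x = 0} : Set _) = 2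
    rw [this, Nat.card_coe_set_eq, Set.ncard_pair]
    intro h'
    have h2 : (1 : (𝓞 K)ˣ) = -1 := h'
    have h3 : (1 : 𝓞 K) = -1 := congrArg Units.val h2
    have : (2 : 𝓞 K) = 0 := by linear_combination h3
    exact two_ne_zero this
  have hm1 : nU K L (-1) = 1 := by
    apply iU_inj (L := L)
    rw [h.iU_nU, map_one]
    ext1
    simp [sU]
  have c2 : Nat.card {x : LinearMap.ker (MonoidHom.toAdditive (nU K L)).toIntLinearMap //
      2 • x = 0} = 2 := by
    have : {x : LinearMap.ker (MonoidHom.toAdditive (nU K L)).toIntLinearMap | 2 • x = 0} =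
        {0, ⟨Additive.ofMul (-1), hm1⟩} := by
      ext x
      have := two_torsion_units (L := L) x.1.toMul
      simp only [Set.mem_ofPred_eq, Set.mem_insert_iff, Set.mem_singleton_iff]
      rw [Subtype.ext_iff, Subtype.ext_iff, Subtype.ext_iff]
      exact this
    change Nat.card ({x : LinearMap.ker (MonoidHom.toAdditive (nU K L)).toIntLinearMap |
      2 • x = 0} : Set _) = 2
    rw [this, Nat.card_coe_set_eq, Set.ncard_pair]
    intro h'
    have h2 : (1 : (𝓞 L)ˣ) = -1 := congrArg Subtype.val h'
    have h3 : (1 : 𝓞 L) = -1 := congrArg Units.val h2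
    exact hne h3.symm
  rw [c1, c2] at key
  have key2 := Nat.eq_of_mul_eq_mul_right (by norm_num : 0 < 2) key
  have e1 : ((MonoidHom.toAdditive (nU K L)).toIntLinearMap.toAddMonoidHom.range).index =
      (nU K L).range.index := by
    rw [← Subgroup.index_toAddSubgroup]; rfl
  rw [e1] at key2
  rw [key2]
  congr 1

end HerbrandUnits


open NumberField

set_option linter.unusedSectionVars false

section GroupCount

theorem group_count1 {G H : Type*} [CommGroup G] [Finite G] [CommGroup H]
    (Rel : G → H → Prop) (A A0 : Subgroup G) (N E : Subgroup H) (hNE : N ≤ E) (hN : N.index ≠ 0)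
    (hmul : ∀ a b u v, Rel a u → Rel b v → Rel (a * b) (u * v))
    (hun : ∀ a u v, Rel a u → Rel a v → v / u ∈ N)
    (hex : ∀ a ∈ A, ∃ u ∈ E, Rel a u)
    (hker : ∀ a ∈ A, ∀ u ∈ N, Rel a u → a ∈ A0) :
    Nat.card A * E.index ≤ Nat.card A0 * N.index := by
  choose! g hgE hg using hex
  let φ : A →* H ⧸ N := MonoidHom.mk' (fun a => (QuotientGroup.mk (g a) : H ⧸ N)) (by
    intro a b
    rw [← QuotientGroup.mk_mul, eq_comm]
    rw [QuotientGroup.eq_iff_div_mem]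
    have := hun _ _ _ (hg _ (a * b).2) (hmul _ _ _ _ (hg a a.2) (hg b b.2))
    exact this)
  have h1 : Nat.card φ.ker ≤ Nat.card A0 := by
    refine Nat.card_le_card_of_injective
      (fun x : φ.ker => (⟨x.1.1, ?_⟩ : A0)) ?_
    · have hx : (QuotientGroup.mk (g x.1.1) : H ⧸ N) = 1 := x.2
      exact hker _ x.1.2 _ ((QuotientGroup.eq_one_iff _).1 hx) (hg _ x.1.2)
    · intro x y hxy
      apply Subtype.ext; apply Subtype.ext
      exact congrArg (fun z : A0 => z.1) hxy
  have h2 : φ.range ≤ E.map (QuotientGroup.mk' N) := by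
    rintro _ ⟨a, rfl⟩
    exact ⟨g a, hgE a a.2, rfl⟩
  have hfin : Finite (H ⧸ N) := by
    have : N.FiniteIndex := ⟨hN⟩
    infer_instance
  have h3 : Nat.card φ.range * E.index ≤ N.index := by
    have h4 : Nat.card (E.map (QuotientGroup.mk' N)) * (E.map (QuotientGroup.mk' N)).index
        = N.index := by
      rw [Subgroup.card_mul_index]; rfl
    have h5 : (E.map (QuotientGroup.mk' N)).index = E.index := by
      rw [Subgroup.index_map, QuotientGroup.ker_mk', sup_eq_left.2 hNE,
        MonoidHom.range_eq_top.2 (QuotientGroup.mk'_surjective N), Subgroup.index_top, mul_one]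
    rw [← h4, h5]
    gcongr
    exact Subgroup.card_le_of_le h2
  have h6 : Nat.card A = Nat.card φ.ker * Nat.card φ.range := by
    rw [← Subgroup.card_mul_index φ.ker, Subgroup.index_ker]
  rw [h6, mul_assoc]
  gcongr

theorem group_count2 {H V : Type*} [CommGroup H] [Finite V] (D E : Subgroup H)
    (R : H → V → Prop) (hex : ∀ a ∈ E, ∃ v, R a v)
    (hun : ∀ a ∈ E, ∀ b ∈ E, ∀ v, R a v → R b v → a / b ∈ D) :
    D.relIndex E ≤ Nat.card V := by
  have : Nonempty V := ⟨(hex 1 E.one_mem).choose⟩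
  choose! g hg using hex
  change Nat.card (E ⧸ D.subgroupOf E) ≤ _
  refine Nat.card_le_card_of_injective (fun q => g (q.out : E)) ?_
  intro q q' h
  have := hun _ q.out.2 _ q'.out.2 _ (hg _ q.out.2) (by
    have h' : g (q.out : E) = g (q'.out : E) := h
    rw [h']; exact hg _ q'.out.2)
  rw [← q.out_eq', ← q'.out_eq', QuotientGroup.eq_iff_div_mem]
  exact this

end GroupCount

section Chevalley

variable {K L : Type*} [Field K] [Field L] [NumberField K] [NumberField L] [Algebra K L]

theorem eq_unit_of_span_eq {R : Type*} [CommRing R] [IsDomain R] {x y : R}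
    (h : Ideal.span {x} = Ideal.span {y}) : ∃ u : Rˣ, x * u = y :=
  Ideal.span_singleton_eq_span_singleton.1 h

theorem frac_hilbert {σ : L ≃ₐ[K] L} (h : Quad K L σ) {a b : 𝓞 L} (hb : b ≠ 0) (ha : a ≠ 0)
    (hab : nI K L a = nI K L b) : ∃ w : 𝓞 L, w ≠ 0 ∧ a * sO σ.toRingEquiv w = b * w := by
  have hb' : (b : L) ≠ 0 := by simpa using hb
  have ha' : (a : L) ≠ 0 := by simpa using ha
  have hsb : σ (b : L) ≠ 0 := by simpa using hb
  have hn := congrArg (algebraMap (𝓞 K) (𝓞 L)) hab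
  rw [h.nI, h.nI] at hn
  have hn' : (a : L) * σ a = b * σ b := by
    have := congrArg (fun z : 𝓞 L => (z : L)) hn
    simpa [sO_coe] using this
  obtain ⟨y, hy, hxy⟩ := h.hilbert90 (x := (a : L) / b) (by
    rw [map_div₀]; field_simp; exact hn')
  obtain ⟨c, d, hd, hcd⟩ := IsFractionRing.div_surjective (A := 𝓞 L) y
  have hd0 : d ≠ 0 := nonZeroDivisors.ne_zero hd
  have hd' : (d : L) ≠ 0 := by simpa using hd0
  have hc0 : c ≠ 0 := by rintro rfl; simp at hcd; exact hy hcd.symm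
  have hc' : (c : L) ≠ 0 := by simpa using hc0
  have hsc : σ (c : L) ≠ 0 := by simpa using hc0
  have hsd : σ (d : L) ≠ 0 := by simpa using hd0
  refine ⟨c * sO σ.toRingEquiv d, mul_ne_zero hc0 ?_, ?_⟩
  · simpa using hd0
  · apply RingOfIntegers.ext
    rw [map_mul]
    simp only [map_mul, sO_coe]
    change (a : L) * (σ c * σ (σ d)) = b * (c * σ d)
    rw [h.sq]
    have hcd' : (c : L) / d = y := hcd
    rw [← hcd', map_div₀, div_div_div_eq, div_eq_div_iff hb' (mul_ne_zero hd' hsc)] at hxy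
    linear_combination hxy

theorem cancel_span {I J : Ideal (𝓞 L)} {x : 𝓞 L} (hx : x ≠ 0)
    (h : Ideal.span {x} * I = Ideal.span {x} * J) : I = J :=
  mul_left_cancel₀ (span_ne_bot hx) h

/-- the relation in Chevalley's argument -/
def ChevRel (K : Type*) {L : Type*} [Field K] [Field L] [NumberField K] [NumberField L] [Algebra K L]
    (σ : L ≃ₐ[K] L) (c : ClassGroup (𝓞 L)) (u : (𝓞 K)ˣ) : Prop :=
  ∃ (I : Ideal (𝓞 L)) (x y : 𝓞 L), I ≠ ⊥ ∧ x ≠ 0 ∧ y ≠ 0 ∧ cl I = c ∧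
    Ideal.span {x} * I = Ideal.span {y} * sI σ.toRingEquiv I ∧ u * nI K L x = nI K L y

theorem span_mul_span {R : Type*} [CommRing R] (x y : R) :
    Ideal.span {x} * Ideal.span {y} = Ideal.span {x * y} := Ideal.span_singleton_mul_span_singleton x y

theorem nI_sO {σ : L ≃ₐ[K] L} (h : Quad K L σ) (x : 𝓞 L) :
    nI K L (sO σ.toRingEquiv x) = nI K L x := by
  apply FaithfulSMul.algebraMap_injective (𝓞 K) (𝓞 L)
  rw [h.nI, h.nI]
  have : sO σ.toRingEquiv (sO σ.toRingEquiv x) = x := RingOfIntegers.ext (h.sq _)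
  rw [this, mul_comm]

theorem ChevRel.mul {σ : L ≃ₐ[K] L} {c d : ClassGroup (𝓞 L)} {u v : (𝓞 K)ˣ}
    (h1 : ChevRel K σ c u) (h2 : ChevRel K σ d v) : ChevRel K σ (c * d) (u * v) := by
  obtain ⟨I, x, y, hI, hx, hy, rfl, e1, e2⟩ := h1
  obtain ⟨I', x', y', hI', hx', hy', rfl, e1', e2'⟩ := h2
  refine ⟨I * I', x * x', y * y', mul_ne_zero hI hI', mul_ne_zero hx hx', mul_ne_zero hy hy',
    cl_mul hI hI', ?_, ?_⟩
  · rw [← span_mul_span, ← span_mul_span, mul_mul_mul_comm, e1, e1', sI_mul, mul_mul_mul_comm]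
  · rw [map_mul, map_mul, ← e2, ← e2']; push_cast; ring

theorem ChevRel.uniq {σ : L ≃ₐ[K] L} (h : Quad K L σ) {c : ClassGroup (𝓞 L)} {u v : (𝓞 K)ˣ}
    (h1 : ChevRel K σ c u) (h2 : ChevRel K σ c v) : v / u ∈ (nU K L).range := by
  obtain ⟨I, x, y, hI, hx, hy, rfl, e1, e2⟩ := h1
  obtain ⟨I', x', y', hI', hx', hy', hc, e1', e2'⟩ := h2
  obtain ⟨a, b, ha, hb, hab⟩ := (cl_eq_iff hI hI').1 hc.symm
  have hsab := congrArg (sI σ.toRingEquiv) hab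
  rw [sI_mul, sI_mul, sI_span, sI_span] at hsab
  set s := sO σ.toRingEquiv
  have hsa : s a ≠ 0 := by simpa using ha
  have key : Ideal.span {x * b * s a * y'} * I' = Ideal.span {y * a * s b * x'} * I' := by
    calc Ideal.span {x * b * s a * y'} * I'
        = Ideal.span {x} * Ideal.span {s a} * Ideal.span {y'} * (Ideal.span {b} * I') := by
          simp only [← span_mul_span]; ring
      _ = (Ideal.span {x} * I) * Ideal.span {s a} * Ideal.span {y'} * Ideal.span {a} := by
          rw [← hab]; ring
      _ = Ideal.span {y} * Ideal.span {y'} * Ideal.span {a} *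
            (Ideal.span {s a} * sI σ.toRingEquiv I) := by
          rw [e1]; ring
      _ = Ideal.span {y} * Ideal.span {a} * Ideal.span {s b} *
            (Ideal.span {y'} * sI σ.toRingEquiv I') := by
          rw [hsab]; ring
      _ = Ideal.span {y * a * s b * x'} * I' := by
          rw [← e1']; simp only [← span_mul_span]; ring
  obtain ⟨ε, hε⟩ := eq_unit_of_span_eq (mul_right_cancel₀ hI' key)
  refine ⟨ε⁻¹, ?_⟩
  rw [map_inv, inv_eq_iff_mul_eq_one, mul_div_assoc', div_eq_one]
  have hn := congrArg (nI K L) hε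
  simp only [map_mul] at hn
  rw [nI_sO h, nI_sO h, ← e2, ← e2'] at hn
  ext1
  have h0 : nI K L x * nI K L b * nI K L a * nI K L x' ≠ 0 := by
    simp [nI_ne_zero, hx, hb, ha, hx']
  have hnε : ((nU K L ε : (𝓞 K)ˣ) : 𝓞 K) = nI K L ε := rfl
  apply mul_left_cancel₀ h0
  rw [Units.val_mul, hnε]
  linear_combination hn

theorem ChevRel.inv_ideal {σ : L ≃ₐ[K] L} (h : Quad K L σ) {c : ClassGroup (𝓞 L)} {u : (𝓞 K)ˣ}
    (h1 : ChevRel K σ c u) (hu : u ∈ (nU K L).range) :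
    ∃ J : Ideal (𝓞 L), J ≠ ⊥ ∧ sI σ.toRingEquiv J = J ∧ cl J = c := by
  obtain ⟨I, x, y, hI, hx, hy, rfl, e1, e2⟩ := h1
  obtain ⟨ε, rfl⟩ := hu
  have hεx : (ε : 𝓞 L) * x ≠ 0 := mul_ne_zero ε.ne_zero hx
  obtain ⟨w, hw, hww⟩ := frac_hilbert h (a := y) (b := ε * x) hεx hy (by
    rw [map_mul, ← e2]; rfl)
  set s := sO σ.toRingEquiv with hs
  have hsw : s w ≠ 0 := by simpa using hw
  have key : Ideal.span {s w} * I = Ideal.span {w} * sI σ.toRingEquiv I := by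
    apply cancel_span hx
    calc Ideal.span {x} * (Ideal.span {s w} * I) = Ideal.span {s w} * (Ideal.span {x} * I) := by ring
      _ = Ideal.span {y * s w} * sI σ.toRingEquiv I := by rw [e1, ← span_mul_span]; ring
      _ = Ideal.span {x} * (Ideal.span {w} * sI σ.toRingEquiv I) := by
        rw [hww, mul_assoc, Ideal.span_singleton_mul_left_unit ε.isUnit, ← span_mul_span, mul_assoc]
  refine ⟨Ideal.span {s w} * I, mul_ne_zero (span_ne_bot hsw) hI, ?_, ?_⟩
  · rw [sI_mul, sI_span]
    have : sO σ.toRingEquiv (s w) = w := RingOfIntegers.ext (h.sq _)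
    rw [this, key]
  · rw [cl_mul (span_ne_bot hsw) hI, cl_span hsw, one_mul]

theorem odd_pow_eq_one {G : Type*} [Group G] {c : G} (h2 : c ^ 2 = 1) {n : ℕ} (hn : Odd n)
    (h : c ^ n = 1) : c = 1 := by
  obtain ⟨k, rfl⟩ := hn
  rw [pow_succ, pow_mul, h2, one_pow, one_mul] at h
  exact h

variable (K L) in
/-- units of `K` that are norms of elements of `L` -/
noncomputable def normUnits : Subgroup (𝓞 K)ˣ :=
  (Units.map (Algebra.norm K : L →* K)).range.comap (Units.map (algebraMap (𝓞 K) K).toMonoidHom)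

theorem mem_normUnits {u : (𝓞 K)ˣ} :
    u ∈ normUnits K L ↔ ∃ z : L, Algebra.norm K z = ((u : 𝓞 K) : K) := by
  constructor
  · rintro ⟨z, hz⟩
    exact ⟨z, congrArg Units.val hz⟩
  · rintro ⟨z, hz⟩
    have hz0 : z ≠ 0 := by
      rintro rfl
      rw [Algebra.norm_zero] at hz
      exact u.ne_zero (RingOfIntegers.ext hz.symm)
    refine ⟨Units.mk0 z hz0, ?_⟩
    ext1
    exact hz

theorem Quad.act_of_sq {σ : L ≃ₐ[K] L} (h : Quad K L σ) (hodd : Odd (Nat.card (ClassGroup (𝓞 K))))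
    {c : ClassGroup (𝓞 L)} (hc : c ^ 2 = 1) : act σ.toRingEquiv c = c := by
  have h1 := h.jj_nm c
  have h2 : nm K L c = 1 := by
    apply odd_pow_eq_one _ hodd pow_card_eq_one'
    rw [← map_pow, hc, map_one]
  rw [h2, map_one] at h1
  rw [pow_two] at hc
  exact mul_left_cancel (h1.symm.trans hc.symm)

theorem ChevRel.exists {σ : L ≃ₐ[K] L} (h : Quad K L σ) (hodd : Odd (Nat.card (ClassGroup (𝓞 K))))
    {c : ClassGroup (𝓞 L)} (hc : c ^ 2 = 1) : ∃ u ∈ normUnits K L, ChevRel K σ c u := by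
  have h1 := h.act_of_sq hodd hc
  obtain ⟨I, hI, rfl⟩ := cl_surj c
  rw [act_cl _ hI] at h1
  obtain ⟨x, y, hx, hy, hxy⟩ := (cl_eq_iff hI (sI_ne_bot _ hI)).1 h1.symm
  have h2 := congrArg (rN K L) hxy
  rw [map_mul, map_mul, rN_sI, rN_span, rN_span] at h2
  obtain ⟨u, hu⟩ := eq_unit_of_span_eq (mul_right_cancel₀ (rN_ne_bot hI) h2)
  refine ⟨u, ?_, I, x, y, hI, hx, hy, rfl, hxy, by rw [mul_comm]; exact hu⟩
  rw [mem_normUnits]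
  refine ⟨(y : L) / x, ?_⟩
  have hx0 : Algebra.norm K (x : L) ≠ 0 := by
    rw [← nI_coe]; simpa using nI_ne_zero hx
  have hx' : (x : L) ≠ 0 := by simpa using hx
  have h3 : Algebra.norm K ((y : L) / x) * Algebra.norm K (x : L) = Algebra.norm K (y : L) := by
    rw [← map_mul, div_mul_cancel₀ _ hx']
  have h4 : ((nI K L x * u : 𝓞 K) : K) = Algebra.norm K (x : L) * ((u : 𝓞 K) : K) := by
    rw [← nI_coe]; rfl
  rw [← nI_coe y, ← hu, mul_comm, h4] at h3
  exact mul_left_cancel₀ hx0 h3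

end Chevalley


open NumberField

set_option linter.unusedSectionVars false

section Chevalley2

variable {K L : Type*} [Field K] [Field L] [NumberField K] [NumberField L] [Algebra K L]

/-- ramified-type primes: fixed by `σ`, not extended -/
def SPrime (K : Type*) {L : Type*} [Field K] [Field L] [NumberField K] [NumberField L] [Algebra K L]
    (σ : L ≃ₐ[K] L) (P : Ideal (𝓞 L)) : Prop :=
  P.IsPrime ∧ P ≠ ⊥ ∧ sI σ.toRingEquiv P = P ∧ ∀ b, P ≠ jI K L b

theorem SPrime.sq {σ : L ≃ₐ[K] L} (h : Quad K L σ) {P : Ideal (𝓞 L)} (hP : SPrime K σ P) :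
    P ^ 2 = jI K L (rN K L P) := by
  rw [h.jI_rN, hP.2.2.1, pow_two]

theorem decomp {σ : L ≃ₐ[K] L} (h : Quad K L σ) (S : Finset (Ideal (𝓞 L)))
    (hS : ∀ P, P ∈ S ↔ SPrime K σ P) :
    ∀ (n : ℕ) (J : Ideal (𝓞 L)), Ideal.absNorm J = n → J ≠ ⊥ → sI σ.toRingEquiv J = J →
      ∃ (f : Ideal (𝓞 L) → ℕ) (b : Ideal (𝓞 K)), b ≠ ⊥ ∧ J = (∏ P ∈ S, P ^ f P) * jI K L b := by
  classical
  intro n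
  induction n using Nat.strong_induction_on with
  | _ n ih =>
  intro J hJn hJ hσJ
  by_cases hT : J = ⊤
  · refine ⟨fun _ => 0, ⊤, by simp, ?_⟩
    rw [hT, jI, Ideal.map_top]; simp [← Ideal.one_eq_top]
  obtain ⟨P, hPm, hJP⟩ := Ideal.exists_le_maximal J hT
  have hPp := hPm.isPrime
  have hP0 : P ≠ ⊥ := fun hb => hJ (by rw [hb] at hJP; exact le_bot_iff.1 hJP)
  -- generic reduction step
  have step : ∀ Q J' : Ideal (𝓞 L), Q ≤ P → sI σ.toRingEquiv Q = Q → J = Q * J' →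
      ∃ (f : Ideal (𝓞 L) → ℕ) (b : Ideal (𝓞 K)), b ≠ ⊥ ∧ J' = (∏ P ∈ S, P ^ f P) * jI K L b := by
    intro Q J' hQP hQ hJQ
    have hQ0 : Q ≠ ⊥ := by rintro rfl; simp at hJQ; exact hJ hJQ
    have hJ0 : J' ≠ ⊥ := by rintro rfl; simp at hJQ; exact hJ hJQ
    refine ih (Ideal.absNorm J') ?_ J' rfl hJ0 ?_
    · rw [← hJn, hJQ, map_mul]
      have h1 : Ideal.absNorm Q ≠ 1 := by
        rw [Ne, Ideal.absNorm_eq_one_iff]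
        rintro rfl
        exact hPp.ne_top (top_le_iff.1 hQP)
      have h2 : Ideal.absNorm Q ≠ 0 := by rw [Ne, Ideal.absNorm_eq_zero_iff]; exact hQ0
      have h3 : Ideal.absNorm J' ≠ 0 := by rw [Ne, Ideal.absNorm_eq_zero_iff]; exact hJ0
      exact lt_mul_of_one_lt_left (Nat.pos_of_ne_zero h3) (by lia)
    · have h4 := hσJ
      rw [hJQ, sI_mul, hQ] at h4
      exact mul_left_cancel₀ hQ0 h4
  by_cases hσP : sI σ.toRingEquiv P = P
  · obtain ⟨J', hJ'⟩ := Ideal.dvd_iff_le.2 hJP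
    obtain ⟨f, b, hb, hf⟩ := step P J' le_rfl hσP hJ'
    by_cases hPS : P ∈ S
    · refine ⟨fun Q => f Q + if Q = P then 1 else 0, b, hb, ?_⟩
      simp_rw [pow_add, Finset.prod_mul_distrib, pow_ite, pow_one, pow_zero]
      rw [Finset.prod_ite_eq' S P (fun Q => Q), if_pos hPS, hJ', hf]
      ring
    · have : ∃ c, P = jI K L c := by
        by_contra hc
        push Not at hc
        exact hPS ((hS P).2 ⟨hPp, hP0, hσP, hc⟩)
      obtain ⟨c, hc⟩ := this
      have hc0 : c ≠ ⊥ := by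
        rintro rfl
        apply hP0; rw [hc, jI, Ideal.map_bot]
      refine ⟨f, c * b, mul_ne_zero hc0 hb, ?_⟩
      rw [jI_mul, ← hc, hJ', hf]; ring
  · have hσle : J ≤ sI σ.toRingEquiv P := by
      rw [← hσJ]; exact Ideal.map_mono hJP
    have hcop : IsCoprime P (sI σ.toRingEquiv P) := by
      rw [Ideal.isCoprime_iff_sup_eq]
      have hm : (sI σ.toRingEquiv P).IsMaximal :=
        (sI_isPrime _ hPp).isMaximal (sI_ne_bot _ hP0)
      exact hPm.coprime_of_ne hm (Ne.symm hσP)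
    have hdvd : P * sI σ.toRingEquiv P ∣ J :=
      hcop.mul_dvd (Ideal.dvd_iff_le.2 hJP) (Ideal.dvd_iff_le.2 hσle)
    obtain ⟨J', hJ'⟩ := hdvd
    rw [← h.jI_rN] at hJ'
    obtain ⟨f, b, hb, hf⟩ := step _ J' (by rw [h.jI_rN]; exact Ideal.mul_le_left) (sI_jI σ _) hJ'
    refine ⟨f, rN K L P * b, mul_ne_zero (rN_ne_bot hP0) hb, ?_⟩
    rw [hJ', jI_mul, hf]; ring

theorem SPrime.diff_mem {σ : L ≃ₐ[K] L} (h : Quad K L σ) {P : Ideal (𝓞 L)} (hP : SPrime K σ P)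
    (θ : 𝓞 L) : θ - sO σ.toRingEquiv θ ∈ P := by
  obtain ⟨hPp, hP0, hσ, hb⟩ := id hP
  have hPm := hPp.isMaximal hP0
  have := h.isGalois
  set p := P.under (𝓞 K) with hp
  have hpp : p.IsPrime := inferInstance
  have hp0 : p ≠ ⊥ := Ideal.under_ne_bot (𝓞 K) hP0
  have hpm := hpp.isMaximal hp0
  have : P.LiesOver p := ⟨rfl⟩
  obtain ⟨f, hf⟩ : ∃ f, rN K L P = p ^ f := Ideal.exists_relNorm_eq_pow_of_isPrime P p
  have hsq := hP.sq h
  rw [hf, jI_pow] at hsq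
  have hPprime : Prime P := Ideal.prime_of_isPrime hP0 hPp
  have hf0 : f ≠ 0 := by
    rintro rfl
    rw [pow_zero] at hsq
    exact hPprime.not_isUnit (isUnit_of_mul_isUnit_left (by rw [← pow_two, hsq]; exact isUnit_one))
  obtain ⟨i, hi, hi'⟩ := (dvd_prime_pow hPprime 2).1 (show jI K L p ∣ P ^ 2 by
    rw [hsq]; exact dvd_pow_self _ hf0)
  rw [associated_iff_eq] at hi'
  have hif : 2 = i * f := by
    rw [hi', ← pow_mul] at hsq
    exact pow_injective_of_not_isUnit hPprime.not_isUnit hPprime.ne_zero hsq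
  have hf1 : f = 1 := by
    interval_cases i
    · simp at hif
    · rw [pow_one] at hi'
      exact absurd hi'.symm (hb p)
    · lia
  rw [hf1, pow_one] at hf
  have hcard : Ideal.absNorm P = Ideal.absNorm p := by rw [← hf, absNorm_rN]
  rw [Ideal.absNorm_apply, Ideal.absNorm_apply, Submodule.cardQuot_apply,
    Submodule.cardQuot_apply] at hcard
  have hfin : Finite (𝓞 L ⧸ P) := Ideal.finiteQuotientOfFreeOfNeBot P hP0
  have hbij := (Nat.bijective_iff_injective_and_card
    (Ideal.quotientMap (I := p) P (algebraMap (𝓞 K) (𝓞 L)) le_rfl)).2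
      ⟨Ideal.quotientMap_injective, hcard.symm⟩
  obtain ⟨a, ha⟩ := hbij.2 (Ideal.Quotient.mk P θ)
  obtain ⟨a, rfl⟩ := Ideal.Quotient.mk_surjective a
  rw [Ideal.quotientMap_mk, Ideal.Quotient.eq] at ha
  have ha' := (mem_sI σ.toRingEquiv P _).2 ha
  rw [hσ, map_sub] at ha'
  have hc : sO σ.toRingEquiv (algebraMap (𝓞 K) (𝓞 L) a) = algebraMap (𝓞 K) (𝓞 L) a :=
    RingOfIntegers.ext (σ.commutes _)
  rw [hc] at ha'
  have := P.sub_mem ha' ha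
  rwa [sub_sub_sub_cancel_left] at this

/-- the map from exponent vectors to classes -/
noncomputable def Psi (S : Finset (Ideal (𝓞 L))) (h : ℕ)
    (hh : ∀ P ∈ S, (cl P ^ h) ^ 2 = 1) :
    Multiplicative (S → ZMod 2) →* ClassGroup (𝓞 L) :=
  MonoidHom.mk' (fun v => ∏ P : S, (cl P.1 ^ h) ^ (v.toAdd P).val) (by
    intro v w
    rw [← Finset.prod_mul_distrib]
    refine Finset.prod_congr rfl fun P _ => ?_
    rw [toAdd_mul, Pi.add_apply, ZMod.val_add, ← pow_add]
    exact (pow_eq_pow_mod _ (hh P P.2)).symm)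

theorem Psi_cast (S : Finset (Ideal (𝓞 L))) (h : ℕ) (hh : ∀ P ∈ S, (cl P ^ h) ^ 2 = 1)
    (hS : ∀ P ∈ S, P ≠ ⊥) (f : Ideal (𝓞 L) → ℕ) :
    Psi S h hh (Multiplicative.ofAdd fun P => (f P : ZMod 2)) = cl (∏ P ∈ S, P ^ f P) ^ h := by
  have h1 : cl (∏ P ∈ S, P ^ f P) = ∏ P ∈ S, cl P ^ f P := by
    clear hh
    classical
    induction S using Finset.induction_on with
    | empty => rw [Finset.prod_empty, Finset.prod_empty, cl_one]
    | insert P S hP ih =>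
      have hS' : ∀ Q ∈ S, Q ≠ ⊥ := fun Q hQ => hS Q (Finset.mem_insert_of_mem hQ)
      rw [Finset.prod_insert hP, Finset.prod_insert hP, cl_mul, ih hS', cl_pow]
      · exact hS P (Finset.mem_insert_self _ _)
      · exact pow_ne_zero _ (hS P (Finset.mem_insert_self _ _))
      · exact Finset.prod_ne_zero_iff.2 fun Q hQ => pow_ne_zero _ (hS' Q hQ)
  rw [h1, ← Finset.prod_pow, ← Finset.prod_coe_sort]
  change ∏ P : S, (cl P.1 ^ h) ^ ((f P : ZMod 2)).val = _
  refine Finset.prod_congr rfl fun P _ => ?_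
  rw [ZMod.val_natCast, ← pow_eq_pow_mod _ (hh P P.2), ← pow_mul, ← pow_mul, mul_comm]

theorem prod_even {σ : L ≃ₐ[K] L} (h : Quad K L σ) (S : Finset (Ideal (𝓞 L)))
    (hS : ∀ P ∈ S, SPrime K σ P) (f : Ideal (𝓞 L) → ℕ) (hf : ∀ P ∈ S, Even (f P)) :
    ∃ b : Ideal (𝓞 K), b ≠ ⊥ ∧ ∏ P ∈ S, P ^ f P = jI K L b := by
  classical
  induction S using Finset.induction_on with
  | empty => exact ⟨⊤, by simp, by rw [jI, Ideal.map_top]; simp⟩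
  | insert P S hP ih =>
    obtain ⟨b, hb, hb'⟩ := ih (fun Q hQ => hS Q (Finset.mem_insert_of_mem hQ))
      (fun Q hQ => hf Q (Finset.mem_insert_of_mem hQ))
    obtain ⟨k, hk⟩ := hf P (Finset.mem_insert_self _ _)
    have hPS := hS P (Finset.mem_insert_self _ _)
    refine ⟨rN K L P ^ k * b, mul_ne_zero (pow_ne_zero _ (rN_ne_bot hPS.2.1)) hb, ?_⟩
    rw [Finset.prod_insert hP, hb', jI_mul, jI_pow, ← hPS.sq h, hk, ← pow_mul, two_mul]

theorem dU_apply (σ : L ≃+* L) (ε : (𝓞 L)ˣ) : dU σ ε * sU σ ε = ε := by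
  rw [dU, MonoidHom.div_apply, div_mul_cancel]; rfl

theorem unit_from_real {σ : L ≃ₐ[K] L} (h : Quad K L σ) (hodd : Odd (Nat.card (ClassGroup (𝓞 K))))
    {ε : (𝓞 L)ˣ} (hε : ε ∈ (nU K L).ker) {β : 𝓞 L} (hβ : β ≠ 0)
    (hεβ : ε * sO σ.toRingEquiv β = β) {b : Ideal (𝓞 K)} (hb : b ≠ ⊥)
    (hβb : Ideal.span {β} = jI K L b) : ε ∈ (dU σ.toRingEquiv).range := by
  obtain ⟨x, hx, hbx⟩ := exists_pow_span b hb
  set n := Nat.card (ClassGroup (𝓞 K))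
  have h1 : Ideal.span {algebraMap (𝓞 K) (𝓞 L) x} = Ideal.span {β ^ n} := by
    rw [← jI_span, ← hbx, jI_pow, ← hβb, Ideal.span_singleton_pow]
  obtain ⟨u, hu⟩ := eq_unit_of_span_eq h1
  set s := sO σ.toRingEquiv
  have hc : s (algebraMap (𝓞 K) (𝓞 L) x) = algebraMap (𝓞 K) (𝓞 L) x :=
    RingOfIntegers.ext (σ.commutes _)
  have hx' : algebraMap (𝓞 K) (𝓞 L) x ≠ 0 := by simpa using hx
  have h2 : ε ^ n * sU σ.toRingEquiv u = u := by
    ext1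
    have hsu : ((sU σ.toRingEquiv u : (𝓞 L)ˣ) : 𝓞 L) = s u := rfl
    apply mul_left_cancel₀ hx'
    push_cast
    rw [hsu, hu, mul_left_comm, ← hc, ← map_mul, hu, map_pow, ← mul_pow, hεβ]
  have h3 : ε ^ n ∈ (dU σ.toRingEquiv).range := by
    refine ⟨u, ?_⟩
    rw [dU, MonoidHom.div_apply, div_eq_iff_eq_mul]; exact h2.symm
  have h4 : ε ^ 2 ∈ (dU σ.toRingEquiv).range := by
    refine ⟨ε, ?_⟩
    have h5 := h.iU_nU ε
    rw [MonoidHom.mem_ker.1 hε, map_one] at h5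
    rw [dU, MonoidHom.div_apply, div_eq_iff_eq_mul, pow_two, mul_assoc, ← h5, mul_one]; rfl
  obtain ⟨k, hk⟩ := hodd
  have h6 := (dU σ.toRingEquiv).range.mul_mem h3 (Subgroup.inv_mem _ (Subgroup.pow_mem _ h4 k))
  have : n = 2 * k + 1 := hk
  rw [this, ← pow_mul, pow_succ, mul_comm (ε ^ (2 * k)), mul_assoc, mul_inv_cancel, mul_one] at h6
  exact h6

theorem chev_ineq2 {σ : L ≃ₐ[K] L} (h : Quad K L σ) (hodd : Odd (Nat.card (ClassGroup (𝓞 K))))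
    (S : Finset (Ideal (𝓞 L))) (hS : ∀ P, P ∈ S ↔ SPrime K σ P) :
    ∃ A0 : Subgroup (ClassGroup (𝓞 L)),
      (∀ J : Ideal (𝓞 L), J ≠ ⊥ → sI σ.toRingEquiv J = J → cl J ^ 2 = 1 → cl J ∈ A0) ∧
      Nat.card A0 * (dU σ.toRingEquiv).range.relIndex (nU K L).ker ≤ 2 ^ S.card := by
  set n := Nat.card (ClassGroup (𝓞 K)) with hn
  have hjn : ∀ c : ClassGroup (𝓞 K), jj K L c ^ n = 1 := fun c => by
    rw [← map_pow, hn, pow_card_eq_one', map_one]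
  have hSne : ∀ P ∈ S, P ≠ ⊥ := fun P hP => ((hS P).1 hP).2.1
  have hh : ∀ P ∈ S, (cl P ^ n) ^ 2 = 1 := by
    intro P hP
    have hPS := (hS P).1 hP
    rw [← pow_mul, mul_comm, pow_mul, ← cl_pow hPS.2.1, hPS.sq h, ← jj_cl (rN_ne_bot hPS.2.1), hjn]
  have hprod : ∀ f : Ideal (𝓞 L) → ℕ, ∏ P ∈ S, P ^ f P ≠ ⊥ := fun f =>
    Finset.prod_ne_zero_iff.2 fun Q hQ => pow_ne_zero _ (hSne Q hQ)
  refine ⟨(Psi S n hh).range, ?_, ?_⟩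
  · intro J hJ hσ hsq
    obtain ⟨f, b, hb, hf⟩ := decomp h S hS _ J rfl hJ hσ
    refine ⟨Multiplicative.ofAdd fun P => (f P : ZMod 2), ?_⟩
    rw [Psi_cast S n hh hSne]
    have h1 : cl J ^ n = cl J := by
      obtain ⟨k, hk⟩ := hodd
      rw [hk, pow_succ, pow_mul, hsq, one_pow, one_mul]
    rw [← h1]
    conv_rhs => rw [hf, cl_mul (hprod f) (jI_ne_bot hb), mul_pow, ← jj_cl hb, hjn, mul_one]
  · have h1 : (dU σ.toRingEquiv).range.relIndex (nU K L).ker ≤ Nat.card (Psi S n hh).ker := by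
      apply group_count2 (V := (Psi S n hh).ker) (R := fun (ε : (𝓞 L)ˣ) v => ∃ (β : 𝓞 L) (f : Ideal (𝓞 L) → ℕ) (b : Ideal (𝓞 K)),
        β ≠ 0 ∧ b ≠ ⊥ ∧ (ε : 𝓞 L) * sO σ.toRingEquiv β = β ∧
        Ideal.span {β} = (∏ P ∈ S, P ^ f P) * jI K L b ∧
        v.1 = Multiplicative.ofAdd fun P : S => (f P : ZMod 2))
      · intro ε hε
        obtain ⟨w, hw, hww⟩ := frac_hilbert h (a := (ε : 𝓞 L)) (b := 1) one_ne_zero ε.ne_zero (by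
          rw [map_one]; exact congrArg Units.val (MonoidHom.mem_ker.1 hε))
        rw [one_mul] at hww
        obtain ⟨f, b, hb, hf⟩ := decomp h S hS _ (Ideal.span {w}) rfl (span_ne_bot hw) (by
          rw [sI_span]
          conv_rhs => rw [← hww]
          rw [Ideal.span_singleton_mul_left_unit ε.isUnit])
        refine ⟨⟨Multiplicative.ofAdd fun P : S => (f P : ZMod 2), ?_⟩, w, f, b, hw, hb, hww, hf, rfl⟩
        rw [MonoidHom.mem_ker, Psi_cast S n hh hSne]
        have h2 : cl (Ideal.span {w}) ^ n = cl ((∏ P ∈ S, P ^ f P) * jI K L b) ^ n := by rw [hf]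
        rw [cl_span hw, cl_mul (hprod f) (jI_ne_bot hb), mul_pow, ← jj_cl hb, hjn, mul_one,
          one_pow] at h2
        exact h2.symm
      · rintro ε hε ε' hε' v ⟨β, f, b, hβ, hb, e1, e2, e3⟩ ⟨β', f', b', hβ', hb', e1', e2', e3'⟩
        have hff : ∀ P ∈ S, Even (f P + f' P) := by
          intro P hP
          have := congrFun (congrArg Multiplicative.toAdd (e3.symm.trans e3')) ⟨P, hP⟩
          have h4 : (f P : ZMod 2) = f' P := this
          rw [← ZMod.natCast_eq_zero_iff_even]
          push_cast
          rw [h4, CharTwo.add_self_eq_zero]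
        obtain ⟨B, hB, hB'⟩ := prod_even h S (fun P hP => (hS P).1 hP) _ hff
        have hmem : ε * ε' ∈ (dU σ.toRingEquiv).range := by
          apply unit_from_real h hodd (β := β * β') (b := B * (b * b'))
            (Subgroup.mul_mem _ hε hε') (mul_ne_zero hβ hβ') _ (mul_ne_zero hB (mul_ne_zero hb hb'))
          · rw [← span_mul_span, e2, e2', jI_mul, jI_mul, ← hB']
            simp_rw [pow_add, Finset.prod_mul_distrib]
            ring
          · rw [map_mul]; push_cast
            rw [mul_mul_mul_comm, e1, e1']
        have h4 : ε' ^ 2 ∈ (dU σ.toRingEquiv).range := by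
          refine ⟨ε', ?_⟩
          have h5 := h.iU_nU ε'
          rw [MonoidHom.mem_ker.1 hε', map_one] at h5
          rw [dU, MonoidHom.div_apply, div_eq_iff_eq_mul, pow_two, mul_assoc, ← h5, mul_one]; rfl
        have h6 := (dU σ.toRingEquiv).range.mul_mem hmem (Subgroup.inv_mem _ h4)
        have h7 : ε / ε' = ε * ε' * (ε' ^ 2)⁻¹ := by
          rw [pow_two, mul_inv, div_eq_mul_inv]; group
        rw [h7]; exact h6
    calc _ ≤ Nat.card (Psi S n hh).range * Nat.card (Psi S n hh).ker := by gcongr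
      _ = Nat.card (Multiplicative (S → ZMod 2)) := by
        rw [← Subgroup.card_mul_index (Psi S n hh).ker, Subgroup.index_ker, mul_comm]
      _ = 2 ^ S.card := by
        change Nat.card (S → ZMod 2) = _
        rw [Nat.card_fun]; simp
      _ ≤ _ := le_rfl

theorem nU_index_ne_zero {σ : L ≃ₐ[K] L} (h : Quad K L σ) : (nU K L).range.index ≠ 0 := by
  have h1 := index_range_two (Additive (𝓞 K)ˣ)
  have hfin2 : Finite {x : Additive (𝓞 K)ˣ // 2 • x = 0} := by
    have hsub : {x : Additive (𝓞 K)ˣ | 2 • x = 0} ⊆ {Additive.ofMul 1, Additive.ofMul (-1)} := by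
      intro x hx
      exact (two_torsion_units (L := K) x.toMul).1 hx
    exact (Set.Finite.subset (Set.toFinite _) hsub).to_subtype
  have h2 : (nsmulAddMonoidHom (α := Additive (𝓞 K)ˣ) 2).range.index ≠ 0 := by
    rw [h1]
    refine mul_ne_zero (by positivity) (Nat.card_ne_zero.2 ⟨⟨0, by simp⟩, hfin2⟩)
  have h3 : (powMonoidHom (α := (𝓞 K)ˣ) 2).range.index ≠ 0 := by
    rw [← Subgroup.index_toAddSubgroup]
    exact h2
  refine fun h0 => h3 (Nat.eq_zero_of_zero_dvd (h0 ▸ Subgroup.index_dvd_of_le ?_))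
  rintro _ ⟨u, rfl⟩
  refine ⟨iU K L u, ?_⟩
  apply iU_inj (L := L)
  rw [h.iU_nU, (h.fixedU _).2 ⟨u, rfl⟩, powMonoidHom_apply, map_pow, pow_two]

/-- Chevalley's ambiguous class inequality. -/
theorem chevalley {σ : L ≃ₐ[K] L} (h : Quad K L σ) (hodd : Odd (Nat.card (ClassGroup (𝓞 K))))
    (t : ℕ) (ht : ∀ s : Finset (Ideal (𝓞 L)), (∀ P ∈ s, P.IsPrime ∧ P ≠ ⊥ ∧
      ∀ θ, θ - sO σ.toRingEquiv θ ∈ P) → s.card ≤ t) :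
    Nat.card {c : ClassGroup (𝓞 L) // c ^ 2 = 1} * (normUnits K L).index * 2 ^ Units.rank L ≤
      2 ^ (t + 2 * Units.rank K) := by
  have hfin : {P : Ideal (𝓞 L) | SPrime K σ P}.Finite := by
    by_contra hinf
    obtain ⟨s, hs, hc⟩ := Set.Infinite.exists_subset_card_eq hinf (t + 1)
    have := ht s (fun P hP => ⟨(hs hP).1, (hs hP).2.1, (hs hP).diff_mem h⟩)
    lia
  have hS : ∀ P, P ∈ hfin.toFinset ↔ SPrime K σ P := by simp
  have hSt : hfin.toFinset.card ≤ t := ht _ (fun P hP => by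
    have := (hS P).1 hP
    exact ⟨this.1, this.2.1, this.diff_mem h⟩)
  obtain ⟨A0, hA0, hc⟩ := chev_ineq2 h hodd _ hS
  have hH := h.herbrand
  have hix := nU_index_ne_zero h
  let A : Subgroup (ClassGroup (𝓞 L)) := (powMonoidHom 2).ker
  have hcnt := group_count1 (ChevRel K σ) A A0 (nU K L).range (normUnits K L) (by
      rintro _ ⟨u, rfl⟩
      rw [mem_normUnits]
      exact ⟨u.1, (nI_coe _).symm⟩) hix (fun _ _ _ _ => ChevRel.mul) (fun _ _ _ => ChevRel.uniq h)
      (fun c hc => ChevRel.exists h hodd hc)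
      (fun c hc u hu hcu => by
        obtain ⟨J, hJ, hσ, rfl⟩ := hcu.inv_ideal h hu
        exact hA0 J hJ hσ hc)
  calc Nat.card {c : ClassGroup (𝓞 L) // c ^ 2 = 1} * (normUnits K L).index * 2 ^ Units.rank L
      ≤ Nat.card A0 * (nU K L).range.index * 2 ^ Units.rank L := by
        exact Nat.mul_le_mul_right _ hcnt
    _ = Nat.card A0 * (dU σ.toRingEquiv).range.relIndex (nU K L).ker * 2 ^ (2 * Units.rank K) := by
        rw [mul_assoc, hH]; ring
    _ ≤ 2 ^ t * 2 ^ (2 * Units.rank K) := by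
        gcongr
        exact hc.trans (Nat.pow_le_pow_right (by norm_num) hSt)
    _ = _ := by rw [pow_add]

theorem chevalley0 {σ : L ≃ₐ[K] L} (h : Quad K L σ) (hodd : Odd (Nat.card (ClassGroup (𝓞 K))))
    (t : ℕ) (ht : ∀ s : Finset (Ideal (𝓞 L)), (∀ P ∈ s, P.IsPrime ∧ P ≠ ⊥ ∧
      ∀ θ, θ - sO σ.toRingEquiv θ ∈ P) → s.card ≤ t) (e : ℕ)
    (he : t + 2 * Units.rank K ≤ Units.rank L + e) :
    Nat.card {c : ClassGroup (𝓞 L) // c ^ 2 = 1} ≤ 2 ^ e := by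
  have h1 := chevalley h hodd t ht
  have h2 : (normUnits K L).index ≠ 0 := fun h0 =>
    nU_index_ne_zero h (Nat.eq_zero_of_zero_dvd (h0 ▸ Subgroup.index_dvd_of_le (by
      rintro _ ⟨u, rfl⟩
      rw [mem_normUnits]
      exact ⟨u.1, (nI_coe _).symm⟩)))
  have h3 : Nat.card {c : ClassGroup (𝓞 L) // c ^ 2 = 1} * 2 ^ Units.rank L ≤
      2 ^ e * 2 ^ Units.rank L := by
    calc _ ≤ Nat.card {c : ClassGroup (𝓞 L) // c ^ 2 = 1} * (normUnits K L).index *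
          2 ^ Units.rank L := by
            gcongr; exact Nat.le_mul_of_pos_right _ (Nat.pos_of_ne_zero h2)
      _ ≤ _ := h1
      _ ≤ 2 ^ (Units.rank L + e) := Nat.pow_le_pow_right (by norm_num) he
      _ = _ := by rw [pow_add, mul_comm]
  exact Nat.le_of_mul_le_mul_right h3 (by positivity)

theorem chevalley1 {σ : L ≃ₐ[K] L} (h : Quad K L σ) (hodd : Odd (Nat.card (ClassGroup (𝓞 K))))
    (t : ℕ) (ht : ∀ s : Finset (Ideal (𝓞 L)), (∀ P ∈ s, P.IsPrime ∧ P ≠ ⊥ ∧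
      ∀ θ, θ - sO σ.toRingEquiv θ ∈ P) → s.card ≤ t) (e : ℕ)
    (u : (𝓞 K)ˣ) (hu : ∀ z : L, Algebra.norm K z ≠ ((u : 𝓞 K) : K))
    (he : t + 2 * Units.rank K ≤ Units.rank L + e + 1) :
    Nat.card {c : ClassGroup (𝓞 L) // c ^ 2 = 1} ≤ 2 ^ e := by
  have h1 := chevalley h hodd t ht
  have h2 : (normUnits K L).index ≠ 0 := fun h0 =>
    nU_index_ne_zero h (Nat.eq_zero_of_zero_dvd (h0 ▸ Subgroup.index_dvd_of_le (by
      rintro _ ⟨u, rfl⟩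
      rw [mem_normUnits]
      exact ⟨u.1, (nI_coe _).symm⟩)))
  have h4 : (normUnits K L).index ≠ 1 := by
    rw [Ne, Subgroup.index_eq_one]
    intro hT
    have : u ∈ normUnits K L := hT ▸ Subgroup.mem_top u
    obtain ⟨z, hz⟩ := mem_normUnits.1 this
    exact hu z hz
  have h5 : 2 ≤ (normUnits K L).index := by lia
  have h3 : Nat.card {c : ClassGroup (𝓞 L) // c ^ 2 = 1} * (2 * 2 ^ Units.rank L) ≤
      2 ^ e * (2 * 2 ^ Units.rank L) := by
    calc _ ≤ Nat.card {c : ClassGroup (𝓞 L) // c ^ 2 = 1} * (normUnits K L).index *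
          2 ^ Units.rank L := by
            rw [mul_assoc]; gcongr
      _ ≤ _ := h1
      _ ≤ 2 ^ (Units.rank L + e + 1) := Nat.pow_le_pow_right (by norm_num) he
      _ = _ := by rw [pow_succ, pow_add]; ring
  exact Nat.le_of_mul_le_mul_right h3 (by positivity)

theorem odd_of_two_torsion {G : Type*} [CommGroup G] [Finite G]
    (h : Nat.card {c : G // c ^ 2 = 1} ≤ 1) : Odd (Nat.card G) := by
  by_contra hn
  rw [Nat.not_odd_iff_even, even_iff_two_dvd] at hn
  have : Fact (Nat.Prime 2) := ⟨Nat.prime_two⟩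
  obtain ⟨x, hx⟩ := exists_prime_orderOf_dvd_card' 2 hn
  have h1 : x ^ 2 = 1 := hx ▸ pow_orderOf_eq_one x
  have hs : Subsingleton {c : G // c ^ 2 = 1} := Finite.card_le_one_iff_subsingleton.1 h
  have := congrArg Subtype.val (hs.elim ⟨x, h1⟩ ⟨1, one_pow 2⟩)
  simp only at this
  rw [this, orderOf_one] at hx
  lia

end Chevalley2


open NumberField

set_option linter.unusedSectionVars false

section PadicChar

variable {p : ℕ} [hpf : Fact p.Prime]

/-- unit part of a `p`-adic number -/
noncomputable def upart (y : ℚ_[p]) : ℤ_[p] := by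
  classical
  exact if h : ‖y * (p : ℚ_[p]) ^ (-y.valuation)‖ ≤ 1 then ⟨_, h⟩ else 0

/-- the quadratic character of the unit part -/
noncomputable def sQ (y : ℚ_[p]) : ℤ := quadraticChar (ZMod p) (PadicInt.toZMod (upart y))

theorem padic_p_ne : (p : ℚ_[p]) ≠ 0 := by
  exact_mod_cast hpf.out.ne_zero

theorem val_of_form {k : ℤ} {u : ℤ_[p]} (hu : ‖u‖ = 1) :
    ((p : ℚ_[p]) ^ k * u).valuation = k := by
  have hu0 : (u : ℚ_[p]) ≠ 0 := by
    intro h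
    have : ‖(u : ℚ_[p])‖ = 1 := hu
    rw [h, norm_zero] at this; norm_num at this
  have hv : (u : ℚ_[p]).valuation = 0 := by
    have h1 := Padic.norm_eq_zpow_neg_valuation hu0
    have h2 : ‖(u : ℚ_[p])‖ = 1 := hu
    rw [h2] at h1
    have hp1 : (1 : ℝ) < p := by exact_mod_cast hpf.out.one_lt
    have := zpow_right_injective₀ (by linarith) hp1.ne' (show (p : ℝ) ^ (0 : ℤ) = _ from by
      rw [zpow_zero]; exact h1)
    lia
  rw [Padic.valuation_mul (zpow_ne_zero _ padic_p_ne) hu0, Padic.valuation_zpow, Padic.valuation_p,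
    hv]; ring

theorem upart_of_form {k : ℤ} {u : ℤ_[p]} (hu : ‖u‖ = 1) :
    upart ((p : ℚ_[p]) ^ k * (u : ℚ_[p])) = u := by
  have h1 : (p : ℚ_[p]) ^ k * u * (p : ℚ_[p]) ^ (-((p : ℚ_[p]) ^ k * u).valuation) = u := by
    rw [val_of_form hu, mul_right_comm, ← zpow_add₀ padic_p_ne, add_neg_cancel, zpow_zero, one_mul]
  rw [upart]
  have h2 : ‖(p : ℚ_[p]) ^ k * u * (p : ℚ_[p]) ^ (-((p : ℚ_[p]) ^ k * u).valuation)‖ ≤ 1 := by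
    rw [h1]; exact u.2
  exact (dif_pos h2).trans (Subtype.ext h1)

theorem sQ_of_form {k : ℤ} {u : ℤ_[p]} (hu : ‖u‖ = 1) :
    sQ ((p : ℚ_[p]) ^ k * (u : ℚ_[p])) = quadraticChar (ZMod p) (PadicInt.toZMod u) := by
  rw [sQ, upart_of_form hu]

theorem exists_form {y : ℚ_[p]} (hy : y ≠ 0) :
    ∃ (k : ℤ) (u : ℤ_[p]), ‖u‖ = 1 ∧ y = (p : ℚ_[p]) ^ k * u := by
  have h1 : ‖y * (p : ℚ_[p]) ^ (-y.valuation)‖ = 1 := by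
    rw [norm_mul, Padic.norm_eq_zpow_neg_valuation hy, norm_zpow, Padic.norm_p, inv_zpow]
    rw [← zpow_neg, ← zpow_add₀]
    · simp
    · exact_mod_cast hpf.out.ne_zero
  refine ⟨y.valuation, ⟨_, h1.le⟩, h1, ?_⟩
  rw [mul_comm, mul_assoc, ← zpow_add₀ padic_p_ne]; simp

theorem toZMod_ne_zero {u : ℤ_[p]} (hu : ‖u‖ = 1) : PadicInt.toZMod u ≠ 0 := by
  intro h
  have : u ∈ RingHom.ker (PadicInt.toZMod : ℤ_[p] →+* ZMod p) := h
  rw [PadicInt.ker_toZMod, IsLocalRing.mem_maximalIdeal, PadicInt.mem_nonunits] at this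
  linarith

theorem toZMod_p : PadicInt.toZMod (p : ℤ_[p]) = 0 := by
  rw [map_natCast]; simp

theorem sQ_mul {x y : ℚ_[p]} (hx : x ≠ 0) (hy : y ≠ 0) : sQ (x * y) = sQ x * sQ y := by
  obtain ⟨k, u, hu, rfl⟩ := exists_form hx
  obtain ⟨l, v, hv, rfl⟩ := exists_form hy
  rw [sQ_of_form hu, sQ_of_form hv, ← map_mul, ← map_mul]
  have : (p : ℚ_[p]) ^ k * u * ((p : ℚ_[p]) ^ l * v) = (p : ℚ_[p]) ^ (k + l) * ((u * v : ℤ_[p])) := by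
    rw [zpow_add₀ padic_p_ne]; push_cast; ring
  rw [this, sQ_of_form (by rw [norm_mul, hu, hv, one_mul])]

theorem sQ_sq_eq_one {x : ℚ_[p]} (hx : x ≠ 0) : sQ x * sQ x = 1 := by
  obtain ⟨k, u, hu, rfl⟩ := exists_form hx
  rw [sQ_of_form hu, ← pow_two, quadraticChar_sq_one (toZMod_ne_zero hu)]

theorem sQ_sq {x : ℚ_[p]} (hx : x ≠ 0) : sQ (x ^ 2) = 1 := by
  rw [pow_two, sQ_mul hx hx, sQ_sq_eq_one hx]

theorem sQ_one : sQ (1 : ℚ_[p]) = 1 := by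
  have := sQ_sq (p := p) one_ne_zero
  rwa [one_pow] at this

theorem sQ_unit {u : ℤ_[p]} (hu : ‖u‖ = 1) :
    sQ (u : ℚ_[p]) = quadraticChar (ZMod p) (PadicInt.toZMod u) := by
  have := sQ_of_form (k := 0) hu
  rwa [zpow_zero, one_mul] at this

theorem sQ_p : sQ (p : ℚ_[p]) = 1 := by
  have := sQ_of_form (p := p) (k := 1) (u := 1) (by simp)
  simpa using this

theorem sQ_int {n : ℤ} (hn : (n : ZMod p) ≠ 0) : sQ (n : ℚ_[p]) = quadraticChar (ZMod p) n := by
  have h1 : ‖((n : ℤ_[p]))‖ = 1 := by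
    by_contra h
    have h2 : ‖((n : ℤ_[p]))‖ < 1 := lt_of_le_of_ne (PadicInt.norm_le_one _) h
    have h3 : (n : ℤ_[p]) ∈ RingHom.ker (PadicInt.toZMod : ℤ_[p] →+* ZMod p) := by
      rw [PadicInt.ker_toZMod, IsLocalRing.mem_maximalIdeal, PadicInt.mem_nonunits]
      exact h2
    rw [RingHom.mem_ker, map_intCast] at h3
    exact hn h3
  have := sQ_unit h1
  rw [map_intCast] at this
  rw [← this]; simp

theorem sQ_neg_one (hp4 : p % 4 = 1) : sQ (-1 : ℚ_[p]) = 1 := by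
  have h := sQ_int (p := p) (n := -1) (by simp)
  push_cast at h
  rw [h, quadraticChar_one_iff_isSquare (by simp)]
  rw [ZMod.exists_sq_eq_neg_one_iff]; lia

theorem not_sq_p {c d : ℚ_[p]} (hc : c ≠ 0) : d ^ 2 ≠ p * c ^ 2 := by
  intro h
  have h1 := congrArg Padic.valuation h
  rw [Padic.valuation_mul padic_p_ne (pow_ne_zero _ hc), Padic.valuation_pow, Padic.valuation_pow,
    Padic.valuation_p] at h1
  push_cast at h1
  lia

theorem sQ_normform (hp4 : p % 4 = 1) {a b : ℚ_[p]} (h0 : a ^ 2 - (p : ℚ_[p]) * b ^ 2 ≠ 0) :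
    sQ (a ^ 2 - (p : ℚ_[p]) * b ^ 2) = 1 := by
  by_cases hb : b = 0
  · subst hb
    have ha : a ≠ 0 := by rintro rfl; simp at h0
    simpa using sQ_sq ha
  by_cases ha : a = 0
  · subst ha
    have : (0 : ℚ_[p]) ^ 2 - p * b ^ 2 = -1 * (p * b ^ 2) := by ring
    rw [this, sQ_mul (by simp) (mul_ne_zero padic_p_ne (pow_ne_zero _ hb)), sQ_neg_one hp4,
      sQ_mul padic_p_ne (pow_ne_zero _ hb), sQ_p, sQ_sq hb]; norm_num
  obtain ⟨k, u, hu, rfl⟩ := exists_form ha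
  obtain ⟨l, v, hv, rfl⟩ := exists_form hb
  have hone : ∀ z : ℤ_[p], PadicInt.toZMod z ≠ 0 → ‖z‖ = 1 := by
    intro z hz
    by_contra h
    have h2 : ‖z‖ < 1 := lt_of_le_of_ne (PadicInt.norm_le_one _) h
    exact hz (by
      have : z ∈ RingHom.ker (PadicInt.toZMod : ℤ_[p] →+* ZMod p) := by
        rw [PadicInt.ker_toZMod, IsLocalRing.mem_maximalIdeal, PadicInt.mem_nonunits]
        exact h2
      exact this)
  rcases le_or_gt k l with hkl | hkl
  · obtain ⟨m, rfl⟩ := Int.le.dest hkl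
    have e : ((p : ℚ_[p]) ^ k * u) ^ 2 - p * ((p : ℚ_[p]) ^ (k + m) * v) ^ 2 =
        (p : ℚ_[p]) ^ (2 * k) * ((u ^ 2 - p * (p ^ m * v) ^ 2 : ℤ_[p])) := by
      rw [two_mul, zpow_add₀ padic_p_ne, zpow_add₀ padic_p_ne]; push_cast; rw [zpow_natCast]; ring
    have hz : PadicInt.toZMod (u ^ 2 - p * (p ^ m * v) ^ 2 : ℤ_[p]) = PadicInt.toZMod u ^ 2 := by
      rw [map_sub, map_mul, toZMod_p, zero_mul, sub_zero, map_pow]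
    have hz0 : PadicInt.toZMod u ^ 2 ≠ 0 := pow_ne_zero _ (toZMod_ne_zero hu)
    rw [e, sQ_of_form (hone _ (by rw [hz]; exact hz0)), hz]
    exact quadraticChar_sq_one' (toZMod_ne_zero hu)
  · obtain ⟨m, hm⟩ := Int.le.dest (Int.add_one_le_of_lt hkl)
    obtain rfl : k = l + 1 + m := hm.symm
    have e : ((p : ℚ_[p]) ^ (l + 1 + (m : ℤ)) * u) ^ 2 - p * ((p : ℚ_[p]) ^ l * v) ^ 2 =
        (p : ℚ_[p]) ^ (2 * l + 1) * ((p * (p ^ m * u) ^ 2 - v ^ 2 : ℤ_[p])) := by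
      rw [two_mul, zpow_add₀ padic_p_ne, zpow_add₀ padic_p_ne, zpow_add₀ padic_p_ne,
        zpow_add₀ padic_p_ne]
      push_cast; rw [zpow_natCast, zpow_one]; ring
    have hz : PadicInt.toZMod (p * (p ^ m * u) ^ 2 - v ^ 2 : ℤ_[p]) = -1 * PadicInt.toZMod v ^ 2 := by
      rw [map_sub, map_mul, toZMod_p, zero_mul, zero_sub, map_pow, neg_one_mul]
    have hz0 : PadicInt.toZMod v ^ 2 ≠ 0 := pow_ne_zero _ (toZMod_ne_zero hv)
    rw [e, sQ_of_form (hone _ (by rw [hz]; simpa using hz0)), hz, map_mul,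
      quadraticChar_sq_one' (toZMod_ne_zero hv), mul_one]
    rw [quadraticChar_one_iff_isSquare (by simp), ZMod.exists_sq_eq_neg_one_iff]; lia

theorem exists_quad {K L : Type*} [Field K] [Field L] [CharZero K] [Algebra K L]
    (h : Module.finrank K L = 2) : ∃ σ : L ≃ₐ[K] L, Quad K L σ := by
  have : FiniteDimensional K L := Module.finite_of_finrank_pos (by lia)
  have : Algebra.IsQuadraticExtension K L := ⟨h⟩
  have hg : IsGalois K L := inferInstance
  have hc := IsGalois.card_aut_eq_finrank K L
  rw [h] at hc
  have : Nontrivial (L ≃ₐ[K] L) := by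
    apply Finite.one_lt_card_iff_nontrivial.1; lia
  obtain ⟨σ, hσ⟩ := exists_ne (1 : L ≃ₐ[K] L)
  exact ⟨σ, h, hσ⟩

end PadicChar


open NumberField

set_option linter.unusedSectionVars false

section GenusChar

variable {K L : Type*} [Field K] [Field L] [NumberField K] [NumberField L] [Algebra K L]

theorem Quad.neg_of_sq {σ : L ≃ₐ[K] L} (h : Quad K L σ) {θ : L} {m : K}
    (hθ : θ ^ 2 = algebraMap K L m) (hθK : ∀ y, algebraMap K L y ≠ θ) : σ θ = -θ := by
  have h1 : σ θ ≠ θ := fun h2 => by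
    obtain ⟨y, hy⟩ := h.fixed h2
    exact hθK y hy
  have h2 : (σ θ) ^ 2 = θ ^ 2 := by rw [← map_pow, hθ, σ.commutes]
  rcases sq_eq_sq_iff_eq_or_eq_neg.1 h2 with h3 | h3
  · exact absurd h3 h1
  · exact h3

theorem Quad.decomp {σ : L ≃ₐ[K] L} (h : Quad K L σ) {θ : L} {m : K}
    (hθ : θ ^ 2 = algebraMap K L m) (hθK : ∀ y, algebraMap K L y ≠ θ) (x : L) :
    ∃ a b : K, x = algebraMap K L a + algebraMap K L b * θ := by
  have hs := h.neg_of_sq hθ hθK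
  have h0 : θ ≠ 0 := fun h0 => hθK 0 (by rw [map_zero, h0])
  obtain ⟨a, ha⟩ := h.fixed (x := (x + σ x) / 2) (by
    rw [map_div₀, map_add, h.sq, add_comm, map_ofNat])
  obtain ⟨b, hb⟩ := h.fixed (x := (x - σ x) / (2 * θ)) (by
    rw [map_div₀, map_sub, h.sq, map_mul, hs, map_ofNat]
    field_simp; ring)
  refine ⟨a, b, ?_⟩
  rw [ha, hb]; field_simp; ring

theorem Quad.norm_decomp {σ : L ≃ₐ[K] L} (h : Quad K L σ) {θ : L} {m : K}
    (hθ : θ ^ 2 = algebraMap K L m) (hθK : ∀ y, algebraMap K L y ≠ θ) (a b : K) :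
    Algebra.norm K (algebraMap K L a + algebraMap K L b * θ) = a ^ 2 - m * b ^ 2 := by
  apply (algebraMap K L).injective
  rw [h.norm, map_add, map_mul, h.neg_of_sq hθ hθK, σ.commutes, σ.commutes, map_sub, map_mul,
    map_pow, map_pow, ← hθ]
  ring

theorem finrank_two_of_sq {θ : L} {m : K} (hθ : θ ^ 2 = algebraMap K L m)
    (hθK : ∀ y, algebraMap K L y ≠ θ) : Module.finrank K (IntermediateField.adjoin K {θ}) = 2 := by
  have hi : IsIntegral K θ := IsIntegral.of_finite K θ
  rw [IntermediateField.adjoin.finrank hi]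
  have h1 : (minpoly K θ).natDegree ≤ 2 := by
    have hd := Polynomial.natDegree_le_of_dvd (minpoly.dvd K θ
      (p := Polynomial.X ^ 2 - Polynomial.C m) (by simp [hθ]))
      (Polynomial.X_pow_sub_C_ne_zero (by norm_num) m)
    rwa [Polynomial.natDegree_X_pow_sub_C] at hd
  have h2 : (minpoly K θ).natDegree ≠ 1 := fun h => by
    obtain ⟨y, hy⟩ := minpoly.natDegree_eq_one_iff.1 h
    exact hθK y hy
  have h3 := minpoly.natDegree_pos hi
  lia

variable {p : ℕ} [hpf : Fact p.Prime]

theorem sQ_norm (hp4 : p % 4 = 1) (ι : K →+* ℚ_[p]) {θ : L} {m : K}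
    (hθ : θ ^ 2 = algebraMap K L m) {c : ℚ_[p]} (hc : c ≠ 0) (hm : ι m = p * c ^ 2)
    {α : L} (hα : α ≠ 0) : sQ (ι (Algebra.norm K α)) = 1 := by
  have hθK : ∀ y, algebraMap K L y ≠ θ := by
    rintro y rfl
    rw [← map_pow] at hθ
    have := (algebraMap K L).injective hθ
    rw [← this, map_pow] at hm
    exact not_sq_p hc hm
  let E := IntermediateField.adjoin K {θ}
  have : NumberField E := by
    have : CharZero E := inferInstance
    have h2 : FiniteDimensional ℚ E := Module.Finite.trans (R := ℚ) K E
    exact ⟨⟩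
  have h2 : Module.finrank K E = 2 := finrank_two_of_sq hθ hθK
  obtain ⟨σ, hσ⟩ := exists_quad h2
  let θ' : E := ⟨θ, IntermediateField.mem_adjoin_simple_self K θ⟩
  have hθ' : θ' ^ 2 = algebraMap K E m := Subtype.ext hθ
  have hθK' : ∀ y, algebraMap K E y ≠ θ' := fun y hy => hθK y (congrArg Subtype.val hy)
  rw [← Algebra.norm_norm (R := K) (S := E)]
  obtain ⟨a, b, hab⟩ := hσ.decomp hθ' hθK' (Algebra.norm E α)
  have hn : Algebra.norm K (Algebra.norm E α) ≠ 0 := by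
    rw [Algebra.norm_norm]; exact (Algebra.norm_ne_zero_iff).2 hα
  have hn' : ι (Algebra.norm K (Algebra.norm E α)) ≠ 0 := by
    rwa [Ne, map_eq_zero]
  rw [hab, hσ.norm_decomp hθ' hθK'] at hn' ⊢
  have e : ι (a ^ 2 - m * b ^ 2) = (ι a) ^ 2 - (p : ℚ_[p]) * (c * ι b) ^ 2 := by
    rw [map_sub, map_mul, hm, map_pow, map_pow]; ring
  rw [e] at hn' ⊢
  exact sQ_normform hp4 hn'

/-- units version of the character -/
noncomputable def sUn : ℚ_[p]ˣ →* ℤˣ := MonoidHom.mk'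
  (fun y => ⟨sQ y.1, sQ y.1, sQ_sq_eq_one y.ne_zero, sQ_sq_eq_one y.ne_zero⟩) (fun x y => by
    ext1
    exact sQ_mul x.ne_zero y.ne_zero)

/-- the character extended to all of `ℚ_p` with values in `ℤˣ` (value at `0` is junk) -/
noncomputable def sZ (y : ℚ_[p]) : ℤˣ := by
  classical
  exact if h : y = 0 then 1 else sUn (Units.mk0 y h)

theorem sZ_coe {y : ℚ_[p]} (h : y ≠ 0) : ((sZ y : ℤˣ) : ℤ) = sQ y := by
  rw [sZ, dif_neg h]; rfl

theorem sZ_mul {x y : ℚ_[p]} (hx : x ≠ 0) (hy : y ≠ 0) : sZ (x * y) = sZ x * sZ y := by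
  ext1
  rw [Units.val_mul, sZ_coe hx, sZ_coe hy, sZ_coe (mul_ne_zero hx hy), sQ_mul hx hy]

theorem sZ_pow {x : ℚ_[p]} (hx : x ≠ 0) (n : ℕ) : sZ (x ^ n) = sZ x ^ n := by
  induction n with
  | zero => rw [pow_zero, pow_zero]; ext1; rw [sZ_coe one_ne_zero, sQ_one]; rfl
  | succ n ih => rw [pow_succ, pow_succ, sZ_mul (pow_ne_zero _ hx) hx, ih]

theorem sZ_eq_one {x : ℚ_[p]} (hx : x ≠ 0) : sZ x = 1 ↔ sQ x = 1 := by
  rw [Units.ext_iff, sZ_coe hx]; rfl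

theorem units_odd_pow (x : ℤˣ) {n : ℕ} (hn : Odd n) : x ^ n = x := by
  obtain ⟨k, rfl⟩ := hn
  rw [pow_succ, pow_mul, Int.units_sq, one_pow, one_mul]

variable {D T T' : Type*} [Field D] [Field T] [Field T'] [NumberField D] [NumberField T]
  [NumberField T'] [Algebra D T] [Algebra D T'] [Algebra T T'] [IsScalarTower D T T']

/-- the character on ideals of `D` -/
noncomputable def sId (ι : D →+* ℚ_[p]) (I : Ideal (𝓞 D)) : ℤˣ := by
  classical
  exact if h : I = ⊥ then 1 else sZ (ι (exists_pow_span I h).choose)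

/-- hypotheses making `sId` well-behaved -/
structure GoodEmb (ι : D →+* ℚ_[p]) : Prop where
  odd : Odd (Nat.card (ClassGroup (𝓞 D)))
  unit : ∀ u : (𝓞 D)ˣ, sQ (ι (u : 𝓞 D)) = 1

theorem emb_ne_zero (ι : D →+* ℚ_[p]) {x : 𝓞 D} (hx : x ≠ 0) : ι (x : D) ≠ 0 := by
  rw [Ne, map_eq_zero]; simpa using hx

theorem sId_eq {ι : D →+* ℚ_[p]} (h : GoodEmb ι) {I : Ideal (𝓞 D)} (hI : I ≠ ⊥) {n : ℕ}
    (hn : Odd n) {x : 𝓞 D} (hx : x ≠ 0) (hIx : I ^ n = Ideal.span {x}) : sId ι I = sZ (ι x) := by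
  rw [sId, dif_neg hI]
  obtain ⟨hy, hIy⟩ := (exists_pow_span I hI).choose_spec
  set y := (exists_pow_span I hI).choose
  set k := Nat.card (ClassGroup (𝓞 D))
  have h1 : Ideal.span {y ^ n} = Ideal.span {x ^ k} := by
    rw [← Ideal.span_singleton_pow, ← Ideal.span_singleton_pow, ← hIx, ← hIy, ← pow_mul, ← pow_mul,
      mul_comm]
  obtain ⟨u, hu⟩ := Ideal.span_singleton_eq_span_singleton.1 h1
  have h2 : ι (y : D) ^ n * ι (u : 𝓞 D) = ι (x : D) ^ k := by
    have := congrArg (fun z : 𝓞 D => ι (z : D)) hu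
    simpa [map_mul, map_pow] using this
  have hu0 : ι ((u : 𝓞 D) : D) ≠ 0 := emb_ne_zero ι u.ne_zero
  have h3 := congrArg sZ h2
  rw [sZ_mul (pow_ne_zero _ (emb_ne_zero ι hy)) hu0, sZ_pow (emb_ne_zero ι hy),
    sZ_pow (emb_ne_zero ι hx), (sZ_eq_one hu0).2 (h.unit u), mul_one, units_odd_pow _ hn,
    units_odd_pow _ h.odd] at h3
  exact h3

theorem sId_span {ι : D →+* ℚ_[p]} (h : GoodEmb ι) {x : 𝓞 D} (hx : x ≠ 0) :
    sId ι (Ideal.span {x}) = sZ (ι x) :=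
  sId_eq h (span_ne_bot hx) odd_one hx (pow_one _)

theorem sId_mul {ι : D →+* ℚ_[p]} (h : GoodEmb ι) {I J : Ideal (𝓞 D)} (hI : I ≠ ⊥) (hJ : J ≠ ⊥) :
    sId ι (I * J) = sId ι I * sId ι J := by
  obtain ⟨x, hx, hIx⟩ := exists_pow_span I hI
  obtain ⟨y, hy, hJy⟩ := exists_pow_span J hJ
  rw [sId_eq h hI h.odd hx hIx, sId_eq h hJ h.odd hy hJy,
    sId_eq h (mul_ne_zero hI hJ) h.odd (mul_ne_zero hx hy), ← sZ_mul (emb_ne_zero ι hx)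
      (emb_ne_zero ι hy), ← map_mul]
  · rfl
  · rw [mul_pow, hIx, hJy, Ideal.span_singleton_mul_span_singleton]

/-- all nonzero norms have trivial character -/
def NormTriv (ι : D →+* ℚ_[p]) (T : Type*) [Field T] [Algebra D T] : Prop :=
  ∀ α : T, α ≠ 0 → sQ (ι (Algebra.norm D α)) = 1

/-- the genus character on the class group of `T` -/
noncomputable def chi (ι : D →+* ℚ_[p]) (h : GoodEmb ι) (hT : NormTriv ι T) :
    ClassGroup (𝓞 T) →* ℤˣ :=
  liftCl (fun I => sId ι (rN D T I))
    (fun I J hI hJ => by rw [map_mul, sId_mul h (rN_ne_bot hI) (rN_ne_bot hJ)])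
    (fun x hx => by
      rw [rN_span, sId_span h (nI_ne_zero hx), sZ_eq_one (emb_ne_zero ι (nI_ne_zero hx)), nI_coe]
      exact hT _ (by simpa using hx))

theorem chi_cl {ι : D →+* ℚ_[p]} (h : GoodEmb ι) (hT : NormTriv ι T) {I : Ideal (𝓞 T)}
    (hI : I ≠ ⊥) : chi ι h hT (cl I) = sId ι (rN D T I) := liftCl_cl _ _ _ hI

theorem chi_nm {ι : D →+* ℚ_[p]} (h : GoodEmb ι) (hT : NormTriv ι T) (hT' : NormTriv ι T')
    (c : ClassGroup (𝓞 T')) : chi ι h hT (nm T T' c) = chi ι h hT' c := by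
  obtain ⟨I, hI, rfl⟩ := cl_surj c
  rw [nm_cl hI, chi_cl h hT (rN_ne_bot hI), chi_cl h hT' hI, rN_rN]

theorem chi_of_span {ι : D →+* ℚ_[p]} (h : GoodEmb ι) (hT : NormTriv ι T) {I : Ideal (𝓞 T)}
    (hI : I ≠ ⊥) {x : 𝓞 D} (hx : x ≠ 0) (hIx : rN D T I = Ideal.span {x}) :
    chi ι h hT (cl I) = sZ (ι x) := by
  rw [chi_cl h hT hI, hIx, sId_span h hx]

end GenusChar


open NumberField IntermediateField

set_option linter.unusedSectionVars false

section Sub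

noncomputable instance instAlgLE (K L : IntermediateField ℚ ℂ) [h : Fact (K ≤ L)] : Algebra K L :=
  (IntermediateField.inclusion h.out).toRingHom.toAlgebra

instance instTowerLE (K L M : IntermediateField ℚ ℂ) [Fact (K ≤ L)] [Fact (L ≤ M)] [Fact (K ≤ M)] :
    IsScalarTower K L M := IsScalarTower.of_algebraMap_eq (fun _ => rfl)

theorem algLE_coe {K L : IntermediateField ℚ ℂ} [Fact (K ≤ L)] (x : K) :
    ((algebraMap K L x : L) : ℂ) = x := rfl

theorem alg_alg {K L : IntermediateField ℚ ℂ} [Fact (K ≤ L)] (x : K) :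
    algebraMap L ℂ (algebraMap K L x) = x := rfl

theorem alg_mk {L : IntermediateField ℚ ℂ} (x : ℂ) (hx : x ∈ L) :
    algebraMap L ℂ ⟨x, hx⟩ = x := rfl

theorem mul_finrank_LE (K L : IntermediateField ℚ ℂ) [Fact (K ≤ L)] [FiniteDimensional ℚ L] :
    Module.finrank ℚ K * Module.finrank K L = Module.finrank ℚ L := by
  have : IsScalarTower ℚ K L := inferInstance
  exact Module.finrank_mul_finrank ℚ K L

theorem finrank_LE_two {K L : IntermediateField ℚ ℂ} [Fact (K ≤ L)] [FiniteDimensional ℚ L] {d : ℕ}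
    (hK : Module.finrank ℚ K = d) (hL : Module.finrank ℚ L = 2 * d) : Module.finrank K L = 2 := by
  have h := mul_finrank_LE K L
  have h0 : 0 < Module.finrank ℚ L := Module.finrank_pos
  rw [hK, hL] at h
  rw [hL] at h0
  have : 0 < d := by lia
  exact Nat.eq_of_mul_eq_mul_left this (by rw [h]; ring)

theorem sup_le_adjoin (K : IntermediateField ℚ ℂ) (θ : ℂ) :
    K ⊔ adjoin ℚ {θ} = (adjoin K {θ}).restrictScalars ℚ :=
  (IntermediateField.restrictScalars_adjoin_eq_sup (F := ℚ) (E := ℂ) K ({θ} : Set ℂ)).symm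

theorem finrank_sup_sq {K : IntermediateField ℚ ℂ} {θ : ℂ} (h2 : θ ^ 2 ∈ K) (h : θ ∉ K) :
    Module.finrank ℚ (K ⊔ adjoin ℚ {θ} : IntermediateField ℚ ℂ) = 2 * Module.finrank ℚ K := by
  rw [sup_le_adjoin]
  change Module.finrank ℚ (adjoin K {θ}) = _
  rw [← Module.finrank_mul_finrank ℚ K (adjoin K {θ}), mul_comm]
  congr 1
  have hi : IsIntegral K θ := by
    refine ⟨Polynomial.X ^ 2 - Polynomial.C ⟨θ ^ 2, h2⟩, Polynomial.monic_X_pow_sub_C _ (by norm_num), ?_⟩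
    rw [← Polynomial.aeval_def]
    simp
  rw [IntermediateField.adjoin.finrank hi]
  have h1 : (minpoly K θ).natDegree ≤ 2 := by
    have hd := Polynomial.natDegree_le_of_dvd (minpoly.dvd K θ
      (p := Polynomial.X ^ 2 - Polynomial.C ⟨θ ^ 2, h2⟩) (by simp))
      (Polynomial.X_pow_sub_C_ne_zero (by norm_num) _)
    rwa [Polynomial.natDegree_X_pow_sub_C] at hd
  have h2 : (minpoly K θ).natDegree ≠ 1 := fun h3 => by
    obtain ⟨y, hy⟩ := minpoly.natDegree_eq_one_iff.1 h3
    exact h (hy ▸ y.2)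
  have h3 := minpoly.natDegree_pos hi
  lia

/-- Decomposition lemma giving degree two. -/
theorem finrank_two_of_decomp {K L : Type*} [Field K] [Field L] [Algebra K L] {θ : L}
    (hθ : ∀ y, algebraMap K L y ≠ θ)
    (h : ∀ x : L, ∃ a b : K, x = algebraMap K L a + algebraMap K L b * θ) :
    Module.finrank K L = 2 := by
  have hli : LinearIndependent K ![(1 : L), θ] := by
    rw [LinearIndependent.pair_iff]
    intro s t hst
    have ht : t = 0 := by
      by_contra ht
      apply hθ (-s / t)
      have : algebraMap K L t ≠ 0 := by simpa using ht
      rw [map_div₀, map_neg, div_eq_iff this]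
      rw [Algebra.smul_def, Algebra.smul_def, mul_one] at hst
      linear_combination -hst
    subst ht
    simpa [Algebra.smul_def] using hst
  have hsp : ⊤ ≤ Submodule.span K (Set.range ![(1 : L), θ]) := by
    rintro x -
    obtain ⟨a, b, rfl⟩ := h x
    refine add_mem ?_ ?_
    · rw [Algebra.algebraMap_eq_smul_one]
      exact Submodule.smul_mem _ _ (Submodule.subset_span ⟨0, rfl⟩)
    · rw [← Algebra.smul_def]
      exact Submodule.smul_mem _ _ (Submodule.subset_span ⟨1, rfl⟩)
  rw [Module.finrank_eq_card_basis (Module.Basis.mk hli hsp), Fintype.card_fin]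

/-- The real numbers as an intermediate field. -/
noncomputable def Rl : IntermediateField ℚ ℂ :=
  (Complex.ofRealHom.toRatAlgHom : ℝ →ₐ[ℚ] ℂ).fieldRange

theorem mem_Rl {z : ℂ} : z ∈ Rl ↔ (starRingEnd ℂ) z = z := by
  rw [Complex.conj_eq_iff_real]
  constructor
  · rintro ⟨x, rfl⟩; exact ⟨x, rfl⟩
  · rintro ⟨x, rfl⟩; exact ⟨x, rfl⟩

instance instInfLE (K : IntermediateField ℚ ℂ) : Fact (K ⊓ Rl ≤ K) := ⟨inf_le_left⟩

theorem conj_decomp {K : IntermediateField ℚ ℂ} (hK : ∀ z ∈ K, (starRingEnd ℂ) z ∈ K) {θ : ℂ} (hθ : θ ∈ K)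
    (h0 : θ ≠ 0) (hc : (starRingEnd ℂ) θ = -θ) : Module.finrank (K ⊓ Rl : IntermediateField ℚ ℂ) K = 2 := by
  apply finrank_two_of_decomp (θ := ⟨θ, hθ⟩)
  · rintro y hy
    have h1 : (y : ℂ) = θ := congrArg Subtype.val hy
    have h2 := mem_Rl.1 y.2.2
    rw [h1, hc] at h2
    exact h0 (by linear_combination -(1/2) * h2)
  · rintro ⟨z, hz⟩
    refine ⟨⟨(z + (starRingEnd ℂ) z) / 2, ?_, ?_⟩, ⟨(z - (starRingEnd ℂ) z) / (2 * θ), ?_, ?_⟩, ?_⟩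
    · exact div_mem (add_mem hz (hK z hz)) (ofNat_mem K 2)
    · rw [SetLike.mem_coe, mem_Rl]; simp [add_comm, map_ofNat (starRingEnd ℂ) 2]
    · exact div_mem (sub_mem hz (hK z hz)) (mul_mem (ofNat_mem K 2) hθ)
    · rw [SetLike.mem_coe, mem_Rl]; simp [hc, map_ofNat (starRingEnd ℂ) 2]; field_simp; ring
    · apply Subtype.ext
      change z = (z + (starRingEnd ℂ) z) / 2 + (z - (starRingEnd ℂ) z) / (2 * θ) * θ
      field_simp; ring

end Sub


open NumberField IntermediateField

set_option linter.unusedSectionVars false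

section Fields

/-- the standard primitive `2^(n+2)`-th root of unity -/
noncomputable def zt (n : ℕ) : ℂ := Complex.exp (2 * Real.pi * Complex.I / (2 ^ (n + 2) : ℕ))

theorem zt_prim (n : ℕ) : IsPrimitiveRoot (zt n) (2 ^ (n + 2)) :=
  Complex.isPrimitiveRoot_exp _ (by positivity)

theorem zt_sq (n : ℕ) : zt (n + 1) ^ 2 = zt n := by
  rw [zt, zt, ← Complex.exp_nat_mul]
  congr 1
  push_cast
  field_simp
  ring

theorem zt_zero : zt 0 = Complex.I := by
  rw [zt]
  have : (2 * Real.pi * Complex.I / (2 ^ (0 + 2) : ℕ) : ℂ) = Real.pi / 2 * Complex.I := by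
    push_cast; ring
  rw [this, Complex.exp_pi_div_two_mul_I]

theorem zt_ne (n : ℕ) : zt n ≠ 0 := Complex.exp_ne_zero _

theorem zt_pow_half (n : ℕ) : zt n ^ 2 ^ (n + 1) = -1 := by
  induction n with
  | zero => rw [zt_zero]; norm_num
  | succ n ih => rw [pow_succ' 2 (n+1), pow_mul, zt_sq, ih]

theorem zt_pow_I (n : ℕ) : zt n ^ 2 ^ n = Complex.I := by
  induction n with
  | zero => rw [zt_zero]; norm_num
  | succ n ih => rw [pow_succ' 2 n, pow_mul, zt_sq, ih]

theorem zt_pow_zt1 (n : ℕ) : zt (n + 1) ^ 2 ^ n = zt 1 := by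
  induction n with
  | zero => norm_num
  | succ n ih => rw [pow_succ' 2 n, pow_mul, zt_sq, ih]

theorem zt_conj (n : ℕ) : (starRingEnd ℂ) (zt n) = (zt n)⁻¹ := by
  rw [Complex.inv_def, Complex.normSq_eq_norm_sq, (zt_prim n).norm'_eq_one (by positivity)]
  simp

/-- `√-2` -/
noncomputable def rm : ℂ := zt 1 + zt 1 ^ 3

theorem zt1_sq : zt 1 ^ 2 = Complex.I := by rw [zt_sq 0, zt_zero]

theorem rm_sq : rm ^ 2 = -2 := by
  have h := zt1_sq
  have h2 : zt 1 ^ 4 = -1 := by rw [show 4 = 2 * 2 from rfl, pow_mul, h, Complex.I_sq]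
  rw [rm]
  linear_combination (1 + zt 1 ^ 4) * h + Complex.I * h2 + 2 * h2

theorem rm_ne : rm ≠ 0 := fun h => by have := rm_sq; rw [h] at this; norm_num at this

theorem rm_conj : (starRingEnd ℂ) rm = -rm := by
  have h : zt 1 ^ 4 = -1 := zt_pow_half 1
  rw [rm, map_add, map_pow, zt_conj]
  have := zt_ne 1
  field_simp
  linear_combination (zt 1^2 + 1) * h

/-- `√p` -/
noncomputable def rp (p : ℕ) : ℂ := (Real.sqrt p : ℝ)

theorem rp_sq (p : ℕ) : rp p ^ 2 = p := by
  rw [rp, ← Complex.ofReal_pow, Real.sq_sqrt (Nat.cast_nonneg p)]; simp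

theorem rp_conj (p : ℕ) : (starRingEnd ℂ) (rp p) = rp p := by rw [rp, Complex.conj_ofReal]

noncomputable def F (n : ℕ) : IntermediateField ℚ ℂ := adjoin ℚ {zt n}
noncomputable def Lf (p n : ℕ) : IntermediateField ℚ ℂ := Lfield n (p : ℤ)
noncomputable def B (n : ℕ) : IntermediateField ℚ ℂ := F n ⊓ Rl
noncomputable def Lp (p n : ℕ) : IntermediateField ℚ ℂ := Lf p n ⊓ Rl
noncomputable def Qm2 : IntermediateField ℚ ℂ := adjoin ℚ {rm}
noncomputable def Qp (p : ℕ) : IntermediateField ℚ ℂ := adjoin ℚ {rp p}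
noncomputable def Mf (p : ℕ) : IntermediateField ℚ ℂ := Qm2 ⊔ Qp p
noncomputable def kf (p : ℕ) : IntermediateField ℚ ℂ := quadField (-2 * (p : ℤ))

theorem zt_mem_F (n : ℕ) : zt n ∈ F n := mem_adjoin_simple_self ℚ _

theorem F_le_succ (n : ℕ) : F n ≤ F (n + 1) := by
  rw [F, adjoin_simple_le_iff, ← zt_sq]
  exact pow_mem (zt_mem_F _) 2

theorem F_mono {m n : ℕ} (h : m ≤ n) : F m ≤ F n := monotone_nat_of_le_succ F_le_succ h

theorem quadField_eq {m : ℤ} {θ : ℂ} (h : θ ^ 2 = m) : quadField m = adjoin ℚ {θ} := by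
  apply le_antisymm
  · rw [quadField, adjoin_le_iff]
    intro z hz
    have hz : z ^ 2 = m := hz
    rcases sq_eq_sq_iff_eq_or_eq_neg.1 (hz.trans h.symm) with h | h
    · rw [h]; exact mem_adjoin_simple_self ℚ _
    · rw [h]; exact neg_mem (mem_adjoin_simple_self ℚ _)
  · rw [adjoin_simple_le_iff, quadField]
    exact subset_adjoin _ _ h

theorem kf_eq (p : ℕ) : kf p = adjoin ℚ {rm * rp p} := by
  apply quadField_eq
  rw [mul_pow, rm_sq, rp_sq]; push_cast; ring

theorem Lf_eq (p n : ℕ) : Lf p n = F n ⊔ Qp p := by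
  rw [Lf, Lfield, adjoin_union]
  congr 1
  · apply le_antisymm
    · rw [adjoin_le_iff]
      intro z hz
      obtain ⟨i, _, rfl⟩ := (zt_prim n).eq_pow_of_pow_eq_one hz
      exact pow_mem (zt_mem_F n) i
    · rw [F, adjoin_simple_le_iff]
      exact subset_adjoin _ _ (zt_prim n).pow_eq_one
  · exact quadField_eq (m := (p : ℤ)) (by rw [rp_sq]; simp)

theorem F_le_Lf (p n : ℕ) : F n ≤ Lf p n := by rw [Lf_eq]; exact le_sup_left
theorem Qp_le_Lf (p n : ℕ) : Qp p ≤ Lf p n := by rw [Lf_eq]; exact le_sup_right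
theorem rp_mem_Qp (p : ℕ) : rp p ∈ Qp p := mem_adjoin_simple_self ℚ _
theorem rm_mem_Qm2 : rm ∈ Qm2 := mem_adjoin_simple_self ℚ _
theorem rp_mem_Lf (p n : ℕ) : rp p ∈ Lf p n := Qp_le_Lf p n (rp_mem_Qp p)
theorem zt_mem_Lf (p n : ℕ) : zt n ∈ Lf p n := F_le_Lf p n (zt_mem_F n)
theorem Qm2_le_Mf (p : ℕ) : Qm2 ≤ Mf p := le_sup_left
theorem Qp_le_Mf (p : ℕ) : Qp p ≤ Mf p := le_sup_right
theorem rm_mem_Mf (p : ℕ) : rm ∈ Mf p := Qm2_le_Mf p rm_mem_Qm2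
theorem rp_mem_Mf (p : ℕ) : rp p ∈ Mf p := Qp_le_Mf p (rp_mem_Qp p)
theorem kf_le_Mf (p : ℕ) : kf p ≤ Mf p := by
  rw [kf_eq, adjoin_simple_le_iff]; exact mul_mem (rm_mem_Mf p) (rp_mem_Mf p)
theorem Lf_le_succ (p n : ℕ) : Lf p n ≤ Lf p (n + 1) := by
  rw [Lf_eq, Lf_eq]; exact sup_le_sup_right (F_le_succ n) _
theorem Lf_mono (p : ℕ) {m n : ℕ} (h : m ≤ n) : Lf p m ≤ Lf p n := by
  rw [Lf_eq, Lf_eq]; exact sup_le_sup_right (F_mono h) _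
theorem Qm2_le_F1 : Qm2 ≤ F 1 := by
  rw [Qm2, adjoin_simple_le_iff, rm]
  exact add_mem (zt_mem_F 1) (pow_mem (zt_mem_F 1) 3)
theorem Qm2_le_F (n : ℕ) : Qm2 ≤ F (n + 1) := Qm2_le_F1.trans (F_mono (by lia))
theorem Mf_le_Lf (p n : ℕ) : Mf p ≤ Lf p (n + 1) := by
  rw [Lf_eq]; exact sup_le_sup_right (Qm2_le_F n) _
theorem B_le_F (n : ℕ) : B n ≤ F n := inf_le_left
theorem Lp_le_Lf (p n : ℕ) : Lp p n ≤ Lf p n := inf_le_left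
theorem B_le_succ (n : ℕ) : B n ≤ B (n + 1) := inf_le_inf_right _ (F_le_succ n)
theorem B_le_Lp (p n : ℕ) : B n ≤ Lp p n := inf_le_inf_right _ (F_le_Lf p n)
theorem Qp_le_Rl (p : ℕ) : Qp p ≤ Rl := by
  rw [Qp, adjoin_simple_le_iff, mem_Rl, rp_conj]
theorem Qp_le_Lp (p n : ℕ) : Qp p ≤ Lp p n := le_inf (Qp_le_Lf p n) (Qp_le_Rl p)

/-- conjugation stability from generators -/
theorem conj_stable {S : Set ℂ} (hS : ∀ s ∈ S, (starRingEnd ℂ) s ∈ adjoin ℚ S) {z : ℂ}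
    (hz : z ∈ adjoin ℚ S) : (starRingEnd ℂ) z ∈ adjoin ℚ S := by
  let c : ℂ →ₐ[ℚ] ℂ := (starRingEnd ℂ).toRatAlgHom
  have : adjoin ℚ S ≤ (adjoin ℚ S).comap c := by
    rw [adjoin_le_iff]; exact hS
  exact this hz

theorem conj_F {n : ℕ} {z : ℂ} (hz : z ∈ F n) : (starRingEnd ℂ) z ∈ F n :=
  conj_stable (by
    rintro s rfl
    rw [zt_conj]
    exact inv_mem (zt_mem_F n)) hz

theorem conj_sup {K L : IntermediateField ℚ ℂ} (hK : ∀ z ∈ K, (starRingEnd ℂ) z ∈ K)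
    (hL : ∀ z ∈ L, (starRingEnd ℂ) z ∈ L) {z : ℂ} (hz : z ∈ K ⊔ L) :
    (starRingEnd ℂ) z ∈ K ⊔ L := by
  rw [← adjoin_self ℚ K, ← adjoin_self ℚ L, ← adjoin_union] at hz ⊢
  apply conj_stable _ hz
  rintro s (hs | hs)
  · exact subset_adjoin _ _ (Or.inl (hK s hs))
  · exact subset_adjoin _ _ (Or.inr (hL s hs))

theorem conj_Qp {p : ℕ} {z : ℂ} (hz : z ∈ Qp p) : (starRingEnd ℂ) z ∈ Qp p := by
  rw [mem_Rl.1 (Qp_le_Rl p hz)]; exact hz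

theorem conj_Lf {p n : ℕ} {z : ℂ} (hz : z ∈ Lf p n) : (starRingEnd ℂ) z ∈ Lf p n := by
  rw [Lf_eq] at *
  exact conj_sup (fun _ => conj_F) (fun _ => conj_Qp) hz

theorem conj_Mf {p : ℕ} {z : ℂ} (hz : z ∈ Mf p) : (starRingEnd ℂ) z ∈ Mf p := by
  refine conj_sup (fun _ h => ?_) (fun _ => conj_Qp) hz
  refine conj_stable ?_ h
  rintro s rfl
  rw [rm_conj]
  exact neg_mem rm_mem_Qm2

instance fdF (n : ℕ) : FiniteDimensional ℚ (F n) :=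
  adjoin.finiteDimensional ((zt_prim n).isIntegral (by positivity)).tower_top
instance fdQp (p : ℕ) : FiniteDimensional ℚ (Qp p) :=
  adjoin.finiteDimensional ⟨Polynomial.X ^ 2 - Polynomial.C (p : ℚ), Polynomial.monic_X_pow_sub_C _ (by norm_num),
    by simp [rp_sq]⟩
instance fdQm2 : FiniteDimensional ℚ Qm2 :=
  adjoin.finiteDimensional ⟨Polynomial.X ^ 2 - Polynomial.C (-2 : ℚ), Polynomial.monic_X_pow_sub_C _ (by norm_num),
    by simp [rm_sq]⟩
theorem fd_of_le {K L : IntermediateField ℚ ℂ} (h : K ≤ L) [FiniteDimensional ℚ L] :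
    FiniteDimensional ℚ K :=
  FiniteDimensional.of_injective (IntermediateField.inclusion h).toLinearMap
    (IntermediateField.inclusion h).injective
instance fdLf (p n : ℕ) : FiniteDimensional ℚ (Lf p n) := by rw [Lf_eq]; infer_instance
instance fdMf (p : ℕ) : FiniteDimensional ℚ (Mf p) := by rw [Mf]; infer_instance
instance fdkf (p : ℕ) : FiniteDimensional ℚ (kf p) := fd_of_le (kf_le_Mf p)
instance fdB (n : ℕ) : FiniteDimensional ℚ (B n) := fd_of_le (B_le_F n)
instance fdLp (p n : ℕ) : FiniteDimensional ℚ (Lp p n) := fd_of_le (Lp_le_Lf p n)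

instance nfF (n : ℕ) : NumberField (F n) := ⟨⟩
instance nfQp (p : ℕ) : NumberField (Qp p) := ⟨⟩
instance nfQm2 : NumberField Qm2 := ⟨⟩
instance nfLf (p n : ℕ) : NumberField (Lf p n) := ⟨⟩
instance nfMf (p : ℕ) : NumberField (Mf p) := ⟨⟩
instance nfkf (p : ℕ) : NumberField (kf p) := ⟨⟩
instance nfB (n : ℕ) : NumberField (B n) := ⟨⟩
instance nfLp (p n : ℕ) : NumberField (Lp p n) := ⟨⟩

instance (n : ℕ) : Fact (F n ≤ F (n + 1)) := ⟨F_le_succ n⟩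
instance (n : ℕ) : Fact (F 0 ≤ F n) := ⟨F_mono (by lia)⟩
instance (n : ℕ) : Fact (F 1 ≤ F (n + 1)) := ⟨F_mono (by lia)⟩
instance (n : ℕ) : Fact (B n ≤ F n) := ⟨B_le_F n⟩
instance (n : ℕ) : Fact (B n ≤ B (n + 1)) := ⟨B_le_succ n⟩
instance (p n : ℕ) : Fact (F n ≤ Lf p n) := ⟨F_le_Lf p n⟩
instance (p n : ℕ) : Fact (F 0 ≤ Lf p n) := ⟨(F_mono (by lia)).trans (F_le_Lf p n)⟩
instance (p n : ℕ) : Fact (Lp p n ≤ Lf p n) := ⟨Lp_le_Lf p n⟩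
instance (p n : ℕ) : Fact (B n ≤ Lp p n) := ⟨B_le_Lp p n⟩
instance (p n : ℕ) : Fact (Lf p n ≤ Lf p (n + 1)) := ⟨Lf_le_succ p n⟩
instance (p n : ℕ) : Fact (Qp p ≤ Lf p n) := ⟨Qp_le_Lf p n⟩
instance (p : ℕ) : Fact (Qp p ≤ Mf p) := ⟨Qp_le_Mf p⟩
instance (p : ℕ) : Fact (kf p ≤ Mf p) := ⟨kf_le_Mf p⟩
instance (p : ℕ) : Fact (Qm2 ≤ Mf p) := ⟨Qm2_le_Mf p⟩
instance (p n : ℕ) : Fact (Qm2 ≤ Lf p (n + 1)) := ⟨(Qm2_le_F n).trans (F_le_Lf p (n + 1))⟩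
instance (p n : ℕ) : Fact (Mf p ≤ Lf p (n + 1)) := ⟨Mf_le_Lf p n⟩
instance (n : ℕ) : Fact (Qm2 ≤ F (n + 1)) := ⟨Qm2_le_F n⟩

end Fields


open NumberField IntermediateField

set_option linter.unusedSectionVars false

section Degrees

instance cycF (n : ℕ) : IsCyclotomicExtension {2 ^ (n + 2)} ℚ (F n) := by
  change IsCyclotomicExtension {2 ^ (n + 2)} ℚ (IntermediateField.adjoin ℚ {zt n}).toSubalgebra
  rw [IntermediateField.adjoin_simple_toSubalgebra_of_isAlgebraic]
  · exact (zt_prim n).adjoin_isCyclotomicExtension ℚ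
  · exact ((zt_prim n).isIntegral (by positivity)).tower_top.isAlgebraic

theorem deg_F (n : ℕ) : Module.finrank ℚ (F n) = 2 ^ (n + 1) := by
  have := cycF n
  rw [IsCyclotomicExtension.finrank (n := 2 ^ (n + 2)) (F n)
    (Polynomial.cyclotomic.irreducible_rat (by positivity)), Nat.totient_prime_pow_succ Nat.prime_two]
  ring

theorem conj_I : (starRingEnd ℂ) Complex.I = -Complex.I := Complex.conj_I

theorem I_mem_F (n : ℕ) : Complex.I ∈ F n := by
  have := F_mono (Nat.zero_le n) (zt_mem_F 0)
  rwa [zt_zero] at this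

theorem quad_BF (n : ℕ) : Module.finrank (B n) (F n) = 2 :=
  conj_decomp (fun _ => conj_F) (I_mem_F n) Complex.I_ne_zero conj_I

theorem deg_B (n : ℕ) : Module.finrank ℚ (B n) = 2 ^ n := by
  have h := mul_finrank_LE (B n) (F n)
  rw [quad_BF, deg_F, pow_succ] at h
  exact Nat.eq_of_mul_eq_mul_right (by norm_num) h

theorem quad_FF (n : ℕ) : Module.finrank (F n) (F (n + 1)) = 2 :=
  finrank_LE_two (deg_F n) (by rw [deg_F]; ring)

theorem quad_BB (n : ℕ) : Module.finrank (B n) (B (n + 1)) = 2 :=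
  finrank_LE_two (deg_B n) (by rw [deg_B]; ring)

theorem zt_notMem (n : ℕ) : zt (n + 1) ∉ F n := by
  intro h
  have h1 : F (n + 1) ≤ F n := by rw [F, adjoin_simple_le_iff]; exact h
  have h2 := deg_F (n + 1)
  rw [le_antisymm h1 (F_le_succ n), deg_F] at h2
  rw [pow_succ 2 (n+1)] at h2
  have : 0 < 2 ^ (n + 1) := by positivity
  lia

theorem B0_eq : B 0 = ⊥ := by
  rw [← IntermediateField.finrank_eq_one_iff, deg_B, pow_zero]

variable {p : ℕ} [hpf : Fact p.Prime]

theorem not_rat_of_sq {z : ℂ} {m : ℕ} (hz : z ^ 2 = m) (hm : ¬ IsSquare m) :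
    z ∉ (⊥ : IntermediateField ℚ ℂ) := by
  intro h
  obtain ⟨q, rfl⟩ := IntermediateField.mem_bot.1 h
  have h1 : q ^ 2 = m := by
    have : ((q ^ 2 : ℚ) : ℂ) = ((m : ℚ) : ℂ) := by push_cast; exact hz
    exact_mod_cast this
  apply hm
  have : IsSquare ((m : ℕ) : ℚ) := ⟨q, by rw [← h1, sq]⟩
  rwa [Rat.isSquare_natCast_iff] at this

theorem not_sq_prime : ¬ IsSquare p := hpf.out.prime.not_isSquare

theorem not_sq_two_prime (hp2 : p % 2 = 1) : ¬ IsSquare (2 * p) := by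
  rintro ⟨a, ha⟩
  rcases Nat.even_or_odd' a with ⟨b, rfl | rfl⟩
  · have : p = 2 * (b * b) := by lia
    lia
  · have : 2 * p = 2 * (2 * (b * b) + 2 * b) + 1 := by rw [ha]; ring
    lia

theorem real_of_sq {z : ℂ} {m : ℕ} (hz : z ^ 2 = m) : z ∈ Rl := by
  have h : z ^ 2 = ((Real.sqrt m : ℝ) : ℂ) ^ 2 := by
    rw [hz, ← Complex.ofReal_pow, Real.sq_sqrt (Nat.cast_nonneg m)]; simp
  rcases sq_eq_sq_iff_eq_or_eq_neg.1 h with h | h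
  · rw [h, mem_Rl, Complex.conj_ofReal]
  · rw [h]; apply neg_mem; rw [mem_Rl, Complex.conj_ofReal]

/-- Galois conjugation on a quadratic step, described by its value on a square root in `ℂ`. -/
theorem neg_of_sq_LE {K L : IntermediateField ℚ ℂ} [Fact (K ≤ L)] [NumberField K] [NumberField L]
    {σ : L ≃ₐ[K] L} (h : Quad K L σ) {θ : L} (h2 : (θ : ℂ) ^ 2 ∈ K) (hθ : (θ : ℂ) ∉ K) : σ θ = -θ := by
  refine h.neg_of_sq (m := ⟨(θ : ℂ) ^ 2, h2⟩) (Subtype.ext rfl) (fun y hy => hθ ?_)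
  have := congrArg Subtype.val hy
  change (y : ℂ) = θ at this
  rw [← this]; exact y.2

theorem fix_LE {K L : IntermediateField ℚ ℂ} [Fact (K ≤ L)] [NumberField K] [NumberField L]
    (σ : L ≃ₐ[K] L) {θ : L} (h2 : (θ : ℂ) ∈ K) : σ θ = θ :=
  σ.commutes (⟨θ, h2⟩ : K)


theorem exists_zt_neg (n : ℕ) : ∃ σ : F (n + 1) ≃ₐ[F n] F (n + 1), Quad (F n) (F (n + 1)) σ ∧
    σ ⟨zt (n + 1), zt_mem_F _⟩ = -⟨zt (n + 1), zt_mem_F _⟩ := by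
  obtain ⟨σ, hσ⟩ := exists_quad (quad_FF n)
  refine ⟨σ, hσ, neg_of_sq_LE hσ ?_ (zt_notMem n)⟩
  change zt (n + 1) ^ 2 ∈ F n
  rw [zt_sq]; exact zt_mem_F n

theorem rp_step1 (n : ℕ) (ih : rp p ∉ F n) (h : rp p ∈ F (n + 1)) :
    ∃ b : ℂ, b ∈ F n ∧ b ^ 2 * zt n = p := by
  obtain ⟨σ, hσ, s1⟩ := exists_zt_neg n
  have s2 : σ ⟨rp p, h⟩ = -⟨rp p, h⟩ := by
    apply neg_of_sq_LE hσ _ ih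
    change rp p ^ 2 ∈ F n
    rw [rp_sq]; exact _root_.natCast_mem _ p
  obtain ⟨b, hb⟩ := hσ.fixed (x := ⟨rp p, h⟩ / ⟨zt (n + 1), zt_mem_F _⟩)
    (by rw [map_div₀, s1, s2, neg_div_neg_eq])
  refine ⟨b, b.2, ?_⟩
  have h1 := congrArg (algebraMap (F (n + 1)) ℂ) hb
  rw [alg_alg, map_div₀, alg_mk, alg_mk] at h1
  rw [h1, div_pow, rp_sq, zt_sq, div_mul_cancel₀ _ (zt_ne n)]

theorem rp_step2 (m : ℕ) {b : ℂ} (hb : b ∈ F (m + 1)) (e : b ^ 2 * zt (m + 1) = p) :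
    ∃ c : ℂ, c ∈ F m ∧ c ^ 2 * zt m = - (p : ℂ) ^ 2 := by
  obtain ⟨τ, hτ, s3⟩ := exists_zt_neg m
  set y : F (m + 1) := ⟨zt (m + 1), zt_mem_F _⟩ with hy
  set b' : F (m + 1) := ⟨b, hb⟩ with hb'
  have e' : b' ^ 2 * y = p := by
    apply (algebraMap (F (m + 1)) ℂ).injective
    rw [map_mul, map_pow, map_natCast, hy, hb', alg_mk, alg_mk, e]
  have e'' := congrArg τ e'
  rw [map_mul, map_pow, s3, map_natCast] at e''
  obtain ⟨c, hc⟩ := hτ.fixed (x := b' * τ b') (by rw [map_mul, hτ.sq, mul_comm])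
  refine ⟨c, c.2, ?_⟩
  have h1 : (b' * τ b') ^ 2 * y ^ 2 = - (p : F (m + 1)) ^ 2 := by
    linear_combination - e'' * (b' ^ 2 * y) - (p : F (m + 1)) * e'
  rw [← hc] at h1
  have h2 := congrArg (algebraMap (F (m + 1)) ℂ) h1
  rw [map_mul, map_pow, map_neg, map_pow, map_pow, map_natCast, alg_alg, hy, alg_mk, zt_sq] at h2
  exact h2

theorem rp_notMem_F (hp2 : p % 2 = 1) (n : ℕ) : rp p ∉ F n := by
  induction n with
  | zero =>
    intro h
    have : rp p ∈ B 0 := ⟨h, real_of_sq (rp_sq p)⟩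
    rw [B0_eq] at this
    exact not_rat_of_sq (rp_sq p) not_sq_prime this
  | succ n ih =>
    intro h
    obtain ⟨b, hb, e⟩ := rp_step1 n ih h
    cases n with
    | zero =>
      have e2 : (b * (1 + Complex.I)) ^ 2 = ((2 * p : ℕ) : ℂ) := by
        rw [zt_zero] at e
        push_cast
        linear_combination 2 * e + b ^ 2 * Complex.I_sq
      have h1 : b * (1 + Complex.I) ∈ F 0 := mul_mem hb (add_mem (one_mem _) (I_mem_F 0))
      have : b * (1 + Complex.I) ∈ B 0 := ⟨h1, real_of_sq e2⟩
      rw [B0_eq] at this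
      exact not_rat_of_sq e2 (not_sq_two_prime hp2) this
    | succ m =>
      obtain ⟨c, hc, e3⟩ := rp_step2 m hb e
      have hc0 : c ≠ 0 := fun h0 => by
        rw [h0] at e3; simp at e3; exact hpf.out.ne_zero e3
      have e4 : (Complex.I * p / c) ^ 2 = zt (m + 1) ^ 2 := by
        rw [zt_sq, div_pow, div_eq_iff (pow_ne_zero 2 hc0), mul_pow, Complex.I_sq]
        linear_combination -e3
      have h5 : Complex.I * p / c ∈ F m := div_mem (mul_mem (I_mem_F m) (_root_.natCast_mem _ p)) hc
      rcases sq_eq_sq_iff_eq_or_eq_neg.1 e4 with h | h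
      · rw [h] at h5; exact zt_notMem m h5
      · rw [h] at h5; exact zt_notMem m (by simpa using neg_mem h5)

theorem deg_Lf (hp2 : p % 2 = 1) (n : ℕ) : Module.finrank ℚ (Lf p n) = 2 ^ (n + 2) := by
  rw [Lf_eq, Qp, finrank_sup_sq (by rw [rp_sq]; exact _root_.natCast_mem _ p) (rp_notMem_F hp2 n), deg_F]
  ring

theorem deg_bot_sup {θ : ℂ} (h2 : θ ^ 2 ∈ (⊥ : IntermediateField ℚ ℂ))
    (h : θ ∉ (⊥ : IntermediateField ℚ ℂ)) : Module.finrank ℚ (adjoin ℚ {θ} : IntermediateField ℚ ℂ) = 2 := by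
  have := finrank_sup_sq h2 h
  rwa [bot_sup_eq, IntermediateField.finrank_bot, mul_one] at this

theorem notMem_bot_of_conj {θ : ℂ} (h0 : θ ≠ 0) (hc : (starRingEnd ℂ) θ = -θ) :
    θ ∉ (⊥ : IntermediateField ℚ ℂ) := by
  intro h
  have h2 := mem_Rl.1 ((bot_le : (⊥ : IntermediateField ℚ ℂ) ≤ Rl) h)
  rw [hc] at h2
  exact h0 (by linear_combination -(1/2) * h2)

theorem rp_ne : rp p ≠ 0 := fun h => by
  have := rp_sq p
  rw [h] at this
  have : (p : ℂ) = 0 := by rw [← this]; ring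
  exact hpf.out.ne_zero (by exact_mod_cast this)

theorem deg_Qm2 : Module.finrank ℚ Qm2 = 2 :=
  deg_bot_sup (by rw [rm_sq]; exact neg_mem (ofNat_mem _ 2)) (notMem_bot_of_conj rm_ne rm_conj)

theorem deg_Qp : Module.finrank ℚ (Qp p) = 2 :=
  deg_bot_sup (by rw [rp_sq]; exact _root_.natCast_mem _ p) (not_rat_of_sq (rp_sq p) not_sq_prime)

theorem deg_kf : Module.finrank ℚ (kf p) = 2 := by
  rw [kf_eq]
  refine deg_bot_sup (by rw [mul_pow, rm_sq, rp_sq]; exact mul_mem (neg_mem (ofNat_mem _ 2)) (_root_.natCast_mem _ p))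
    (notMem_bot_of_conj (mul_ne_zero rm_ne rp_ne) (by rw [map_mul, rm_conj, rp_conj]; ring))

theorem deg_Mf (hp2 : p % 2 = 1) : Module.finrank ℚ (Mf p) = 4 := by
  rw [Mf, Qp, finrank_sup_sq (by rw [rp_sq]; exact _root_.natCast_mem _ p)
    (fun h => rp_notMem_F hp2 1 (Qm2_le_F1 h)), deg_Qm2]

theorem quad_FL (hp2 : p % 2 = 1) (n : ℕ) : Module.finrank (F n) (Lf p n) = 2 :=
  finrank_LE_two (deg_F n) (by rw [deg_Lf hp2]; ring)

theorem quad_LpL (n : ℕ) : Module.finrank (Lp p n) (Lf p n) = 2 :=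
  conj_decomp (fun _ => conj_Lf) (F_le_Lf p n (I_mem_F n)) Complex.I_ne_zero conj_I

theorem deg_Lp (hp2 : p % 2 = 1) (n : ℕ) : Module.finrank ℚ (Lp p n) = 2 ^ (n + 1) := by
  have h := mul_finrank_LE (Lp p n) (Lf p n)
  rw [quad_LpL, deg_Lf hp2, pow_succ] at h
  exact Nat.eq_of_mul_eq_mul_right (by norm_num) h

theorem quad_BLp (hp2 : p % 2 = 1) (n : ℕ) : Module.finrank (B n) (Lp p n) = 2 :=
  finrank_LE_two (deg_B n) (by rw [deg_Lp hp2]; ring)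
theorem quad_LL (hp2 : p % 2 = 1) (n : ℕ) : Module.finrank (Lf p n) (Lf p (n + 1)) = 2 :=
  finrank_LE_two (deg_Lf hp2 n) (by rw [deg_Lf hp2]; ring)
theorem quad_ML (hp2 : p % 2 = 1) : Module.finrank (Mf p) (Lf p 1) = 2 :=
  finrank_LE_two (deg_Mf hp2) (by rw [deg_Lf hp2]; norm_num)
theorem quad_QpM (hp2 : p % 2 = 1) : Module.finrank (Qp p) (Mf p) = 2 :=
  finrank_LE_two deg_Qp (by rw [deg_Mf hp2])
theorem quad_Qm2M (hp2 : p % 2 = 1) : Module.finrank Qm2 (Mf p) = 2 :=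
  finrank_LE_two deg_Qm2 (by rw [deg_Mf hp2])
theorem quad_kM (hp2 : p % 2 = 1) : Module.finrank (kf p) (Mf p) = 2 :=
  finrank_LE_two deg_kf (by rw [deg_Mf hp2])

theorem conj_LE {K L : IntermediateField ℚ ℂ} [Fact (K ≤ L)] [NumberField K] [NumberField L]
    {σ : L ≃ₐ[K] L} (h : Quad K L σ) (hK : K ≤ Rl) {θ : L} (h0 : θ ≠ 0)
    (hc : (starRingEnd ℂ) (θ : ℂ) = -θ) (h2 : (θ : ℂ) ^ 2 ∈ K) (x : L) :
    ((σ x : L) : ℂ) = (starRingEnd ℂ) (x : ℂ) := by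
  have hθK : (θ : ℂ) ∉ K := fun h3 => by
    have := mem_Rl.1 (hK h3)
    rw [hc] at this
    exact h0 (Subtype.ext (by change (θ : ℂ) = 0; linear_combination -(1/2) * this))
  have h3 := neg_of_sq_LE h h2 hθK
  obtain ⟨a, b, rfl⟩ := h.decomp (θ := θ) (m := ⟨(θ : ℂ) ^ 2, h2⟩) (Subtype.ext rfl) (fun y hy => hθK (by
    have := congrArg Subtype.val hy
    change (y : ℂ) = θ at this
    rw [← this]; exact y.2)) x
  rw [map_add, map_mul, σ.commutes, σ.commutes, h3]
  change (a : ℂ) + b * (-(θ : ℂ)) = (starRingEnd ℂ) ((a : ℂ) + b * θ)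
  rw [map_add, map_mul, hc, mem_Rl.1 (hK a.2), mem_Rl.1 (hK b.2)]

end Degrees


open NumberField IntermediateField

set_option linter.unusedSectionVars false

section Ranks

theorem rank_real (K : Type*) [Field K] [NumberField K] [IsTotallyReal K] :
    Units.rank K + 1 = Module.finrank ℚ K := by
  have h1 := IsTotallyReal.finrank (K := K)
  have h2 := InfinitePlace.card_eq_nrRealPlaces_add_nrComplexPlaces K
  have h3 := IsTotallyReal.nrComplexPlaces_eq_zero (K := K)
  have h4 : 0 < Module.finrank ℚ K := Module.finrank_pos
  rw [Units.rank]
  lia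

theorem rank_complex (K : Type*) [Field K] [NumberField K] [IsTotallyComplex K] :
    2 * (Units.rank K + 1) = Module.finrank ℚ K := by
  have h1 := IsTotallyComplex.finrank (K := K)
  have h2 := InfinitePlace.card_eq_nrRealPlaces_add_nrComplexPlaces K
  have h3 := IsTotallyComplex.nrRealPlaces_eq_zero (K := K)
  have h4 : 0 < Module.finrank ℚ K := Module.finrank_pos
  rw [Units.rank]
  lia

theorem rank_rat : Units.rank ℚ = 0 := by
  have := rank_real ℚ
  rw [Module.finrank_self] at this
  lia

theorem isTotallyComplex_of_sq {K : Type*} [Field K] [NumberField K] {θ : K} {m : ℕ} (hm : m ≠ 0)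
    (h : θ ^ 2 = -(m : K)) : IsTotallyComplex K := by
  refine ⟨fun v => ?_⟩
  rw [← InfinitePlace.not_isReal_iff_isComplex]
  intro hv
  have h1 := InfinitePlace.isReal_iff.1 hv
  rw [ComplexEmbedding.isReal_iff] at h1
  have h2 := RingHom.congr_fun h1 θ
  rw [ComplexEmbedding.conjugate_coe_eq] at h2
  obtain ⟨x, hx⟩ := Complex.conj_eq_iff_real.1 h2
  have h3 := congrArg v.embedding h
  rw [map_pow, hx, map_neg, map_natCast] at h3
  have h4 : x ^ 2 = -(m : ℝ) := by exact_mod_cast h3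
  have h5 : (0 : ℝ) < m := by exact_mod_cast Nat.pos_of_ne_zero hm
  nlinarith [sq_nonneg x]

instance tcF (n : ℕ) : IsTotallyComplex (F n) :=
  isTotallyComplex_of_sq (θ := ⟨Complex.I, I_mem_F n⟩) (m := 1) one_ne_zero (by
    apply (algebraMap (F n) ℂ).injective
    rw [map_pow, alg_mk, Complex.I_sq]; simp)

theorem I_mem_Lf (p n : ℕ) : Complex.I ∈ Lf p n := F_le_Lf p n (I_mem_F n)

instance tcLf (p n : ℕ) : IsTotallyComplex (Lf p n) :=
  isTotallyComplex_of_sq (θ := ⟨Complex.I, I_mem_Lf p n⟩) (m := 1) one_ne_zero (by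
    apply (algebraMap (Lf p n) ℂ).injective
    rw [map_pow, alg_mk, Complex.I_sq]; simp)

instance tcQm2 : IsTotallyComplex Qm2 :=
  isTotallyComplex_of_sq (θ := ⟨rm, rm_mem_Qm2⟩) (m := 2) two_ne_zero (by
    apply (algebraMap Qm2 ℂ).injective
    rw [map_pow, alg_mk, rm_sq, map_neg, map_natCast]; norm_num)

instance tcMf (p : ℕ) : IsTotallyComplex (Mf p) :=
  isTotallyComplex_of_sq (θ := ⟨rm, rm_mem_Mf p⟩) (m := 2) two_ne_zero (by
    apply (algebraMap (Mf p) ℂ).injective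
    rw [map_pow, alg_mk, rm_sq, map_neg, map_natCast]; norm_num)

theorem rmrp_mem_kf (p : ℕ) : rm * rp p ∈ kf p := by rw [kf_eq]; exact mem_adjoin_simple_self ℚ _

instance tckf (p : ℕ) [hp : Fact p.Prime] : IsTotallyComplex (kf p) :=
  isTotallyComplex_of_sq (θ := ⟨rm * rp p, rmrp_mem_kf p⟩) (m := 2 * p)
    (mul_ne_zero two_ne_zero hp.out.ne_zero) (by
    apply (algebraMap (kf p) ℂ).injective
    rw [map_pow, alg_mk, mul_pow, rm_sq, rp_sq, map_neg, map_natCast]; push_cast; ring)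

/-- embeddings of `Lf` commute with complex conjugation -/
theorem emb_conj (p n : ℕ) (φ : Lf p n →+* ℂ) (x y : Lf p n)
    (h : (y : ℂ) = (starRingEnd ℂ) (x : ℂ)) : φ y = (starRingEnd ℂ) (φ x) := by
  have hs : Lf p n = adjoin ℚ {zt n, rp p} := by
    rw [Lf_eq, F, Qp, ← adjoin_union]; rfl
  let c : ℂ →ₐ[ℚ] ℂ := (starRingEnd ℂ).toRatAlgHom
  let cL : Lf p n →ₐ[ℚ] Lf p n := (c.comp (Lf p n).val).codRestrict (Lf p n).toSubalgebra
    (fun x => conj_Lf x.2)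
  have hcl : ∀ x, ((cL x : Lf p n) : ℂ) = (starRingEnd ℂ) (x : ℂ) := fun x => rfl
  let φ' : Lf p n →ₐ[ℚ] ℂ := φ.toRatAlgHom
  have key : φ'.comp cL = c.comp φ' := by
    refine IntermediateField.algHom_ext_of_eq_adjoin ℚ hs ?_
    rintro z (hz | hz)
    · have hu : ∀ hz' : z ∈ Lf p n, (⟨z, hz'⟩ : Lf p n) ^ 2 ^ (n + 2) = 1 := fun hz' => by
        apply (algebraMap (Lf p n) ℂ).injective
        rw [map_pow, alg_mk, hz, (zt_prim n).pow_eq_one, map_one]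
      have hz' : z ∈ Lf p n := by rw [hz]; exact zt_mem_Lf p n
      have e1 : cL ⟨z, hz'⟩ * ⟨z, hz'⟩ = 1 := by
        apply (algebraMap (Lf p n) ℂ).injective
        rw [map_mul, alg_mk, map_one]
        change (starRingEnd ℂ) z * z = 1
        rw [hz, zt_conj, inv_mul_cancel₀ (zt_ne n)]
      have e2 : φ' ⟨z, hz'⟩ ^ 2 ^ (n + 2) = 1 := by rw [← map_pow, hu, map_one]
      have e3 : (starRingEnd ℂ) (φ' ⟨z, hz'⟩) * φ' ⟨z, hz'⟩ = 1 := by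
        rw [mul_comm, Complex.mul_conj, Complex.normSq_eq_norm_sq,
          Complex.norm_eq_one_of_pow_eq_one e2 (by positivity)]
        simp
      have e4 : φ' (cL ⟨z, hz'⟩) * φ' ⟨z, hz'⟩ = 1 := by rw [← map_mul, e1, map_one]
      have e5 : φ' ⟨z, hz'⟩ ≠ 0 := right_ne_zero_of_mul_eq_one e4
      exact mul_right_cancel₀ e5 (e4.trans e3.symm)
    · have hz : z = rp p := hz
      have hz' : z ∈ Lf p n := by rw [hz]; exact rp_mem_Lf p n
      have e1 : cL ⟨z, hz'⟩ = ⟨z, hz'⟩ := by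
        apply (algebraMap (Lf p n) ℂ).injective
        change (starRingEnd ℂ) z = z
        rw [hz, rp_conj]
      have e2 : φ' ⟨z, hz'⟩ ^ 2 = p := by
        rw [← map_pow, ← map_natCast φ']
        congr 1
        apply (algebraMap (Lf p n) ℂ).injective
        rw [map_pow, alg_mk, hz, rp_sq, map_natCast]
      change φ' (cL ⟨z, hz'⟩) = (starRingEnd ℂ) (φ' ⟨z, hz'⟩)
      rw [e1, mem_Rl.1 (real_of_sq e2)]
  have h1 := AlgHom.congr_fun key x
  have h2 : cL x = y := Subtype.ext ((hcl x).trans h.symm)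
  rw [AlgHom.comp_apply, h2] at h1
  exact h1

theorem tr_of_le {p n : ℕ} {K : IntermediateField ℚ ℂ} [NumberField K] (h : K ≤ Lf p n) (hR : K ≤ Rl) :
    IsTotallyReal K := by
  have : Fact (K ≤ Lf p n) := ⟨h⟩
  refine ⟨fun v => ?_⟩
  rw [InfinitePlace.isReal_iff, ComplexEmbedding.isReal_iff]
  ext x
  rw [ComplexEmbedding.conjugate_coe_eq]
  let _ : Algebra K ℂ := v.embedding.toAlgebra
  have : Algebra.IsAlgebraic K (Lf p n) := Algebra.IsAlgebraic.tower_top (K := ℚ) K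
  let φ : Lf p n →ₐ[K] ℂ := IsAlgClosed.lift
  have h1 : φ (algebraMap K (Lf p n) x) = v.embedding x := φ.commutes x
  rw [← h1]
  exact (emb_conj p n φ.toRingHom _ _ (mem_Rl.1 (hR x.2)).symm).symm

instance trB (n : ℕ) : IsTotallyReal (B n) :=
  tr_of_le ((B_le_F n).trans (F_le_Lf 2 n)) inf_le_right
instance trLp (p n : ℕ) : IsTotallyReal (Lp p n) := tr_of_le (Lp_le_Lf p n) inf_le_right
instance trQp (p : ℕ) : IsTotallyReal (Qp p) := tr_of_le (Qp_le_Lf p 0) (Qp_le_Rl p)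

variable {p : ℕ} [hpf : Fact p.Prime]

theorem rk_F (n : ℕ) : Units.rank (F n) + 1 = 2 ^ n := by
  have := rank_complex (F n); rw [deg_F, pow_succ] at this; lia
theorem rk_B (n : ℕ) : Units.rank (B n) + 1 = 2 ^ n := by
  rw [rank_real (B n), deg_B]
theorem rk_Lf (hp2 : p % 2 = 1) (n : ℕ) : Units.rank (Lf p n) + 1 = 2 ^ (n + 1) := by
  have := rank_complex (Lf p n); rw [deg_Lf hp2, pow_succ] at this; lia
theorem rk_Lp (hp2 : p % 2 = 1) (n : ℕ) : Units.rank (Lp p n) + 1 = 2 ^ (n + 1) := by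
  rw [rank_real (Lp p n), deg_Lp hp2]
theorem rk_Qm2 : Units.rank Qm2 = 0 := by
  have := rank_complex Qm2; rw [deg_Qm2] at this; lia
theorem rk_Qp : Units.rank (Qp p) = 1 := by
  have := rank_real (Qp p); rw [deg_Qp] at this; lia
theorem rk_kf : Units.rank (kf p) = 0 := by
  have := rank_complex (kf p); rw [deg_kf] at this; lia
theorem rk_Mf (hp2 : p % 2 = 1) : Units.rank (Mf p) = 1 := by
  have := rank_complex (Mf p); rw [deg_Mf hp2] at this; lia

end Ranks


open NumberField IntermediateField

set_option linter.unusedSectionVars false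

section TBound

variable {L : Type*} [Field L] [NumberField L]

open ArithmeticFunction in
theorem card_mul_le {δ : 𝓞 L} (hδ : δ ≠ 0) (g : ℕ) (s : Finset (Ideal (𝓞 L)))
    (hs : ∀ P ∈ s, P.IsPrime ∧ P ≠ ⊥ ∧ δ ∈ P ∧ g ≤ cardFactors (Ideal.absNorm P)) :
    s.card * g ≤ cardFactors (Ideal.absNorm (Ideal.span {δ})) := by
  have hd : ∏ P ∈ s, P ∣ Ideal.span {δ} := by
    apply Finset.prod_primes_dvd
    · intro P hP; exact Ideal.prime_of_isPrime (hs P hP).2.1 (hs P hP).1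
    · intro P hP; rw [Ideal.dvd_span_singleton]; exact (hs P hP).2.2.1
  have h0 : Ideal.absNorm (Ideal.span {δ}) ≠ 0 := by
    rw [Ne, Ideal.absNorm_eq_zero_iff, Ideal.span_singleton_eq_bot]; exact hδ
  obtain ⟨J, hJ⟩ := hd
  rw [hJ, map_mul] at h0 ⊢
  rw [cardFactors_mul (left_ne_zero_of_mul h0) (right_ne_zero_of_mul h0)]
  refine le_trans ?_ (Nat.le_add_right _ _)
  clear hJ h0
  induction s using Finset.cons_induction with
  | empty => simp
  | cons P s hPs ih =>
    have h1 : ∀ Q ∈ Finset.cons P s hPs, Ideal.absNorm Q ≠ 0 := fun Q hQ => by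
      rw [Ne, Ideal.absNorm_eq_zero_iff]; exact (hs Q hQ).2.1
    rw [Finset.prod_cons, map_mul, cardFactors_mul (h1 P (Finset.mem_cons_self _ _)) (by
      rw [map_prod, Finset.prod_ne_zero_iff]
      exact fun Q hQ => h1 Q (Finset.mem_cons_of_mem hQ)), Finset.card_cons, add_mul, one_mul, add_comm]
    exact add_le_add (hs P (Finset.mem_cons_self _ _)).2.2.2
      (ih (fun Q hQ => hs Q (Finset.mem_cons_of_mem hQ)))

open ArithmeticFunction in
theorem one_le_omega {P : Ideal (𝓞 L)} (hP : P.IsPrime) (h0 : P ≠ ⊥) :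
    1 ≤ cardFactors (Ideal.absNorm P) := by
  rw [Nat.one_le_iff_ne_zero, Ne, cardFactors_eq_zero_iff_eq_zero_or_one]
  push Not
  refine ⟨by rw [Ne, Ideal.absNorm_eq_zero_iff]; exact h0, fun h => hP.ne_top ?_⟩
  exact Ideal.absNorm_eq_one_iff.1 h

open ArithmeticFunction in
theorem omega_of_sq {θ : 𝓞 L} {m : ℤ} (hm : m ≠ 0) (hθ : θ ^ 2 = m) :
    2 * cardFactors (Ideal.absNorm (Ideal.span {θ})) = Module.finrank ℚ L * cardFactors m.natAbs := by
  have h1 : Ideal.absNorm (Ideal.span {θ}) ^ 2 = m.natAbs ^ Module.finrank ℚ L := by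
    rw [← map_pow, Ideal.span_singleton_pow, hθ, Ideal.absNorm_span_singleton,
      show (m : 𝓞 L) = algebraMap ℤ (𝓞 L) m by simp, Algebra.norm_algebraMap, RingOfIntegers.rank,
      Int.natAbs_pow]
  rw [← cardFactors_pow, h1, cardFactors_pow]

open ArithmeticFunction in
/-- standard bound -/
theorem card_le_of_sq {θ : 𝓞 L} {m : ℤ} (hm : m ≠ 0) (hθ : θ ^ 2 = m) {t g : ℕ} (hg : 0 < g)
    (ht : Module.finrank ℚ L * cardFactors m.natAbs ≤ 2 * t * g) (s : Finset (Ideal (𝓞 L)))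
    (hs : ∀ P ∈ s, P.IsPrime ∧ P ≠ ⊥ ∧ θ ∈ P ∧ g ≤ cardFactors (Ideal.absNorm P)) : s.card ≤ t := by
  have hθ0 : θ ≠ 0 := by
    rintro rfl
    rw [zero_pow two_ne_zero] at hθ
    exact hm (by exact_mod_cast hθ.symm)
  have h1 := card_mul_le hθ0 g s hs
  have h2 := omega_of_sq hm hθ
  have : s.card * g ≤ t * g := by
    have e : 2 * t * g = 2 * (t * g) := by ring
    rw [e] at ht
    lia
  exact Nat.le_of_mul_le_mul_right this hg

end TBound

section Coe

/-- coercion of integers to `ℂ` -/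
noncomputable def co (L : IntermediateField ℚ ℂ) : 𝓞 L →+* ℂ :=
  (algebraMap L ℂ).comp (algebraMap (𝓞 L) L)

theorem co_def {L : IntermediateField ℚ ℂ} (x : 𝓞 L) : co L x = ((x : L) : ℂ) := rfl

theorem co_inj {L : IntermediateField ℚ ℂ} {x y : 𝓞 L} (h : co L x = co L y) : x = y :=
  RingOfIntegers.ext (Subtype.ext h)

noncomputable def mkO (L : IntermediateField ℚ ℂ) (z : ℂ) (hz : z ∈ L) (hi : IsIntegral ℤ z) : 𝓞 L :=
  ⟨⟨z, hz⟩, by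
    have : IsIntegral ℤ (algebraMap L ℂ ⟨z, hz⟩) := hi
    exact (isIntegral_algebraMap_iff (algebraMap L ℂ).injective).1 this⟩

theorem co_mk {L : IntermediateField ℚ ℂ} {z : ℂ} (hz : z ∈ L) (hi : IsIntegral ℤ z) :
    co L (mkO L z hz hi) = z := rfl

theorem mk_coe {L : IntermediateField ℚ ℂ} {z : ℂ} (hz : z ∈ L) (hi : IsIntegral ℤ z) :
    ((mkO L z hz hi : 𝓞 L) : L) = ⟨z, hz⟩ := rfl

theorem co_alg {K L : IntermediateField ℚ ℂ} [NumberField K] [NumberField L] [Fact (K ≤ L)] (x : 𝓞 K) :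
    co L (algebraMap (𝓞 K) (𝓞 L) x) = co K x := rfl

theorem co_sO {L : IntermediateField ℚ ℂ} [NumberField L] (σ : L ≃+* L) (x : 𝓞 L) :
    co L (sO σ x) = algebraMap L ℂ (σ x) := rfl

theorem int_of_sq {θ : ℂ} {m : ℤ} (h : θ ^ 2 = m) : IsIntegral ℤ θ :=
  ⟨Polynomial.X ^ 2 - Polynomial.C m, Polynomial.monic_X_pow_sub_C _ (by norm_num), by
    rw [Polynomial.eval₂_sub, Polynomial.eval₂_C, Polynomial.eval₂_pow, Polynomial.eval₂_X, h]; simp⟩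

theorem zt_int (n : ℕ) : IsIntegral ℤ (zt n) := (zt_prim n).isIntegral (by positivity)
theorem rm_int : IsIntegral ℤ rm := int_of_sq (m := -2) (by rw [rm_sq]; simp)
theorem rp_int (p : ℕ) : IsIntegral ℤ (rp p) := int_of_sq (m := p) (by rw [rp_sq]; simp)

/-- `(1+√p)/2` -/
noncomputable def om (p : ℕ) : ℂ := (1 + rp p) / 2

theorem om_sq {p : ℕ} (hp4 : p % 4 = 1) : om p ^ 2 = om p + ((p / 4 : ℕ) : ℂ) := by
  have h : (p : ℂ) = 4 * ((p / 4 : ℕ) : ℂ) + 1 := by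
    have : p = 4 * (p / 4) + 1 := by lia
    exact_mod_cast this
  have h2 := rp_sq p
  rw [om]
  linear_combination h2 / 4 + h / 4

theorem om_int {p : ℕ} (hp4 : p % 4 = 1) : IsIntegral ℤ (om p) := by
  refine ⟨Polynomial.X ^ 2 - (Polynomial.X + Polynomial.C ((p / 4 : ℕ) : ℤ)), ?_, ?_⟩
  · apply Polynomial.Monic.sub_of_left (Polynomial.monic_X_pow 2)
    rw [Polynomial.degree_X_add_C, Polynomial.degree_X_pow]; norm_num
  · rw [Polynomial.eval₂_sub, Polynomial.eval₂_add, Polynomial.eval₂_C, Polynomial.eval₂_pow,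
      Polynomial.eval₂_X, om_sq hp4]; simp only [eq_intCast, Int.cast_natCast, sub_self]

theorem om_mem {p : ℕ} {L : IntermediateField ℚ ℂ} (h : rp p ∈ L) : om p ∈ L :=
  div_mem (add_mem (one_mem _) h) (ofNat_mem _ 2)

theorem two_om (p : ℕ) : 2 * om p = 1 + rp p := by rw [om]; ring

end Coe

section Parity1

variable {p : ℕ} [hpf : Fact p.Prime]

theorem odd_of_card_le {G : Type*} [CommGroup G] [Finite G]
    (h : Nat.card {c : G // c ^ 2 = 1} ≤ 2 ^ 0) : Odd (Nat.card G) := by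
  exact odd_of_two_torsion (by simpa using h)

theorem odd_rat : Odd (Nat.card (ClassGroup (𝓞 ℚ))) := by
  have : Subsingleton (ClassGroup (𝓞 ℚ)) := by
    have h := Rat.classNumber_eq
    rw [NumberField.classNumber, Fintype.card_eq_one_iff] at h
    obtain ⟨x, hx⟩ := h
    exact ⟨fun a b => (hx a).trans (hx b).symm⟩
  rw [Nat.card_of_subsingleton 1]; exact odd_one

end Parity1


open NumberField IntermediateField

set_option linter.unusedSectionVars false

section Parity2

theorem two_mem_pow {R : Type*} [CommRing R] {P : Ideal R} (hP : P.IsPrime) (h2 : (2 : R) ∈ P) (k : ℕ) :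
    ∀ z : R, z ^ 2 ^ k = 1 → 1 - z ∈ P := by
  induction k with
  | zero => intro z hz; rw [pow_zero, pow_one] at hz; rw [hz, sub_self]; exact P.zero_mem
  | succ k ih =>
    intro z hz
    have h1 := ih (z ^ 2) (by rw [← pow_mul, ← pow_succ', hz])
    apply hP.mem_of_pow_mem 2
    have : (1 - z) ^ 2 = (1 - z ^ 2) + 2 * (z ^ 2 - z) := by ring
    rw [this]
    exact P.add_mem h1 (P.mul_mem_right _ h2)

theorem mem_of_diff {L : Type*} [Field L] [NumberField L] {σ : L ≃+* L} {θ : 𝓞 L} (hθ : σ θ = -(θ : L))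
    {P : Ideal (𝓞 L)} (hP : P.IsPrime) (h : θ - sO σ θ ∈ P) : 2 ∈ P ∨ θ ∈ P := by
  apply hP.mem_or_mem
  have : sO σ θ = -θ := RingOfIntegers.ext (by rw [sO_coe, hθ]; rfl)
  rw [this] at h
  convert h using 1; ring

/-- if a square is in `⊥`, negation for extensions of `ℚ` -/
theorem neg_of_sq_Q {L : IntermediateField ℚ ℂ} [NumberField L] {σ : L ≃ₐ[ℚ] L} (h : Quad ℚ L σ) {θ : ℂ}
    (hL : θ ∈ L) {m : ℤ} (h2 : θ ^ 2 = m) (hn : θ ∉ (⊥ : IntermediateField ℚ ℂ)) :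
    σ ⟨θ, hL⟩ = -⟨θ, hL⟩ := by
  refine h.neg_of_sq (m := (m : ℚ)) ?_ ?_
  · apply (algebraMap L ℂ).injective
    rw [map_pow, alg_mk, h2, map_intCast, map_intCast]
  · intro y hy
    apply hn
    have := congrArg (algebraMap L ℂ) hy
    rw [alg_mk θ hL, ← IsScalarTower.algebraMap_apply] at this
    exact IntermediateField.mem_bot.2 ⟨y, this⟩

theorem neg_one_nonnorm {L : IntermediateField ℚ ℂ} [NumberField L] {σ : L ≃ₐ[ℚ] L} (h : Quad ℚ L σ) {θ : ℂ}
    (hL : θ ∈ L) {m : ℤ} (h2 : θ ^ 2 = m) (hm : m < 0) (hn : θ ∉ (⊥ : IntermediateField ℚ ℂ)) (z : L) :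
    Algebra.norm ℚ z ≠ (((-1 : (𝓞 ℚ)ˣ) : 𝓞 ℚ) : ℚ) := by
  have e1 : (⟨θ, hL⟩ : L) ^ 2 = algebraMap ℚ L (m : ℚ) := by
    apply (algebraMap L ℂ).injective
    rw [map_pow, alg_mk, h2, map_intCast, map_intCast]
  have e2 : ∀ y, algebraMap ℚ L y ≠ ⟨θ, hL⟩ := by
    intro y hy
    apply hn
    have := congrArg (algebraMap L ℂ) hy
    rw [alg_mk θ hL, ← IsScalarTower.algebraMap_apply] at this
    exact IntermediateField.mem_bot.2 ⟨y, this⟩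
  obtain ⟨a, b, rfl⟩ := h.decomp e1 e2 z
  rw [h.norm_decomp e1 e2]
  have : (((-1 : (𝓞 ℚ)ˣ) : 𝓞 ℚ) : ℚ) = -1 := by
    rw [Units.val_neg, Units.val_one]; exact (map_neg (algebraMap (𝓞 ℚ) ℚ) 1).trans (by rw [map_one])
  rw [this]
  have hm' : (m : ℚ) < 0 := by exact_mod_cast hm
  nlinarith [sq_nonneg a, sq_nonneg b]

theorem mkO_sq {L : IntermediateField ℚ ℂ} {θ : ℂ} (hL : θ ∈ L) (hi : IsIntegral ℤ θ) {m : ℤ} (h2 : θ ^ 2 = m) :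
    mkO L θ hL hi ^ 2 = (m : 𝓞 L) := by
  apply co_inj
  rw [map_pow, co_mk, h2, map_intCast]

/-- the integer `zt n` -/
noncomputable def zO {L : IntermediateField ℚ ℂ} {n : ℕ} (h : zt n ∈ L) : 𝓞 L := mkO L (zt n) h (zt_int n)

theorem co_zO {L : IntermediateField ℚ ℂ} {n : ℕ} (h : zt n ∈ L) : co L (zO h) = zt n := rfl

theorem zO_pow {L : IntermediateField ℚ ℂ} {n : ℕ} (h : zt n ∈ L) : zO h ^ 2 ^ (n + 2) = 1 := by
  apply co_inj
  rw [map_pow, co_zO, (zt_prim n).pow_eq_one, map_one]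

theorem zO_unit {L : IntermediateField ℚ ℂ} {n : ℕ} (h : zt n ∈ L) : IsUnit (zO h) :=
  IsUnit.of_pow_eq_one (zO_pow h) (by positivity)

theorem absNorm_zF (n : ℕ) : Ideal.absNorm (Ideal.span {1 - zO (zt_mem_F n)}) = 2 := by
  have hζ : IsPrimitiveRoot (⟨zt n, zt_mem_F n⟩ : F n) (2 ^ (n + 2)) :=
    IsPrimitiveRoot.of_map_of_injective (f := algebraMap (F n) ℂ) (zt_prim n) (algebraMap (F n) ℂ).injective
  have h1 := hζ.norm_sub_one_two (K := ℚ) (by lia)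
    (Polynomial.cyclotomic.irreducible_rat (by positivity))
  have h2 : Ideal.span {1 - zO (zt_mem_F n)} = Ideal.span {zO (zt_mem_F n) - 1} := by
    rw [← Ideal.span_singleton_neg, neg_sub]
  rw [h2, Ideal.absNorm_span_singleton]
  have h3 : (Algebra.norm ℤ (zO (zt_mem_F n) - 1) : ℤ) = (2 : ℤ) := by
    have : ((Algebra.norm ℤ (zO (zt_mem_F n) - 1) : ℤ) : ℚ) = 2 := by
      rw [Algebra.coe_norm_int, ← h1]; rfl
    exact_mod_cast this
  rw [h3]; rfl

theorem omega_two : ArithmeticFunction.cardFactors 2 = 1 :=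
  ArithmeticFunction.cardFactors_apply_prime Nat.prime_two

theorem ht_F (n : ℕ) (s : Finset (Ideal (𝓞 (F n)))) (hs : ∀ P ∈ s, P.IsPrime ∧ P ≠ ⊥ ∧ (2 : 𝓞 (F n)) ∈ P) :
    s.card ≤ 1 := by
  have h0 : (1 - zO (zt_mem_F n)) ≠ 0 := by
    intro h
    have := absNorm_zF n
    rw [h] at this
    simp at this
  have := card_mul_le h0 1 s (fun P hP => ⟨(hs P hP).1, (hs P hP).2.1,
    two_mem_pow (hs P hP).1 (hs P hP).2.2 _ _ (zO_pow _), one_le_omega (hs P hP).1 (hs P hP).2.1⟩)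
  rwa [absNorm_zF, omega_two, mul_one] at this

theorem odd_F0 : Odd (Nat.card (ClassGroup (𝓞 (F 0)))) := by
  obtain ⟨σ, hσ⟩ := exists_quad (K := ℚ) (L := F 0) (by rw [deg_F]; rfl)
  have hi : zt 0 ∉ (⊥ : IntermediateField ℚ ℂ) := by
    rw [zt_zero]; exact notMem_bot_of_conj Complex.I_ne_zero conj_I
  have h2 : zt 0 ^ 2 = ((-1 : ℤ) : ℂ) := by rw [zt_zero, Complex.I_sq]; simp
  have hneg := neg_of_sq_Q hσ (zt_mem_F 0) h2 hi
  refine odd_of_card_le (chevalley1 hσ odd_rat 1 (fun s hs => ht_F 0 s (fun P hP => ?_)) 0 (-1)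
    (neg_one_nonnorm hσ (zt_mem_F 0) h2 (by norm_num) hi) ?_)
  · obtain ⟨h1, h2, h3⟩ := hs P hP
    refine ⟨h1, h2, ?_⟩
    rcases mem_of_diff (θ := zO (zt_mem_F 0)) hneg h1 (h3 _) with h | h
    · exact h
    · exact absurd (P.eq_top_of_isUnit_mem h (zO_unit _)) h1.ne_top
  · rw [rank_rat]; have := rk_F 0; lia

theorem odd_F (n : ℕ) : Odd (Nat.card (ClassGroup (𝓞 (F n)))) := by
  induction n with
  | zero => exact odd_F0
  | succ n ih =>
    obtain ⟨σ, hσ, hneg⟩ := exists_zt_neg n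
    refine odd_of_card_le (chevalley0 hσ ih 1 (fun s hs => ht_F (n + 1) s (fun P hP => ?_)) 0 ?_)
    · obtain ⟨h1, h2, h3⟩ := hs P hP
      refine ⟨h1, h2, ?_⟩
      rcases mem_of_diff (θ := zO (zt_mem_F (n + 1))) hneg h1 (h3 _) with h | h
      · exact h
      · exact absurd (P.eq_top_of_isUnit_mem h (zO_unit _)) h1.ne_top
    · have h1 := rk_F n; have h2 := rk_F (n + 1); rw [pow_succ] at h2; lia

theorem odd_Qm2 : Odd (Nat.card (ClassGroup (𝓞 Qm2))) := by
  obtain ⟨σ, hσ⟩ := exists_quad (K := ℚ) (L := Qm2) deg_Qm2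
  have hi : rm ∉ (⊥ : IntermediateField ℚ ℂ) := notMem_bot_of_conj rm_ne rm_conj
  have h2 : rm ^ 2 = ((-2 : ℤ) : ℂ) := by rw [rm_sq]; simp
  have hneg := neg_of_sq_Q hσ rm_mem_Qm2 h2 hi
  refine odd_of_card_le (chevalley1 hσ odd_rat 1 (fun s hs => card_le_of_sq (m := -2) (by norm_num)
    (mkO_sq rm_mem_Qm2 rm_int h2) one_pos ?_ s fun P hP => ?_) 0 (-1)
    (neg_one_nonnorm hσ rm_mem_Qm2 h2 (by norm_num) hi) ?_)
  · rw [deg_Qm2, show (-2 : ℤ).natAbs = 2 from rfl, omega_two]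
  · obtain ⟨h1, h3, h4⟩ := hs P hP
    refine ⟨h1, h3, ?_, one_le_omega h1 h3⟩
    rcases mem_of_diff (θ := mkO Qm2 rm rm_mem_Qm2 rm_int) hneg h1 (h4 _) with h | h
    · apply h1.mem_of_pow_mem 2
      rw [mkO_sq rm_mem_Qm2 rm_int h2]
      have : ((-2 : ℤ) : 𝓞 Qm2) = -2 := by simp
      rw [this]; exact P.neg_mem h
    · exact h
  · rw [rank_rat, rk_Qm2]

variable {p : ℕ} [hpf : Fact p.Prime]

theorem omega_p : ArithmeticFunction.cardFactors p = 1 :=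
  ArithmeticFunction.cardFactors_apply_prime hpf.out

theorem rpO_sq {L : IntermediateField ℚ ℂ} (h : rp p ∈ L) : mkO L (rp p) h (rp_int p) ^ 2 = ((p : ℤ) : 𝓞 L) :=
  mkO_sq h _ (by rw [rp_sq]; simp)

/-- `√p` lies in the ramified primes -/
theorem rp_mem_of_diff (hp4 : p % 4 = 1) {L : IntermediateField ℚ ℂ} [NumberField L] {σ : L ≃+* L} (h : rp p ∈ L)
    (hneg : σ ⟨rp p, h⟩ = -⟨rp p, h⟩) {P : Ideal (𝓞 L)} (hd : ∀ θ, θ - sO σ θ ∈ P) :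
    mkO L (rp p) h (rp_int p) ∈ P := by
  have h1 := hd (mkO L (om p) (om_mem h) (om_int hp4))
  convert h1 using 1
  apply co_inj
  rw [map_sub, co_sO, co_mk, co_mk, mk_coe]
  have e : (⟨om p, om_mem h⟩ : L) = (1 + ⟨rp p, h⟩) / 2 := by
    apply (algebraMap L ℂ).injective
    rw [map_div₀, map_add, alg_mk (om p), alg_mk (rp p), map_one, map_ofNat, om]
  rw [e, map_div₀, map_add, map_one, map_ofNat, hneg, map_div₀, map_add, map_neg,
    alg_mk (rp p), map_one, map_ofNat, om]
  ring

theorem odd_Qp (hp4 : p % 4 = 1) : Odd (Nat.card (ClassGroup (𝓞 (Qp p)))) := by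
  obtain ⟨σ, hσ⟩ := exists_quad (K := ℚ) (L := Qp p) deg_Qp
  have hneg := neg_of_sq_Q hσ (m := p) (rp_mem_Qp p) (by rw [rp_sq]; simp)
    (not_rat_of_sq (rp_sq p) not_sq_prime)
  refine odd_of_card_le (chevalley0 hσ odd_rat 1 (fun s hs => card_le_of_sq (m := p)
    (by exact_mod_cast hpf.out.ne_zero) (rpO_sq (rp_mem_Qp p)) one_pos ?_ s fun P hP => ?_) 0 ?_)
  · rw [deg_Qp, Int.natAbs_natCast, omega_p]
  · obtain ⟨h1, h3, h4⟩ := hs P hP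
    exact ⟨h1, h3, rp_mem_of_diff hp4 _ hneg h4, one_le_omega h1 h3⟩
  · rw [rank_rat, rk_Qp]

theorem card_Mf (hp4 : p % 4 = 1) : Nat.card {c : ClassGroup (𝓞 (Mf p)) // c ^ 2 = 1} ≤ 2 := by
  have hp2 : p % 2 = 1 := by lia
  obtain ⟨σ, hσ⟩ := exists_quad (quad_Qm2M (p := p) hp2)
  have hneg : σ ⟨rp p, rp_mem_Mf p⟩ = -⟨rp p, rp_mem_Mf p⟩ := by
    apply neg_of_sq_LE hσ
    · change rp p ^ 2 ∈ _
      rw [rp_sq]; exact _root_.natCast_mem _ p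
    · exact fun h => rp_notMem_F hp2 1 (Qm2_le_F1 h)
  refine chevalley0 hσ odd_Qm2 2 (fun s hs => card_le_of_sq (m := p)
    (by exact_mod_cast hpf.out.ne_zero) (rpO_sq (rp_mem_Mf p)) one_pos ?_ s fun P hP => ?_) 1 ?_
  · rw [deg_Mf hp2, Int.natAbs_natCast, omega_p]
  · obtain ⟨h1, h3, h4⟩ := hs P hP
    exact ⟨h1, h3, rp_mem_of_diff hp4 _ hneg h4, one_le_omega h1 h3⟩
  · rw [rk_Qm2, rk_Mf hp2]

theorem card_kf : Nat.card {c : ClassGroup (𝓞 (kf p)) // c ^ 2 = 1} ≤ 2 := by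
  obtain ⟨σ, hσ⟩ := exists_quad (K := ℚ) (L := kf p) deg_kf
  have hi : rm * rp p ∉ (⊥ : IntermediateField ℚ ℂ) :=
    notMem_bot_of_conj (mul_ne_zero rm_ne rp_ne) (by rw [map_mul, rm_conj, rp_conj]; ring)
  have h2 : (rm * rp p) ^ 2 = ((-2 * p : ℤ) : ℂ) := by rw [mul_pow, rm_sq, rp_sq]; push_cast; ring
  have hinteg := int_of_sq h2
  have hneg := neg_of_sq_Q hσ (rmrp_mem_kf p) h2 hi
  have hp0 : 0 < p := hpf.out.pos
  refine chevalley1 hσ odd_rat 2 (fun s hs => card_le_of_sq (m := -2 * p) (by lia)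
    (mkO_sq (rmrp_mem_kf p) hinteg h2) one_pos ?_ s fun P hP => ?_) 1 (-1)
    (neg_one_nonnorm hσ (rmrp_mem_kf p) h2 (by lia) hi) ?_
  · rw [deg_kf, show (-2 * (p : ℤ)).natAbs = 2 * p by lia,
      ArithmeticFunction.cardFactors_mul two_ne_zero hp0.ne', omega_two, omega_p]; norm_num
  · obtain ⟨h1, h3, h4⟩ := hs P hP
    refine ⟨h1, h3, ?_, one_le_omega h1 h3⟩
    rcases mem_of_diff (θ := mkO (kf p) _ (rmrp_mem_kf p) hinteg) hneg h1 (h4 _) with h | h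
    · apply h1.mem_of_pow_mem 2
      rw [mkO_sq (rmrp_mem_kf p) hinteg h2]
      have : ((-2 * p : ℤ) : 𝓞 (kf p)) = 2 * -(p : 𝓞 (kf p)) := by push_cast; ring
      rw [this]; exact P.mul_mem_right _ h
    · exact h
  · rw [rank_rat, rk_kf]

end Parity2


open NumberField IntermediateField

set_option linter.unusedSectionVars false

section ModP

variable {p : ℕ} [hpf : Fact p.Prime]

theorem no_eighth (hp : p % 16 = 9) (y : ZMod p) : y ^ 8 ≠ -1 := by
  intro h
  have hy : y ≠ 0 := by rintro rfl; norm_num at h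
  have h1 := ZMod.pow_card_sub_one_eq_one hy
  have h2 : p - 1 = 8 * (2 * (p / 16) + 1) := by lia
  rw [h2, pow_mul, h, pow_succ, pow_mul] at h1
  norm_num at h1
  have : Fact (2 < p) := ⟨by lia⟩
  exact ZMod.neg_one_ne_one h1

theorem exists_z (hp : p % 8 = 1) : ∃ z : ZMod p, z ^ 4 = -1 := by
  obtain ⟨a, ha⟩ := FiniteField.exists_nonsquare (F := ZMod p) (by rw [ZMod.ringChar_zmod_n]; lia)
  have ha0 : a ≠ 0 := by rintro rfl; exact ha IsSquare.zero
  refine ⟨a ^ (p / 8), ?_⟩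
  rw [← pow_mul, show p / 8 * 4 = p / 2 by lia]
  rcases ZMod.pow_div_two_eq_neg_one_or_one p ha0 with h | h
  · exact absurd ((ZMod.euler_criterion p ha0).2 h) ha
  · exact h

theorem exists_zp (hp : p % 8 = 1) : ∃ z : ℤ_[p], z ^ 4 = -1 := by
  obtain ⟨a, ha⟩ := exists_z hp
  have h0 : a ≠ 0 := by rintro rfl; norm_num at ha
  have h2 : (4 : ZMod p) ≠ 0 := by
    intro h
    have : ((4 : ℕ) : ZMod p) = 0 := by exact_mod_cast h
    rw [ZMod.natCast_eq_zero_iff] at this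
    have := Nat.le_of_dvd (by norm_num) this
    have := hpf.out.two_le
    interval_cases p <;> lia
  obtain ⟨b, rfl⟩ : ∃ b : ℤ_[p], PadicInt.toZMod b = a :=
    ZMod.ringHom_surjective PadicInt.toZMod a
  have key : ∀ x : ℤ_[p], PadicInt.toZMod x = 0 ↔ ‖x‖ < 1 := fun x => by
    rw [← PadicInt.mem_nonunits, ← IsLocalRing.mem_maximalIdeal, ← PadicInt.ker_toZMod, RingHom.mem_ker]
  have k1 : ‖b ^ 4 + 1‖ < 1 := by
    rw [← key, map_add, map_pow, ha, map_one]; norm_num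
  have k2 : ‖4 * b ^ 3‖ = 1 := by
    refine le_antisymm (PadicInt.norm_le_one _) (not_lt.1 fun h => ?_)
    rw [← key, map_mul, map_pow, map_ofNat] at h
    exact mul_ne_zero h2 (pow_ne_zero _ h0) h
  obtain ⟨z, hz, -⟩ := hensels_lemma (R := ℤ) (p := p) (F := (Polynomial.X ^ 4 + 1 : Polynomial ℤ)) (a := b) (by
      have e1 : Polynomial.aeval b (Polynomial.X ^ 4 + 1 : Polynomial ℤ) = b ^ 4 + 1 := by
        rw [map_add, map_pow, Polynomial.aeval_X, map_one]
      have e2 : Polynomial.aeval b (Polynomial.derivative (Polynomial.X ^ 4 + 1 : Polynomial ℤ)) = 4 * b ^ 3 := by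
        simp only [Polynomial.derivative_add, Polynomial.derivative_X_pow, Polynomial.derivative_one, add_zero,
          map_mul, map_pow, Polynomial.aeval_X, Polynomial.aeval_C, map_natCast]
        norm_num
      rw [e1, e2, k2]; simpa using k1)
  refine ⟨z, ?_⟩
  rw [map_add, map_pow, Polynomial.aeval_X, map_one] at hz
  linear_combination hz

variable {z : ZMod p} (hz : z ^ 4 = -1)
include hz

theorem m_z_ne : z ≠ 0 := by
  rintro rfl; norm_num at hz

theorem m_z (hp : p % 16 = 9) : ¬ IsSquare z := by
  rintro ⟨y, rfl⟩
  exact no_eighth hp y (by linear_combination hz)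

theorem m_2 (hp : p % 16 = 9) : (2 : ZMod p) ≠ 0 := by
  intro h
  have : ((2 : ℕ) : ZMod p) = 0 := by exact_mod_cast h
  rw [ZMod.natCast_eq_zero_iff] at this
  have := Nat.le_of_dvd (by norm_num) this
  lia

theorem m_1i (hp : p % 16 = 9) (h24 : ∃ x : ZMod p, x ^ 4 = 2) : ¬ IsSquare (1 + z ^ 2) := by
  rintro ⟨y, hy⟩
  obtain ⟨x, hx⟩ := h24
  have hx0 : x ≠ 0 := by
    rintro rfl
    exact m_2 hz hp (by rw [← hx]; norm_num)
  apply no_eighth hp (y / x)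
  rw [div_pow, div_eq_iff (pow_ne_zero _ hx0)]
  have e1 : y ^ 8 = (1 + z ^ 2) ^ 4 := by rw [hy]; ring
  have e2 : x ^ 8 = 4 := by rw [show x ^ 8 = (x ^ 4) ^ 2 by ring, hx]; norm_num
  rw [e1, e2]
  linear_combination (z ^ 4 + 4 * z ^ 2 + 5) * hz

theorem m_rm (h24 : ∃ x : ZMod p, x ^ 4 = 2) : IsSquare (z + z ^ 3) := by
  obtain ⟨x, hx⟩ := h24
  have h : (z + z ^ 3) ^ 2 = (z ^ 2 * x ^ 2) ^ 2 := by
    linear_combination (z ^ 2 + 2) * hz - z ^ 4 * hx - 2 * hz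
  rcases sq_eq_sq_iff_eq_or_eq_neg.1 h with h | h
  · exact ⟨z * x, by rw [h]; ring⟩
  · exact ⟨z ^ 2 * (z * x), by rw [h]; linear_combination (-z^2 * x ^ 2) * hz⟩

theorem m_r2 (hp : p % 16 = 9) (h24 : ∃ x : ZMod p, x ^ 4 = 2) : ¬ IsSquare (1 + (z - z ^ 3)) := by
  rintro ⟨y, hy⟩
  obtain ⟨x, hx⟩ := h24
  have h2 := m_2 hz hp
  have h : (z - z ^ 3) ^ 2 = (x ^ 2) ^ 2 := by
    linear_combination (z ^ 2 - 2) * hz - hx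
  have h3 : ∃ w, z - z ^ 3 = w ^ 2 := by
    rcases sq_eq_sq_iff_eq_or_eq_neg.1 h with h | h
    · exact ⟨x, by rw [h]⟩
    · exact ⟨z ^ 2 * x, by rw [h]; linear_combination (-x ^ 2) * hz⟩
  obtain ⟨w, hw⟩ := h3
  have hx0 : x ≠ 0 := by
    rintro rfl
    exact h2 (by rw [← hx]; norm_num)
  have hw0 : w ≠ 0 := by
    rintro rfl
    rw [hw] at h
    have : (x ^ 2) ^ 2 = 0 := by rw [← h]; norm_num
    exact pow_ne_zero _ (pow_ne_zero _ hx0) this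
  have hy0 : y ≠ 0 := by
    rintro rfl
    have e : (z - z ^ 3) = -1 := by linear_combination hy
    rw [e, ← pow_mul, hx] at h
    have : (1 : ZMod p) = 0 := by linear_combination -h
    exact one_ne_zero this
  apply m_z hz hp
  refine ⟨(1 + z) / (w * y), ?_⟩
  have e : (1 + z) ^ 2 = z * (w ^ 2 * (y * y)) := by
    rw [← hw, ← hy]
    linear_combination (-z ^ 3 + 2 * z + 1) * hz
  field_simp
  linear_combination -e

end ModP

section Iota

variable {p : ℕ} [hpf : Fact p.Prime]

theorem zp_norm {z : ℤ_[p]} (hz : z ^ 4 = -1) : ‖z‖ = 1 := by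
  have h : IsUnit (z ^ 4) := by rw [hz]; exact isUnit_one.neg
  exact PadicInt.isUnit_iff.1 (isUnit_of_pow_ne_zero h)
where isUnit_of_pow_ne_zero {z : ℤ_[p]} (h : IsUnit (z ^ 4)) : IsUnit z := (isUnit_pow_iff (by norm_num)).1 h

theorem sQ_one_of {u : ℤ_[p]} (h0 : PadicInt.toZMod u ≠ 0) (h : IsSquare (PadicInt.toZMod u)) :
    sQ (u : ℚ_[p]) = 1 := by
  rw [sQ_unit (norm_of h0), quadraticChar_one_iff_isSquare h0]; exact h
where norm_of {u : ℤ_[p]} (h0 : PadicInt.toZMod u ≠ 0) : ‖u‖ = 1 := by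
        rw [← PadicInt.isUnit_iff, ← not_not (a := IsUnit _), ← mem_nonunits_iff,
          ← IsLocalRing.mem_maximalIdeal, ← PadicInt.ker_toZMod, RingHom.mem_ker]; exact h0

theorem sQ_neg_of {u : ℤ_[p]} (h : ¬ IsSquare (PadicInt.toZMod u)) :
    sQ (u : ℚ_[p]) = -1 := by
  have h0 : PadicInt.toZMod u ≠ 0 := fun h0 => h (by rw [h0]; exact IsSquare.zero)
  rw [sQ_unit (sQ_one_of.norm_of h0), quadraticChar_neg_one_iff_not_isSquare]; exact h

/-- an embedding of `ℚ(ζ₈)` into `ℚ_p` -/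
structure Iota (ι : F 1 →+* ℚ_[p]) (z : ℤ_[p]) : Prop where
  z4 : z ^ 4 = -1
  map : ∀ x : F 1, (x : ℂ) = zt 1 → ι x = z

theorem prim8 {K : Type*} [Field K] [CharZero K] {z : K} (hz : z ^ 4 = -1) : IsPrimitiveRoot z 8 := by
  rw [show 8 = 2 ^ (2 + 1) by norm_num, IsPrimitiveRoot.iff_orderOf]
  apply orderOf_eq_prime_pow
  · rw [show 2 ^ 2 = 4 by norm_num, hz]; norm_num
  · rw [show 2 ^ (2 + 1) = 4 * 2 by norm_num, pow_mul, hz]; norm_num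

theorem exists_emb8 {K : Type*} [Field K] [CharZero K] {z : K} (hz : z ^ 4 = -1) {w : ℂ} (hw : IsPrimitiveRoot w 8) :
    ∃ φ : adjoin ℚ {w} →+* K, φ (AdjoinSimple.gen ℚ w) = z := by
  have hi : IsIntegral ℚ w := (hw.isIntegral (by norm_num)).tower_top
  have hpr := prim8 hz
  have hm : minpoly ℚ w = Polynomial.cyclotomic 8 ℚ :=
    (Polynomial.cyclotomic_eq_minpoly_rat hw (by norm_num)).symm
  have hroot : z ∈ (minpoly ℚ w).aroots K := by
    rw [Polynomial.mem_aroots, hm]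
    refine ⟨Polynomial.cyclotomic_ne_zero _ _, ?_⟩
    rw [Polynomial.aeval_def, Polynomial.eval₂_eq_eval_map, Polynomial.map_cyclotomic]
    exact hpr.isRoot_cyclotomic (by norm_num)
  exact ⟨((algHomAdjoinIntegralEquiv ℚ hi (K := K)).symm ⟨z, hroot⟩).toRingHom,
    algHomAdjoinIntegralEquiv_symm_apply_gen ℚ hi ⟨z, hroot⟩⟩

theorem exists_iota (hp : p % 8 = 1) : ∃ (ι : F 1 →+* ℚ_[p]) (z : ℤ_[p]), Iota ι z := by
  obtain ⟨z, hz⟩ := exists_zp hp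
  have hz' : (z : ℚ_[p]) ^ 4 = -1 := by exact_mod_cast congrArg (fun t : ℤ_[p] => (t : ℚ_[p])) hz
  have hw := zt_prim 1
  rw [show 2 ^ (1 + 2) = 8 by norm_num] at hw
  obtain ⟨φ, hφ⟩ := exists_emb8 hz' hw
  refine ⟨φ, z, hz, fun x hx => ?_⟩
  have h1 : x = AdjoinSimple.gen ℚ (zt 1) := Subtype.ext (by rw [hx, AdjoinSimple.coe_gen])
  rw [h1]
  exact hφ

variable {ι : F 1 →+* ℚ_[p]} {z : ℤ_[p]} (hι : Iota ι z)
include hι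

theorem Iota.bar : (PadicInt.toZMod z) ^ 4 = -1 := by rw [← map_pow, hι.z4, map_neg, map_one]

/-- polynomial expressions in `ζ₈` -/
theorem Iota.gen (x : F 1) : ∃ ζ : F 1, (ζ : ℂ) = zt 1 ∧ ι ζ = z := by
  exact ⟨⟨zt 1, zt_mem_F 1⟩, rfl, hι.map _ rfl⟩

theorem Iota.s_zt (hp : p % 16 = 9) (x : F 1) (hx : (x : ℂ) = zt 1) : sQ (ι x) = -1 := by
  rw [hι.map x hx]
  exact sQ_neg_of (m_z hι.bar hp)

theorem Iota.s_1i (hp : p % 16 = 9) (h24 : ∃ x : ZMod p, x ^ 4 = 2) (x : F 1) (hx : (x : ℂ) = 1 + Complex.I) :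
    sQ (ι x) = -1 := by
  have h1 : x = 1 + (⟨zt 1, zt_mem_F 1⟩ : F 1) ^ 2 := by
    apply (algebraMap (F 1) ℂ).injective
    rw [map_add, map_pow, map_one, alg_mk (zt 1), zt1_sq]; exact hx
  have h2 : ι x = ((1 + z ^ 2 : ℤ_[p]) : ℚ_[p]) := by
    rw [h1, map_add, map_one, map_pow, hι.map _ rfl]; push_cast; rfl
  rw [h2]
  apply sQ_neg_of
  rw [map_add, map_one, map_pow]
  exact m_1i hι.bar hp h24

theorem Iota.s_rm (hp : p % 16 = 9) (h24 : ∃ x : ZMod p, x ^ 4 = 2) (x : F 1) (hx : (x : ℂ) = rm) :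
    sQ (ι x) = 1 := by
  have h1 : x = (⟨zt 1, zt_mem_F 1⟩ : F 1) + (⟨zt 1, zt_mem_F 1⟩ : F 1) ^ 3 := by
    apply (algebraMap (F 1) ℂ).injective
    rw [map_add, map_pow, alg_mk (zt 1), ← rm]; exact hx
  have h2 : ι x = ((z + z ^ 3 : ℤ_[p]) : ℚ_[p]) := by
    rw [h1, map_add, map_pow, hι.map _ rfl]; push_cast; rfl
  rw [h2]
  have hb := hι.bar
  apply sQ_one_of <;> rw [map_add, map_pow]
  · intro h
    apply m_2 hb hp
    linear_combination (-(PadicInt.toZMod z) - (PadicInt.toZMod z) ^ 3) * h + ((PadicInt.toZMod z) ^ 2 + 2) * hb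
  · exact m_rm hb h24

theorem Iota.s_r2 (hp : p % 16 = 9) (h24 : ∃ x : ZMod p, x ^ 4 = 2) (x : F 1)
    (hx : (x : ℂ) = 1 + (zt 1 + (zt 1)⁻¹)) : sQ (ι x) = -1 := by
  have h0 : (zt 1)⁻¹ = - zt 1 ^ 3 := by
    have h := zt_pow_half 1
    have h2 := zt_ne 1
    norm_num at h
    rw [inv_eq_iff_eq_inv, eq_comm, inv_eq_iff_eq_inv, eq_comm]
    rw [eq_comm]
    refine eq_inv_of_mul_eq_one_left ?_
    linear_combination -h
  have h1 : x = 1 + ((⟨zt 1, zt_mem_F 1⟩ : F 1) - (⟨zt 1, zt_mem_F 1⟩ : F 1) ^ 3) := by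
    apply (algebraMap (F 1) ℂ).injective
    rw [map_add, map_sub, map_one, map_pow, alg_mk (zt 1)]; refine hx.trans ?_
    rw [h0]; ring
  have h2 : ι x = ((1 + (z - z ^ 3) : ℤ_[p]) : ℚ_[p]) := by
    rw [h1, map_add, map_sub, map_pow, map_one, hι.map _ rfl]; push_cast; rfl
  rw [h2]
  apply sQ_neg_of
  rw [map_add, map_one, map_sub, map_pow]
  exact m_r2 hι.bar hp h24

end Iota

section UnitQ

variable {p : ℕ} [hpf : Fact p.Prime]

theorem sQ_sq_neg_one (hp : p % 8 = 1) {y : ℚ_[p]} (hy : y ^ 2 = -1) : sQ y = 1 := by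
  obtain ⟨z, hz⟩ := exists_zp hp
  have hz' : (z : ℚ_[p]) ^ 4 = -1 := by exact_mod_cast congrArg (fun t : ℤ_[p] => (t : ℚ_[p])) hz
  have h0 : (z : ℚ_[p]) ≠ 0 := fun h => by rw [h] at hz'; norm_num at hz'
  have h1 : y ^ 2 = ((z : ℚ_[p]) ^ 2) ^ 2 := by rw [hy, ← pow_mul, hz']
  rcases sq_eq_sq_iff_eq_or_eq_neg.1 h1 with h | h
  · rw [h, sQ_sq h0]
  · rw [h, ← neg_one_mul, sQ_mul (by norm_num) (pow_ne_zero _ h0), sQ_sq h0, sQ_neg_one (by lia), one_mul]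

theorem sQ_cube {y : ℚ_[p]} (hy : y ≠ 0) : sQ (y ^ 3) = sQ y := by
  rw [pow_succ, sQ_mul (pow_ne_zero _ hy) hy, sQ_sq hy, one_mul]

theorem unit_sQ (hp : p % 8 = 1) {L : Type*} [Field L] [NumberField L] {σ : L ≃ₐ[ℚ] L} (h : Quad ℚ L σ) {θ : L}
    {m : ℚ} (h2 : θ ^ 2 = algebraMap ℚ L m) (hm : m < 0) (hn : ∀ y, algebraMap ℚ L y ≠ θ) (ι : L →+* ℚ_[p])
    (u : (𝓞 L)ˣ) : sQ (ι (u : 𝓞 L)) = 1 := by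
  obtain ⟨a, b, hab⟩ := h.decomp h2 hn ((u : 𝓞 L) : L)
  have hN : Algebra.norm ℚ ((u : 𝓞 L) : L) = a ^ 2 - m * b ^ 2 := by rw [hab, h.norm_decomp h2 hn]
  have hN1 : |Algebra.norm ℚ ((u : 𝓞 L) : L)| = 1 := by
    have := NumberField.isUnit_iff_norm.1 u.isUnit
    rwa [RingOfIntegers.coe_norm] at this
  have hpos : 0 ≤ a ^ 2 - m * b ^ 2 := by nlinarith [sq_nonneg a, sq_nonneg b]
  rw [hN, abs_of_nonneg hpos] at hN1
  have hs := h.neg_of_sq h2 hn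
  have htr : IsIntegral ℤ (2 * a) := by
    have h3 : IsIntegral ℤ (((u : 𝓞 L) + sO σ.toRingEquiv u : 𝓞 L) : L) := RingOfIntegers.isIntegral_coe _
    have h4 : (((u : 𝓞 L) + sO σ.toRingEquiv u : 𝓞 L) : L) = algebraMap ℚ L (2 * a) := by
      change ((u : 𝓞 L) : L) + σ ((u : 𝓞 L) : L) = _
      rw [hab, map_add, map_mul, hs, σ.commutes, σ.commutes, map_mul, map_ofNat]; ring
    rw [h4] at h3
    exact (isIntegral_algebraMap_iff (algebraMap ℚ L).injective).1 h3
  obtain ⟨t, ht⟩ := IsIntegrallyClosed.isIntegral_iff.1 htr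
  have ht' : (t : ℚ) = 2 * a := by simpa using ht
  have hroot : ((u : 𝓞 L) : L) ^ 2 - t * ((u : 𝓞 L) : L) + 1 = 0 := by
    have e : (t : L) = 2 * algebraMap ℚ L a := by
      have := congrArg (algebraMap ℚ L) ht'
      rwa [map_intCast, map_mul, map_ofNat] at this
    have e2 : (algebraMap ℚ L a) ^ 2 - algebraMap ℚ L m * (algebraMap ℚ L b) ^ 2 = 1 := by
      rw [← map_pow, ← map_pow, ← map_mul, ← map_sub, hN1, map_one]
    rw [e, hab]
    linear_combination (algebraMap ℚ L b) ^ 2 * h2 - e2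
  have hroot' := congrArg ι hroot
  rw [map_add, map_sub, map_mul, map_pow, map_one, map_zero, map_intCast] at hroot'
  set y := ι ((u : 𝓞 L) : L) with hy
  have hy0 : y ≠ 0 := by
    intro h0; rw [h0] at hroot'; norm_num at hroot'
  have htb : -2 ≤ t ∧ t ≤ 2 := by
    have : (t : ℚ) ^ 2 ≤ 4 := by rw [ht']; nlinarith [sq_nonneg b, mul_nonneg (neg_nonneg.2 hm.le) (sq_nonneg b)]
    have : t ^ 2 ≤ 4 := by exact_mod_cast this
    constructor <;> nlinarith
  obtain ⟨l1, l2⟩ := htb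
  have hneg : sQ (-1 : ℚ_[p]) = 1 := sQ_neg_one (by lia)
  interval_cases t
  · have : (y + 1) ^ 2 = 0 := by push_cast at hroot'; linear_combination hroot'
    have : y = -1 := by
      have := pow_eq_zero_iff (two_ne_zero) |>.1 this
      linear_combination this
    rw [this]; exact hneg
  · rw [← sQ_cube hy0]
    have : y ^ 3 = 1 := by push_cast at hroot'; linear_combination (y - 1) * hroot'
    rw [this, sQ_one]
  · apply sQ_sq_neg_one hp
    push_cast at hroot'; linear_combination hroot'
  · rw [← sQ_cube hy0]
    have : y ^ 3 = -1 := by push_cast at hroot'; linear_combination (y + 1) * hroot'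
    rw [this, hneg]
  · have : (y - 1) ^ 2 = 0 := by push_cast at hroot'; linear_combination hroot'
    have : y = 1 := by
      have := pow_eq_zero_iff (two_ne_zero) |>.1 this
      linear_combination this
    rw [this]; exact sQ_one

end UnitQ


open NumberField IntermediateField

set_option linter.unusedSectionVars false

section XX

/-- `2cos` -/
noncomputable def xx (n : ℕ) : ℂ := zt n + (zt n)⁻¹

theorem xx_sq (n : ℕ) : xx (n + 1) ^ 2 = xx n + 2 := by
  have h := zt_ne (n + 1)
  rw [xx, xx, ← zt_sq n, add_sq, mul_assoc, mul_inv_cancel₀ h, inv_pow]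
  ring

theorem xx_zero : xx 0 = 0 := by
  rw [xx, zt_zero, Complex.inv_I]; ring

theorem xx_ne (n : ℕ) : xx (n + 1) ≠ 0 := by
  intro h
  have h1 := zt_ne (n + 1)
  have h2 : zt n = -1 := by
    rw [xx] at h
    have : zt (n + 1) * (zt (n + 1) + (zt (n + 1))⁻¹) = 0 := by rw [h, mul_zero]
    rw [mul_add, mul_inv_cancel₀ h1, ← sq, zt_sq] at this
    linear_combination this
  have h3 := zt_pow_half n
  rw [h2, pow_succ', pow_mul] at h3
  norm_num at h3

theorem xx_mem_F (n : ℕ) : xx n ∈ F n := add_mem (zt_mem_F n) (inv_mem (zt_mem_F n))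

theorem xx_mem_B (n : ℕ) : xx n ∈ B n := by
  refine ⟨xx_mem_F n, ?_⟩
  change xx n ∈ Rl
  rw [mem_Rl, xx, map_add, map_inv₀, zt_conj, inv_inv, add_comm]

theorem xx_int (n : ℕ) : IsIntegral ℤ (xx n) :=
  (zt_int n).add ((zt_prim n).inv.isIntegral (by positivity))

theorem xx_notMem (n : ℕ) : xx (n + 1) ∉ F n := by
  intro h
  obtain ⟨σ, hσ, s1⟩ := exists_zt_neg n
  have h1 := fix_LE σ (θ := ⟨xx (n + 1), xx_mem_F _⟩) h
  have e : (⟨xx (n + 1), xx_mem_F _⟩ : F (n + 1)) = ⟨zt (n + 1), zt_mem_F _⟩ + (⟨zt (n + 1), zt_mem_F _⟩)⁻¹ := rfl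
  have h2 : σ ⟨xx (n + 1), xx_mem_F _⟩ = -⟨xx (n + 1), xx_mem_F _⟩ := by
    rw [e, map_add, map_inv₀, s1, inv_neg]; ring
  rw [h1] at h2
  have h3 := congrArg (algebraMap (F (n + 1)) ℂ) h2
  rw [map_neg, alg_mk (xx (n + 1))] at h3
  exact xx_ne n (by linear_combination h3 / 2)

instance instB1 (n : ℕ) : Fact (B 1 ≤ B (n + 1)) :=
  ⟨le_inf ((inf_le_left).trans (F_mono (by lia))) inf_le_right⟩
instance instB1Lp (p n : ℕ) : Fact (B 1 ≤ Lp p (n + 1)) := ⟨(instB1 n).out.trans (B_le_Lp _ _)⟩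
instance instF1Lf (p n : ℕ) : Fact (F 1 ≤ Lf p (n + 1)) := ⟨(F_mono (by lia)).trans (F_le_Lf _ _)⟩

theorem norm_zt (n : ℕ) : Algebra.norm (F n) (⟨zt (n + 1), zt_mem_F _⟩ : F (n + 1)) = -⟨zt n, zt_mem_F n⟩ := by
  obtain ⟨σ, hσ, s1⟩ := exists_zt_neg n
  have h := hσ.norm ⟨zt (n + 1), zt_mem_F _⟩
  rw [s1] at h
  apply (algebraMap (F n) ℂ).injective
  have h3 := congrArg (algebraMap (F (n + 1)) ℂ) h
  rw [map_mul, map_neg, alg_mk (zt (n + 1)), alg_alg] at h3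
  rw [map_neg, alg_mk (zt n)]
  refine h3.trans (by rw [← zt_sq n]; ring)

theorem exists_xx_neg (n : ℕ) : ∃ σ : B (n + 1) ≃ₐ[B n] B (n + 1), Quad (B n) (B (n + 1)) σ ∧
    σ ⟨xx (n + 1), xx_mem_B _⟩ = -⟨xx (n + 1), xx_mem_B _⟩ := by
  obtain ⟨σ, hσ⟩ := exists_quad (quad_BB n)
  refine ⟨σ, hσ, neg_of_sq_LE hσ ?_ (fun h => xx_notMem n (B_le_F n h))⟩
  change xx (n + 1) ^ 2 ∈ B n
  rw [xx_sq]; exact add_mem (xx_mem_B n) (_root_.ofNat_mem _ 2)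

theorem yy_mem (n : ℕ) : 1 + xx n ∈ B n := add_mem (one_mem _) (xx_mem_B n)

theorem norm_yy (n : ℕ) : Algebra.norm (B n) (⟨1 + xx (n + 1), yy_mem _⟩ : B (n + 1)) = -⟨1 + xx n, yy_mem n⟩ := by
  obtain ⟨σ, hσ, s1⟩ := exists_xx_neg n
  have h := hσ.norm ⟨1 + xx (n + 1), yy_mem _⟩
  have e : (⟨1 + xx (n + 1), yy_mem _⟩ : B (n + 1)) = 1 + ⟨xx (n + 1), xx_mem_B _⟩ := rfl
  have s2 : σ ⟨1 + xx (n + 1), yy_mem _⟩ = 1 + -⟨xx (n + 1), xx_mem_B _⟩ := by rw [e, map_add, map_one, s1]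
  rw [s2] at h
  apply (algebraMap (B n) ℂ).injective
  have h3 := congrArg (algebraMap (B (n + 1)) ℂ) h
  rw [map_mul, map_add, map_neg, map_one, alg_mk (xx (n + 1)), alg_mk (1 + xx (n + 1)), alg_alg] at h3
  rw [map_neg, alg_mk (1 + xx n)]
  refine h3.trans ?_
  linear_combination -xx_sq n

end XX

section Nonnorm

variable {p : ℕ} [hpf : Fact p.Prime]

theorem norm_step (hp4 : p % 4 = 1) {D K L : Type*} [Field D] [Field K] [Field L] [NumberField D] [NumberField K]
    [NumberField L] [Algebra D K] [Algebra K L] [Algebra D L] [IsScalarTower D K L] (ι : D →+* ℚ_[p])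
    {y : L} {y' : K} (h : Algebra.norm K y = -y') (hs : sQ (ι (Algebra.norm D y')) = -1) :
    sQ (ι (Algebra.norm D y)) = -1 := by
  have h0 : ι (Algebra.norm D y') ≠ 0 := fun h => by rw [h, sQ] at hs; simp [upart] at hs
  rw [← Algebra.norm_norm (S := K), h, ← neg_one_mul, map_mul, map_mul]
  have h1 : Algebra.norm D (-1 : K) = (-1) ^ Module.finrank D K := by
    have := Algebra.norm_algebraMap (S := K) (-1 : D)
    rwa [map_neg, map_one] at this
  have hn : sQ (-1 : ℚ_[p]) = 1 := sQ_neg_one hp4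
  have h2 : sQ (ι (Algebra.norm D (-1 : K))) = 1 := by
    rw [h1, map_pow, map_neg, map_one]
    rcases neg_one_pow_eq_or ℚ_[p] (Module.finrank D K) with h | h <;> rw [h]
    · exact sQ_one
    · exact hn
  rw [sQ_mul _ h0, h2, hs, one_mul]
  rw [h1, map_pow, map_neg, map_one]
  exact pow_ne_zero _ (by norm_num)

theorem norm_self {K L : IntermediateField ℚ ℂ} [NumberField K] [NumberField L] [Fact (K ≤ L)] (h : L ≤ K)
    (x : L) (y : K) (hxy : (x : ℂ) = y) : Algebra.norm K x = y := by
  have h1 : Module.finrank K L = 1 := by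
    have h0 : Module.finrank ℚ K = Module.finrank ℚ L := by
      rw [le_antisymm h (Fact.out : K ≤ L)]
    have h := mul_finrank_LE K L
    have : 0 < Module.finrank ℚ K := Module.finrank_pos
    rw [← h0] at h
    exact Nat.eq_of_mul_eq_mul_left this (h.trans (mul_one _).symm)
  have h2 := Algebra.norm_algebraMap (S := L) y
  rw [h1, pow_one] at h2
  have h3 : algebraMap K L y = x := Subtype.ext ((algLE_coe y).trans hxy.symm)
  rwa [h3] at h2

variable {ι : F 1 →+* ℚ_[p]} {z : ℤ_[p]} (hι : Iota ι z)
include hι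

theorem s_norm_zt (hp : p % 16 = 9) (n : ℕ) :
    sQ (ι (Algebra.norm (F 1) (⟨zt (n + 1), zt_mem_F _⟩ : F (n + 1)))) = -1 := by
  induction n with
  | zero =>
    rw [norm_self le_rfl _ ⟨zt 1, zt_mem_F 1⟩ rfl]
    exact hι.s_zt hp _ rfl
  | succ n ih => exact norm_step (by lia) ι (norm_zt (n + 1)) ih

theorem s_norm_yy (hp : p % 16 = 9) (h24 : ∃ x : ZMod p, x ^ 4 = 2) (n : ℕ) :
    sQ ((ι.comp (algebraMap (B 1) (F 1))) (Algebra.norm (B 1) (⟨1 + xx (n + 1), yy_mem _⟩ : B (n + 1)))) = -1 := by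
  induction n with
  | zero =>
    rw [norm_self le_rfl _ ⟨1 + xx 1, yy_mem 1⟩ rfl]
    exact hι.s_r2 hp h24 _ rfl
  | succ n ih => exact norm_step (by lia) (ι.comp (algebraMap (B 1) (F 1))) (norm_yy (n + 1)) ih

omit hι in
/-- anything over a subfield `D` embedding into `ℚ_p` containing `√p` has trivial norm symbol -/
theorem normTriv (hp4 : p % 4 = 1) {D T : IntermediateField ℚ ℂ} [NumberField D] [NumberField T] [Fact (D ≤ T)]
    (ι : D →+* ℚ_[p]) (h : rp p ∈ T) : NormTriv ι T := by
  intro α hα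
  refine sQ_norm hp4 ι (θ := (⟨rp p, h⟩ : T)) (m := (p : D)) ?_ (c := 1) one_ne_zero ?_ hα
  · apply (algebraMap T ℂ).injective
    rw [map_pow, alg_mk (rp p), rp_sq, map_natCast, map_natCast]
  · rw [map_natCast, one_pow, mul_one]

theorem zt_nonnorm (hp : p % 16 = 9) (n : ℕ) (w : Lf p (n + 1)) :
    Algebra.norm (F (n + 1)) w ≠ ⟨zt (n + 1), zt_mem_F _⟩ := by
  intro h
  have h1 := s_norm_zt hι hp n
  rw [← h, Algebra.norm_norm, normTriv (by lia) ι (rp_mem_Lf p (n + 1))] at h1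
  · norm_num at h1
  · rintro rfl
    rw [Algebra.norm_zero] at h
    have := congrArg (algebraMap (F (n + 1)) ℂ) h
    rw [map_zero, alg_mk (zt (n + 1))] at this
    exact zt_ne _ this.symm

omit hι in
theorem rp_mem_Lp (p n : ℕ) : rp p ∈ Lp p n := Qp_le_Lp p n (rp_mem_Qp p)

theorem yy_nonnorm (hp : p % 16 = 9) (h24 : ∃ x : ZMod p, x ^ 4 = 2) (n : ℕ) (w : Lp p (n + 1)) :
    Algebra.norm (B (n + 1)) w ≠ ⟨1 + xx (n + 1), yy_mem _⟩ := by
  intro h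
  have h1 := s_norm_yy hι hp h24 n
  by_cases hw : w = 0
  · rw [← h, hw, Algebra.norm_zero, Algebra.norm_zero, map_zero] at h1
    rw [sQ] at h1
    simp [upart] at h1
  · rw [← h, Algebra.norm_norm, normTriv (by lia) (ι.comp (algebraMap (B 1) (F 1))) (rp_mem_Lp p (n + 1)) _ hw] at h1
    norm_num at h1

omit hι in
theorem goodF0 (hp : p % 8 = 1) (ι : F 0 →+* ℚ_[p]) : GoodEmb ι := by
  refine ⟨odd_F 0, fun u => ?_⟩
  obtain ⟨σ, hσ⟩ := exists_quad (K := ℚ) (L := F 0) (by rw [deg_F]; norm_num)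
  refine unit_sQ hp hσ (θ := ⟨zt 0, zt_mem_F 0⟩) (m := -1) ?_ (by norm_num) (fun y hy => ?_) ι u
  · apply (algebraMap (F 0) ℂ).injective
    rw [map_pow, alg_mk (zt 0), zt_zero, Complex.I_sq, map_neg, map_neg, map_one, map_one]
  · have := congrArg (algebraMap (F 0) ℂ) hy
    rw [alg_mk (zt 0), zt_zero] at this
    refine notMem_bot_of_conj Complex.I_ne_zero conj_I ?_
    rw [IntermediateField.mem_bot]
    exact ⟨y, by rw [← this]; rfl⟩

omit hι in
theorem goodQm2 (hp : p % 8 = 1) (ι : Qm2 →+* ℚ_[p]) : GoodEmb ι := by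
  refine ⟨odd_Qm2, fun u => ?_⟩
  obtain ⟨σ, hσ⟩ := exists_quad (K := ℚ) (L := Qm2) deg_Qm2
  refine unit_sQ hp hσ (θ := ⟨rm, rm_mem_Qm2⟩) (m := -2) ?_ (by norm_num) (fun y hy => ?_) ι u
  · apply (algebraMap Qm2 ℂ).injective
    rw [map_pow, alg_mk rm, rm_sq, map_neg, map_neg, map_ofNat, map_ofNat]
  · have := congrArg (algebraMap Qm2 ℂ) hy
    rw [alg_mk rm] at this
    refine notMem_bot_of_conj rm_ne rm_conj ?_
    rw [IntermediateField.mem_bot]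
    exact ⟨y, by rw [← this]; rfl⟩

end Nonnorm


open NumberField IntermediateField

set_option linter.unusedSectionVars false

section Seq

theorem seq_of_two {R : Type*} [CommRing R] {P : Ideal R} (hP : P.IsPrime) {X : ℕ → R} {N : ℕ} (h0 : X 0 = 0)
    (hX : ∀ m < N, X (m + 1) ^ 2 = X m + 2) (h2 : (2 : R) ∈ P) : ∀ m ≤ N, X m ∈ P := by
  intro m
  induction m with
  | zero => intro _; rw [h0]; exact P.zero_mem
  | succ m ih =>
    intro h
    apply hP.mem_of_pow_mem 2
    rw [hX m h]
    exact P.add_mem (ih (by lia)) h2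

theorem seq_two {R : Type*} [CommRing R] {P : Ideal R} {X : ℕ → R} {N : ℕ} (h0 : X 0 = 0)
    (hX : ∀ m < N + 1, X (m + 1) ^ 2 = X m + 2) (h : X (N + 1) ∈ P) : (2 : R) ∈ P := by
  have key : ∀ m ≤ N, (X m - 2 ∈ P ∨ X m + 2 ∈ P) → (2 : R) ∈ P := by
    intro m
    induction m with
    | zero =>
      rw [h0]
      rintro - (h | h)
      · simpa using P.neg_mem h
      · simpa using h
    | succ m ih =>
      intro hm h
      refine ih (by lia) (Or.inl ?_)
      have e : X m - 2 = (X (m + 1) - 2) * (X (m + 1) + 2) := by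
        linear_combination -(hX m (by lia))
      rw [e]
      rcases h with h | h
      · exact P.mul_mem_right _ h
      · exact P.mul_mem_left _ h
  refine key N le_rfl (Or.inr ?_)
  rw [← hX N (by lia), sq]
  exact P.mul_mem_left _ h

theorem seq_unit {R : Type*} [CommRing R] {X : ℕ → R} {N : ℕ} (h0 : X 0 = 0)
    (hX : ∀ m < N, X (m + 1) ^ 2 = X m + 2) : ∀ m ≤ N, IsUnit (1 + X m) := by
  intro m
  induction m with
  | zero => intro _; rw [h0, add_zero]; exact isUnit_one
  | succ m ih =>
    intro h
    apply isUnit_of_mul_isUnit_left (y := 1 - X (m + 1))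
    have e : (1 + X (m + 1)) * (1 - X (m + 1)) = -(1 + X m) := by linear_combination -(hX m h)
    rw [e]
    exact (ih (by lia)).neg

theorem seq_root {k : Type*} [Field k] (h2 : (2 : k) ≠ 0) {X : ℕ → k} {N : ℕ} (h0 : X 0 = 0)
    (hX : ∀ m < N, X (m + 1) ^ 2 = X m + 2) {a : k} (ha : a ^ 2 = -1) :
    ∀ m ≤ N, ∃ z : k, z ≠ 0 ∧ z ^ 2 + 1 = X m * z ∧ z ^ 2 ^ (m + 1) = -1 := by
  intro m
  induction m with
  | zero =>
    intro _
    refine ⟨a, ?_, ?_, ?_⟩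
    · rintro rfl; norm_num at ha
    · rw [ha, h0]; ring
    · simpa using ha
  | succ m ih =>
    intro h
    obtain ⟨z, hz0, hz1, hz2⟩ := ih (by lia)
    have hx := hX m h
    have hne : X (m + 1) ≠ 0 := by
      intro h3
      rw [h3] at hx
      have : (z + 1) ^ 2 = 0 := by linear_combination hz1 - z * hx
      have h4 : z = -1 := by
        have := pow_eq_zero_iff two_ne_zero |>.1 this
        linear_combination this
      rw [h4, pow_succ', pow_mul] at hz2
      norm_num at hz2
      apply h2; linear_combination hz2
    have e : ((1 + z) / X (m + 1)) ^ 2 = z := by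
      rw [div_pow, div_eq_iff (pow_ne_zero _ hne), hx]
      linear_combination hz1
    refine ⟨(1 + z) / X (m + 1), ?_, ?_, ?_⟩
    · intro h3; rw [h3] at e; apply hz0; rw [← e]; norm_num
    · rw [e]; field_simp; ring
    · rw [pow_succ', pow_mul, e, hz2]

end Seq

section XO

open Classical in
/-- `x_m` as an algebraic integer of `L` -/
noncomputable def XO (L : IntermediateField ℚ ℂ) (m : ℕ) : 𝓞 L :=
  if h : xx m ∈ L then mkO L (xx m) h (xx_int m) else 0

theorem co_XO {L : IntermediateField ℚ ℂ} {m : ℕ} (h : xx m ∈ L) : co L (XO L m) = xx m := by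
  rw [XO, dif_pos h, co_mk]

theorem XO_zero {L : IntermediateField ℚ ℂ} : XO L 0 = 0 := by
  apply co_inj
  rw [co_XO, xx_zero, map_zero]
  rw [xx_zero]; exact zero_mem _

theorem XO_sq {L : IntermediateField ℚ ℂ} {m : ℕ} (h : xx m ∈ L) (h' : xx (m + 1) ∈ L) :
    XO L (m + 1) ^ 2 = XO L m + 2 := by
  apply co_inj
  rw [map_pow, co_XO h', xx_sq, map_add, co_XO h, map_ofNat]

theorem B_mono {m n : ℕ} (h : m ≤ n) : B m ≤ B n :=
  le_inf (inf_le_left.trans (F_mono h)) inf_le_right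

theorem XO_sq_B {L : IntermediateField ℚ ℂ} {N : ℕ} (h : B N ≤ L) : ∀ m < N, XO L (m + 1) ^ 2 = XO L m + 2 :=
  fun m hm => XO_sq (h (B_mono (by lia) (xx_mem_B m))) (h (B_mono (by lia) (xx_mem_B (m + 1))))

theorem absNorm_xB (n : ℕ) : Ideal.absNorm (Ideal.span {2 - XO (B n) n}) = 2 := by
  have h1 : jI (B n) (F n) (Ideal.span {2 - XO (B n) n}) = Ideal.span {1 - zO (zt_mem_F n)} ^ 2 := by
    rw [jI_span, Ideal.span_singleton_pow]
    rw [Ideal.span_singleton_eq_span_singleton]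
    obtain ⟨u, hu⟩ := (zO_unit (zt_mem_F n)).neg
    refine ⟨u, ?_⟩
    rw [hu]
    apply co_inj
    rw [map_mul, co_alg, map_pow, map_sub, map_sub, map_neg, co_XO (xx_mem_B n), co_zO, map_ofNat, map_one, xx]
    have := zt_ne n
    field_simp
    ring
  have h2 := congrArg (fun I => Ideal.absNorm (rN (B n) (F n) I)) h1
  beta_reduce at h2
  rw [rN_jI, quad_BF, absNorm_rN, map_pow, map_pow, absNorm_zF] at h2
  exact Nat.pow_left_injective (n := 2) (by norm_num) h2

theorem odd_B0 : Odd (Nat.card (ClassGroup (𝓞 (B 0)))) := by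
  have e0 : (B 0) ≃+* ℚ := by
    rw [B0_eq]; exact (botEquiv ℚ ℂ).toRingEquiv
  have e : 𝓞 (B 0) ≃+* ℤ := (RingOfIntegers.mapRingEquiv e0).trans Rat.ringOfIntegersEquiv
  have : IsPrincipalIdealRing (𝓞 (B 0)) := IsPrincipalIdealRing.of_surjective e.symm.toRingHom e.symm.surjective
  have : Nat.card (ClassGroup (𝓞 (B 0))) = 1 := by
    have hs : Subsingleton (ClassGroup (𝓞 (B 0))) := by
      constructor
      intro a b
      obtain ⟨I, rfl⟩ := ClassGroup.mk0_surjective a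
      obtain ⟨J, rfl⟩ := ClassGroup.mk0_surjective b
      rw [(ClassGroup.mk0_eq_one_iff I.2).2 (IsPrincipalIdealRing.principal _),
        (ClassGroup.mk0_eq_one_iff J.2).2 (IsPrincipalIdealRing.principal _)]
    exact Nat.card_of_subsingleton 1
  rw [this]; exact odd_one

theorem odd_B (n : ℕ) : Odd (Nat.card (ClassGroup (𝓞 (B n)))) := by
  induction n with
  | zero => exact odd_B0
  | succ n ih =>
    obtain ⟨σ, hσ, hneg⟩ := exists_xx_neg n
    refine odd_of_card_le (chevalley0 hσ ih 1 (fun s hs => ?_) 0 ?_)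
    · have hne : (2 - XO (B (n + 1)) (n + 1)) ≠ 0 := by
        intro h
        have h2 := absNorm_xB (n + 1)
        rw [h] at h2
        simp at h2
      have h := card_mul_le hne 1 s (fun P hP => ?_)
      · rwa [absNorm_xB, omega_two, mul_one] at h
      · obtain ⟨h1, h2, h3⟩ := hs P hP
        refine ⟨h1, h2, ?_, one_le_omega h1 h2⟩
        have hneg' : σ (XO (B (n + 1)) (n + 1) : 𝓞 (B (n + 1))) = -((XO (B (n + 1)) (n + 1) : 𝓞 (B (n + 1))) : B (n + 1)) := by
          rw [XO, dif_pos (xx_mem_B (n + 1)), mk_coe, hneg]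
        have h4 : (2 : 𝓞 (B (n + 1))) ∈ P := by
          rcases mem_of_diff (σ := σ.toRingEquiv) hneg' h1 (h3 _) with h | h
          · exact h
          · exact seq_two XO_zero (XO_sq_B le_rfl) h
        exact P.sub_mem h4 (seq_of_two h1 XO_zero (XO_sq_B le_rfl) h4 _ le_rfl)
    · have h1 := rk_B n; have h2 := rk_B (n + 1); rw [pow_succ] at h2; lia

end XO

section Residue

variable {p : ℕ} [hpf : Fact p.Prime]

theorem dvd_of_pow (hp : p % 16 = 9) (n : ℕ) : ∀ f : ℕ, 2 ^ (n + 3) ∣ p ^ f - 1 → 2 ^ n ∣ f := by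
  induction n with
  | zero => intro f _; simp
  | succ n ih =>
    intro f hf
    have hpos : 1 ≤ p ^ f := Nat.one_le_pow _ _ hpf.out.pos
    have h16 : p ^ f % 16 = 1 := by
      have : 16 ∣ p ^ f - 1 := (Dvd.intro_left (2 ^ n) (by ring)).trans hf
      lia
    have hev : ∃ e, f = 2 * e := by
      rcases Nat.even_or_odd' f with ⟨e, he | he⟩
      · exact ⟨e, he⟩
      · exfalso
        rw [he, pow_succ, pow_mul, Nat.mul_mod, Nat.pow_mod, Nat.pow_mod p, hp] at h16
        norm_num at h16
    obtain ⟨e, rfl⟩ := hev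
    have h1 : 1 ≤ p ^ e := Nat.one_le_pow _ _ hpf.out.pos
    have h4 : p ^ e % 4 = 1 := by
      rw [Nat.pow_mod, show p % 4 = 1 by lia, one_pow]
      norm_num
    obtain ⟨c, hc⟩ : ∃ c, p ^ e = 4 * c + 1 := ⟨p ^ e / 4, by lia⟩
    have h5 : p ^ (2 * e) - 1 = 2 * ((p ^ e - 1) * (2 * c + 1)) := by
      rw [mul_comm, pow_mul, hc, Nat.add_sub_cancel]
      apply Nat.sub_eq_of_eq_add; ring
    rw [h5, show n + 1 + 3 = (n + 3) + 1 by ring, pow_succ'] at hf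
    have h6 := Nat.dvd_of_mul_dvd_mul_left two_pos hf
    have h7 : Nat.Coprime (2 ^ (n + 3)) (2 * c + 1) :=
      Nat.Coprime.pow_left _ (by rw [Nat.coprime_two_left, Nat.odd_iff]; lia)
    rw [pow_succ']
    exact Nat.mul_dvd_mul_left 2 (ih e (h7.dvd_of_dvd_mul_right h6))

theorem omega_field (hp : p % 16 = 9) {k : Type*} [Field k] [Finite k] (hk : (p : k) = 0) {n : ℕ} {z : k}
    (hz : z ^ 2 ^ (n + 2) = -1) : 2 ^ n ≤ ArithmeticFunction.cardFactors (Nat.card k) := by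
  have := Fintype.ofFinite k
  obtain ⟨q, hq⟩ := CharP.exists k
  obtain ⟨f, hqp, hcard⟩ := FiniteField.card k q
  have hqp' : q = p := by
    have := (CharP.cast_eq_zero_iff k q p).1 hk
    exact (Nat.prime_dvd_prime_iff_eq hqp hpf.out).1 this
  subst hqp'
  have h2 : (1 : k) ≠ -1 := by
    intro h
    have h3 : ((2 : ℕ) : k) = 0 := by push_cast; linear_combination h
    rw [CharP.cast_eq_zero_iff k q] at h3
    have := Nat.le_of_dvd two_pos h3
    lia
  have hz0 : z ≠ 0 := by
    rintro rfl
    rw [zero_pow (by positivity)] at hz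
    exact one_ne_zero (α := k) (by linear_combination hz)
  have hord : orderOf z = 2 ^ (n + 2 + 1) := by
    apply orderOf_eq_prime_pow
    · rw [hz]; exact h2.symm
    · rw [pow_succ, pow_mul, hz]; norm_num
  have h3 := orderOf_dvd_of_pow_eq_one (FiniteField.pow_card_sub_one_eq_one z hz0)
  rw [hord, hcard] at h3
  have h4 := dvd_of_pow hp n _ h3
  rw [Nat.card_eq_fintype_card, hcard, ArithmeticFunction.cardFactors_apply_prime_pow hqp]
  exact Nat.le_of_dvd f.pos h4

theorem two_notMem {L : IntermediateField ℚ ℂ} (hp2 : p % 2 = 1) {P : Ideal (𝓞 L)} (hP : P.IsPrime)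
    (h : rp p ∈ L) (hm : mkO L (rp p) h (rp_int p) ∈ P) : (p : 𝓞 L) ∈ P ∧ (2 : 𝓞 L) ∉ P := by
  have h1 : (p : 𝓞 L) ∈ P := by
    have := rpO_sq h
    rw [Int.cast_natCast] at this
    rw [← this, sq]; exact P.mul_mem_left _ hm
  refine ⟨h1, fun h2 => hP.ne_top ((Ideal.eq_top_iff_one _).2 ?_)⟩
  have : (1 : 𝓞 L) = (p : 𝓞 L) - ((p / 2 : ℕ) : 𝓞 L) * 2 := by
    have e : p = 1 + p / 2 * 2 := by lia
    have e2 : (p : 𝓞 L) = 1 + ((p / 2 : ℕ) : 𝓞 L) * 2 := by exact_mod_cast congrArg (fun t : ℕ => (t : 𝓞 L)) e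
    linear_combination -e2
  rw [this]
  exact P.sub_mem h1 (P.mul_mem_left _ h2)

theorem absNorm_card {L : Type*} [Field L] [NumberField L] (P : Ideal (𝓞 L)) :
    Ideal.absNorm P = Nat.card (𝓞 L ⧸ P) := by
  rw [Ideal.absNorm_apply, Submodule.cardQuot_apply]

theorem omega_Lf (hp : p % 16 = 9) {n : ℕ} {P : Ideal (𝓞 (Lf p (n + 1)))} (hP : P.IsPrime) (h0 : P ≠ ⊥)
    (hm : mkO _ (rp p) (rp_mem_Lf p (n + 1)) (rp_int p) ∈ P) :
    2 ^ n ≤ ArithmeticFunction.cardFactors (Ideal.absNorm P) := by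
  have hmax : P.IsMaximal := hP.isMaximal h0
  letI := Ideal.Quotient.field P
  have : Finite (𝓞 (Lf p (n + 1)) ⧸ P) := Ideal.finiteQuotientOfFreeOfNeBot P h0
  rw [absNorm_card]
  refine omega_field hp (z := Ideal.Quotient.mk P (zO (zt_mem_Lf p (n + 1)))) ?_ ?_
  · rw [← map_natCast (Ideal.Quotient.mk P), Ideal.Quotient.eq_zero_iff_mem]
    exact (two_notMem (by lia) hP _ hm).1
  · have : zO (zt_mem_Lf p (n + 1)) ^ 2 ^ (n + 2) = -1 := by
      apply co_inj
      rw [map_pow, co_zO, map_neg, map_one]; exact zt_pow_half (n + 1)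
    rw [← map_pow, this, map_neg, map_one]

theorem omega_Lp (hp : p % 16 = 9) {n : ℕ} {P : Ideal (𝓞 (Lp p (n + 1)))} (hP : P.IsPrime) (h0 : P ≠ ⊥)
    (hm : mkO _ (rp p) (rp_mem_Lp p (n + 1)) (rp_int p) ∈ P) :
    2 ^ n ≤ ArithmeticFunction.cardFactors (Ideal.absNorm P) := by
  have hmax : P.IsMaximal := hP.isMaximal h0
  letI := Ideal.Quotient.field P
  have : Finite (𝓞 (Lp p (n + 1)) ⧸ P) := Ideal.finiteQuotientOfFreeOfNeBot P h0
  rw [absNorm_card]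
  obtain ⟨m1, m2⟩ := two_notMem (by lia) hP _ hm
  have hk : (p : 𝓞 (Lp p (n + 1)) ⧸ P) = 0 := by
    rw [← map_natCast (Ideal.Quotient.mk P), Ideal.Quotient.eq_zero_iff_mem]; exact m1
  have hk2 : (2 : 𝓞 (Lp p (n + 1)) ⧸ P) ≠ 0 := by
    rw [← map_ofNat (Ideal.Quotient.mk P), Ne, Ideal.Quotient.eq_zero_iff_mem]; exact m2
  obtain ⟨z, hz⟩ := exists_z (p := p) (by lia)
  have hch : CharP (𝓞 (Lp p (n + 1)) ⧸ P) p := by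
    obtain ⟨q, hq⟩ := CharP.exists (𝓞 (Lp p (n + 1)) ⧸ P)
    have h1 := (CharP.cast_eq_zero_iff _ q p).1 hk
    rcases (Nat.dvd_prime hpf.out).1 h1 with h | h
    · exact absurd h (CharP.char_ne_one (𝓞 (Lp p (n + 1)) ⧸ P) q)
    · rw [h] at hq; exact hq
  have ha : (ZMod.castHom dvd_rfl (𝓞 (Lp p (n + 1)) ⧸ P) (z ^ 2)) ^ 2 = -1 := by
    rw [← map_pow, ← pow_mul, hz, map_neg, map_one]
  obtain ⟨w, -, -, hw⟩ := seq_root hk2 (X := fun m => Ideal.Quotient.mk P (XO (Lp p (n + 1)) m)) (N := n + 1)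
    (by simp only [XO_zero, map_zero])
    (fun m hm => by
      beta_reduce
      rw [← map_pow, XO_sq_B (B_le_Lp p (n + 1)) m hm, map_add, map_ofNat]) ha (n + 1) le_rfl
  exact omega_field hp hk hw

variable {ι : F 1 →+* ℚ_[p]} {z : ℤ_[p]} (hι : Iota ι z)

theorem exists_FL_neg (hp2 : p % 2 = 1) (n : ℕ) : ∃ σ : Lf p n ≃ₐ[F n] Lf p n, Quad (F n) (Lf p n) σ ∧
    σ ⟨rp p, rp_mem_Lf p n⟩ = -⟨rp p, rp_mem_Lf p n⟩ := by
  obtain ⟨σ, hσ⟩ := exists_quad (quad_FL (p := p) hp2 n)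
  refine ⟨σ, hσ, neg_of_sq_LE hσ ?_ (rp_notMem_F hp2 n)⟩
  change rp p ^ 2 ∈ _
  rw [rp_sq]; exact _root_.natCast_mem _ p

theorem exists_BLp_neg (hp2 : p % 2 = 1) (n : ℕ) : ∃ σ : Lp p n ≃ₐ[B n] Lp p n, Quad (B n) (Lp p n) σ ∧
    σ ⟨rp p, rp_mem_Lp p n⟩ = -⟨rp p, rp_mem_Lp p n⟩ := by
  obtain ⟨σ, hσ⟩ := exists_quad (quad_BLp (p := p) hp2 n)
  refine ⟨σ, hσ, neg_of_sq_LE hσ ?_ (fun h => rp_notMem_F hp2 n (B_le_F n h))⟩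
  change rp p ^ 2 ∈ _
  rw [rp_sq]; exact _root_.natCast_mem _ p

include hι

theorem card_Lf (hp : p % 16 = 9) (n : ℕ) :
    Nat.card {c : ClassGroup (𝓞 (Lf p (n + 1))) // c ^ 2 = 1} ≤ 4 := by
  have hp2 : p % 2 = 1 := by lia
  obtain ⟨σ, hσ, hneg⟩ := exists_FL_neg (p := p) hp2 (n + 1)
  obtain ⟨u, hu⟩ := zO_unit (zt_mem_F (n + 1))
  refine chevalley1 hσ (odd_F _) 4 (fun s hs => card_le_of_sq (m := p)
    (by exact_mod_cast hpf.out.ne_zero) (rpO_sq (rp_mem_Lf p (n + 1))) (g := 2 ^ n) (by positivity) ?_ s fun P hP => ?_)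
    2 u (fun w hw => zt_nonnorm hι hp n w ?_) ?_
  · rw [deg_Lf hp2, Int.natAbs_natCast, omega_p]; apply le_of_eq; ring
  · obtain ⟨h1, h3, h4⟩ := hs P hP
    have h5 := rp_mem_of_diff (p := p) (by lia) _ hneg h4
    exact ⟨h1, h3, h5, omega_Lf hp h1 h3 h5⟩
  · rw [hw, hu]; exact mk_coe _ _
  · have h1 := rk_F (n + 1); have h2 := rk_Lf (p := p) hp2 (n + 1); rw [pow_succ] at h2; lia

theorem odd_Lp (hp : p % 16 = 9) (h24 : ∃ x : ZMod p, x ^ 4 = 2) (n : ℕ) :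
    Odd (Nat.card (ClassGroup (𝓞 (Lp p (n + 1))))) := by
  have hp2 : p % 2 = 1 := by lia
  obtain ⟨σ, hσ, hneg⟩ := exists_BLp_neg (p := p) hp2 (n + 1)
  obtain ⟨u, hu⟩ := seq_unit (XO_zero (L := B (n + 1))) (XO_sq_B le_rfl) (n + 1) le_rfl
  refine odd_of_card_le (chevalley1 hσ (odd_B _) 2 (fun s hs => card_le_of_sq (m := p)
    (by exact_mod_cast hpf.out.ne_zero) (rpO_sq (rp_mem_Lp p (n + 1))) (g := 2 ^ n) (by positivity) ?_ s fun P hP => ?_)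
    0 u (fun w hw => yy_nonnorm hι hp h24 n w ?_) ?_)
  · rw [deg_Lp hp2, Int.natAbs_natCast, omega_p]; apply le_of_eq; ring
  · obtain ⟨h1, h3, h4⟩ := hs P hP
    have h5 := rp_mem_of_diff (p := p) (by lia) _ hneg h4
    exact ⟨h1, h3, h5, omega_Lp hp h1 h3 h5⟩
  · rw [hw, hu]
    apply (algebraMap (B (n + 1)) ℂ).injective
    rw [alg_mk (1 + xx (n + 1))]
    refine (co_def _).symm.trans ?_
    rw [map_add, map_one, co_XO (xx_mem_B _)]
  · have h1 := rk_B (n + 1); have h2 := rk_Lp (p := p) hp2 (n + 1); rw [pow_succ] at h2; lia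

end Residue


open NumberField IntermediateField

set_option linter.unusedSectionVars false

section PiIdeals

theorem pq_mul {R : Type*} [CommRing R] {π ω c : R} (h : ω * (ω - 1) = π * c) :
    Ideal.span {π, ω} * Ideal.span {π, ω - 1} = Ideal.span {π} := by
  rw [Ideal.span_pair_mul_span_pair]
  apply le_antisymm
  · rw [Ideal.span_le]
    rintro x (rfl | rfl | rfl | rfl) <;> rw [SetLike.mem_coe, Ideal.mem_span_singleton]
    · exact Dvd.intro _ rfl
    · exact Dvd.intro _ rfl
    · exact Dvd.intro_left _ rfl
    · exact ⟨c, h⟩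
  · rw [Ideal.span_singleton_le_iff_mem]
    have e : ω * π - π * (ω - 1) = π := by ring
    have := Ideal.sub_mem (Ideal.span {π * π, π * (ω - 1), ω * π, ω * (ω - 1)})
      (a := ω * π) (b := π * (ω - 1)) (Ideal.subset_span (by simp)) (Ideal.subset_span (by simp))
    rwa [e] at this

variable {L : Type*} [Field L] [NumberField L]

theorem prime_of_two {Q : Ideal (𝓞 L)} (h : Ideal.absNorm Q = 2) : Q.IsPrime := by
  apply Ideal.isPrime_of_irreducible_absNorm
  rw [h]; exact Nat.prime_two

theorem ne_bot_of_two {Q : Ideal (𝓞 L)} {m : ℕ} (hm : m ≠ 0) (h : Ideal.absNorm Q = m) : Q ≠ ⊥ := by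
  rintro rfl
  rw [Ideal.absNorm_bot] at h
  exact hm h.symm

theorem two_mem_of_two {Q : Ideal (𝓞 L)} (h : Ideal.absNorm Q = 2) : (2 : 𝓞 L) ∈ Q := by
  have := Ideal.absNorm_mem Q
  rw [h] at this
  exact_mod_cast this

theorem eq_of_le_norm {I J : Ideal (𝓞 L)} (hIJ : I ≤ J) (h0 : I ≠ ⊥) (h : Ideal.absNorm I = Ideal.absNorm J) :
    I = J := by
  obtain ⟨C, hC⟩ := Ideal.dvd_iff_le.2 hIJ
  have h1 := congrArg Ideal.absNorm hC
  rw [map_mul, ← h] at h1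
  have h2 : Ideal.absNorm I ≠ 0 := fun h => h0 (Ideal.absNorm_eq_zero_iff.1 h)
  have h3 : Ideal.absNorm C = 1 := by
    have := Nat.eq_of_mul_eq_mul_left (Nat.pos_of_ne_zero h2) (h1.symm.trans (mul_one _).symm)
    exact this
  rw [Ideal.absNorm_eq_one_iff] at h3
  rw [hC, h3, Ideal.mul_top]

open UniqueFactorizationMonoid in
open Classical in
noncomputable def vv (Q I : Ideal (𝓞 L)) : ℕ := (normalizedFactors I).count Q

open UniqueFactorizationMonoid in
theorem vv_mul (Q : Ideal (𝓞 L)) {I J : Ideal (𝓞 L)} (hI : I ≠ ⊥) (hJ : J ≠ ⊥) :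
    vv Q (I * J) = vv Q I + vv Q J := by
  classical
  rw [vv, vv, vv, normalizedFactors_mul hI hJ, Multiset.count_add]

open UniqueFactorizationMonoid in
theorem vv_zero {Q I : Ideal (𝓞 L)} (h : ¬ Q ∣ I) : vv Q I = 0 := by
  classical
  rw [vv, Multiset.count_eq_zero]
  exact fun hm => h (dvd_of_mem_normalizedFactors hm)

open UniqueFactorizationMonoid in
theorem vv_self {Q : Ideal (𝓞 L)} (hQ : Q.IsPrime) (h0 : Q ≠ ⊥) : vv Q Q = 1 := by
  classical
  have : Irreducible Q := (Ideal.prime_of_isPrime h0 hQ).irreducible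
  rw [vv, normalizedFactors_irreducible this, normalize_eq]
  simp

theorem vv_top (Q : Ideal (𝓞 L)) : vv Q ⊤ = 0 := by
  rw [vv, ← Ideal.one_eq_top, UniqueFactorizationMonoid.normalizedFactors_one]; simp

theorem eq_of_dvd_prime {Q R : Ideal (𝓞 L)} (hQ : Q.IsPrime) (hR : R.IsPrime) (hQ0 : Q ≠ ⊥) (hR0 : R ≠ ⊥)
    (h : Q ∣ R) : Q = R :=
  ((hR.isMaximal hR0).eq_of_le hQ.ne_top (Ideal.dvd_iff_le.1 h)).symm

variable {K : Type*} [Field K] [NumberField K] [Algebra K L]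

theorem jI_top : jI K L ⊤ = ⊤ := by
  rw [← Ideal.span_singleton_one, jI_span, map_one, Ideal.span_singleton_one]

theorem vv_even {τ : L ≃ₐ[K] L} (h : Quad K L τ) {Q : Ideal (𝓞 L)} (hQ : Q.IsPrime) (hQ0 : Q ≠ ⊥)
    (hτ : sI τ.toRingEquiv Q = Q) (hP : (rN K L Q).IsPrime) (b : Ideal (𝓞 K)) (hb : b ≠ ⊥) :
    Even (vv Q (jI K L b)) := by
  have hP0 : rN K L Q ≠ ⊥ := rN_ne_bot hQ0
  induction b using UniqueFactorizationMonoid.induction_on_prime with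
  | h₁ => exact absurd rfl hb
  | h₂ x hx =>
    rw [Ideal.isUnit_iff] at hx
    rw [hx, jI_top, vv_top]; exact Even.zero
  | h₃ a R ha hR ih =>
    have ha' : a ≠ ⊥ := ha
    have hR0 : R ≠ ⊥ := hR.ne_zero
    have hRp : R.IsPrime := Ideal.isPrime_of_prime hR
    rw [jI_mul, vv_mul _ (jI_ne_bot hR0) (jI_ne_bot ha')]
    refine Even.add ?_ (ih ha')
    by_cases hd : Q ∣ jI K L R
    · have h1 := map_dvd (rN K L) hd
      rw [rN_jI, h.two] at h1
      have h2 := (Ideal.prime_of_isPrime hP0 hP).dvd_of_dvd_pow h1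
      rw [← eq_of_dvd_prime hP hRp hP0 hR0 h2, h.jI_rN, hτ, vv_mul _ hQ0 hQ0, vv_self hQ hQ0]
      exact even_two
    · rw [vv_zero hd]; exact Even.zero

theorem conj_inv_ideal {c : L ≃ₐ[K] L} (h : Quad K L c) {Q Q' : Ideal (𝓞 L)} {π : 𝓞 L} (h0 : π ≠ 0)
    (hQQ : Q * Q' = Ideal.span {π}) (hS : ∀ P, SPrime K c P → P = Q ∨ P = Q') {J : Ideal (𝓞 L)}
    (hJ0 : J ≠ ⊥) (hJ : sI c.toRingEquiv J = J) :
    cl J ^ (Nat.card (ClassGroup (𝓞 K))) ∈ Subgroup.zpowers (cl Q) := by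
  classical
  have hb : Q * Q' ≠ ⊥ := by rw [hQQ]; exact span_ne_bot h0
  have hQ0 : Q ≠ ⊥ := fun h => hb (by rw [h]; simp)
  have hQ0' : Q' ≠ ⊥ := fun h => hb (by rw [h]; simp)
  have hc : cl Q' = (cl Q)⁻¹ := by
    apply eq_inv_of_mul_eq_one_right
    rw [← cl_mul hQ0 hQ0', hQQ, cl_span h0]
  have hfin : {P | SPrime K c P}.Finite :=
    Set.Finite.subset (Set.toFinite {Q, Q'}) (fun P hP => by simpa using hS P hP)
  obtain ⟨f, b, hb0, e⟩ := decomp h hfin.toFinset (by simp) _ J rfl hJ0 hJ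
  have hprod : ∀ s : Finset (Ideal (𝓞 L)), (∀ P ∈ s, SPrime K c P) →
      (∏ P ∈ s, P ^ f P) ≠ ⊥ ∧ cl (∏ P ∈ s, P ^ f P) ∈ Subgroup.zpowers (cl Q) := by
    intro s
    induction s using Finset.induction_on with
    | empty => intro _; rw [Finset.prod_empty]; exact ⟨one_ne_zero, by rw [cl_one]; exact one_mem _⟩
    | insert P s hP ih =>
      intro hs
      obtain ⟨i1, i2⟩ := ih (fun P hP => hs P (Finset.mem_insert_of_mem hP))
      have hPs := hs P (Finset.mem_insert_self _ _)
      have hP0 : P ≠ ⊥ := hPs.2.1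
      have hP1 : P ^ f P ≠ ⊥ := pow_ne_zero _ hP0
      rw [Finset.prod_insert hP]
      refine ⟨mul_ne_zero hP1 i1, ?_⟩
      rw [cl_mul hP1 i1, cl_pow hP0]
      refine mul_mem (pow_mem ?_ _) i2
      rcases hS P hPs with h | h
      · rw [h]; exact Subgroup.mem_zpowers _
      · rw [h, hc]; exact inv_mem (Subgroup.mem_zpowers _)
  obtain ⟨i1, i2⟩ := hprod hfin.toFinset (by simp)
  rw [e, cl_mul i1 (jI_ne_bot hb0), mul_pow, ← jj_cl hb0, ← map_pow, pow_card_eq_one', map_one, mul_one]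
  exact pow_mem i2 _

end PiIdeals


open NumberField IntermediateField

set_option linter.unusedSectionVars false

section Capit

theorem jI_sI_compat {K L : Type*} [Field K] [Field L] [NumberField K] [NumberField L] [Algebra K L]
    (σK : K ≃+* K) (σL : L ≃+* L) (h : ∀ y : K, σL (algebraMap K L y) = algebraMap K L (σK y))
    (I : Ideal (𝓞 K)) : jI K L (sI σK I) = sI σL (jI K L I) := by
  unfold jI sI
  rw [Ideal.map_map, Ideal.map_map]
  congr 1
  ext x
  exact (h x).symm

variable {Kp K Lp L : Type*} [Field Kp] [Field K] [Field Lp] [Field L] [NumberField Kp] [NumberField K]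
  [NumberField Lp] [NumberField L] [Algebra Kp K] [Algebra K L] [Algebra Lp L]

theorem int_hilbert {c : K ≃ₐ[Kp] K} (h : Quad Kp K c) {g : K} (hg : g * c g = 1) :
    ∃ δ : 𝓞 K, δ ≠ 0 ∧ g * c δ = δ := by
  obtain ⟨y, hy0, hy⟩ := h.hilbert90 hg
  obtain ⟨a, b, hb, rfl⟩ := IsFractionRing.div_surjective (A := 𝓞 K) y
  have hb0 : b ≠ 0 := nonZeroDivisors.ne_zero hb
  have hb1 : (b : K) ≠ 0 := by simpa using hb0
  have ha1 : (a : K) ≠ 0 := by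
    intro h; apply hy0; change algebraMap (𝓞 K) K a = 0 at h; rw [h]; simp
  have ha0 : a ≠ 0 := by rintro rfl; simp at ha1
  have hcb : c (b : K) ≠ 0 := by simpa using hb0
  have hca : c (a : K) ≠ 0 := by simpa using ha0
  refine ⟨a * sO c.toRingEquiv b, mul_ne_zero ha0 ((sO c.toRingEquiv).map_ne_zero_iff.2 hb0), ?_⟩
  have e1 : ((a * sO c.toRingEquiv b : 𝓞 K) : K) = a * c b := by
    rfl
  rw [e1, hy, map_mul, map_div₀, h.sq]
  field_simp

theorem capit {cK : K ≃ₐ[Kp] K} {cL : L ≃ₐ[Lp] L} {τ : L ≃ₐ[K] L} (hcK : Quad Kp K cK) (hcL : Quad Lp L cL)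
    (hτ : Quad K L τ) (hc : ∀ y : K, cL (algebraMap K L y) = algebraMap K L (cK y))
    (hcomm : ∀ x : L, cL (τ x) = τ (cL x))
    (hroot : ∀ u : (𝓞 L)ˣ, ∃ N : ℕ, 0 < N ∧ ((u : 𝓞 L) : L) ^ N = cL ((u : 𝓞 L) : L) ^ N)
    (Q : Ideal (𝓞 L))
    (hξ : ∀ (ξ : L) (k : ℕ), ξ ^ 2 ^ k = 1 → ξ * τ ξ = 1 → ∃ w : 𝓞 L, w ≠ 0 ∧
      (IsUnit w ∨ Odd (vv Q (Ideal.span {sO cL.toRingEquiv w}))) ∧ ξ * (w * τ (cL w)) = τ w * cL w)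
    (hevK : ∀ b, b ≠ ⊥ → Even (vv Q (jI K L b))) (hevL : ∀ b, b ≠ ⊥ → Even (vv Q (jI Lp L b)))
    {I : Ideal (𝓞 K)} (hI : I ≠ ⊥) (hj : jj K L (cl I) = 1) :
    ∃ (N : ℕ) (J : Ideal (𝓞 K)), Odd N ∧ J ≠ ⊥ ∧ sI cK.toRingEquiv J = J ∧ cl I ^ N = cl J := by
  rw [jj_cl hI, cl_eq_one_iff (jI_ne_bot hI)] at hj
  obtain ⟨α0, hα0, hIα⟩ := hj
  have h1 := sI_jI (L := L) τ I
  rw [hIα, sI_span] at h1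
  obtain ⟨u0, hu0⟩ := eq_unit_of_span_eq h1.symm
  obtain ⟨N0, hN0, hr⟩ := hroot u0
  obtain ⟨k, N, hN, rfl⟩ := Nat.exists_eq_two_pow_mul_odd hN0.ne'
  set α : L := ((α0 ^ N : 𝓞 L) : L) with hα
  set u : L := (((u0 ^ N : (𝓞 L)ˣ) : 𝓞 L) : L) with hu
  have hα1 : α ≠ 0 := by
    rw [hα]; simpa using fun h => absurd h hα0
  have hu1 : u ≠ 0 := by
    rw [hu]; simp
  have hαu : α * u = τ α := by
    have e : α0 ^ N * (u0 : 𝓞 L) ^ N = sO τ.toRingEquiv (α0 ^ N) := by rw [← mul_pow, hu0, map_pow]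
    have e2 := congrArg (algebraMap (𝓞 L) L) e
    rw [map_mul] at e2
    rw [hα, hu, Units.val_pow_eq_pow_val, e2]; rfl
  have huk : u ^ 2 ^ k = cL u ^ 2 ^ k := by
    have hun : u = ((u0 : 𝓞 L) : L) ^ N := by rw [hu]; simp
    rw [hun, map_pow, ← pow_mul, ← pow_mul, mul_comm N]; exact hr
  have hcu : cL u ≠ 0 := by simpa using hu1
  have hcα : cL α ≠ 0 := by simpa using hα1
  have huτ : u * τ u = 1 := by
    have h2 : τ (α * u) = α := by rw [hαu, hτ.sq]
    rw [map_mul, ← hαu] at h2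
    have h3 : α * (u * τ u - 1) = 0 := by linear_combination h2
    rcases mul_eq_zero.1 h3 with h | h
    · exact absurd h hα1
    · linear_combination h
  have hcuτ : cL u * τ (cL u) = 1 := by
    rw [← hcomm, ← map_mul, huτ, map_one]
  obtain ⟨w, hw0, hw, hwξ⟩ := hξ (u / cL u) k (by rw [div_pow, huk, div_self]; exact pow_ne_zero _ hcu)
    (by rw [map_div₀, div_mul_div_comm, huτ, hcuτ, div_one])
  have hw1 : (w : L) ≠ 0 := by simpa using hw0
  have hcw : cL (w : L) ≠ 0 := by simpa using hw0
  have hτw : τ (w : L) ≠ 0 := by simpa using hw0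
  have hτcα : τ (cL α) = cL α * cL u := by rw [← hcomm, ← hαu, map_mul]
  have hγ : τ (α * cL w / (cL α * w)) = α * cL w / (cL α * w) := by
    rw [map_div₀, map_mul, map_mul, hτcα, ← hαu]
    field_simp at hwξ ⊢
    linear_combination hwξ
  obtain ⟨g, hg⟩ := hτ.fixed hγ
  have hgc : g * cK g = 1 := by
    apply (algebraMap K L).injective
    rw [map_mul, ← hc, hg, map_one, map_div₀, map_mul, map_mul, hcL.sq, hcL.sq]
    field_simp
  obtain ⟨δ, hδ0, hδ⟩ := int_hilbert hcK hgc
  set δ' := algebraMap (𝓞 K) (𝓞 L) (sO cK.toRingEquiv δ) with hδ'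
  have hcδ0 : sO cK.toRingEquiv δ ≠ 0 := (sO cK.toRingEquiv).map_ne_zero_iff.2 hδ0
  have hδ'c : (δ' : L) = algebraMap K L (cK δ) := rfl
  have hcδ' : cL (δ' : L) = algebraMap K L δ := by
    rw [hδ'c, hc, hcK.sq]
  set x : 𝓞 L := α0 ^ N * sO cL.toRingEquiv w * δ' with hx
  have hxL : (x : L) = α * cL w * δ' := rfl
  have hxc : sO cL.toRingEquiv x = x := by
    apply RingOfIntegers.ext
    change cL (x : L) = x
    rw [hxL, map_mul, map_mul, hcL.sq, hcδ', hδ'c]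
    have h5 := congrArg (algebraMap K L) hδ
    rw [map_mul, hg] at h5
    rw [← h5]
    field_simp
  obtain ⟨y, hy⟩ := hcL.fixedO hxc
  have hcw0 : sO cL.toRingEquiv w ≠ 0 := (sO cL.toRingEquiv).map_ne_zero_iff.2 hw0
  have hδ'0 : δ' ≠ 0 := by
    rw [hδ']
    intro h
    exact hcδ0 ((FaithfulSMul.algebraMap_injective (𝓞 K) (𝓞 L)) (by rw [h, map_zero]))
  have hx0 : x ≠ 0 := mul_ne_zero (mul_ne_zero (pow_ne_zero _ hα0) hcw0) hδ'0
  have hy0 : y ≠ 0 := by rintro rfl; exact hx0 (by rw [← hy, map_zero])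
  set J := I ^ N * Ideal.span {sO cK.toRingEquiv δ} with hJ
  have hIN : I ^ N ≠ ⊥ := pow_ne_zero _ hI
  have hJ0 : J ≠ ⊥ := mul_ne_zero hIN (span_ne_bot hcδ0)
  have hspan : Ideal.span {x} = jI K L J * Ideal.span {sO cL.toRingEquiv w} := by
    rw [hJ, jI_mul, jI_pow, hIα, jI_span, Ideal.span_singleton_pow, Ideal.span_singleton_mul_span_singleton,
      Ideal.span_singleton_mul_span_singleton, hx]
    congr 2; ring
  rcases hw with hw | hw
  · have hsp : Ideal.span {x} = jI K L J := by
      rw [hspan, Ideal.span_singleton_eq_top.2 (hw.map (sO cL.toRingEquiv)), Ideal.mul_top]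
    refine ⟨N, J, hN, hJ0, ?_, ?_⟩
    · apply jI_inj (L := L)
      rw [jI_sI_compat cK.toRingEquiv cL.toRingEquiv hc, ← hsp, sI_span, hxc]
    · rw [hJ, cl_mul hIN (span_ne_bot hcδ0), cl_pow hI, cl_span hcδ0, mul_one]
  · exfalso
    have e1 := hevL (Ideal.span {y}) (span_ne_bot hy0)
    rw [jI_span, hy, hspan, vv_mul _ (jI_ne_bot hJ0) (span_ne_bot hcw0)] at e1
    have e2 := hevK J hJ0
    rw [Nat.even_add] at e1
    exact (Nat.not_even_iff_odd.2 hw) (e1.1 e2)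

end Capit


open NumberField IntermediateField

set_option linter.unusedSectionVars false

section QDsec

variable {K L : Type*} [Field K] [Field L] [NumberField K] [NumberField L] [Algebra K L]

/-- the two primes above two -/
structure QD (L : Type*) [Field L] [NumberField L] (π ω : 𝓞 L) : Prop where
  mul : Ideal.span {π, ω} * Ideal.span {π, ω - 1} = Ideal.span {π}
  n1 : Ideal.absNorm (Ideal.span {π, ω}) = 2
  n2 : Ideal.absNorm (Ideal.span {π, ω - 1}) = 2
  two : ∀ P : Ideal (𝓞 L), P.IsPrime → 2 ∈ P → π ∈ P

theorem QD_mk {π ω c : 𝓞 L} (h : ω * (ω - 1) = π * c) (hn : Ideal.absNorm (Ideal.span {π}) = 4)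
    (σ : L ≃+* L) (hω : sO σ ω = 1 - ω) (hπ : sO σ π = π)
    (two : ∀ P : Ideal (𝓞 L), P.IsPrime → 2 ∈ P → π ∈ P) : QD L π ω := by
  have hm := pq_mul h
  have hs : sI σ (Ideal.span {π, ω}) = Ideal.span {π, ω - 1} := by
    have : sI σ (Ideal.span {π, ω}) = Ideal.span {π, -(ω - 1)} := by
      change Ideal.map (sO σ) _ = _
      rw [Ideal.map_span, Set.image_pair, hω, hπ, neg_sub]
    rw [this, Ideal.span_pair_neg]
  have he : Ideal.absNorm (Ideal.span {π, ω - 1}) = Ideal.absNorm (Ideal.span {π, ω}) := by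
    rw [← hs, absNorm_sI]
  have h4 := congrArg Ideal.absNorm hm
  rw [map_mul, he, hn] at h4
  have h2 : Ideal.absNorm (Ideal.span {π, ω}) = 2 := by nlinarith
  exact ⟨hm, h2, he.trans h2, two⟩

variable {π ω : 𝓞 L}

theorem QD.pi_mem (_h : QD L π ω) : π ∈ Ideal.span {π, ω} := Ideal.subset_span (by simp)
theorem QD.om_mem (_h : QD L π ω) : ω ∈ Ideal.span {π, ω} := Ideal.subset_span (by simp)
theorem QD.prime (h : QD L π ω) : (Ideal.span {π, ω}).IsPrime := prime_of_two h.n1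
theorem QD.prime' (h : QD L π ω) : (Ideal.span {π, ω - 1}).IsPrime := prime_of_two h.n2
theorem QD.ne_bot (h : QD L π ω) : Ideal.span {π, ω} ≠ ⊥ := ne_bot_of_two two_ne_zero h.n1
theorem QD.ne_bot' (h : QD L π ω) : Ideal.span {π, ω - 1} ≠ ⊥ := ne_bot_of_two two_ne_zero h.n2

theorem QD.pi_ne (h : QD L π ω) : π ≠ 0 := by
  rintro rfl
  have := h.mul
  rw [Ideal.span_singleton_eq_bot.2 rfl] at this
  rcases mul_eq_zero.1 this with h1 | h1
  · exact h.ne_bot h1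
  · exact h.ne_bot' h1

theorem QD.ne (h : QD L π ω) : Ideal.span {π, ω} ≠ Ideal.span {π, ω - 1} := by
  intro he
  apply h.prime.ne_top
  rw [Ideal.eq_top_iff_one]
  have h1 : ω - 1 ∈ Ideal.span {π, ω} := by rw [he]; exact Ideal.subset_span (by simp)
  have := Ideal.sub_mem _ h.om_mem h1
  simpa using this

theorem QD.or (h : QD L π ω) {P : Ideal (𝓞 L)} (hP : P.IsPrime) (hP0 : P ≠ ⊥) (hπ : π ∈ P) :
    P = Ideal.span {π, ω} ∨ P = Ideal.span {π, ω - 1} := by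
  have h1 : Ideal.span {π, ω} * Ideal.span {π, ω - 1} ≤ P := by
    rw [h.mul, Ideal.span_singleton_le_iff_mem]; exact hπ
  rcases hP.mul_le.1 h1 with h2 | h2
  · exact Or.inl (eq_of_dvd_prime hP h.prime hP0 h.ne_bot (Ideal.dvd_iff_le.2 h2))
  · exact Or.inr (eq_of_dvd_prime hP h.prime' hP0 h.ne_bot' (Ideal.dvd_iff_le.2 h2))

theorem QD.vv_pi (h : QD L π ω) : vv (Ideal.span {π, ω}) (Ideal.span {π}) = 1 := by
  rw [← h.mul, vv_mul _ h.ne_bot h.ne_bot', vv_self h.prime h.ne_bot, vv_zero]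
  intro hd
  exact h.ne (eq_of_dvd_prime h.prime h.prime' h.ne_bot h.ne_bot' hd)

theorem QD.stable (h : QD L π ω) {s : L ≃+* L} (hω : sO s ω = ω) (hπ : sO s π ∈ Ideal.span {π, ω}) :
    sI s (Ideal.span {π, ω}) = Ideal.span {π, ω} := by
  apply eq_of_le_norm _ (sI_ne_bot s h.ne_bot) (absNorm_sI s _)
  change Ideal.map (sO s) _ ≤ _
  rw [Ideal.map_span, Set.image_pair, hω, Ideal.span_le]
  intro x hx
  rcases hx with rfl | rfl
  · exact hπ
  · exact h.om_mem

theorem nI_mem_rN {I : Ideal (𝓞 L)} {x : 𝓞 L} (hx : x ∈ I) : nI K L x ∈ rN K L I := by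
  rw [← Ideal.span_singleton_le_iff_mem, ← rN_span, ← Ideal.dvd_iff_le]
  exact map_dvd _ (Ideal.dvd_iff_le.2 ((Ideal.span_singleton_le_iff_mem _).2 hx))

theorem nI_alg (x : 𝓞 K) : nI K L (algebraMap (𝓞 K) (𝓞 L) x) = x ^ Module.finrank K L := by
  apply RingOfIntegers.ext
  rw [nI_coe]
  have : ((algebraMap (𝓞 K) (𝓞 L) x : 𝓞 L) : L) = algebraMap K L x := rfl
  rw [this, Algebra.norm_algebraMap]
  simp

theorem QD.rN_eq {π' ω' : 𝓞 K} (h : QD L π ω) (h' : QD K π' ω') (hω : algebraMap (𝓞 K) (𝓞 L) ω' = ω) :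
    rN K L (Ideal.span {π, ω}) = Ideal.span {π', ω'} := by
  have hn : Ideal.absNorm (rN K L (Ideal.span {π, ω})) = 2 := by rw [absNorm_rN, h.n1]
  have hP := prime_of_two hn
  symm
  apply eq_of_le_norm _ h'.ne_bot (by rw [hn, h'.n1])
  rw [Ideal.span_le]
  intro x hx
  rcases hx with rfl | rfl
  · exact h'.two _ hP (two_mem_of_two hn)
  · have h1 := nI_mem_rN (K := K) h.om_mem
    have e := nI_alg (L := L) x
    rw [hω] at e; rw [e] at h1
    exact hP.mem_of_pow_mem _ h1

end QDsec

section QDcon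

variable {p : ℕ}

/-- the integer omega in a subfield of the complex numbers -/
noncomputable def wO {K : IntermediateField ℚ ℂ} (hp4 : p % 4 = 1) (h : rp p ∈ K) : 𝓞 K :=
  mkO K (om p) (om_mem h) (om_int hp4)

theorem co_wO {K : IntermediateField ℚ ℂ} (hp4 : p % 4 = 1) (h : rp p ∈ K) : co K (wO hp4 h) = om p := co_mk _ _

theorem wO_mul {K : IntermediateField ℚ ℂ} (hp : p % 16 = 9) (h : rp p ∈ K) :
    wO (by lia) h * (wO (by lia) h - 1) = (2 : 𝓞 K) * ((p / 8 : ℕ) : 𝓞 K) := by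
  apply co_inj
  simp only [map_mul, map_sub, map_one, co_wO, map_natCast, map_ofNat]
  have h1 := om_sq (p := p) (by lia)
  have h2 : ((p / 4 : ℕ) : ℂ) = 2 * ((p / 8 : ℕ) : ℂ) := by
    have : p / 4 = 2 * (p / 8) := by lia
    rw [this]; push_cast; ring
  rw [h2] at h1
  linear_combination h1

theorem alg_wO {K L : IntermediateField ℚ ℂ} [NumberField K] [NumberField L] [Fact (K ≤ L)] (hp4 : p % 4 = 1)
    (h : rp p ∈ K) (h' : rp p ∈ L) : algebraMap (𝓞 K) (𝓞 L) (wO hp4 h) = wO hp4 h' := by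
  apply co_inj; rw [co_alg, co_wO, co_wO]

theorem sO_wO_neg {L : IntermediateField ℚ ℂ} [NumberField L] (hp4 : p % 4 = 1)
    (h : rp p ∈ L) (σ : L ≃+* L) (hσ : σ ⟨rp p, h⟩ = -⟨rp p, h⟩) : sO σ (wO hp4 h) = 1 - wO hp4 h := by
  have h2 : (2 : 𝓞 L) * wO hp4 h = 1 + mkO L (rp p) h (rp_int p) := by
    apply co_inj; simp only [map_mul, map_add, map_one, map_ofNat, co_wO, co_mk, two_om]
  have h3 : sO σ (mkO L (rp p) h (rp_int p)) = - mkO L (rp p) h (rp_int p) := by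
    apply RingOfIntegers.ext
    exact hσ
  have h4 := congrArg (sO σ) h2
  rw [map_mul, map_add, map_one, map_ofNat, h3] at h4
  have h5 : (2 : 𝓞 L) * (sO σ (wO hp4 h) - (1 - wO hp4 h)) = 0 := by linear_combination h4 + h2
  rcases mul_eq_zero.1 h5 with h6 | h6
  · exact absurd h6 two_ne_zero
  · exact sub_eq_zero.1 h6

theorem sO_fix {K L : IntermediateField ℚ ℂ} [NumberField K] [NumberField L] [Fact (K ≤ L)]
    (σ : L ≃ₐ[K] L) (x : 𝓞 L) (hx : co L x ∈ K) : sO σ.toRingEquiv x = x := by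
  apply RingOfIntegers.ext
  exact fix_LE σ hx

variable [hpf : Fact p.Prime]

theorem two_pi_zt {K : IntermediateField ℚ ℂ} {n : ℕ} (h : zt n ∈ K) (P : Ideal (𝓞 K)) (hP : P.IsPrime)
    (h2 : 2 ∈ P) : 1 - zO h ∈ P := two_mem_pow hP h2 (n + 2) _ (zO_pow h)

theorem geom_two {R : Type*} [CommRing R] (z : R) {k : ℕ} (h : z ^ 2 ^ k = -1) : ∃ e, (2 : R) = (1 - z) * e := by
  obtain ⟨e, he⟩ := sub_dvd_pow_sub_pow (1 : R) z (2 ^ k)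
  exact ⟨e, by rw [← he, h]; ring⟩

theorem zO_half {L : IntermediateField ℚ ℂ} {n : ℕ} (h : zt n ∈ L) : zO h ^ 2 ^ (n + 1) = -1 := by
  apply co_inj; rw [map_pow, co_zO, map_neg, map_one, zt_pow_half]

/-- prime elements above two -/
noncomputable abbrev piL (p n : ℕ) : 𝓞 (Lf p n) := 1 - zO (zt_mem_Lf p n)

theorem QD_Lf (hp : p % 16 = 9) (n : ℕ) : QD (Lf p n) (piL p n) (wO (by lia) (rp_mem_Lf p n)) := by
  obtain ⟨e, he⟩ := geom_two (zO (zt_mem_Lf p n)) (zO_half _)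
  obtain ⟨σ, hσ, hr⟩ := exists_FL_neg (p := p) (by lia) n
  refine QD_mk (c := e * ((p / 8 : ℕ) : 𝓞 (Lf p n))) (by rw [wO_mul hp]; linear_combination ((p / 8 : ℕ) : 𝓞 (Lf p n)) * he) ?_
    σ.toRingEquiv (sO_wO_neg _ _ _ hr) (sO_fix σ _ ?_) (two_pi_zt _)
  · have h1 : jI (F n) (Lf p n) (Ideal.span {1 - zO (zt_mem_F n)}) = Ideal.span {piL p n} := by
      have e : algebraMap (𝓞 (F n)) (𝓞 (Lf p n)) (1 - zO (zt_mem_F n)) = piL p n := by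
        apply co_inj; rw [co_alg]; simp only [map_sub, map_one, co_zO]
      rw [jI_span, e]
    rw [← h1, ← absNorm_rN (K := F n), rN_jI, map_pow, absNorm_zF, quad_FL (by lia)]; norm_num
  · simp only [map_sub, map_one, co_zO]
    exact sub_mem (one_mem _) (zt_mem_F n)

noncomputable abbrev rmO {L : IntermediateField ℚ ℂ} (h : rm ∈ L) : 𝓞 L := mkO L rm h rm_int

theorem rmO_sq {L : IntermediateField ℚ ℂ} (h : rm ∈ L) : rmO h ^ 2 = -2 := by
  apply co_inj; rw [map_pow, co_mk, rm_sq, map_neg, map_ofNat]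

theorem two_pi_rm {K : IntermediateField ℚ ℂ} (h : rm ∈ K) (P : Ideal (𝓞 K)) (hP : P.IsPrime)
    (h2 : 2 ∈ P) : rmO h ∈ P := by
  apply hP.mem_of_pow_mem 2
  rw [rmO_sq]; exact neg_mem h2

theorem exists_Qm2M_neg (hp2 : p % 2 = 1) : ∃ σ : Mf p ≃ₐ[Qm2] Mf p, Quad Qm2 (Mf p) σ ∧
    σ ⟨rp p, rp_mem_Mf p⟩ = -⟨rp p, rp_mem_Mf p⟩ := by
  obtain ⟨σ, hσ⟩ := exists_quad (quad_Qm2M (p := p) hp2)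
  refine ⟨σ, hσ, neg_of_sq_LE hσ ?_ ?_⟩
  · rw [rp_sq]; exact _root_.natCast_mem _ _
  · intro h
    exact rp_notMem_F hp2 1 (Qm2_le_F1 h)

theorem QD_Mf (hp : p % 16 = 9) : QD (Mf p) (rmO (rm_mem_Mf p)) (wO (by lia) (rp_mem_Mf p)) := by
  obtain ⟨σ, hσ, hr⟩ := exists_Qm2M_neg (p := p) (by lia)
  have h2 := rmO_sq (rm_mem_Mf p)
  refine QD_mk (c := -rmO (rm_mem_Mf p) * ((p / 8 : ℕ) : 𝓞 (Mf p))) (by rw [wO_mul hp]; linear_combination ((((p / 8 : ℕ) : 𝓞 (Mf p)))) * h2) ?_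
    σ.toRingEquiv (sO_wO_neg _ _ _ hr) (sO_fix σ _ (by rw [co_mk]; exact rm_mem_Qm2)) (two_pi_rm _)
  have h4 : Ideal.absNorm (Ideal.span {rmO (rm_mem_Mf p) ^ 2}) = 16 := by
    rw [h2, show (-2 : 𝓞 (Mf p)) = algebraMap ℤ _ (-2) by simp, Ideal.absNorm_span_singleton, Algebra.norm_algebraMap,
      RingOfIntegers.rank, deg_Mf (by lia)]; norm_num
  rw [← Ideal.span_singleton_pow, map_pow] at h4
  nlinarith

end QDcon


open NumberField IntermediateField

set_option linter.unusedSectionVars false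
set_option autoImplicit false

section Autos

variable {p : ℕ} [hpf : Fact p.Prime]

theorem deg_contra {K : IntermediateField ℚ ℂ} [FiniteDimensional ℚ K] (hp2 : p % 2 = 1) {n : ℕ}
    (hd : Module.finrank ℚ K = 2 ^ (n + 1)) (hz : F n ≤ K) (hr : rp p ∈ K) : False := by
  have : F n = K := IntermediateField.eq_of_le_of_finrank_eq hz (by rw [deg_F, hd])
  rw [← this] at hr
  exact rp_notMem_F hp2 n hr

theorem F_le_of_zt {K : IntermediateField ℚ ℂ} {n : ℕ} (h : zt n ∈ K) : F n ≤ K := by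
  unfold F
  rw [adjoin_le_iff]
  intro x hx
  rcases hx with rfl
  exact h

theorem zt_notMem_Lf (hp2 : p % 2 = 1) (n : ℕ) : zt (n + 1) ∉ Lf p n := fun h =>
  deg_contra hp2 (by rw [deg_Lf hp2]) (F_le_of_zt h) (rp_mem_Lf p n)

theorem zt_notMem_Mf (hp2 : p % 2 = 1) : zt 1 ∉ Mf p := fun h =>
  deg_contra hp2 (by rw [deg_Mf hp2]; norm_num) (F_le_of_zt h) (rp_mem_Mf p)

theorem exists_cLf (p : ℕ) [hpf : Fact p.Prime] (n : ℕ) : ∃ c : Lf p n ≃ₐ[Lp p n] Lf p n, Quad (Lp p n) (Lf p n) c ∧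
    ∀ x : Lf p n, ((c x : Lf p n) : ℂ) = (starRingEnd ℂ) (x : ℂ) := by
  obtain ⟨c, hc⟩ := exists_quad (quad_LpL (p := p) n)
  refine ⟨c, hc, conj_LE hc (inf_le_right : Lf p n ⊓ Rl ≤ Rl) (θ := ⟨Complex.I, I_mem_Lf p n⟩) ?_ conj_I ?_⟩
  · intro h
    exact Complex.I_ne_zero (congrArg Subtype.val h)
  · change Complex.I ^ 2 ∈ _
    rw [Complex.I_sq]; exact neg_mem (one_mem _)

theorem exists_cMf (hp2 : p % 2 = 1) : ∃ c : Mf p ≃ₐ[Qp p] Mf p, Quad (Qp p) (Mf p) c ∧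
    ∀ x : Mf p, ((c x : Mf p) : ℂ) = (starRingEnd ℂ) (x : ℂ) := by
  obtain ⟨c, hc⟩ := exists_quad (quad_QpM (p := p) hp2)
  refine ⟨c, hc, conj_LE hc (Qp_le_Rl p) (θ := ⟨rm, rm_mem_Mf p⟩) ?_ rm_conj ?_⟩
  · intro h
    exact rm_ne (congrArg Subtype.val h)
  · change rm ^ 2 ∈ _
    rw [rm_sq]; exact neg_mem (_root_.ofNat_mem _ 2)

theorem exists_tLf (hp2 : p % 2 = 1) (n : ℕ) : ∃ τ : Lf p (n + 1) ≃ₐ[Lf p n] Lf p (n + 1), Quad (Lf p n) (Lf p (n + 1)) τ ∧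
    τ ⟨zt (n + 1), zt_mem_Lf p _⟩ = -⟨zt (n + 1), zt_mem_Lf p _⟩ := by
  obtain ⟨τ, hτ⟩ := exists_quad (quad_LL (p := p) hp2 n)
  refine ⟨τ, hτ, neg_of_sq_LE hτ ?_ (zt_notMem_Lf hp2 n)⟩
  change zt (n + 1) ^ 2 ∈ _
  rw [zt_sq]; exact zt_mem_Lf p n

theorem exists_tMf (hp2 : p % 2 = 1) : ∃ τ : Lf p 1 ≃ₐ[Mf p] Lf p 1, Quad (Mf p) (Lf p 1) τ ∧
    τ ⟨zt 1, zt_mem_Lf p 1⟩ = ⟨zt 1, zt_mem_Lf p 1⟩ ^ 3 := by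
  obtain ⟨τ, hτ⟩ := exists_quad (quad_ML (p := p) hp2)
  refine ⟨τ, hτ, ?_⟩
  set ζ : Lf p 1 := ⟨zt 1, zt_mem_Lf p 1⟩ with hζ
  have h4 : ζ ^ 4 = -1 := by
    apply (algebraMap (Lf p 1) ℂ).injective
    rw [map_pow, map_neg, map_one]
    exact zt_pow_half 1
  have hrm : algebraMap (Lf p 1) ℂ (ζ + ζ ^ 3) = rm := by
    rw [map_add, map_pow]
    change zt 1 + zt 1 ^ 3 = rm
    unfold rm; ring
  have hf : τ (ζ + ζ ^ 3) = ζ + ζ ^ 3 := by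
    apply fix_LE
    change algebraMap (Lf p 1) ℂ (ζ + ζ ^ 3) ∈ _
    rw [hrm]; exact rm_mem_Mf p
  have h4' : τ ζ ^ 4 = -1 := by rw [← map_pow, h4, map_neg, map_one]
  rw [map_add, map_pow] at hf
  have hz0 : ζ ≠ 0 := by intro h; rw [h] at h4; norm_num at h4
  have e : (τ ζ - ζ) * (τ ζ - ζ ^ 3) = 0 := by
    have e1 : ζ ^ 2 = (ζ + ζ ^ 3) * ζ + 1 := by linear_combination -h4
    have e2 : τ ζ ^ 2 = (ζ + ζ ^ 3) * τ ζ + 1 := by rw [← hf]; linear_combination -h4'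
    linear_combination e2 + h4
  rcases mul_eq_zero.1 e with h | h
  · exfalso
    obtain ⟨y, hy⟩ := hτ.fixed (sub_eq_zero.1 h)
    apply zt_notMem_Mf (p := p) hp2
    have := congrArg (algebraMap (Lf p 1) ℂ) hy
    rw [alg_alg] at this
    have h5 : (y : ℂ) = zt 1 := this
    rw [← h5]; exact y.2
  · exact sub_eq_zero.1 h

theorem comm_c {n : ℕ} {c τ : Lf p n ≃+* Lf p n}
    (hc : ∀ x : Lf p n, ((c x : Lf p n) : ℂ) = (starRingEnd ℂ) (x : ℂ)) (x : Lf p n) : c (τ x) = τ (c x) := by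
  apply Subtype.ext
  rw [hc]
  exact (emb_conj p n ((algebraMap (Lf p n) ℂ).comp τ.toRingHom) x (c x) (hc x)).symm

theorem unit_root {n : ℕ} {c : Lf p n ≃+* Lf p n}
    (hc : ∀ x : Lf p n, ((c x : Lf p n) : ℂ) = (starRingEnd ℂ) (x : ℂ)) (u : (𝓞 (Lf p n))ˣ) :
    ∃ N : ℕ, 0 < N ∧ ((u : 𝓞 (Lf p n)) : Lf p n) ^ N = c ((u : 𝓞 (Lf p n)) : Lf p n) ^ N := by
  set v : 𝓞 (Lf p n) := u * sO c ((u⁻¹ : (𝓞 (Lf p n))ˣ) : 𝓞 (Lf p n)) with hv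
  have huu : ((u : 𝓞 (Lf p n)) : Lf p n) * (((u⁻¹ : (𝓞 (Lf p n))ˣ) : 𝓞 (Lf p n)) : Lf p n) = 1 :=
    congrArg (algebraMap (𝓞 (Lf p n)) (Lf p n)) u.mul_inv
  have hvc : (v : Lf p n) = ((u : 𝓞 (Lf p n)) : Lf p n) * c (((u⁻¹ : (𝓞 (Lf p n))ˣ) : 𝓞 (Lf p n)) : Lf p n) := rfl
  have hcu := congrArg c huu
  rw [map_mul, map_one] at hcu
  have hv2 : (v : Lf p n) * c ((u : 𝓞 (Lf p n)) : Lf p n) = ((u : 𝓞 (Lf p n)) : Lf p n) := by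
    rw [hvc]; linear_combination ((u : 𝓞 (Lf p n)) : Lf p n) * hcu
  obtain ⟨N, hN, h1⟩ := NumberField.Embeddings.pow_eq_one_of_norm_eq_one (Lf p n) ℂ (x := (v : Lf p n)) v.2 (by
    intro φ
    have e := congrArg φ hv2
    rw [map_mul, emb_conj p n φ _ _ (hc _)] at e
    have e2 := congrArg norm e
    rw [norm_mul, RCLike.norm_conj] at e2
    have hne : ‖φ ((u : 𝓞 (Lf p n)) : Lf p n)‖ ≠ 0 := by
      rw [norm_ne_zero_iff, map_ne_zero]
      intro h; rw [h, zero_mul] at huu; exact zero_ne_one huu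
    exact mul_right_cancel₀ hne (by rw [e2, one_mul]))
  refine ⟨N, hN, ?_⟩
  have := congrArg (· ^ N) hv2
  simp only [mul_pow, h1, one_mul] at this
  exact this.symm

theorem root_pow (hp2 : p % 2 = 1) {n : ℕ} (ξ : Lf p n) (k : ℕ) (h : ξ ^ 2 ^ k = 1) :
    ∃ j : ℕ, ξ = ⟨zt n, zt_mem_Lf p n⟩ ^ j := by
  set x : ℂ := algebraMap (Lf p n) ℂ ξ with hx
  have hxk : x ^ 2 ^ k = 1 := by rw [hx, ← map_pow, h, map_one]
  obtain ⟨a, _, ha⟩ := (Nat.dvd_prime_pow Nat.prime_two).1 (orderOf_dvd_of_pow_eq_one hxk)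
  have hx2 : x ^ 2 ^ (n + 2) = 1 := by
    rw [← orderOf_dvd_iff_pow_eq_one, ha]
    apply pow_dvd_pow
    by_contra hlt
    apply zt_notMem_Lf (p := p) hp2 n
    have hpr : IsPrimitiveRoot x (2 ^ a) := by rw [← ha]; exact IsPrimitiveRoot.orderOf x
    have hz : zt (n + 1) ^ 2 ^ a = 1 := by
      rw [show a = (n + 1 + 2) + (a - (n + 3)) by lia, pow_add, pow_mul, (zt_prim (n + 1)).pow_eq_one, one_pow]
    have : NeZero (2 ^ a) := ⟨by positivity⟩
    obtain ⟨i, _, hi⟩ := hpr.eq_pow_of_pow_eq_one hz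
    rw [← hi]
    exact pow_mem ξ.2 i
  obtain ⟨j, _, hj⟩ := (zt_prim n).eq_pow_of_pow_eq_one hx2
  refine ⟨j, ?_⟩
  apply (algebraMap (Lf p n) ℂ).injective
  rw [map_pow]; exact hj.symm

end Autos


open NumberField IntermediateField

set_option linter.unusedSectionVars false
set_option autoImplicit false

section CapCon

variable {p : ℕ} [hpf : Fact p.Prime]

/-- the distinguished primes above two -/
noncomputable def QL (hp : p % 16 = 9) (n : ℕ) : Ideal (𝓞 (Lf p n)) :=
  Ideal.span {piL p n, wO (by lia) (rp_mem_Lf p n)}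

noncomputable def QM (hp : p % 16 = 9) : Ideal (𝓞 (Mf p)) :=
  Ideal.span {rmO (rm_mem_Mf p), wO (by lia) (rp_mem_Mf p)}

theorem absNorm_QL (hp : p % 16 = 9) (n : ℕ) : Ideal.absNorm (QL hp n) = 2 := (QD_Lf hp n).n1
theorem absNorm_QM (hp : p % 16 = 9) : Ideal.absNorm (QM hp) = 2 := (QD_Mf hp).n1
theorem QL_ne (hp : p % 16 = 9) (n : ℕ) : QL hp n ≠ ⊥ := (QD_Lf hp n).ne_bot
theorem QM_ne (hp : p % 16 = 9) : QM hp ≠ ⊥ := (QD_Mf hp).ne_bot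

theorem rN_QL (hp : p % 16 = 9) (n : ℕ) : rN (Lf p n) (Lf p (n + 1)) (QL hp (n + 1)) = QL hp n :=
  (QD_Lf hp (n + 1)).rN_eq (QD_Lf hp n) (alg_wO _ _ _)

theorem rN_QM (hp : p % 16 = 9) : rN (Mf p) (Lf p 1) (QL hp 1) = QM hp :=
  (QD_Lf hp 1).rN_eq (QD_Mf hp) (alg_wO _ _ _)

theorem co_c {L : IntermediateField ℚ ℂ} [NumberField L] {c : L ≃+* L}
    (hc : ∀ x : L, ((c x : L) : ℂ) = (starRingEnd ℂ) (x : ℂ)) (x : 𝓞 L) : co L (sO c x) = (starRingEnd ℂ) (co L x) := hc x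

theorem c_pi {n : ℕ} {c : Lf p n ≃+* Lf p n}
    (hc : ∀ x : Lf p n, ((c x : Lf p n) : ℂ) = (starRingEnd ℂ) (x : ℂ)) :
    sO c (zO (zt_mem_Lf p n)) * zO (zt_mem_Lf p n) = 1 := by
  apply co_inj
  rw [map_mul, co_c hc, map_one, co_zO, zt_conj]
  exact inv_mul_cancel₀ (zt_ne n)

theorem om_conj (p : ℕ) : (starRingEnd ℂ) (om p) = om p := by
  have h := congrArg (starRingEnd ℂ) (two_om p)
  rw [map_mul, map_add, map_one, map_ofNat, rp_conj, ← two_om] at h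
  exact mul_left_cancel₀ two_ne_zero h

theorem c_om {L : IntermediateField ℚ ℂ} [NumberField L] {c : L ≃+* L} (hp4 : p % 4 = 1) (hr : rp p ∈ L)
    (hc : ∀ x : L, ((c x : L) : ℂ) = (starRingEnd ℂ) (x : ℂ)) :
    sO c (wO hp4 hr) = wO hp4 hr := by
  apply co_inj
  rw [co_c hc, co_wO, om_conj]

theorem cpi_eq {R : Type*} [CommRing R] {z w : R} (h : w * z = 1) : 1 - w = (1 - z) * -w := by
  linear_combination -h

theorem span_cpi {R : Type*} [CommRing R] {z w : R} (h : w * z = 1) : Ideal.span {1 - w} = Ideal.span {1 - z} := by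
  rw [cpi_eq h]
  exact Ideal.span_singleton_mul_right_unit (IsUnit.neg (IsUnit.of_mul_eq_one z h)) _

theorem c_QL (hp : p % 16 = 9) {n : ℕ} {c : Lf p n ≃+* Lf p n}
    (hc : ∀ x : Lf p n, ((c x : Lf p n) : ℂ) = (starRingEnd ℂ) (x : ℂ)) : sI c (QL hp n) = QL hp n := by
  apply (QD_Lf hp n).stable (c_om _ _ hc)
  rw [map_sub, map_one, cpi_eq (c_pi hc)]
  exact Ideal.mul_mem_right _ _ (QD_Lf hp n).pi_mem

theorem c_rm {c : Mf p ≃+* Mf p}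
    (hc : ∀ x : Mf p, ((c x : Mf p) : ℂ) = (starRingEnd ℂ) (x : ℂ)) :
    sO c (rmO (rm_mem_Mf p)) = - rmO (rm_mem_Mf p) := by
  apply co_inj
  rw [co_c hc, map_neg, co_mk, rm_conj]

theorem c_QM (hp : p % 16 = 9) {c : Mf p ≃+* Mf p}
    (hc : ∀ x : Mf p, ((c x : Mf p) : ℂ) = (starRingEnd ℂ) (x : ℂ)) : sI c (QM hp) = QM hp := by
  apply (QD_Mf hp).stable (c_om _ _ hc)
  rw [c_rm hc]
  exact neg_mem (QD_Mf hp).pi_mem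

theorem om_in {K : IntermediateField ℚ ℂ} {L : IntermediateField ℚ ℂ} (hp4 : p % 4 = 1) (hK : rp p ∈ K) (hL : rp p ∈ L) :
    co L (wO hp4 hL) ∈ K := by rw [co_wO]; exact om_mem hK

theorem t_zO {n : ℕ} {τ : Lf p (n + 1) ≃ₐ[Lf p n] Lf p (n + 1)}
    (h : τ ⟨zt (n + 1), zt_mem_Lf p _⟩ = -⟨zt (n + 1), zt_mem_Lf p _⟩) :
    sO τ.toRingEquiv (zO (zt_mem_Lf p (n + 1))) = - zO (zt_mem_Lf p (n + 1)) := by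
  apply RingOfIntegers.ext
  exact h

theorem t_zO1 {τ : Lf p 1 ≃ₐ[Mf p] Lf p 1}
    (h : τ ⟨zt 1, zt_mem_Lf p 1⟩ = ⟨zt 1, zt_mem_Lf p 1⟩ ^ 3) :
    sO τ.toRingEquiv (zO (zt_mem_Lf p 1)) = zO (zt_mem_Lf p 1) ^ 3 := by
  apply RingOfIntegers.ext
  exact h

theorem t_QL (hp : p % 16 = 9) {n : ℕ} {τ : Lf p (n + 1) ≃ₐ[Lf p n] Lf p (n + 1)}
    (h : τ ⟨zt (n + 1), zt_mem_Lf p _⟩ = -⟨zt (n + 1), zt_mem_Lf p _⟩) :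
    sI τ.toRingEquiv (QL hp (n + 1)) = QL hp (n + 1) := by
  apply (QD_Lf hp (n + 1)).stable (sO_fix τ _ (om_in _ (rp_mem_Lf p n) _))
  rw [map_sub, map_one, t_zO h]
  have h2 : (2 : 𝓞 (Lf p (n + 1))) ∈ QL hp (n + 1) := two_mem_of_two (absNorm_QL hp _)
  have h3 := Ideal.sub_mem _ h2 (QD_Lf hp (n + 1)).pi_mem
  have h4 : (1 : 𝓞 (Lf p (n + 1))) - -zO (zt_mem_Lf p (n + 1)) = 2 - piL p (n + 1) := by ring
  rw [h4]; exact h3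

theorem t_QL1 (hp : p % 16 = 9) {τ : Lf p 1 ≃ₐ[Mf p] Lf p 1}
    (h : τ ⟨zt 1, zt_mem_Lf p 1⟩ = ⟨zt 1, zt_mem_Lf p 1⟩ ^ 3) :
    sI τ.toRingEquiv (QL hp 1) = QL hp 1 := by
  apply (QD_Lf hp 1).stable (sO_fix τ _ (om_in _ (rp_mem_Mf p) _))
  rw [map_sub, map_one, t_zO1 h]
  have h4 : (1 : 𝓞 (Lf p 1)) - zO (zt_mem_Lf p 1) ^ 3 = piL p 1 * (1 + zO (zt_mem_Lf p 1) + zO (zt_mem_Lf p 1) ^ 2) := by ring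
  rw [h4]; exact Ideal.mul_mem_right _ _ (QD_Lf hp 1).pi_mem

theorem sprime_Lf (hp : p % 16 = 9) {n : ℕ} {c : Lf p n ≃ₐ[Lp p n] Lf p n} (hq : Quad (Lp p n) (Lf p n) c)
    (hc : ∀ x : Lf p n, ((c x : Lf p n) : ℂ) = (starRingEnd ℂ) (x : ℂ)) {P : Ideal (𝓞 (Lf p n))}
    (hP : SPrime (Lp p n) c P) : P = QL hp n ∨ P = Ideal.span {piL p n, wO (by lia) (rp_mem_Lf p n) - 1} := by
  apply (QD_Lf hp n).or hP.1 hP.2.1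
  apply (QD_Lf hp n).two _ hP.1
  have hI : zt 0 ∈ Lf p n := by rw [zt_zero]; exact I_mem_Lf p n
  have h1 := hP.diff_mem hq (zO hI)
  have h2 : sO c.toRingEquiv (zO hI) = - zO hI := by
    apply co_inj
    rw [co_c (c := c.toRingEquiv) hc, map_neg, co_zO, zt_zero, conj_I]
  rw [h2] at h1
  have h3 := P.mul_mem_left (-zO hI) h1
  have h4 : zO hI ^ 2 ^ (0 + 1) = -1 := zO_half hI
  norm_num at h4
  have : (-zO hI) * (zO hI - -zO hI) = 2 := by linear_combination (-2) * h4
  rwa [this] at h3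

theorem sprime_Mf (hp : p % 16 = 9) {c : Mf p ≃ₐ[Qp p] Mf p} (hq : Quad (Qp p) (Mf p) c)
    (hc : ∀ x : Mf p, ((c x : Mf p) : ℂ) = (starRingEnd ℂ) (x : ℂ)) {P : Ideal (𝓞 (Mf p))}
    (hP : SPrime (Qp p) c P) : P = QM hp ∨ P = Ideal.span {rmO (rm_mem_Mf p), wO (by lia) (rp_mem_Mf p) - 1} := by
  apply (QD_Mf hp).or hP.1 hP.2.1
  have h1 := hP.diff_mem hq (rmO (rm_mem_Mf p))
  rw [c_rm hc] at h1
  have h2 := rmO_sq (rm_mem_Mf p)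
  have : rmO (rm_mem_Mf p) - -rmO (rm_mem_Mf p) = - rmO (rm_mem_Mf p) ^ 3 := by
    linear_combination rmO (rm_mem_Mf p) * h2
  rw [this] at h1
  exact hP.1.mem_of_pow_mem 3 (by simpa using h1)

end CapCon


open NumberField IntermediateField

set_option linter.unusedSectionVars false
set_option autoImplicit false

section CapCon2

variable {p : ℕ} [hpf : Fact p.Prime]

theorem vv_w (hp : p % 16 = 9) {n : ℕ} {c : Lf p n ≃+* Lf p n}
    (hc : ∀ x : Lf p n, ((c x : Lf p n) : ℂ) = (starRingEnd ℂ) (x : ℂ)) {u : 𝓞 (Lf p n)} (hu : IsUnit u) :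
    vv (QL hp n) (Ideal.span {sO c (u * piL p n)}) = 1 := by
  have h1 : Ideal.span {sO c (u * piL p n)} = Ideal.span {piL p n} := by
    rw [map_mul, mul_comm, Ideal.span_singleton_mul_right_unit (hu.map (sO c)), map_sub, map_one, span_cpi (c_pi hc)]
  rw [h1]; exact (QD_Lf hp n).vv_pi

theorem zL_prim (p n : ℕ) : IsPrimitiveRoot (⟨zt n, zt_mem_Lf p n⟩ : Lf p n) (2 ^ (n + 2)) := by
  apply IsPrimitiveRoot.of_map_of_injective (f := algebraMap (Lf p n) ℂ) _ (algebraMap (Lf p n) ℂ).injective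
  exact zt_prim n

theorem pm_of_sq {L : Type*} [Field L] {x : L} (h : x ^ 2 = 1) : x = 1 ∨ x = -1 := by
  have : (x - 1) * (x + 1) = 0 := by linear_combination h
  rcases mul_eq_zero.mp this with h | h
  · exact Or.inl (by linear_combination h)
  · exact Or.inr (by linear_combination h)

theorem xi_pm {L : Type*} [Field L] {ζ : L} {n j : ℕ} (hp1 : IsPrimitiveRoot ζ (2 ^ (n + 3)))
    (h : ζ ^ j * (-ζ) ^ j = 1) : ζ ^ j = 1 ∨ ζ ^ j = -1 := by
  have h3 : ζ ^ (4 * j) = 1 := by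
    have : ζ ^ (4 * j) = (ζ ^ j * (-ζ) ^ j) ^ 2 := by
      rw [mul_pow, ← pow_mul, ← pow_mul, mul_comm j 2, pow_mul (-ζ), neg_sq, ← pow_mul, ← pow_add]
      congr 1; ring
    rw [this, h, one_pow]
  have h4 := hp1.dvd_of_pow_eq_one _ h3
  have h5 : Even j := by
    rw [show n + 3 = 2 + (n + 1) by lia, pow_add] at h4
    have := Nat.dvd_of_mul_dvd_mul_left (by norm_num) h4
    rw [even_iff_two_dvd]
    exact (dvd_pow_self 2 (by lia)).trans this
  rw [h5.neg_pow, ← sq] at h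
  exact pm_of_sq h

theorem xi_z4 {L : Type*} [Field L] {ζ : L} (hp1 : IsPrimitiveRoot ζ (2 ^ 3)) : ζ ^ 4 = -1 := by
  have h1 : (ζ ^ 4) ^ 2 = 1 := by rw [← pow_mul]; exact hp1.pow_eq_one
  rcases pm_of_sq h1 with h | h
  · exact absurd h (hp1.pow_ne_one_of_pos_of_lt (by norm_num) (by norm_num))
  · exact h

theorem xi_four {L : Type*} [Field L] {ζ : L} {j : ℕ} (hp1 : IsPrimitiveRoot ζ (2 ^ 3))
    (h : ζ ^ j * (ζ ^ 3) ^ j = 1) : ζ ^ j = 1 ∨ ζ ^ j = -1 ∨ ζ ^ j = ζ ^ 2 ∨ ζ ^ j = - ζ ^ 2 := by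
  have h4 := xi_z4 hp1
  have h3 : (ζ ^ j) ^ 4 = 1 := by rw [← h]; ring
  have h5 : ((ζ ^ j) ^ 2 - 1) * ((ζ ^ j) ^ 2 + 1) = 0 := by linear_combination h3
  rcases mul_eq_zero.mp h5 with h | h
  · have : (ζ ^ j - 1) * (ζ ^ j + 1) = 0 := by linear_combination h
    rcases mul_eq_zero.mp this with h | h
    · exact Or.inl (by linear_combination h)
    · exact Or.inr (Or.inl (by linear_combination h))
  · have : (ζ ^ j - ζ ^ 2) * (ζ ^ j + ζ ^ 2) = 0 := by linear_combination h - h4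
    rcases mul_eq_zero.mp this with h | h
    · exact Or.inr (Or.inr (Or.inl (by linear_combination h)))
    · exact Or.inr (Or.inr (Or.inr (by linear_combination h)))

theorem xi_w1 {L : Type*} [Field L] (c t : L →+* L) {ζ : L} (hc : c ζ * ζ = 1) (ht : t ζ = -ζ)
    (hct : t (c ζ) = - c ζ) : (-1 : L) * ((1 - ζ) * t (c (1 - ζ))) = t (1 - ζ) * c (1 - ζ) := by
  simp only [map_sub, map_one, ht, hct]
  linear_combination 2 * hc

theorem xi_w2 {L : Type*} [Field L] (t : L →+* L) {ζ d : L} (hc : d * ζ = 1) (ht : t ζ = ζ ^ 3) :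
    t (d) = d ^ 3 := by
  have h1 : t d * t ζ = 1 := by rw [← map_mul, hc, map_one]
  rw [ht] at h1
  have h2 : d ^ 3 * ζ ^ 3 = 1 := by rw [← mul_pow, hc, one_pow]
  have : ζ ^ 3 ≠ 0 := fun h => by rw [h, mul_zero] at h2; exact zero_ne_one h2
  exact mul_right_cancel₀ this (h1.trans h2.symm)

theorem cap_Lf' (hp : p % 16 = 9) {n : ℕ} (hodd : Odd (Nat.card (ClassGroup (𝓞 (Lp p n)))))
    (x : ClassGroup (𝓞 (Lf p n))) (hx : jj (Lf p n) (Lf p (n + 1)) x = 1) :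
    ∃ N : ℕ, Odd N ∧ x ^ N ∈ Subgroup.zpowers (cl (QL hp n)) := by
  obtain ⟨cK, hqK, hcK⟩ := exists_cLf p n
  obtain ⟨cL, hqL, hcL⟩ := exists_cLf p (n + 1)
  obtain ⟨τ, hqτ, hτ⟩ := exists_tLf (p := p) (by lia) n
  obtain ⟨I, hI, rfl⟩ := cl_surj x
  have hcomm : ∀ x, cL (τ x) = τ (cL x) := fun x => comm_c (c := cL.toRingEquiv) (τ := τ.toRingEquiv) hcL x
  have key := capit hqK hqL hqτ (by
      intro y
      apply Subtype.ext
      rw [hcL, algLE_coe, algLE_coe, hcK]) hcomm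
    (unit_root (c := cL.toRingEquiv) hcL) (QL hp (n + 1)) (by
      intro ξ k h1 h2
      obtain ⟨j, rfl⟩ := root_pow (p := p) (by lia) ξ k h1
      have hp1 := zL_prim p (n + 1)
      have hcz : sO cL.toRingEquiv (zO (zt_mem_Lf p (n + 1))) * zO (zt_mem_Lf p (n + 1)) = 1 :=
        c_pi (c := cL.toRingEquiv) hcL
      have hcz' := congrArg (algebraMap (𝓞 (Lf p (n + 1))) (Lf p (n + 1))) hcz
      rw [map_mul, map_one] at hcz'
      have hcz2 : cL ⟨zt (n + 1), zt_mem_Lf p _⟩ * ⟨zt (n + 1), zt_mem_Lf p _⟩ = 1 := hcz'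
      rw [map_pow, hτ] at h2
      rcases xi_pm hp1 h2 with h3 | h3
      · rw [h3]
        exact ⟨1, one_ne_zero, Or.inl isUnit_one, by simp⟩
      · rw [h3]
        have hw : ((1 * piL p (n + 1) : 𝓞 (Lf p (n + 1))) : Lf p (n + 1)) = 1 - ⟨zt (n + 1), zt_mem_Lf p _⟩ := by
          rw [one_mul]; rfl
        refine ⟨1 * piL p (n + 1), ?_, Or.inr ?_, ?_⟩
        · rw [one_mul]; exact (QD_Lf hp (n + 1)).pi_ne
        · rw [vv_w hp (c := cL.toRingEquiv) hcL isUnit_one]; exact odd_one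
        · rw [hw]
          exact xi_w1 (cL : Lf p (n + 1) →+* Lf p (n + 1)) (τ : Lf p (n + 1) →+* Lf p (n + 1)) hcz2 hτ
            (by change τ (cL _) = - cL _; rw [← hcomm, hτ, map_neg]))
    (fun b hb => vv_even hqτ (QD_Lf hp (n + 1)).prime (QL_ne hp _) (t_QL hp hτ)
      (prime_of_two (by rw [absNorm_rN]; exact absNorm_QL hp _)) b hb)
    (fun b hb => vv_even hqL (QD_Lf hp (n + 1)).prime (QL_ne hp _) (c_QL hp (c := cL.toRingEquiv) hcL)
      (prime_of_two (by rw [absNorm_rN]; exact absNorm_QL hp _)) b hb) hI hx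
  obtain ⟨N, J, hN, hJ0, hJ, hIJ⟩ := key
  refine ⟨N * Nat.card (ClassGroup (𝓞 (Lp p n))), hN.mul hodd, ?_⟩
  rw [pow_mul, hIJ]
  exact conj_inv_ideal hqK (QD_Lf hp n).pi_ne (QD_Lf hp n).mul (fun P hP => sprime_Lf hp hqK hcK hP) hJ0 hJ

theorem cap_Mf (hp : p % 16 = 9) (hodd : Odd (Nat.card (ClassGroup (𝓞 (Qp p)))))
    (x : ClassGroup (𝓞 (Mf p))) (hx : jj (Mf p) (Lf p 1) x = 1) :
    ∃ N : ℕ, Odd N ∧ x ^ N ∈ Subgroup.zpowers (cl (QM hp)) := by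
  obtain ⟨cK, hqK, hcK⟩ := exists_cMf (p := p) (by lia)
  obtain ⟨cL, hqL, hcL⟩ := exists_cLf p 1
  obtain ⟨τ, hqτ, hτ⟩ := exists_tMf (p := p) (by lia)
  obtain ⟨I, hI, rfl⟩ := cl_surj x
  have hcomm : ∀ x, cL (τ x) = τ (cL x) := fun x => comm_c (c := cL.toRingEquiv) (τ := τ.toRingEquiv) hcL x
  have key := capit hqK hqL hqτ (by
      intro y
      apply Subtype.ext
      rw [hcL, algLE_coe, algLE_coe, hcK]) hcomm
    (unit_root (c := cL.toRingEquiv) hcL) (QL hp 1) (by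
      intro ξ k h1 h2
      obtain ⟨j, rfl⟩ := root_pow (p := p) (by lia) ξ k h1
      have hp1 := zL_prim p 1
      have hcz : sO cL.toRingEquiv (zO (zt_mem_Lf p 1)) * zO (zt_mem_Lf p 1) = 1 :=
        c_pi (c := cL.toRingEquiv) hcL
      have hu : IsUnit (zO (zt_mem_Lf p 1)) := IsUnit.of_mul_eq_one _ (by rw [mul_comm]; exact hcz)
      have hcz' := congrArg (algebraMap (𝓞 (Lf p 1)) (Lf p 1)) hcz
      rw [map_mul, map_one] at hcz'
      have hcz2 : cL ⟨zt 1, zt_mem_Lf p _⟩ * ⟨zt 1, zt_mem_Lf p _⟩ = 1 := hcz'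
      have hz : ((zO (zt_mem_Lf p 1) : 𝓞 (Lf p 1)) : Lf p 1) = ⟨zt 1, zt_mem_Lf p _⟩ := rfl
      have hpi : ((piL p 1 : 𝓞 (Lf p 1)) : Lf p 1) = 1 - ⟨zt 1, zt_mem_Lf p _⟩ := rfl
      rw [map_pow, hτ] at h2
      have hx4 := xi_four hp1 h2
      have hz4 := xi_z4 hp1
      generalize hζ : (⟨zt 1, zt_mem_Lf p _⟩ : Lf p 1) = ζ at *
      have htc := xi_w2 (τ : Lf p 1 →+* Lf p 1) hcz2 hτ
      have htc' : τ (cL ζ) = (cL ζ) ^ 3 := htc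
      generalize hd : cL ζ = d at *
      have hd1 : d = -ζ ^ 3 := by linear_combination d * hz4 - ζ ^ 3 * hcz2
      have hd3 : d ^ 3 = -ζ := by
        rw [hd1]; linear_combination (-ζ ^ 5 + ζ) * hz4
      rw [hd3] at htc'
      rcases hx4 with h3 | h3 | h3 | h3
      · rw [h3]
        exact ⟨1, one_ne_zero, Or.inl isUnit_one, by simp⟩
      · rw [h3]
        refine ⟨_, hu.ne_zero, Or.inl hu, ?_⟩
        rw [hz, hd, htc', hτ, hd1]
        linear_combination ζ ^ 2 * hz4
      · rw [h3]
        refine ⟨1 * piL p 1, ?_, Or.inr ?_, ?_⟩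
        · rw [one_mul]; exact (QD_Lf hp 1).pi_ne
        · rw [vv_w hp (c := cL.toRingEquiv) hcL isUnit_one]; exact odd_one
        · rw [one_mul, hpi]
          simp only [map_sub, map_one, hd, htc', hτ]
          rw [hd1]
          linear_combination (ζ ^ 2 - 1) * hz4
      · rw [h3]
        refine ⟨zO (zt_mem_Lf p 1) * piL p 1, ?_, Or.inr ?_, ?_⟩
        · exact mul_ne_zero hu.ne_zero (QD_Lf hp 1).pi_ne
        · rw [vv_w hp (c := cL.toRingEquiv) hcL hu]; exact odd_one
        · change -ζ ^ 2 * (((zO (zt_mem_Lf p 1) : Lf p 1) * (piL p 1 : Lf p 1)) *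
            τ (cL ((zO (zt_mem_Lf p 1) : Lf p 1) * (piL p 1 : Lf p 1)))) =
            τ ((zO (zt_mem_Lf p 1) : Lf p 1) * (piL p 1 : Lf p 1)) *
            cL ((zO (zt_mem_Lf p 1) : Lf p 1) * (piL p 1 : Lf p 1))
          rw [hpi, hz]
          simp only [map_mul, map_sub, map_one, hd, htc', hτ]
          rw [hd1]
          linear_combination (ζ ^ 4 - ζ ^ 8) * hz4)
    (fun b hb => vv_even hqτ (QD_Lf hp 1).prime (QL_ne hp _) (t_QL1 hp hτ)
      (prime_of_two (by rw [absNorm_rN]; exact absNorm_QL hp _)) b hb)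
    (fun b hb => vv_even hqL (QD_Lf hp 1).prime (QL_ne hp _) (c_QL hp (c := cL.toRingEquiv) hcL)
      (prime_of_two (by rw [absNorm_rN]; exact absNorm_QL hp _)) b hb) hI hx
  obtain ⟨N, J, hN, hJ0, hJ, hIJ⟩ := key
  refine ⟨N * Nat.card (ClassGroup (𝓞 (Qp p))), hN.mul hodd, ?_⟩
  rw [pow_mul, hIJ]
  exact conj_inv_ideal hqK (QD_Mf hp).pi_ne (QD_Mf hp).mul (fun P hP => sprime_Mf hp hqK hcK hP) hJ0 hJ

end CapCon2


open NumberField IntermediateField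

set_option linter.unusedSectionVars false
set_option autoImplicit false

section Frob

theorem frob_card {k : Type*} [Field k] [Finite k] {q : ℕ} (hq : 1 < q) (h : ∀ y : k, y ^ q = y) :
    Nat.card k ≤ q := by
  classical
  have := Fintype.ofFinite k
  rw [Nat.card_eq_fintype_card, ← FiniteField.X_pow_card_sub_X_natDegree_eq k hq]
  have hne := FiniteField.X_pow_card_sub_X_ne_zero k hq
  refine le_trans ?_ (Polynomial.card_roots' (Polynomial.X ^ q - Polynomial.X : Polynomial k))
  have hsub : (Finset.univ : Finset k) ⊆ (Polynomial.X ^ q - Polynomial.X : Polynomial k).roots.toFinset := by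
    intro y _
    rw [Multiset.mem_toFinset, Polynomial.mem_roots hne]
    simp [h y]
  calc Fintype.card k = (Finset.univ : Finset k).card := rfl
    _ ≤ _ := Finset.card_le_card hsub
    _ ≤ _ := Multiset.toFinset_card_le _

variable {p : ℕ} [hpf : Fact p.Prime]

theorem exists_ell (hp : p % 16 = 9) (N : ℕ) : ∃ l : ℕ, l.Prime ∧ p < l ∧ l % 2 ^ (N + 3) = 2 ^ (N + 3) - 1 ∧
    ¬ IsSquare ((l : ℕ) : ZMod p) := by
  have hF : ringChar (ZMod p) ≠ 2 := by
    rw [ZMod.ringChar_zmod_n]; rintro rfl; norm_num at hp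
  obtain ⟨a, ha⟩ := FiniteField.exists_nonsquare hF
  have hco : (2 ^ (N + 3)).Coprime p := by
    apply Nat.Coprime.pow_left
    rw [Nat.coprime_two_left, Nat.odd_iff]; lia
  obtain ⟨c, hc1, hc2⟩ := Nat.chineseRemainder hco (2 ^ (N + 3) - 1) a.val
  have hpos : 0 < 2 ^ (N + 3) := by positivity
  have hcop : c.Coprime (2 ^ (N + 3) * p) := by
    apply Nat.Coprime.mul_right
    · have h1 : (2 ^ (N + 3) - 1).Coprime (2 ^ (N + 3)) := by
        rw [Nat.coprime_self_sub_left hpos]; exact Nat.coprime_one_left _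
      rwa [Nat.Coprime, hc1.gcd_eq]
    · rw [Nat.coprime_comm, hpf.out.coprime_iff_not_dvd, ← ZMod.natCast_eq_zero_iff]
      rw [(ZMod.natCast_eq_natCast_iff _ _ _).2 hc2, ZMod.natCast_zmod_val]
      rintro rfl
      exact ha (IsSquare.zero)
  obtain ⟨l, hlp, hl, hm⟩ := Nat.forall_exists_prime_gt_and_modEq p (q := 2 ^ (N + 3) * p) (a := c)
    (mul_ne_zero hpos.ne' hpf.out.ne_zero) hcop
  refine ⟨l, hl, hlp, ?_, ?_⟩
  · have : l ≡ 2 ^ (N + 3) - 1 [MOD 2 ^ (N + 3)] := (hm.of_mul_right p).trans hc1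
    rw [this, Nat.mod_eq_of_lt (by lia)]
  · have : l ≡ a.val [MOD p] := (hm.of_mul_left _).trans hc2
    rw [(ZMod.natCast_eq_natCast_iff _ _ _).2 this, ZMod.natCast_zmod_val]
    exact ha

structure Ell (p n l : ℕ) : Prop where
  prime : l.Prime
  gt : p < l
  md : l % 2 ^ (n + 3) = 2 ^ (n + 3) - 1
  ns : ¬ IsSquare ((l : ℕ) : ZMod p)

theorem Ell.m8 {n l : ℕ} (h : Ell p n l) : l % 8 = 7 := by
  have h1 := h.md
  have h2 : l % 8 = (l % 2 ^ (n + 3)) % 8 := by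
    rw [Nat.mod_mod_of_dvd]
    exact pow_dvd_pow 2 (m := 3) (by lia)
  rw [h2, h1]
  have : 0 < 2 ^ n := by positivity
  rw [show 2 ^ (n + 3) = 2 ^ n * 8 by ring]
  lia

theorem Ell.sq_mod {n l : ℕ} (h : Ell p n l) : ∃ e, l ^ 2 = 2 ^ (n + 3) * e + 1 := by
  have h1 := Nat.div_add_mod l (2 ^ (n + 3))
  rw [h.md] at h1
  have h2 : l + 1 = 2 ^ (n + 3) * (l / 2 ^ (n + 3) + 1) := by
    have : 0 < 2 ^ (n + 3) := by positivity
    rw [mul_add, mul_one]; lia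
  have h3 : 1 < l := h.prime.one_lt
  refine ⟨(l / 2 ^ (n + 3) + 1) * (l - 1), ?_⟩
  rw [← mul_assoc, ← h2]
  obtain ⟨m, rfl⟩ : ∃ m, l = m + 1 := ⟨l - 1, by lia⟩
  simp only [Nat.add_sub_cancel]; ring

theorem charP_of_prime_zero {k : Type*} [Field k] {l : ℕ} (hl : l.Prime) (h : (l : k) = 0) : CharP k l := by
  have h1 := ringChar.dvd h
  rcases (Nat.dvd_prime hl).1 h1 with h2 | h2
  · exact absurd h2 (CharP.ringChar_ne_one)
  · exact h2 ▸ ringChar.charP k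

theorem frob_adjoin {A k : Type*} [CommRing A] [Field k] {l : ℕ} [Fact l.Prime] [CharP k l] (f : A →+* k)
    {ζ : A} (hA : Algebra.adjoin ℤ {ζ} = ⊤) {m : ℕ} (hζ : f ζ ^ l ^ m = f ζ) (a : A) : f a ^ l ^ m = f a := by
  have ha : a ∈ Algebra.adjoin ℤ {ζ} := by rw [hA]; trivial
  induction ha using Algebra.adjoin_induction with
  | mem x hx => rw [Set.mem_singleton_iff] at hx; rw [hx, hζ]
  | algebraMap r =>
    rw [← iterateFrobenius_def, eq_intCast, map_intCast, map_intCast]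
  | add x y _ _ hx hy => rw [map_add, add_pow_char_pow, hx, hy]
  | mul x y _ _ hx hy => rw [map_mul, mul_pow, hx, hy]

theorem frob_root {k : Type*} [Field k] {l : ℕ} [Fact l.Prime] [CharP k l] (hl2 : l ≠ 2) {p : ℕ} {r : k} (hr : r ^ 2 = p)
    (hp0 : (p : k) ≠ 0) : r ^ l ^ 2 = r := by
  have h1 : ((p : ZMod l)) ^ (l - 1) = 1 := by
    apply ZMod.pow_card_sub_one_eq_one
    intro h
    apply hp0
    have := congrArg (ZMod.castHom (dvd_refl l) k) h
    simpa using this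
  have h2 : (p : k) ^ (l - 1) = 1 := by
    have := congrArg (ZMod.castHom (dvd_refl l) k) h1
    simpa using this
  have hodd : Odd l := (Fact.out : l.Prime).odd_of_ne_two hl2
  obtain ⟨m, rfl⟩ := hodd
  rw [show (2 * m + 1) ^ 2 = 2 * ((2 * m) * (m + 1)) + 1 by ring, pow_succ, pow_mul, hr, pow_mul]
  rw [Nat.add_sub_cancel] at h2
  rw [h2, one_pow, one_mul]

theorem frob_half {k : Type*} [Field k] {l : ℕ} [Fact l.Prime] [CharP k l] {m : ℕ} {d z t r u : k} (hd : d ≠ 0)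
    (hd' : d ^ l ^ m = d) (ht : t ^ l ^ m = t) (hr : r ^ l ^ m = r) (hu : u ^ l ^ m = u) (h : d * z = t + r * u) : z ^ l ^ m = z := by
  have : (d * z) ^ l ^ m = d * z := by
    rw [h, add_pow_char_pow, mul_pow, ht, hr, hu]
  rw [mul_pow, hd'] at this
  exact mul_left_cancel₀ hd this

theorem adjoin_zF (n : ℕ) : Algebra.adjoin ℤ {zO (zt_mem_F n)} = ⊤ := by
  have hz : IsPrimitiveRoot (⟨zt n, zt_mem_F n⟩ : F n) (2 ^ (n + 2)) := by
    apply IsPrimitiveRoot.of_map_of_injective (f := algebraMap (F n) ℂ) _ (algebraMap (F n) ℂ).injective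
    exact zt_prim n
  haveI : Fact (Nat.Prime 2) := ⟨Nat.prime_two⟩
  have h := hz.integralPowerBasisOfPrimePow.adjoin_gen_eq_top
  rw [IsPrimitiveRoot.integralPowerBasisOfPrimePow_gen] at h
  exact h

/-- every residue class is fixed by the square of Frobenius -/
theorem Ell.frob {n l : ℕ} (h : Ell p n l) (hp : p % 16 = 9) {I : Ideal (𝓞 (Lf p n))} (hI : I.IsPrime) (h0 : I ≠ ⊥)
    (hl : (l : 𝓞 (Lf p n)) ∈ I) (y : 𝓞 (Lf p n) ⧸ I) : y ^ l ^ 2 = y := by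
  have := hI.isMaximal h0
  let _ := Ideal.Quotient.field I
  have hlp : Fact l.Prime := ⟨h.prime⟩
  have hl8 := h.m8
  have hlgt := h.gt
  have hchar : CharP (𝓞 (Lf p n) ⧸ I) l := by
    apply charP_of_prime_zero h.prime
    rw [← map_natCast (Ideal.Quotient.mk I)]
    exact Ideal.Quotient.eq_zero_iff_mem.2 hl
  obtain ⟨z, rfl⟩ := Ideal.Quotient.mk_surjective y
  obtain ⟨σ, hσ, hσr⟩ := exists_FL_neg (p := p) (by lia) n
  have hF : ∀ a : 𝓞 (F n), (Ideal.Quotient.mk I (algebraMap (𝓞 (F n)) (𝓞 (Lf p n)) a)) ^ l ^ 2 =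
      Ideal.Quotient.mk I (algebraMap (𝓞 (F n)) (𝓞 (Lf p n)) a) := by
    apply frob_adjoin ((Ideal.Quotient.mk I).comp (algebraMap (𝓞 (F n)) (𝓞 (Lf p n)))) (adjoin_zF n)
    rw [← map_pow]
    congr 1
    obtain ⟨e, he⟩ := h.sq_mod
    rw [he, pow_succ, show 2 ^ (n + 3) * e = 2 ^ (n + 2) * (2 * e) by ring, pow_mul, zO_pow, one_pow, one_mul]
  set r : 𝓞 (Lf p n) := mkO _ (rp p) (rp_mem_Lf p n) (rp_int p) with hr
  have hr2 : r ^ 2 = (p : 𝓞 (Lf p n)) := by rw [hr, rpO_sq]; push_cast; rfl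
  have hsr : sO σ.toRingEquiv r = - r := by
    apply co_inj
    rw [co_sO, map_neg, hr, co_mk]
    have := congrArg (algebraMap (Lf p n) ℂ) hσr
    rw [map_neg] at this
    exact this
  have hp0 : ((p : ℕ) : 𝓞 (Lf p n) ⧸ I) ≠ 0 := by
    rw [Ne, CharP.cast_eq_zero_iff _ l]
    intro hd
    exact absurd (Nat.le_of_dvd hpf.out.pos hd) (by lia)
  have h20 : ((2 : ℕ) : 𝓞 (Lf p n) ⧸ I) ≠ 0 := by
    rw [Ne, CharP.cast_eq_zero_iff _ l]
    intro hd
    have := (Nat.le_of_dvd (by norm_num) hd); lia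
  have hfr : (Ideal.Quotient.mk I r) ^ l ^ 2 = Ideal.Quotient.mk I r := by
    apply frob_root (by rintro rfl; lia) (p := p) _ hp0
    rw [← map_pow, hr2, map_natCast]
  obtain ⟨t, ht⟩ := hσ.fixedO (x := z + sO σ.toRingEquiv z) (by
    rw [map_add]
    have : sO σ.toRingEquiv (sO σ.toRingEquiv z) = z := by
      apply RingOfIntegers.ext; exact hσ.sq z
    rw [this, add_comm])
  obtain ⟨u, hu⟩ := hσ.fixedO (x := r * (z - sO σ.toRingEquiv z)) (by
    have : sO σ.toRingEquiv (sO σ.toRingEquiv z) = z := by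
      apply RingOfIntegers.ext; exact hσ.sq z
    rw [map_mul, map_sub, hsr, this]; ring)
  refine frob_half (d := ((2 * p : ℕ) : 𝓞 (Lf p n) ⧸ I))
    (t := (p : ℕ) * Ideal.Quotient.mk I (algebraMap (𝓞 (F n)) (𝓞 (Lf p n)) t)) (r := Ideal.Quotient.mk I r)
    (u := Ideal.Quotient.mk I (algebraMap (𝓞 (F n)) (𝓞 (Lf p n)) u)) ?_ ?_ ?_ hfr (hF u) ?_
  · push_cast; exact mul_ne_zero (by exact_mod_cast h20) hp0
  · rw [← iterateFrobenius_def, map_natCast]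
  · rw [mul_pow, hF, ← iterateFrobenius_def, map_natCast]
  · rw [ht, hu, ← map_natCast (Ideal.Quotient.mk I), ← map_natCast (Ideal.Quotient.mk I), ← map_mul, ← map_mul, ← map_mul, ← map_add]
    congr 1
    push_cast
    linear_combination (-(z - sO σ.toRingEquiv z)) * hr2

theorem Ell.norm_le {n l : ℕ} (h : Ell p n l) (hp : p % 16 = 9) {I : Ideal (𝓞 (Lf p n))} (hI : I.IsPrime) (h0 : I ≠ ⊥)
    (hl : (l : 𝓞 (Lf p n)) ∈ I) : Ideal.absNorm I ≤ l ^ 2 := by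
  have := hI.isMaximal h0
  let _ := Ideal.Quotient.field I
  have : Finite (𝓞 (Lf p n) ⧸ I) := Ideal.finiteQuotientOfFreeOfNeBot I h0
  rw [absNorm_card]
  exact frob_card (Nat.one_lt_pow (by norm_num) h.prime.one_lt) (h.frob hp hI h0 hl)

end Frob


open NumberField IntermediateField
set_option linter.unusedSectionVars false
set_option autoImplicit false

/-! ### Inert primes -/

section Inert

variable {L D : Type*} [Field L] [NumberField L] [Field D] [NumberField D]

theorem norm_ne_of_nonsq {θ : 𝓞 L} {m : ℤ} (hθ : θ ^ 2 = m) {l : ℕ} (hl : l.Prime)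
    (hns : ¬ IsSquare (m : ZMod l)) (I : Ideal (𝓞 L)) : Ideal.absNorm I ≠ l := by
  intro h
  rw [absNorm_card] at h
  have : Finite (𝓞 L ⧸ I) := Nat.finite_of_card_ne_zero (by rw [h]; exact hl.ne_zero)
  have := Fintype.ofFinite (𝓞 L ⧸ I)
  let e := ZMod.ringEquivOfPrime (𝓞 L ⧸ I) hl (by rw [← Nat.card_eq_fintype_card, h])
  apply hns
  refine ⟨e.symm (Ideal.Quotient.mk I θ), ?_⟩
  rw [← map_mul, ← map_mul, ← pow_two, hθ]
  simp

theorem norm_prime_pow {l : ℕ} (hl : l.Prime) {I : Ideal (𝓞 L)} (hlI : (l : 𝓞 L) ∈ I) :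
    ∃ k, k ≤ Module.finrank ℚ L ∧ Ideal.absNorm I = l ^ k := by
  have h1 : Ideal.absNorm I ∣ l ^ Module.finrank ℚ L := by
    have := Ideal.absNorm_dvd_absNorm_of_le ((Ideal.span_singleton_le_iff_mem I).2 hlI)
    rw [Ideal.absNorm_span_natCast] at this
    rwa [RingOfIntegers.rank] at this
  exact (Nat.dvd_prime_pow hl).1 h1

theorem inert_prime (hd : Module.finrank ℚ D = 2) {θ : 𝓞 D} {m : ℤ} (hθ : θ ^ 2 = m) {l : ℕ}
    (hl : l.Prime) (hns : ¬ IsSquare (m : ZMod l)) {P : Ideal (𝓞 D)} (hP : P ≠ ⊤)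
    (hlP : (l : 𝓞 D) ∈ P) : P = Ideal.span {(l : 𝓞 D)} ∧ Ideal.absNorm P = l ^ 2 := by
  obtain ⟨k, hk, h⟩ := norm_prime_pow hl hlP
  rw [hd] at hk
  have h2 : k = 2 := by
    interval_cases k
    · exact absurd (Ideal.absNorm_eq_one_iff.1 (by simpa using h)) hP
    · exact absurd (by simpa using h) (norm_ne_of_nonsq hθ hl hns P)
    · rfl
  subst h2
  refine ⟨(eq_of_le_norm ((Ideal.span_singleton_le_iff_mem P).2 hlP) ?_ ?_).symm, h⟩
  · rw [Ne, Ideal.span_singleton_eq_bot]; exact_mod_cast hl.ne_zero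
  · rw [Ideal.absNorm_span_natCast, RingOfIntegers.rank, hd, h]

theorem rN_inert [Algebra D L] (hd : Module.finrank ℚ D = 2) {θ : 𝓞 D} {m : ℤ} (hθ : θ ^ 2 = m)
    {l : ℕ} (hl : l.Prime) (hns : ¬ IsSquare (m : ZMod l)) {I : Ideal (𝓞 L)}
    (hI : Ideal.absNorm I = l ^ 2) : rN D L I = Ideal.span {(l : 𝓞 D)} := by
  have h1 : Ideal.absNorm (rN D L I) = l ^ 2 := by rw [absNorm_rN, hI]
  have hne : rN D L I ≠ ⊤ := by
    intro h; rw [h, Ideal.absNorm_top] at h1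
    have := hl.one_lt; nlinarith
  obtain ⟨P, hP, hle⟩ := Ideal.exists_le_maximal _ hne
  have hlP : (l : 𝓞 D) ∈ P := by
    have := hle (Ideal.absNorm_mem (rN D L I))
    rw [h1] at this
    push_cast at this
    exact hP.isPrime.mem_of_pow_mem _ this
  obtain ⟨h2, h3⟩ := inert_prime hd hθ hl hns hP.ne_top hlP
  rw [← h2]
  apply eq_of_le_norm hle _ (h1.trans h3.symm)
  rintro h; rw [h, Ideal.absNorm_bot] at h1
  exact absurd h1.symm (pow_ne_zero 2 hl.ne_zero)

end Inert

section InertCon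
variable {p : ℕ} [hpf : Fact p.Prime]

theorem Ell.neg_two {n l : ℕ} (h : Ell p n l) : ¬ IsSquare (((-2 : ℤ)) : ZMod l) := by
  have : Fact l.Prime := ⟨h.prime⟩
  have h8 := h.m8
  have := ZMod.exists_sq_eq_neg_two_iff (p := l) (by rintro rfl; simp at h8)
  push_cast
  rw [this]; lia

theorem Ell.neg_one {n l : ℕ} (h : Ell p n l) : ¬ IsSquare (((-1 : ℤ)) : ZMod l) := by
  have : Fact l.Prime := ⟨h.prime⟩
  have h8 := h.m8
  have := ZMod.exists_sq_eq_neg_one_iff (p := l)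
  push_cast
  rw [this]; lia

theorem rm_mem_Lf (p n : ℕ) : rm ∈ Lf p (n + 1) := Mf_le_Lf p n (rm_mem_Mf p)

theorem Ell.norm_eq {n l : ℕ} (h : Ell p (n + 1) l) (hp : p % 16 = 9)
    {I : Ideal (𝓞 (Lf p (n + 1)))} (hI : I.IsPrime) (h0 : I ≠ ⊥)
    (hl : (l : 𝓞 (Lf p (n + 1))) ∈ I) : Ideal.absNorm I = l ^ 2 := by
  have h1 := h.norm_le hp hI h0 hl
  obtain ⟨k, -, hk⟩ := norm_prime_pow h.prime hl
  rw [hk] at h1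
  have h2 : k ≤ 2 := (Nat.pow_le_pow_iff_right h.prime.one_lt).1 h1
  have : k = 2 := by
    interval_cases k
    · exact absurd (Ideal.absNorm_eq_one_iff.1 (by simpa using hk)) hI.ne_top
    · have h3 : rmO (rm_mem_Lf p n) ^ 2 = ((-2 : ℤ) : 𝓞 (Lf p (n + 1))) := by
        rw [rmO_sq]; push_cast; rfl
      exact absurd (by simpa using hk) (norm_ne_of_nonsq h3 h.prime h.neg_two I)
    · rfl
  rw [hk, this]

theorem Ell.exists_prime {n l : ℕ} (h : Ell p n l) :
    ∃ I : Ideal (𝓞 (Lf p n)), I.IsPrime ∧ I ≠ ⊥ ∧ (l : 𝓞 (Lf p n)) ∈ I := by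
  have hne : Ideal.span {(l : 𝓞 (Lf p n))} ≠ ⊤ := by
    intro h1
    have h2 := Ideal.absNorm_span_natCast (S := 𝓞 (Lf p n)) l
    rw [h1, Ideal.absNorm_top] at h2
    have h3 : Module.finrank ℤ (𝓞 (Lf p n)) ≠ 0 := by
      rw [RingOfIntegers.rank]; exact Module.finrank_pos.ne'
    have := Nat.one_lt_pow h3 h.prime.one_lt
    lia
  obtain ⟨P, hP, hle⟩ := Ideal.exists_le_maximal _ hne
  have hm : (l : 𝓞 (Lf p n)) ∈ P := hle (Ideal.mem_span_singleton_self _)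
  refine ⟨P, hP.isPrime, ?_, hm⟩
  rintro rfl
  have : (l : 𝓞 (Lf p n)) = 0 := by simpa using hm
  exact h.prime.ne_zero (by exact_mod_cast this)

theorem exists_Ell (hp : p % 16 = 9) (n : ℕ) : ∃ l, Ell p n l := by
  obtain ⟨l, h1, h2, h3, h4⟩ := exists_ell hp n
  exact ⟨l, h1, h2, h3, h4⟩

end InertCon


open NumberField IntermediateField
set_option linter.unusedSectionVars false
set_option autoImplicit false

/-! ### The genus characters on the tower -/

section CharCon
variable {p : ℕ} [hpf : Fact p.Prime]

theorem Ell.sZ_l {n l : ℕ} (h : Ell p n l) : sZ ((l : ℚ_[p])) = -1 := by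
  have h0 : ((l : ℤ) : ZMod p) ≠ 0 := by
    intro h1
    apply h.ns
    push_cast at h1
    rw [h1]; exact ⟨0, by simp⟩
  have hl0 : (l : ℚ_[p]) ≠ 0 := by exact_mod_cast h.prime.ne_zero
  have h1 := sQ_int (p := p) h0
  rw [quadraticChar_neg_one_iff_not_isSquare.2 (by simpa using h.ns)] at h1
  push_cast at h1
  rw [← sZ_coe hl0] at h1
  exact Units.ext (by simpa using h1)

theorem sZ_neg {x : ℚ_[p]} (h : sQ x = -1) (hx : x ≠ 0) : sZ x = -1 := by
  rw [← sZ_coe hx] at h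
  exact Units.ext (by simpa using h)

/-- the prime above 2 in a quadratic field where it is generated by `π` -/
theorem rN_two {D L : Type*} [Field D] [NumberField D] [Field L] [NumberField L] [Algebra D L]
    {π : 𝓞 D} (hn : Ideal.absNorm (Ideal.span {π}) = 2)
    (hm : ∀ P : Ideal (𝓞 D), P.IsPrime → (2 : 𝓞 D) ∈ P → π ∈ P) {Q : Ideal (𝓞 L)}
    (hQ : Ideal.absNorm Q = 2) : rN D L Q = Ideal.span {π} := by
  have h1 : Ideal.absNorm (rN D L Q) = 2 := by rw [absNorm_rN, hQ]
  symm
  apply eq_of_le_norm _ (ne_bot_of_two two_ne_zero hn) (hn.trans h1.symm)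
  rw [Ideal.span_singleton_le_iff_mem]
  exact hm _ (prime_of_two h1) (two_mem_of_two h1)

theorem absNorm_rm : Ideal.absNorm (Ideal.span {rmO rm_mem_Qm2}) = 2 := by
  have h : Ideal.absNorm (Ideal.span {rmO rm_mem_Qm2}) ^ 2 = 4 := by
    rw [← map_pow, Ideal.span_singleton_pow, rmO_sq, Ideal.span_singleton_neg]
    have := Ideal.absNorm_span_natCast (S := 𝓞 Qm2) 2
    rw [RingOfIntegers.rank, deg_Qm2] at this
    exact_mod_cast this
  nlinarith [h]

structure Chars (hp : p % 16 = 9) (χ1 χ2 : ∀ n, ClassGroup (𝓞 (Lf p (n + 1))) →* ℤˣ)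
    (χM : ClassGroup (𝓞 (Mf p)) →* ℤˣ) : Prop where
  nm2 : ∀ n c, χ2 n (nm (Lf p (n + 1)) (Lf p (n + 1 + 1)) c) = χ2 (n + 1) c
  nmM : ∀ c, χM (nm (Mf p) (Lf p 1) c) = χ2 0 c
  q1 : ∀ n, χ1 n (cl (QL hp (n + 1))) = -1
  q2 : ∀ n, χ2 n (cl (QL hp (n + 1))) = 1
  l1 : ∀ n l (I : Ideal (𝓞 (Lf p (n + 1)))), Ell p (n + 1) l → Ideal.absNorm I = l ^ 2 →
    χ1 n (cl I) = -1
  l2 : ∀ n l (I : Ideal (𝓞 (Lf p (n + 1)))), Ell p (n + 1) l → Ideal.absNorm I = l ^ 2 →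
    χ2 n (cl I) = -1

theorem exists_Chars (hp : p % 16 = 9) (h24 : ∃ x : ZMod p, x ^ 4 = 2) :
    ∃ χ1 χ2 χM, Chars hp χ1 χ2 χM := by
  obtain ⟨ι, z, hι⟩ := exists_iota (p := p) (by lia)
  have hp8 : p % 8 = 1 := by lia
  have hp4 : p % 4 = 1 := by lia
  let ι1 : F 0 →+* ℚ_[p] := ι.comp (algebraMap (F 0) (F 1))
  let ι2 : Qm2 →+* ℚ_[p] := ι.comp (algebraMap Qm2 (F 1))
  have g1 : GoodEmb ι1 := goodF0 hp8 ι1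
  have g2 : GoodEmb ι2 := goodQm2 hp8 ι2
  have t1 : ∀ n, NormTriv ι1 (Lf p (n + 1)) := fun n => normTriv hp4 ι1 (rp_mem_Lf p _)
  have t2 : ∀ n, NormTriv ι2 (Lf p (n + 1)) := fun n => normTriv hp4 ι2 (rp_mem_Lf p _)
  have tM : NormTriv ι2 (Mf p) := normTriv hp4 ι2 (rp_mem_Mf p)
  have l0 : ∀ {l n}, Ell p n l → ∀ {D : IntermediateField ℚ ℂ}, ((l : 𝓞 D) ≠ 0) := by
    intro l n h D; exact_mod_cast h.prime.ne_zero
  have i2 : zO (zt_mem_F 0) ^ 2 = ((-1 : ℤ) : 𝓞 (F 0)) := by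
    have := zO_half (zt_mem_F 0)
    simpa using this
  have m2 : rmO rm_mem_Qm2 ^ 2 = ((-2 : ℤ) : 𝓞 Qm2) := by
    rw [rmO_sq]; push_cast; rfl
  have Q0 : ∀ n, (QL hp n) ≠ ⊥ := QL_ne hp
  refine ⟨fun n => chi ι1 g1 (t1 n), fun n => chi ι2 g2 (t2 n), chi ι2 g2 tM, ?_, ?_, ?_, ?_, ?_, ?_⟩
  · intro n c; exact chi_nm g2 (t2 n) (t2 (n + 1)) c
  · intro c; exact chi_nm g2 tM (t2 0) c
  · intro n
    have hn0 : Ideal.absNorm (Ideal.span {1 - zO (zt_mem_F 0)}) = 2 := absNorm_zF 0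
    have hne : (1 - zO (zt_mem_F 0)) ≠ 0 := by
      intro h; rw [h] at hn0; simp at hn0
    -- the generator `1 + i = i (1 - i)`
    have hgen : Ideal.span {1 - zO (zt_mem_F 0)} = Ideal.span {1 + zO (zt_mem_F 0)} := by
      rw [Ideal.span_singleton_eq_span_singleton]
      have e : (1 - zO (zt_mem_F 0)) * zO (zt_mem_F 0) = 1 + zO (zt_mem_F 0) := by
        have := i2; push_cast at this; linear_combination -this
      exact ⟨(zO_unit (zt_mem_F 0)).unit, e⟩
    have hne' : (1 + zO (zt_mem_F 0)) ≠ 0 := by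
      intro h; rw [hgen, h] at hn0; simp at hn0
    change chi ι1 g1 (t1 n) _ = _
    rw [chi_of_span g1 (t1 n) (Q0 _) hne'
      ((rN_two hn0 (fun P hP h => two_pi_zt _ P hP h) (absNorm_QL hp _)).trans hgen)]
    refine sZ_neg (hι.s_1i hp h24 _ ?_) (emb_ne_zero ι1 hne')
    rw [algLE_coe, ← co_def, map_add, map_one, co_zO, zt_zero]
  · intro n
    have hne : rmO rm_mem_Qm2 ≠ 0 := by
      intro h; have := absNorm_rm; rw [h] at this; simp at this
    change chi ι2 g2 (t2 n) _ = _
    rw [chi_of_span g2 (t2 n) (Q0 _) hne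
      (rN_two absNorm_rm (fun P hP h => two_pi_rm _ P hP h) (absNorm_QL hp _))]
    refine (sZ_eq_one (emb_ne_zero ι2 hne)).2 (hι.s_rm hp h24 _ ?_)
    rw [algLE_coe, ← co_def, co_mk]
  · intro n l I h hI
    change chi ι1 g1 (t1 n) _ = _
    rw [chi_of_span g1 (t1 n) (ne_bot_of_two (pow_ne_zero 2 h.prime.ne_zero) hI) (l0 h)
      (rN_inert (by rw [deg_F]; norm_num) i2 h.prime h.neg_one hI), ← h.sZ_l]
    congr 1
    push_cast; simp
  · intro n l I h hI
    change chi ι2 g2 (t2 n) _ = _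
    rw [chi_of_span g2 (t2 n) (ne_bot_of_two (pow_ne_zero 2 h.prime.ne_zero) hI) (l0 h)
      (rN_inert deg_Qm2 m2 h.prime h.neg_two hI), ← h.sZ_l]
    congr 1
    push_cast; simp

end CharCon


open NumberField IntermediateField
set_option linter.unusedSectionVars false
set_option autoImplicit false

/-! ### The genus character on `ℚ(√-2p)` -/

section KChar
variable {p : ℕ} [hpf : Fact p.Prime]

theorem exists_prime_over {L : Type*} [Field L] [NumberField L] {l : ℕ} (h : l.Prime) :
    ∃ I : Ideal (𝓞 L), I.IsPrime ∧ I ≠ ⊥ ∧ (l : 𝓞 L) ∈ I := by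
  have hne : Ideal.span {(l : 𝓞 L)} ≠ ⊤ := by
    intro h1
    have h2 := Ideal.absNorm_span_natCast (S := 𝓞 L) l
    rw [h1, Ideal.absNorm_top] at h2
    have h3 : Module.finrank ℤ (𝓞 L) ≠ 0 := by
      rw [RingOfIntegers.rank]; exact Module.finrank_pos.ne'
    have := Nat.one_lt_pow h3 h.one_lt
    lia
  obtain ⟨P, hP, hle⟩ := Ideal.exists_le_maximal _ hne
  have hm : (l : 𝓞 L) ∈ P := hle (Ideal.mem_span_singleton_self _)
  refine ⟨P, hP.isPrime, ?_, hm⟩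
  rintro rfl
  have : (l : 𝓞 L) = 0 := by simpa using hm
  exact h.ne_zero (by exact_mod_cast this)

theorem Ell.sq_2p {n l : ℕ} (h : Ell p n l) (hp : p % 16 = 9) :
    IsSquare (((-2 * p : ℤ)) : ZMod l) := by
  have : Fact l.Prime := ⟨h.prime⟩
  have h2 := h.neg_two
  have h8 := h.m8
  have hlp : ¬ IsSquare ((p : ZMod l)) := by
    have := ZMod.exists_sq_eq_prime_iff_of_mod_four_eq_one (p := p) (q := l) (by lia)
      (by rintro rfl; simp at h8)
    rw [← this]; exact h.ns
  have e1 := quadraticChar_neg_one_iff_not_isSquare.2 h2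
  have e2 := quadraticChar_neg_one_iff_not_isSquare.2 hlp
  have e3 : quadraticChar (ZMod l) (((-2 * p : ℤ)) : ZMod l) = 1 := by
    have : (((-2 * p : ℤ)) : ZMod l) = ((-2 : ℤ) : ZMod l) * (p : ZMod l) := by push_cast; ring
    rw [this, map_mul, e1, e2]; norm_num
  by_contra hns
  rw [quadraticChar_neg_one_iff_not_isSquare.2 hns] at e3
  norm_num at e3

theorem coprime_mem {R : Type*} [CommRing R] {P : Ideal R} {l : ℕ} {m : ℤ} (h : IsCoprime (l : ℤ) m)
    (h1 : (l : R) ∈ P) (h2 : (m : R) ∈ P) : P = ⊤ := by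
  obtain ⟨a, b, e⟩ := h
  rw [Ideal.eq_top_iff_one]
  have e' : (a : R) * (l : R) + b * m = 1 := by exact_mod_cast congrArg (Int.cast : ℤ → R) e
  rw [← e']
  exact P.add_mem (P.mul_mem_left _ h1) (P.mul_mem_left _ h2)

theorem norm_split {D : Type*} [Field D] [NumberField D] (hd : Module.finrank ℚ D = 2)
    {σ : D ≃+* D} {θ : 𝓞 D} {m : ℤ} (hθ : θ ^ 2 = m) (hσ : sO σ θ = -θ) {l : ℕ}
    (hl : l.Prime) (hl2 : l ≠ 2) (hlm : IsCoprime (l : ℤ) m)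
    (hsq : IsSquare (m : ZMod l)) : ∃ P : Ideal (𝓞 D), P ≠ ⊥ ∧ Ideal.absNorm P = l := by
  obtain ⟨P, hP, hP0, hlP⟩ := exists_prime_over (L := D) hl
  refine ⟨P, hP0, ?_⟩
  obtain ⟨k, hk, h⟩ := norm_prime_pow hl hlP
  rw [hd] at hk
  interval_cases k
  · exact absurd (Ideal.absNorm_eq_one_iff.1 (by simpa using h)) hP.ne_top
  · simpa using h
  · exfalso
    have hPl : Ideal.span {(l : 𝓞 D)} = P := by
      refine eq_of_le_norm ((Ideal.span_singleton_le_iff_mem P).2 hlP) ?_ ?_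
      · rw [Ne, Ideal.span_singleton_eq_bot]; exact_mod_cast hl.ne_zero
      · rw [Ideal.absNorm_span_natCast, RingOfIntegers.rank, hd, h]
    have hst : ∀ x ∈ P, sO σ x ∈ P := by
      intro x hx
      rw [← hPl, Ideal.mem_span_singleton] at hx ⊢
      obtain ⟨y, rfl⟩ := hx
      exact ⟨sO σ y, by rw [map_mul, map_natCast]⟩
    obtain ⟨s, hs⟩ := hsq
    obtain ⟨s, rfl⟩ := ZMod.intCast_surjective s
    have hdv : (l : ℤ) ∣ m - s * s := by
      rw [← ZMod.intCast_zmod_eq_zero_iff_dvd]; push_cast; rw [hs, sub_self]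
    obtain ⟨t, ht⟩ := hdv
    have hprod : (θ - s) * (θ + s) ∈ P := by
      have : (θ - (s : 𝓞 D)) * (θ + s) = l * t := by
        have e : (m : 𝓞 D) - s * s = l * t := by exact_mod_cast congrArg (Int.cast : ℤ → 𝓞 D) ht
        linear_combination hθ + e
      rw [this]; exact P.mul_mem_right _ hlP
    have h2θ : 2 * θ ∈ P := by
      rcases hP.mem_or_mem hprod with h1 | h1
      · have h3 := hst _ h1
        rw [map_sub, hσ, map_intCast] at h3
        have := P.sub_mem h1 h3
        convert this using 1; ring
      · have h3 := hst _ h1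
        rw [map_add, hσ, map_intCast] at h3
        have := P.sub_mem h1 h3
        convert this using 1; ring
    rcases hP.mem_or_mem h2θ with h1 | h1
    · apply hP.ne_top
      apply coprime_mem (l := l) (m := 2) _ hlP (by exact_mod_cast h1)
      have := (Nat.coprime_primes hl Nat.prime_two).2 hl2
      exact_mod_cast this.isCoprime
    · apply hP.ne_top
      apply coprime_mem hlm hlP
      rw [← hθ]; exact P.pow_mem_of_mem h1 2 (by norm_num)

theorem goodRat (hp4 : p % 4 = 1) (ι : ℚ →+* ℚ_[p]) : GoodEmb ι := by
  refine ⟨odd_rat, fun u => ?_⟩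
  have h : ((u : 𝓞 ℚ) : ℚ) = 1 ∨ ((u : 𝓞 ℚ) : ℚ) = -1 := by
    have h2 := Rat.ringOfIntegersEquiv.injective
    rcases Int.isUnit_iff.1 (u.isUnit.map Rat.ringOfIntegersEquiv) with h | h
    · left
      have : (u : 𝓞 ℚ) = 1 := h2 (by rw [h, map_one])
      rw [this]; rfl
    · right
      have : (u : 𝓞 ℚ) = -1 := h2 (by rw [h, map_neg, map_one])
      rw [this]; rfl
  rcases h with h | h
  · rw [h, map_one]; exact sQ_one
  · rw [h, map_neg, map_one]; exact sQ_neg_one hp4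

theorem normTrivRat (hp4 : p % 4 = 1) (ι : ℚ →+* ℚ_[p]) {T : IntermediateField ℚ ℂ} [NumberField T]
    {θ : ℂ} (hT : θ ∈ T) {m : ℚ} (hθ : θ ^ 2 = (m : ℂ)) {c : ℚ_[p]} (hc : c ≠ 0)
    (hm : ι m = p * c ^ 2) : NormTriv ι T := by
  intro α hα
  refine sQ_norm hp4 ι (θ := (⟨θ, hT⟩ : T)) (m := m) ?_ hc hm hα
  apply (algebraMap T ℂ).injective
  rw [map_pow, alg_mk θ, hθ]
  simp

theorem exists_chik (hp : p % 16 = 9) : ∃ χ : ClassGroup (𝓞 (kf p)) →* ℤˣ,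
    (∃ c, χ c = -1) ∧ ∀ c, χ (nm (kf p) (Mf p) c) = 1 := by
  obtain ⟨ι1, z, hι⟩ := exists_iota (p := p) (by lia)
  have hp4 : p % 4 = 1 := by lia
  let ι : ℚ →+* ℚ_[p] := algebraMap ℚ ℚ_[p]
  have g : GoodEmb ι := goodRat hp4 ι
  have tQ : NormTriv ι (Qp p) := normTrivRat hp4 ι (rp_mem_Qp p) (m := p)
    (by rw [rp_sq]; simp) one_ne_zero (by simp)
  have tM : NormTriv ι (Mf p) := normTrivRat hp4 ι (rp_mem_Mf p) (m := p)
    (by rw [rp_sq]; simp) one_ne_zero (by simp)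
  have h2 : (rm * rp p) ^ 2 = ((-2 * p : ℤ) : ℂ) := by rw [mul_pow, rm_sq, rp_sq]; push_cast; ring
  have tk : NormTriv ι (kf p) := by
    have hc : ι1 ⟨rm, Qm2_le_F1 rm_mem_Qm2⟩ ^ 2 = -2 := by
      have : (⟨rm, Qm2_le_F1 rm_mem_Qm2⟩ : F 1) ^ 2 = -2 := by
        apply (algebraMap (F 1) ℂ).injective
        rw [map_pow, alg_mk rm, rm_sq, map_neg, map_ofNat]
      rw [← map_pow, this, map_neg, map_ofNat]
    refine normTrivRat hp4 ι (rmrp_mem_kf p) (m := -2 * p) (by rw [h2]; push_cast; ring)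
      (c := ι1 ⟨rm, Qm2_le_F1 rm_mem_Qm2⟩) ?_ ?_
    · intro h; rw [h] at hc; norm_num at hc
    · rw [hc]; simp; ring
  refine ⟨chi ι g tk, ?_, fun c => ?_⟩
  · obtain ⟨l, hl⟩ := exists_Ell hp 0
    obtain ⟨σ, hσ⟩ := exists_quad (K := ℚ) (L := kf p) deg_kf
    have hi : rm * rp p ∉ (⊥ : IntermediateField ℚ ℂ) :=
      notMem_bot_of_conj (mul_ne_zero rm_ne rp_ne) (by rw [map_mul, rm_conj, rp_conj]; ring)
    have hinteg := int_of_sq h2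
    have hneg := neg_of_sq_Q hσ (rmrp_mem_kf p) h2 hi
    have h8 := hl.m8
    have hl2 : l ≠ 2 := by rintro rfl; simp at h8
    have hcop : IsCoprime (l : ℤ) (-2 * p) := by
      rw [neg_mul, IsCoprime.neg_right_iff]
      apply IsCoprime.mul_right
      · have := (Nat.coprime_primes hl.prime Nat.prime_two).2 hl2
        exact_mod_cast this.isCoprime
      · have := (Nat.coprime_primes hl.prime hpf.out).2 hl.gt.ne'
        exact_mod_cast this.isCoprime
    obtain ⟨P, hP0, hP⟩ := norm_split (D := kf p) deg_kf (σ := σ.toRingEquiv)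
      (mkO_sq (rmrp_mem_kf p) hinteg h2) (by
        apply co_inj
        rw [co_sO, map_neg, co_mk, mk_coe]
        have := congrArg (algebraMap (kf p) ℂ) hneg
        rw [map_neg, alg_mk (rm * rp p)] at this
        exact this) hl.prime hl2 hcop (hl.sq_2p hp)
    refine ⟨cl P, ?_⟩
    have hl0 : (l : 𝓞 ℚ) ≠ 0 := by exact_mod_cast hl.prime.ne_zero
    have hr : rN ℚ (kf p) P = Ideal.span {(l : 𝓞 ℚ)} := by
      have h1 : Ideal.absNorm (rN ℚ (kf p) P) = l := by rw [absNorm_rN, hP]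
      symm
      apply eq_of_le_norm
      · rw [Ideal.span_singleton_le_iff_mem]
        have := Ideal.absNorm_mem (rN ℚ (kf p) P)
        rwa [h1] at this
      · exact span_ne_bot hl0
      · rw [h1, Ideal.absNorm_span_natCast, RingOfIntegers.rank, Module.finrank_self, pow_one]
    rw [chi_of_span g tk hP0 hl0 hr, ← hl.sZ_l]
    congr 1
  · rw [chi_nm g tk tM, ← chi_nm g tQ tM, ← units_odd_pow (chi ι g tQ _) (odd_Qp hp4), ← map_pow,
      pow_card_eq_one', map_one]

end KChar


open NumberField IntermediateField
set_option linter.unusedSectionVars false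
set_option autoImplicit false

/-! ### Abstract 2-group lemmas -/

section TwoGroups
variable {G : Type*} [CommGroup G] [Finite G]

abbrev PC (G : Type*) [CommGroup G] : Subgroup G := CommGroup.primaryComponent G 2

theorem mem_PC {x : G} : x ∈ PC G ↔ ∃ k : ℕ, x ^ 2 ^ k = 1 := Iff.rfl

theorem PC_map {G H : Type*} [CommGroup G] [CommGroup H] (f : G →* H) {x : G} (h : x ∈ PC G) :
    f x ∈ PC H := by
  obtain ⟨k, hk⟩ := h
  exact ⟨k, by rw [← map_pow, hk, map_one]⟩

theorem PC_odd {x : G} (h : x ∈ PC G) {N : ℕ} (hN : Odd N) (hx : x ^ N = 1) : x = 1 := by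
  obtain ⟨k, hk⟩ := h
  have h1 := orderOf_dvd_of_pow_eq_one hk
  have h2 := orderOf_dvd_of_pow_eq_one hx
  have h3 : Nat.Coprime (2 ^ k) N := (Nat.coprime_two_left.2 hN).pow_left k
  exact orderOf_eq_one_iff.1 (Nat.eq_one_of_dvd_coprimes h3 h1 h2)

theorem PC_mem_of_odd {x : G} (h : x ∈ PC G) {N : ℕ} (hN : Odd N) {H : Subgroup G}
    (hx : x ^ N ∈ H) : x ∈ H := by
  obtain ⟨k, hk⟩ := h
  have h3 : Nat.Coprime N (2 ^ k) := (Nat.coprime_two_right.2 hN).pow_right k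
  have h4 : (N : ℤ) * N.gcdA (2 ^ k) + (2 ^ k : ℕ) * N.gcdB (2 ^ k) = 1 := by
    rw [← Nat.gcd_eq_gcd_ab, h3]; rfl
  have : x = (x ^ N) ^ (N.gcdA (2 ^ k)) := by
    conv_lhs => rw [← zpow_one x, ← h4, zpow_add, zpow_mul, zpow_mul, zpow_natCast, zpow_natCast, hk,
      one_zpow, mul_one]
  rw [this]; exact H.zpow_mem hx _

theorem exists_odd_PC (G : Type*) [CommGroup G] [Finite G] : ∃ N : ℕ, Odd N ∧ ∀ x : G, x ^ N ∈ PC G := by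
  obtain ⟨k, m, hm, h⟩ := Nat.exists_eq_two_pow_mul_odd (n := Nat.card G) Nat.card_pos.ne'
  refine ⟨m, hm, fun x => ⟨k, ?_⟩⟩
  rw [← pow_mul, mul_comm, ← h, pow_card_eq_one']

theorem PC_order {x : G} (h : x ∈ PC G) : ∃ k, orderOf x = 2 ^ k := by
  obtain ⟨k, hk⟩ := h
  obtain ⟨j, -, hj⟩ := (Nat.dvd_prime_pow Nat.prime_two).1 (orderOf_dvd_of_pow_eq_one hk)
  exact ⟨j, hj⟩

/-- squares are the joint kernel of enough characters -/
theorem sq_of_ker {A W : Type*} [CommGroup A] [Finite A] [CommGroup W] [Finite W] (f : A →* W)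
    (hf : Function.Surjective f) (hW : ∀ w : W, w ^ 2 = 1)
    (hc : Nat.card {c : A // c ^ 2 = 1} ≤ Nat.card W) {x : A} (hx : f x = 1) : ∃ y, x = y ^ 2 := by
  have h1 : (powMonoidHom 2 : A →* A).range ≤ f.ker := by
    rintro _ ⟨y, rfl⟩
    rw [MonoidHom.mem_ker, powMonoidHom_apply, map_pow, hW]
  have h2 : Nat.card f.ker ≤ Nat.card (powMonoidHom 2 : A →* A).range := by
    have e1 := f.ker.card_mul_index
    rw [Subgroup.index_ker, MonoidHom.range_eq_top.2 hf, Subgroup.card_top] at e1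
    have e2 := (powMonoidHom 2 : A →* A).ker.card_mul_index
    rw [Subgroup.index_ker] at e2
    have e3 : Nat.card (powMonoidHom 2 : A →* A).ker = Nat.card {c : A // c ^ 2 = 1} := rfl
    rw [e3] at e2
    have hW0 : 0 < Nat.card W := Nat.card_pos
    by_contra hlt
    push Not at hlt
    have := Nat.mul_le_mul_right (Nat.card (powMonoidHom 2 : A →* A).range) hc
    nlinarith
  have h3 := Subgroup.eq_of_le_of_card_ge h1 h2
  have h4 : x ∈ (powMonoidHom 2 : A →* A).range := by rw [h3]; exact hx
  obtain ⟨y, hy⟩ := h4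
  exact ⟨y, hy.symm⟩

theorem card_PC_sq : Nat.card {c : PC G // c ^ 2 = 1} ≤ Nat.card {c : G // c ^ 2 = 1} := by
  apply Nat.card_le_card_of_injective (fun c => ⟨(c.1 : G), by
    have := c.2; exact_mod_cast congrArg (Subtype.val) this⟩)
  rintro ⟨⟨a, _⟩, _⟩ ⟨⟨b, _⟩, _⟩ h
  simpa using h

theorem gen_of_sq {H : Subgroup G} (h : ∀ x ∈ PC G, ∃ y ∈ PC G, ∃ g ∈ H, x = g * y ^ 2) {x : G}
    (hx : x ∈ PC G) : x ∈ H := by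
  obtain ⟨N, hN, hP⟩ := exists_odd_PC G
  have key : ∀ k : ℕ, ∀ x ∈ PC G, ∃ y ∈ PC G, ∃ g ∈ H, x = g * y ^ 2 ^ k := by
    intro k
    induction k with
    | zero => intro x hx; exact ⟨x, hx, 1, H.one_mem, by simp⟩
    | succ k ih =>
      intro x hx
      obtain ⟨y, hy, g, hg, rfl⟩ := ih x hx
      obtain ⟨y', hy', g', hg', rfl⟩ := h y hy
      refine ⟨y', hy', g * g' ^ 2 ^ k, H.mul_mem hg (H.pow_mem hg' _), ?_⟩
      rw [mul_pow, ← pow_mul, pow_succ', mul_assoc]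
  obtain ⟨y, hy, g, hg, e⟩ := key (Nat.card G) x hx
  obtain ⟨k, hk⟩ := PC_order hy
  have hle : 2 ^ k ≤ Nat.card G := hk ▸ Nat.le_of_dvd Nat.card_pos (orderOf_dvd_natCard y)
  have hk2 : k ≤ Nat.card G := (Nat.lt_two_pow_self).le.trans hle
  have : y ^ 2 ^ (Nat.card G) = 1 := by
    rw [← orderOf_dvd_iff_pow_eq_one, hk]; exact pow_dvd_pow 2 hk2
  rw [e, this, mul_one]; exact hg

theorem unit_cases (u : ℤˣ) : u = 1 ∨ u = -1 := Int.units_eq_one_or u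

theorem gen_one {χ : G →* ℤˣ} (hc : Nat.card {c : G // c ^ 2 = 1} ≤ 2) {b : G} (hb : b ∈ PC G)
    (hχ : χ b = -1) {x : G} (hx : x ∈ PC G) : x ∈ Subgroup.zpowers b := by
  have hsq : ∀ y ∈ PC G, χ y = 1 → ∃ z ∈ PC G, y = z ^ 2 := by
    intro y hy h1
    obtain ⟨z, hz⟩ := sq_of_ker (χ.comp (PC G).subtype) (fun w => by
      rcases unit_cases w with rfl | rfl
      · exact ⟨1, by simp⟩
      · exact ⟨⟨b, hb⟩, hχ⟩) (fun w => by rcases unit_cases w with rfl | rfl <;> simp)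
      (card_PC_sq.trans (by simpa using hc)) (x := ⟨y, hy⟩) h1
    exact ⟨z, z.2, congrArg Subtype.val hz⟩
  refine gen_of_sq (fun y hy => ?_) hx
  rcases unit_cases (χ y) with h | h
  · obtain ⟨z, hz, rfl⟩ := hsq y hy h
    exact ⟨z, hz, 1, Subgroup.one_mem _, by simp⟩
  · obtain ⟨z, hz, e⟩ := hsq (b⁻¹ * y) ((PC G).mul_mem ((PC G).inv_mem hb) hy)
      (by rw [map_mul, map_inv, hχ, h]; decide)
    exact ⟨z, hz, b, Subgroup.mem_zpowers b, by rw [← e]; group⟩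

/-- Admissible data: two characters and two elements. -/
structure Adm (χ1 χ2 : G →* ℤˣ) (a q : G) : Prop where
  ha : a ∈ PC G
  q2 : q ^ 2 = 1
  a2 : χ2 a = -1
  q1 : χ1 q = -1
  q2' : χ2 q = 1

variable {χ1 χ2 : G →* ℤˣ} {a q : G}

theorem Adm.hq (h : Adm χ1 χ2 a q) : q ∈ PC G := ⟨1, by simpa using h.q2⟩

theorem Adm.gen (h : Adm χ1 χ2 a q) (hc : Nat.card {c : G // c ^ 2 = 1} ≤ 4) {x : G}
    (hx : x ∈ PC G) : ∃ i e : ℤ, x = a ^ i * q ^ e := by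
  have hsq : ∀ y ∈ PC G, χ1 y = 1 → χ2 y = 1 → ∃ z ∈ PC G, y = z ^ 2 := by
    intro y hy h1 h2
    obtain ⟨z, hz⟩ := sq_of_ker ((χ1.prod χ2).comp (PC G).subtype) (fun w => by
      obtain ⟨w1, w2⟩ := w
      have h3 := h.q1
      have h4 := h.q2'
      have h5 := h.a2
      rcases unit_cases w2 with rfl | rfl <;> rcases unit_cases w1 with rfl | rfl
      · exact ⟨1, by simp⟩
      · exact ⟨⟨q, h.hq⟩, by simp [h3, h4]⟩
      · rcases unit_cases (χ1 a) with h6 | h6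
        · exact ⟨⟨a, h.ha⟩, by simp [h5, h6]⟩
        · exact ⟨⟨a, h.ha⟩ * ⟨q, h.hq⟩, by simp [h5, h6, h3, h4]⟩
      · rcases unit_cases (χ1 a) with h6 | h6
        · exact ⟨⟨a, h.ha⟩ * ⟨q, h.hq⟩, by simp [h5, h6, h3, h4]⟩
        · exact ⟨⟨a, h.ha⟩, by simp [h5, h6]⟩)
      (fun w => by
        obtain ⟨w1, w2⟩ := w
        rcases unit_cases w2 with rfl | rfl <;> rcases unit_cases w1 with rfl | rfl <;> simp)
      (card_PC_sq.trans (by rw [Nat.card_prod]; simpa using hc)) (x := ⟨y, hy⟩)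
      (by simp [h1, h2])
    exact ⟨z, z.2, congrArg Subtype.val hz⟩
  have hm : x ∈ Subgroup.zpowers a ⊔ Subgroup.zpowers q := by
    refine gen_of_sq (fun y hy => ?_) hx
    -- first adjust χ2 by a, then χ1 by q
    have step1 : ∃ g ∈ Subgroup.zpowers a ⊔ Subgroup.zpowers q, g ∈ PC G ∧ χ2 (g * y) = 1 := by
      rcases unit_cases (χ2 y) with h1 | h1
      · exact ⟨1, one_mem _, one_mem _, by simpa using h1⟩
      · exact ⟨a, Subgroup.mem_sup_left (Subgroup.mem_zpowers a), h.ha, by simp [h1, h.a2]⟩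
    obtain ⟨g, hg, hgP, h1⟩ := step1
    have step2 : ∃ g' ∈ Subgroup.zpowers a ⊔ Subgroup.zpowers q, g' ∈ PC G ∧ χ2 (g' * y) = 1 ∧
        χ1 (g' * y) = 1 := by
      rcases unit_cases (χ1 (g * y)) with h2 | h2
      · exact ⟨g, hg, hgP, h1, h2⟩
      · refine ⟨q * g, Subgroup.mul_mem _ (Subgroup.mem_sup_right (Subgroup.mem_zpowers q)) hg,
          (PC G).mul_mem h.hq hgP, ?_, ?_⟩
        · rw [mul_assoc, map_mul, h1, h.q2', one_mul]
        · rw [mul_assoc, map_mul, h2, h.q1]; decide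
    obtain ⟨g', hg', hgP', h3, h4⟩ := step2
    obtain ⟨z, hz, e⟩ := hsq _ ((PC G).mul_mem hgP' hy) h4 h3
    exact ⟨z, hz, g'⁻¹, inv_mem hg', by rw [← e]; group⟩
  obtain ⟨u, ⟨i, rfl⟩, v, ⟨e, rfl⟩, rfl⟩ := Subgroup.mem_sup.1 hm
  exact ⟨i, e, rfl⟩

theorem Adm.indep (h : Adm χ1 χ2 a q) {i e : ℤ} (hie : a ^ i * q ^ e = 1) :
    Even e ∧ a ^ i = 1 := by
  have hi : Even i := by
    have := congrArg χ2 hie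
    rw [map_mul, map_zpow, map_zpow, h.a2, h.q2', one_zpow, mul_one, map_one] at this
    by_contra ho
    rw [Int.not_even_iff_odd] at ho
    rw [ho.neg_one_zpow] at this
    exact absurd this (by decide)
  have he : Even e := by
    have := congrArg χ1 hie
    obtain ⟨k, rfl⟩ := hi
    rw [map_mul, map_zpow, map_zpow, h.q1, map_one, zpow_add, ← mul_zpow] at this
    have h1 : χ1 a * χ1 a = 1 := by rcases unit_cases (χ1 a) with h6 | h6 <;> simp [h6]
    rw [h1, one_zpow, one_mul] at this
    by_contra ho
    rw [Int.not_even_iff_odd] at ho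
    rw [ho.neg_one_zpow] at this
    exact absurd this (by decide)
  refine ⟨he, ?_⟩
  obtain ⟨k, rfl⟩ := he
  rwa [zpow_add, ← mul_zpow, ← pow_two, h.q2, one_zpow, mul_one] at hie

end TwoGroups


open NumberField IntermediateField
set_option linter.unusedSectionVars false
set_option autoImplicit false

section TwoGroups2

theorem Adm.equiv {G : Type*} [CommGroup G] [Finite G] {χ1 χ2 : G →* ℤˣ} {a q : G}
    (h : Adm χ1 χ2 a q) (hc : Nat.card {c : G // c ^ 2 = 1} ≤ 4) :
    Nonempty (PC G ≃* Multiplicative (ZMod (orderOf a) × ZMod 2)) := by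
  let A : PC G := ⟨a, h.ha⟩
  let Q : PC G := ⟨q, h.hq⟩
  let f1 : ZMod (orderOf a) →+ Additive (PC G) :=
    ZMod.lift _ ⟨zmultiplesHom _ (Additive.ofMul A), by
      rw [zmultiplesHom_apply]
      apply Additive.toMul.injective
      apply Subtype.ext
      simp [A, pow_orderOf_eq_one]⟩
  let f2 : ZMod 2 →+ Additive (PC G) :=
    ZMod.lift _ ⟨zmultiplesHom _ (Additive.ofMul Q), by
      rw [zmultiplesHom_apply]
      apply Additive.toMul.injective
      apply Subtype.ext
      have := h.q2
      simpa [Q] using this⟩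
  have e1 : ∀ i : ℤ, f1 (i : ZMod _) = Additive.ofMul (A ^ i) := fun i => by
    simp [f1, ZMod.lift_coe]
  have e2 : ∀ i : ℤ, f2 (i : ZMod _) = Additive.ofMul (Q ^ i) := fun i => by
    simp [f2, ZMod.lift_coe]
  have e3 : ∀ i e : ℤ, (f1.coprod f2) ((i : ZMod _), (e : ZMod _)) = Additive.ofMul (A ^ i * Q ^ e) := by
    intro i e
    rw [AddMonoidHom.coprod_apply, e1, e2]; rfl
  have hb : Function.Bijective (f1.coprod f2) := by
    constructor
    · rw [injective_iff_map_eq_zero]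
      rintro ⟨x, y⟩ hxy
      obtain ⟨i, rfl⟩ := ZMod.intCast_surjective x
      obtain ⟨e, rfl⟩ := ZMod.intCast_surjective y
      rw [e3] at hxy
      have h1 : A ^ i * Q ^ e = 1 := hxy
      have h2 : a ^ i * q ^ e = 1 := congrArg Subtype.val h1
      obtain ⟨h3, h4⟩ := h.indep h2
      rw [← orderOf_dvd_iff_zpow_eq_one] at h4
      rw [(ZMod.intCast_zmod_eq_zero_iff_dvd _ _).2 h4,
        (ZMod.intCast_zmod_eq_zero_iff_dvd _ _).2 (by exact_mod_cast h3.two_dvd)]; rfl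
    · intro x
      obtain ⟨i, e, hx⟩ := h.gen hc (x := (x.toMul : G)) x.toMul.2
      refine ⟨((i : ZMod _), (e : ZMod _)), ?_⟩
      rw [e3]
      apply Additive.toMul.injective
      apply Subtype.ext
      rw [hx]; rfl
  exact ⟨(AddEquiv.toMultiplicative (AddEquiv.ofBijective _ hb)).symm⟩

theorem Adm.card {G : Type*} [CommGroup G] [Finite G] {χ1 χ2 : G →* ℤˣ} {a q : G}
    (h : Adm χ1 χ2 a q) (hc : Nat.card {c : G // c ^ 2 = 1} ≤ 4) :
    Nat.card (PC G) = 2 * orderOf a := by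
  obtain ⟨e⟩ := h.equiv hc
  rw [Nat.card_congr e.toEquiv, Nat.card_congr Multiplicative.toAdd, Nat.card_prod, Nat.card_zmod,
    Nat.card_zmod, mul_comm]

theorem two_dvd_of_chi {G : Type*} [CommGroup G] [Finite G] {χ : G →* ℤˣ} {a : G}
    (h : χ a = -1) : 2 ∣ orderOf a := by
  rw [← even_iff_two_dvd]
  by_contra ho
  rw [Nat.not_even_iff_odd] at ho
  have := congrArg χ (pow_orderOf_eq_one a)
  rw [map_pow, h, map_one, ho.neg_one_pow] at this
  exact absurd this (by decide)

theorem ord_half {G : Type*} [CommGroup G] [Finite G] {x : G} {u : ℤ} (h2 : 2 ∣ orderOf x)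
    (hx : x ∈ PC G) (hu : 4 ∣ u - 1) : 2 * orderOf (x ^ (1 + u)) = orderOf x := by
  obtain ⟨k, hk⟩ := PC_order hx
  obtain ⟨w, hw⟩ := hu
  cases k with
  | zero => rw [hk] at h2; simp at h2
  | succ k =>
    suffices orderOf (x ^ (1 + u)) = 2 ^ k by rw [this, hk]; ring
    apply Nat.dvd_antisymm
    · rw [orderOf_dvd_iff_pow_eq_one, ← zpow_natCast, ← zpow_mul, ← orderOf_dvd_iff_zpow_eq_one, hk]
      refine ⟨1 + 2 * w, ?_⟩
      rw [show u = 4 * w + 1 by linarith]; push_cast; ring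
    · have h1 : (x ^ (1 + u)) ^ (orderOf (x ^ (1 + u)) : ℤ) = 1 := by
        rw [zpow_natCast, pow_orderOf_eq_one]
      rw [← zpow_mul, ← orderOf_dvd_iff_zpow_eq_one, hk,
        show 1 + u = 2 * (1 + 2 * w) by linarith] at h1
      have h3 : ((2 : ℤ) ^ k) ∣ (1 + 2 * w) * (orderOf (x ^ (1 + u)) : ℤ) := by
        refine Int.dvd_of_mul_dvd_mul_left (a := 2) (by norm_num) ?_
        have : (2 : ℤ) * 2 ^ k = ((2 ^ (k + 1) : ℕ) : ℤ) := by push_cast; ring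
        rw [this, ← mul_assoc]
        convert h1 using 3
        rw [show 1 + u = 2 * (1 + 2 * w) by linarith]
      have h4 : IsCoprime ((2 : ℤ) ^ k) (1 + 2 * w) := by
        apply IsCoprime.pow_left
        exact ⟨-w, 1, by ring⟩
      have := h4.dvd_of_dvd_mul_left h3
      exact_mod_cast this

theorem even_zpow {G : Type*} [CommGroup G] {q : G} (h : q ^ 2 = 1) {e : ℤ} (he : Even e) :
    q ^ e = 1 := by
  obtain ⟨k, rfl⟩ := he
  rw [zpow_add, ← mul_zpow, ← pow_two, h, one_zpow]

theorem zpow_odd_unit {u : ℤˣ} {i : ℤ} (h : Odd i) : u ^ i = u := by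
  obtain ⟨k, rfl⟩ := h
  rw [zpow_add, zpow_mul]
  have : u ^ (2 : ℤ) = 1 := by rcases unit_cases u with rfl | rfl <;> decide
  rw [this]; simp

/-- growth step -/
theorem growth {G' G : Type*} [CommGroup G'] [Finite G'] [CommGroup G] [Finite G]
    {N : G' →* G} {j : G →* G'} {t : G' →* G'} (hjN : ∀ x, j (N x) = x * t x)
    (hNt : ∀ x, N (t x) = N x) {χ1' χ2' : G' →* ℤˣ} {χ1 χ2 : G →* ℤˣ} {a' q' : G'}
    (h' : Adm χ1' χ2' a' q') (h : Adm χ1 χ2 (N a') (N q'))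
    (hc : Nat.card {c : G' // c ^ 2 = 1} ≤ 4) (h4 : 4 ∣ orderOf (N a'))
    (hk : ∀ x ∈ PC G, j x = 1 → x ∈ Subgroup.zpowers (N q')) :
    orderOf a' = 2 * orderOf (N a') := by
  obtain ⟨u, e, hu⟩ := h'.gen hc (PC_map t h'.ha)
  have h1 := congrArg N hu
  rw [hNt, map_mul, map_zpow, map_zpow] at h1
  have h2 : (N a') ^ (u - 1) * (N q') ^ e = 1 := by
    rw [zpow_sub_one, mul_right_comm, ← h1, mul_inv_cancel]
  obtain ⟨he, hu1⟩ := h.indep h2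
  rw [even_zpow h'.q2 he, mul_one] at hu
  rw [← orderOf_dvd_iff_zpow_eq_one] at hu1
  have h5 : j (N a') = a' ^ (1 + u) := by rw [hjN, hu, zpow_one_add]
  rw [← ord_half (two_dvd_of_chi h'.a2) h'.ha ((by exact_mod_cast h4 : (4 : ℤ) ∣ _).trans hu1), ← h5]
  congr 1
  apply Nat.dvd_antisymm (orderOf_map_dvd _ _)
  have h6 : j ((N a') ^ orderOf (j (N a'))) = 1 := by rw [map_pow, pow_orderOf_eq_one]
  obtain ⟨i, hi⟩ := hk _ ((PC G).pow_mem h.ha _) h6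
  have h7 : (N a') ^ ((orderOf (j (N a')) : ℕ) : ℤ) * (N q') ^ (-i) = 1 := by
    rw [zpow_natCast, ← hi]; simp
  have := (h.indep h7).2
  rw [zpow_natCast] at this
  exact orderOf_dvd_of_pow_eq_one this

theorem base_four {G : Type*} [CommGroup G] [Finite G] {χ : G →* ℤˣ} {b s : G}
    (hc : Nat.card {c : G // c ^ 2 = 1} ≤ 2) (hb : b ∈ PC G) (hχ : χ b = -1)
    (hs1 : s ≠ 1) (hs2 : s ^ 2 = 1) (hχs : χ s = 1) :
    4 ∣ orderOf b ∧ s = b ^ (orderOf b / 2) := by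
  obtain ⟨i, hi⟩ := gen_one hc hb hχ (x := s) ⟨1, by simpa using hs2⟩
  change b ^ i = s at hi
  have hie : Even i := by
    by_contra ho
    rw [Int.not_even_iff_odd] at ho
    rw [← hi, map_zpow, hχ, ho.neg_one_zpow] at hχs
    exact absurd hχs (by decide)
  obtain ⟨k, hk⟩ := PC_order hb
  have h2 : (orderOf b : ℤ) ∣ i * 2 := by
    rw [orderOf_dvd_iff_zpow_eq_one, zpow_mul, hi]; exact_mod_cast hs2
  have h1 : ¬ (orderOf b : ℤ) ∣ i := by
    rw [orderOf_dvd_iff_zpow_eq_one, hi]; exact hs1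
  rw [hk] at h1 h2 ⊢
  match k with
  | 0 => simp at h1
  | 1 => exact absurd (by exact_mod_cast hie.two_dvd) h1
  | k + 2 =>
    refine ⟨⟨2 ^ k, by ring⟩, ?_⟩
    obtain ⟨w, hw⟩ := h2
    have hi2 : i = 2 ^ (k + 1) * w := by
      have : (((2 : ℕ) ^ (k + 2) : ℕ) : ℤ) = 2 ^ (k + 1) * 2 := by push_cast; ring
      rw [this] at hw; linarith
    have hwo : Odd w := by
      rw [← Int.not_even_iff_odd]
      rintro ⟨v, rfl⟩
      apply h1
      exact ⟨v, by rw [hi2]; push_cast; ring⟩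
    obtain ⟨v, rfl⟩ := hwo
    rw [← hi, hi2, show (2 : ℤ) ^ (k + 1) * (2 * v + 1) = (2 ^ (k + 2) : ℕ) * v + (2 ^ (k + 1) : ℕ) by
      push_cast; ring, zpow_add, zpow_mul, zpow_natCast, ← hk, pow_orderOf_eq_one, one_zpow, one_mul,
      zpow_natCast, hk, show (2 : ℕ) ^ (k + 2) / 2 = 2 ^ (k + 1) by
        rw [pow_succ _ (k + 1)]; exact Nat.mul_div_cancel _ two_pos]

theorem base_step {G' G : Type*} [CommGroup G'] [Finite G'] [CommGroup G] [Finite G]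
    {N : G' →* G} {j : G →* G'} {t : G' →* G'} (hjN : ∀ x, j (N x) = x * t x)
    (hNt : ∀ x, N (t x) = N x) {χ1 χ2 : G' →* ℤˣ} {χM : G →* ℤˣ} {a q : G'}
    (h : Adm χ1 χ2 a q) (hχ : ∀ c, χM (N c) = χ2 c)
    (hc : Nat.card {c : G' // c ^ 2 = 1} ≤ 4) (hcM : Nat.card {c : G // c ^ 2 = 1} ≤ 2)
    (ht1 : χ1 (t a) = χ1 a) (htq : t q = q) (hs1 : N q ≠ 1)
    (hk : ∀ x ∈ PC G, j x = 1 → x ∈ Subgroup.zpowers (N q)) :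
    orderOf a = orderOf (N a) := by
  obtain ⟨h4, hs⟩ := base_four hcM (PC_map N h.ha) ((hχ a).trans h.a2) hs1
    (by rw [← map_pow, h.q2, map_one]) ((hχ q).trans h.q2')
  obtain ⟨u, e, hu⟩ := h.gen hc (PC_map t h.ha)
  have hu1 : Odd u := by
    have := congrArg χ2 hu
    rw [map_mul, map_zpow, map_zpow, h.q2', one_zpow, mul_one, ← hχ, hNt, hχ, h.a2] at this
    rw [← Int.not_even_iff_odd]
    intro he
    rw [he.neg_one_zpow] at this
    exact absurd this (by decide)
  have he : Even e := by
    have := congrArg χ1 hu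
    rw [map_mul, map_zpow, map_zpow, ht1, zpow_odd_unit hu1, h.q1] at this
    by_contra ho
    rw [Int.not_even_iff_odd] at ho
    rw [ho.neg_one_zpow, eq_comm, mul_eq_left] at this
    exact absurd this (by decide)
  rw [even_zpow h.q2 he, mul_one] at hu
  have h1 := congrArg N hu
  rw [hNt, map_zpow] at h1
  have h2 : (orderOf (N a) : ℤ) ∣ u - 1 := by
    rw [orderOf_dvd_iff_zpow_eq_one, zpow_sub_one, ← h1, mul_inv_cancel]
  have h5 : j (N a) = a ^ (1 + u) := by rw [hjN, hu, zpow_one_add]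
  rw [← ord_half (two_dvd_of_chi h.a2) h.ha ((by exact_mod_cast h4 : (4 : ℤ) ∣ _).trans h2), ← h5]
  have hs' : j (N q) = 1 := by rw [hjN, htq, ← pow_two, h.q2]
  obtain ⟨w, hw⟩ := h4
  have hw2 : orderOf (N a) / 2 = 2 * w := by lia
  suffices orderOf (j (N a)) = 2 * w by lia
  apply Nat.dvd_antisymm
  · rw [orderOf_dvd_iff_pow_eq_one, ← map_pow, ← hw2, ← hs, hs']
  · have h6 : j ((N a) ^ orderOf (j (N a))) = 1 := by rw [map_pow, pow_orderOf_eq_one]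
    obtain ⟨i, hi⟩ := hk _ ((PC G).pow_mem (PC_map N h.ha) _) h6
    have h7 : (N a) ^ (orderOf (j (N a)) * 2) = 1 := by
      rw [pow_mul, ← hi]
      change ((N q) ^ i) ^ 2 = 1
      rw [← zpow_natCast, ← zpow_mul, mul_comm, zpow_mul, zpow_natCast, ← map_pow, h.q2, map_one,
        one_zpow]
    have := orderOf_dvd_of_pow_eq_one h7
    rw [hw, show 4 * w = (2 * w) * 2 by ring] at this
    exact Nat.dvd_of_mul_dvd_mul_right two_pos this

theorem sq_cases {G : Type*} [CommGroup G] [Finite G] (hc : Nat.card {c : G // c ^ 2 = 1} ≤ 2)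
    {s x : G} (hs1 : s ≠ 1) (hs2 : s ^ 2 = 1) (hx : x ^ 2 = 1) : x = 1 ∨ x = s := by
  by_contra hn
  push Not at hn
  have hi : Function.Injective (![⟨1, one_pow 2⟩, ⟨s, hs2⟩, ⟨x, hx⟩] : Fin 3 → {c : G // c ^ 2 = 1}) := by
    intro i j
    fin_cases i <;> fin_cases j <;> simp [hs1, hs1.symm, hn.1, hn.2, Ne.symm hn.1, Ne.symm hn.2]
  have := Nat.card_le_card_of_injective _ hi
  rw [Nat.card_fin] at this
  lia

theorem mk_step {G k : Type*} [CommGroup G] [Finite G] [CommGroup k] [Finite k]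
    {N : G →* k} {j : k →* G} (hjN : ∀ x ∈ PC G, j (N x) = x ^ 2) (hNj : ∀ y, N (j y) = y ^ 2)
    {χM : G →* ℤˣ} {χ : k →* ℤˣ} {b s : G} (hcM : Nat.card {c : G // c ^ 2 = 1} ≤ 2)
    (hck : Nat.card {c : k // c ^ 2 = 1} ≤ 2) (hb : b ∈ PC G) (hχb : χM b = -1)
    (hs2 : s ^ 2 = 1) (hNs : N s ≠ 1) (hχ1 : ∃ c, χ c = -1) (hχ : ∀ c, χ (N c) = 1) :
    Nat.card (PC k) = 2 * orderOf b := by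
  have hs1 : s ≠ 1 := fun h => hNs (by rw [h, map_one])
  have hinj : ∀ x ∈ PC G, N x = 1 → x = 1 := by
    intro x hx h1
    have := hjN x hx
    rw [h1, map_one] at this
    rcases sq_cases hcM hs1 hs2 this.symm with h | h
    · exact h
    · exact absurd (h ▸ h1) hNs
  obtain ⟨c0, hc0⟩ := hχ1
  obtain ⟨M, hM, hMP⟩ := exists_odd_PC k
  have hc := hMP c0
  have hχc : χ (c0 ^ M) = -1 := by rw [map_pow, hc0, hM.neg_one_pow]
  generalize c0 ^ M = c at hc hχc
  have hcard : Nat.card (PC k) = orderOf c := by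
    rw [← Nat.card_zpowers]
    have : PC k = Subgroup.zpowers c :=
      le_antisymm (fun x hx => gen_one hck hc hχc hx) (Subgroup.zpowers_le.2 hc)
    rw [this]
  have hob : orderOf (N b) = orderOf b := by
    apply Nat.dvd_antisymm (orderOf_map_dvd _ _)
    apply orderOf_dvd_of_pow_eq_one
    apply hinj _ ((PC G).pow_mem hb _)
    rw [map_pow, pow_orderOf_eq_one]
  have h1 : N b ∈ Subgroup.zpowers (c ^ 2) := by
    obtain ⟨i, hi⟩ := gen_one hck hc hχc (PC_map N hb)
    change c ^ i = N b at hi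
    have hie : Even i := by
      by_contra ho
      rw [Int.not_even_iff_odd] at ho
      have := hχ b
      rw [← hi, map_zpow, hχc, ho.neg_one_zpow] at this
      exact absurd this (by decide)
    obtain ⟨v, rfl⟩ := hie
    refine ⟨v, ?_⟩
    change (c ^ 2) ^ v = _
    rw [← hi, zpow_add, ← mul_zpow, pow_two]
  have h2 : c ^ 2 ∈ Subgroup.zpowers (N b) := by
    obtain ⟨i, hi⟩ := gen_one hcM hb hχb (PC_map j hc)
    change b ^ i = j c at hi
    refine ⟨i, ?_⟩
    change N b ^ i = _
    rw [← map_zpow, hi, hNj]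
  have h3 : Subgroup.zpowers (c ^ 2) = Subgroup.zpowers (N b) :=
    le_antisymm (Subgroup.zpowers_le.2 h2) (Subgroup.zpowers_le.2 h1)
  have h4 : orderOf (c ^ 2) = orderOf b := by
    rw [← hob, ← Nat.card_zpowers, h3, Nat.card_zpowers]
  have h5 := two_dvd_of_chi hχc
  rw [hcard, ← h4, orderOf_pow_of_dvd (by norm_num) h5]
  lia

end TwoGroups2


open NumberField IntermediateField
set_option linter.unusedSectionVars false
set_option autoImplicit false

section KArith

theorem ratO_int (y : 𝓞 ℚ) : ∃ n : ℤ, y = n :=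
  ⟨Rat.ringOfIntegersEquiv y, by apply Rat.ringOfIntegersEquiv.injective; simp⟩

/-- ideals of norm two are not principal in `ℚ(√(-2p))`. -/
theorem nonprincipal_two {D : Type*} [Field D] [NumberField D] {σ : D ≃ₐ[ℚ] D} (h : Quad ℚ D σ)
    {θ : 𝓞 D} {p : ℕ} (hp : p.Prime) (hp16 : p % 16 = 9) (hθ : θ ^ 2 = ((-2 * p : ℤ) : 𝓞 D))
    (hσ : sO σ.toRingEquiv θ = -θ) {x : 𝓞 D} (hx : Ideal.absNorm (Ideal.span {x}) = 2) : False := by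
  have hss : sO σ.toRingEquiv (sO σ.toRingEquiv x) = x := by
    apply RingOfIntegers.ext
    exact h.sq _
  have hfix : ∀ z : 𝓞 D, sO σ.toRingEquiv z = z → ∃ n : ℤ, z = n := by
    intro z hz
    obtain ⟨y, rfl⟩ := h.fixedO hz
    obtain ⟨n, rfl⟩ := ratO_int y
    exact ⟨n, by simp⟩
  obtain ⟨A, hA⟩ := hfix (x + sO σ.toRingEquiv x) (by rw [map_add, hss, add_comm])
  obtain ⟨δ, hδ⟩ := hfix (x * sO σ.toRingEquiv x) (by rw [map_mul, hss, mul_comm])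
  obtain ⟨E, hE⟩ := hfix (θ * (x - sO σ.toRingEquiv x)) (by rw [map_mul, map_sub, hss, hσ]; ring)
  have h1 : E ^ 2 = -2 * p * (A ^ 2 - 4 * δ) := by
    have : ((E ^ 2 : ℤ) : 𝓞 D) = ((-2 * p * (A ^ 2 - 4 * δ) : ℤ) : 𝓞 D) := by
      rw [Int.cast_pow, Int.cast_mul, ← hθ, Int.cast_sub, Int.cast_pow, Int.cast_mul, ← hE, ← hA, ← hδ]
      push_cast; ring
    exact_mod_cast this
  have h2 : δ.natAbs = 2 := by
    have e1 : Ideal.absNorm (Ideal.span {(δ : 𝓞 D)}) = 4 := by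
      rw [← hδ, ← Ideal.span_singleton_mul_span_singleton, map_mul, ← sI_span, absNorm_sI, hx]
    rw [show (δ : 𝓞 D) = algebraMap ℤ _ δ by simp, Ideal.absNorm_span_singleton, Algebra.norm_algebraMap,
      RingOfIntegers.rank, h.two, Int.natAbs_pow] at e1
    exact Nat.pow_left_injective two_ne_zero e1
  have hp0 : 0 < (p : ℤ) := by exact_mod_cast hp.pos
  have h3 : A ^ 2 ≤ 4 * δ := by
    by_contra hlt
    push Not at hlt
    nlinarith [sq_nonneg E, mul_pos hp0 (sub_pos.2 hlt)]
  have h4 : δ = 2 := by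
    have : 0 ≤ δ := by nlinarith [sq_nonneg A]
    lia
  subst h4
  have h5 : (p : ℤ) ∣ E := (Nat.prime_iff_prime_int.1 hp).dvd_of_dvd_pow (n := 2)
    ⟨-2 * (A ^ 2 - 4 * 2), by rw [h1]; ring⟩
  obtain ⟨w, rfl⟩ := h5
  have h6 : (p : ℤ) ∣ 2 * (8 - A ^ 2) := by
    refine ⟨w ^ 2, ?_⟩
    have : (p : ℤ) * (2 * (8 - A ^ 2)) = p * (p * w ^ 2) := by linarith
    exact mul_left_cancel₀ hp0.ne' this
  have h7 : 8 - A ^ 2 ≠ 0 := by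
    intro h0
    have : A ≤ 2 := by nlinarith
    have : -2 ≤ A := by nlinarith
    interval_cases A <;> simp at h0
  have h8 : (p : ℤ) ≤ 2 * (8 - A ^ 2) := Int.le_of_dvd (by lia) h6
  have h9 : p ≤ 16 := by have := sq_nonneg A; lia
  have h10 : p = 9 := by lia
  subst h10
  revert hp; norm_num

theorem two_sq {D : Type*} [Field D] [NumberField D] (hd : Module.finrank ℚ D = 2)
    {θ : 𝓞 D} {p : ℕ} (hp16 : p % 16 = 9) (hθ : θ ^ 2 = ((-2 * p : ℤ) : 𝓞 D))
    {T : Ideal (𝓞 D)} (hT : Ideal.absNorm T = 2) : T ^ 2 = Ideal.span {2} := by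
  have h2 := two_mem_of_two hT
  have hP := prime_of_two hT
  have hθT : θ ∈ T := by
    apply hP.mem_of_pow_mem 2
    rw [hθ]
    push_cast
    rw [neg_mul]
    exact T.neg_mem (T.mul_mem_right _ h2)
  symm
  apply eq_of_le_norm
  · rw [Ideal.span_singleton_le_iff_mem, pow_two]
    obtain ⟨k, hk⟩ : ∃ k, p = 16 * k + 9 := ⟨p / 16, by lia⟩
    have e : (2 : 𝓞 D) = -(θ * θ) - (2 * 2) * (8 * k + 4) := by
      rw [← pow_two, hθ, hk]
      push_cast; ring
    rw [e]
    exact Ideal.sub_mem _ ((Ideal.neg_mem_iff _).2 (Ideal.mul_mem_mul hθT hθT))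
      (Ideal.mul_mem_right _ _ (Ideal.mul_mem_mul h2 h2))
  · simp
  · have := Ideal.absNorm_span_natCast (S := 𝓞 D) 2
    rw [RingOfIntegers.rank, hd] at this
    rw [map_pow, hT]
    exact_mod_cast this

variable {p : ℕ} [hpf : Fact p.Prime]

theorem rmrp_sq : (rm * rp p) ^ 2 = ((-2 * p : ℤ) : ℂ) := by
  rw [mul_pow, rm_sq, rp_sq]; push_cast; ring

theorem exists_kf : ∃ σ : kf p ≃ₐ[ℚ] kf p, Quad ℚ (kf p) σ ∧
    σ ⟨rm * rp p, rmrp_mem_kf p⟩ = -⟨rm * rp p, rmrp_mem_kf p⟩ := by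
  obtain ⟨σ, hσ⟩ := exists_quad (K := ℚ) (L := kf p) deg_kf
  have hi : rm * rp p ∉ (⊥ : IntermediateField ℚ ℂ) :=
    notMem_bot_of_conj (mul_ne_zero rm_ne rp_ne) (by rw [map_mul, rm_conj, rp_conj]; ring)
  exact ⟨σ, hσ, neg_of_sq_Q hσ (rmrp_mem_kf p) rmrp_sq hi⟩

theorem cl_T (hp : p % 16 = 9) {T : Ideal (𝓞 (kf p))} (hT : Ideal.absNorm T = 2) {N : ℕ} (hN : Odd N) :
    cl T ^ N ≠ 1 := by
  obtain ⟨σ, hσ, hneg⟩ := exists_kf (p := p)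
  have hθ := mkO_sq (rmrp_mem_kf p) (int_of_sq rmrp_sq) rmrp_sq
  have hT0 : T ≠ ⊥ := ne_bot_of_two two_ne_zero hT
  have h2 : cl T ^ 2 = 1 := by
    rw [← cl_pow hT0, two_sq deg_kf hp hθ hT, cl_span (by norm_num)]
  obtain ⟨k, rfl⟩ := hN
  rw [pow_succ, pow_mul, h2, one_pow, one_mul]
  intro h1
  obtain ⟨x, hx0, hx⟩ := (cl_eq_one_iff hT0).1 h1
  rw [hx] at hT
  refine nonprincipal_two hσ hpf.out hp hθ ?_ hT
  apply co_inj
  rw [co_sO, map_neg, co_mk, mk_coe]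
  have := congrArg (algebraMap (kf p) ℂ) hneg
  rw [map_neg, alg_mk (rm * rp p)] at this
  exact this

theorem kf_fix {f : Mf p ≃+* Mf p}
    (hf : f ⟨rm * rp p, kf_le_Mf p (rmrp_mem_kf p)⟩ = ⟨rm * rp p, kf_le_Mf p (rmrp_mem_kf p)⟩)
    (y : kf p) : f (algebraMap (kf p) (Mf p) y) = algebraMap (kf p) (Mf p) y := by
  obtain ⟨σ, hσ⟩ := exists_quad (K := ℚ) (L := kf p) deg_kf
  have hi : rm * rp p ∉ (⊥ : IntermediateField ℚ ℂ) :=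
    notMem_bot_of_conj (mul_ne_zero rm_ne rp_ne) (by rw [map_mul, rm_conj, rp_conj]; ring)
  obtain ⟨a, b, rfl⟩ := hσ.decomp (θ := ⟨rm * rp p, rmrp_mem_kf p⟩) (m := -2 * p) (by
    apply (algebraMap (kf p) ℂ).injective
    rw [map_pow, alg_mk (rm * rp p), rmrp_sq]
    simp only [map_mul, map_neg, map_ofNat, map_natCast]; push_cast; ring) (fun y hy => hi (by
      have := congrArg (algebraMap (kf p) ℂ) hy
      rw [alg_mk (rm * rp p)] at this
      rw [← this, mem_bot]
      exact ⟨y, by simp⟩)) y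
  have e : algebraMap (kf p) (Mf p) ⟨rm * rp p, rmrp_mem_kf p⟩ =
      ⟨rm * rp p, kf_le_Mf p (rmrp_mem_kf p)⟩ := by
    apply (algebraMap (Mf p) ℂ).injective
    rw [alg_alg, alg_mk (rm * rp p)]
  rw [map_add, map_mul, map_add, map_mul, e, hf]
  simp

theorem inv_of_odd {K L : Type*} [Field K] [Field L] [NumberField K] [NumberField L] [Algebra K L]
    {σ : L ≃ₐ[K] L} (h : Quad K L σ) (hK : Odd (Nat.card (ClassGroup (𝓞 K))))
    {x : ClassGroup (𝓞 L)} (hx : x ∈ PC (ClassGroup (𝓞 L))) : act σ.toRingEquiv x = x⁻¹ := by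
  have h1 : nm K L x = 1 := PC_odd (PC_map _ hx) hK pow_card_eq_one'
  have h2 := h.jj_nm x
  rw [h1, map_one] at h2
  exact (inv_eq_of_mul_eq_one_right h2.symm).symm

theorem jN_kM (hp : p % 16 = 9) {x : ClassGroup (𝓞 (Mf p))} (hx : x ∈ PC (ClassGroup (𝓞 (Mf p)))) :
    jj (kf p) (Mf p) (nm (kf p) (Mf p) x) = x ^ 2 := by
  have hp2 : p % 2 = 1 := by lia
  obtain ⟨σ, hσ, hσp⟩ := exists_Qm2M_neg (p := p) hp2
  obtain ⟨c, hc, hcc⟩ := exists_cMf (p := p) hp2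
  have hcm : c ⟨rm, rm_mem_Mf p⟩ = -⟨rm, rm_mem_Mf p⟩ := by
    apply (algebraMap (Mf p) ℂ).injective
    rw [map_neg, alg_mk rm]
    exact (hcc _).trans rm_conj
  have hcp : c ⟨rp p, rp_mem_Mf p⟩ = ⟨rp p, rp_mem_Mf p⟩ := by
    apply (algebraMap (Mf p) ℂ).injective
    rw [alg_mk (rp p)]
    exact (hcc _).trans (rp_conj p)
  have hsm : σ ⟨rm, rm_mem_Mf p⟩ = ⟨rm, rm_mem_Mf p⟩ := fix_LE σ rm_mem_Qm2
  have hprod : (⟨rm * rp p, kf_le_Mf p (rmrp_mem_kf p)⟩ : Mf p) =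
      ⟨rm, rm_mem_Mf p⟩ * ⟨rp p, rp_mem_Mf p⟩ := by
    apply (algebraMap (Mf p) ℂ).injective
    rw [map_mul, alg_mk rm, alg_mk (rp p), alg_mk (rm * rp p)]
  let f : Mf p ≃+* Mf p := c.toRingEquiv.trans σ.toRingEquiv
  have hff : ∀ y, f y = σ (c y) := fun _ => rfl
  have hf : f ⟨rm * rp p, kf_le_Mf p (rmrp_mem_kf p)⟩ = ⟨rm * rp p, kf_le_Mf p (rmrp_mem_kf p)⟩ := by
    rw [hff, hprod, map_mul, hcm, hcp, map_mul, map_neg, hsm, hσp]; ring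
  let ρ : Mf p ≃ₐ[kf p] Mf p := AlgEquiv.ofRingEquiv (f := f) (kf_fix hf)
  have hρ : Quad (kf p) (Mf p) ρ := by
    refine ⟨quad_kM hp2, fun h => ?_⟩
    have h1 : f ⟨rm, rm_mem_Mf p⟩ = ⟨rm, rm_mem_Mf p⟩ := by
      change ρ _ = _
      rw [h]; rfl
    rw [hff, hcm, map_neg, hsm] at h1
    have h2 := congrArg (algebraMap (Mf p) ℂ) h1
    rw [map_neg, alg_mk rm] at h2
    have := rm_ne
    apply this
    linear_combination (-1/2 : ℂ) * h2
  have hact : act ρ.toRingEquiv x = x := by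
    have h1 : ρ.toRingEquiv = f := rfl
    rw [h1, ← act_act, inv_of_odd hc (odd_Qp (by lia)) hx, map_inv, inv_of_odd hσ odd_Qm2 hx, inv_inv]
  rw [hρ.jj_nm, hact, pow_two]

end KArith


open NumberField IntermediateField
set_option linter.unusedSectionVars false
set_option autoImplicit false

section Final
variable {p : ℕ} [hpf : Fact p.Prime]

theorem cl_QL_pow (hp : p % 16 = 9) (n : ℕ) :
    (cl (QL hp n) ^ 2) ^ Nat.card (ClassGroup (𝓞 (Lp p n))) = 1 := by
  obtain ⟨c, hc, hcc⟩ := exists_cLf p n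
  have h1 : jj (Lp p n) (Lf p n) (nm (Lp p n) (Lf p n) (cl (QL hp n))) = cl (QL hp n) ^ 2 := by
    rw [hc.jj_nm, act_cl _ (QL_ne hp n), c_QL hp hcc, pow_two]
  rw [← h1, ← map_pow, pow_card_eq_one', map_one]

theorem unit_odd {u : ℤˣ} {N : ℕ} (h : Odd N) (hu : u = -1) : u ^ N = -1 := by
  rw [hu, h.neg_one_pow]

variable {χ1 χ2 : ∀ n, ClassGroup (𝓞 (Lf p (n + 1))) →* ℤˣ} {χM : ClassGroup (𝓞 (Mf p)) →* ℤˣ}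

theorem adm_Lf {hp : p % 16 = 9} (hX : Chars hp χ1 χ2 χM) (m : ℕ) {M : ℕ} (hM : Odd M)
    (hd : Nat.card (ClassGroup (𝓞 (Lp p (m + 1)))) ∣ M) {a : ClassGroup (𝓞 (Lf p (m + 1)))}
    (ha : a ∈ PC (ClassGroup (𝓞 (Lf p (m + 1))))) (ha2 : χ2 m a = -1) :
    Adm (χ1 m) (χ2 m) a (cl (QL hp (m + 1)) ^ M) where
  ha := ha
  q2 := by
    obtain ⟨d, rfl⟩ := hd
    rw [← pow_mul, mul_comm, pow_mul, pow_mul, cl_QL_pow, one_pow]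
  a2 := ha2
  q1 := by rw [map_pow, unit_odd hM (hX.q1 m)]
  q2' := by rw [map_pow, hX.q2, one_pow]

theorem exists_a {hp : p % 16 = 9} (hX : Chars hp χ1 χ2 χM) (m : ℕ) :
    ∃ a ∈ PC (ClassGroup (𝓞 (Lf p (m + 1)))), χ2 m a = -1 ∧
      ∀ τ : Lf p (m + 1) ≃+* Lf p (m + 1), χ1 m (act τ a) = χ1 m a := by
  obtain ⟨l, hl⟩ := exists_Ell hp (m + 1)
  obtain ⟨I, hI, h0, hlI⟩ := hl.exists_prime
  have hn := hl.norm_eq hp hI h0 hlI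
  obtain ⟨N, hN, hP⟩ := exists_odd_PC (ClassGroup (𝓞 (Lf p (m + 1))))
  refine ⟨cl I ^ N, hP _, ?_, fun τ => ?_⟩
  · rw [map_pow, unit_odd hN (hX.l2 m l I hl hn)]
  · rw [map_pow, act_cl _ h0, map_pow, map_pow, hX.l1 m l _ hl hn,
      hX.l1 m l _ hl (by rw [absNorm_sI, hn])]

theorem mem_zpowers_odd {G : Type*} [CommGroup G] [Finite G] {x g : G} (hx : x ∈ PC G) {N M : ℕ}
    (hN : Odd N) (hM : Odd M) (h : x ^ N ∈ Subgroup.zpowers g) : x ∈ Subgroup.zpowers (g ^ M) := by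
  apply PC_mem_of_odd hx (hN.mul hM)
  obtain ⟨i, hi⟩ := h
  refine ⟨i, ?_⟩
  change (g ^ M) ^ i = _
  change g ^ i = _ at hi
  rw [pow_mul, ← hi, ← zpow_natCast, ← zpow_natCast, ← zpow_mul, ← zpow_mul, mul_comm]

theorem card_base {hp : p % 16 = 9} (hX : Chars hp χ1 χ2 χM)
    (hodd : ∀ m, Odd (Nat.card (ClassGroup (𝓞 (Lp p (m + 1))))))
    (hcard : ∀ n, Nat.card {c : ClassGroup (𝓞 (Lf p (n + 1))) // c ^ 2 = 1} ≤ 4) :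
    Nat.card (PC (ClassGroup (𝓞 (Lf p 1)))) = Nat.card (PC (ClassGroup (𝓞 (kf p)))) ∧
      8 ∣ Nat.card (PC (ClassGroup (𝓞 (kf p)))) := by
  have hp2 : p % 2 = 1 := by lia
  have hp4 : p % 4 = 1 := by lia
  obtain ⟨a, ha, ha2, hat⟩ := exists_a hX 0
  obtain ⟨τ, hτ, hτz⟩ := exists_tMf (p := p) hp2
  obtain ⟨χ, hχ1, hχ⟩ := exists_chik hp
  have hM := hodd 0
  have hA := adm_Lf hX 0 hM dvd_rfl ha ha2
  have hNq : nm (Mf p) (Lf p 1) (cl (QL hp (0 + 1)) ^ Nat.card (ClassGroup (𝓞 (Lp p (0 + 1))))) =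
      cl (QM hp) ^ Nat.card (ClassGroup (𝓞 (Lp p (0 + 1)))) := by
    rw [map_pow, nm_cl (QL_ne hp 1), rN_QM]
  have hNs : nm (kf p) (Mf p) (cl (QM hp) ^ Nat.card (ClassGroup (𝓞 (Lp p (0 + 1))))) ≠ 1 := by
    rw [map_pow, nm_cl (QM_ne hp)]
    exact cl_T hp (by rw [absNorm_rN, absNorm_QM]) hM
  have hs2 : (cl (QM hp) ^ Nat.card (ClassGroup (𝓞 (Lp p (0 + 1))))) ^ 2 = 1 := by
    rw [← hNq, ← map_pow, hA.q2, map_one]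
  have hs1 : cl (QM hp) ^ Nat.card (ClassGroup (𝓞 (Lp p (0 + 1)))) ≠ 1 := fun h =>
    hNs (by rw [h, map_one])
  have hb := PC_map (nm (Mf p) (Lf p 1)) ha
  have hχb : χM (nm (Mf p) (Lf p 1) a) = -1 := (hX.nmM a).trans ha2
  have h1 := base_step (N := nm (Mf p) (Lf p 1)) (j := jj (Mf p) (Lf p 1)) (t := act τ.toRingEquiv)
    (χM := χM) hτ.jj_nm (nm_act τ) hA hX.nmM (hcard 0) (card_Mf hp4) (hat _)
    (by rw [map_pow, act_cl _ (QL_ne hp _), t_QL1 hp hτz])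
    (by rw [hNq]; exact hs1)
    (fun x hx h => by
      rw [hNq]
      obtain ⟨N, hN, hxN⟩ := cap_Mf hp (odd_Qp hp4) x h
      exact mem_zpowers_odd hx hN hM hxN)
  have h2 := mk_step (N := nm (kf p) (Mf p)) (j := jj (kf p) (Mf p)) (fun x hx => jN_kM hp hx)
    (fun y => by rw [nm_jj, quad_kM hp2]) (card_Mf hp4) card_kf hb hχb hs2 hNs hχ1 hχ
  have h3 := (base_four (card_Mf hp4) hb hχb hs1 hs2
    (by rw [← hNq, hX.nmM, hA.q2'])).1
  rw [h2, hA.card (hcard 0), h1]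
  refine ⟨rfl, ?_⟩
  rw [show 8 = 2 * 4 by rfl]
  exact mul_dvd_mul_left 2 h3

theorem card_succ {hp : p % 16 = 9} (hX : Chars hp χ1 χ2 χM)
    (hodd : ∀ m, Odd (Nat.card (ClassGroup (𝓞 (Lp p (m + 1))))))
    (hcard : ∀ n, Nat.card {c : ClassGroup (𝓞 (Lf p (n + 1))) // c ^ 2 = 1} ≤ 4) (m : ℕ)
    (h8 : 8 ∣ Nat.card (PC (ClassGroup (𝓞 (Lf p (m + 1)))))) :
    Nat.card (PC (ClassGroup (𝓞 (Lf p (m + 1 + 1))))) =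
      2 * Nat.card (PC (ClassGroup (𝓞 (Lf p (m + 1))))) := by
  have hp2 : p % 2 = 1 := by lia
  obtain ⟨a, ha, ha2, -⟩ := exists_a hX (m + 1)
  obtain ⟨τ, hτ, hτz⟩ := exists_tLf (p := p) hp2 (m + 1)
  obtain ⟨M, hM, hd1, hd2⟩ : ∃ M, Odd M ∧ Nat.card (ClassGroup (𝓞 (Lp p (m + 1)))) ∣ M ∧
      Nat.card (ClassGroup (𝓞 (Lp p (m + 1 + 1)))) ∣ M :=
    ⟨_, (hodd m).mul (hodd (m + 1)), dvd_mul_right _ _, dvd_mul_left _ _⟩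
  have hA := adm_Lf hX (m + 1) hM hd2 ha ha2
  have hNq : nm (Lf p (m + 1)) (Lf p (m + 1 + 1)) (cl (QL hp (m + 1 + 1)) ^ M) =
      cl (QL hp (m + 1)) ^ M := by
    rw [map_pow, nm_cl (QL_ne hp _), rN_QL]
  have hB := adm_Lf hX m hM hd1 (PC_map (nm (Lf p (m + 1)) (Lf p (m + 1 + 1))) ha)
    ((hX.nm2 m a).trans ha2)
  have hcB := hB.card (hcard m)
  have h1 := growth (N := nm (Lf p (m + 1)) (Lf p (m + 1 + 1)))
    (j := jj (Lf p (m + 1)) (Lf p (m + 1 + 1))) (t := act τ.toRingEquiv) hτ.jj_nm (nm_act τ) hA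
    (χ1 := χ1 m) (χ2 := χ2 m) (by rw [hNq]; exact hB) (hcard (m + 1)) (by rw [hcB] at h8; lia)
    (fun x hx h => by
      rw [hNq]
      obtain ⟨N, hN, hxN⟩ := cap_Lf' hp (hodd m) x h
      exact mem_zpowers_odd hx hN hM hxN)
  rw [hcB, hA.card (hcard (m + 1)), h1]

theorem final_aux (hp : p % 16 = 9) (h24 : ∃ x : ZMod p, x ^ 4 = 2) (r : ℕ)
    (hr : 2 ^ r = Nat.card (PC (ClassGroup (𝓞 (kf p))))) (m : ℕ) :
    Nonempty (PC (ClassGroup (𝓞 (Lf p (m + 1)))) ≃* Multiplicative (ZMod (2 ^ (m + 1 + r - 2)) × ZMod 2)) := by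
  obtain ⟨χ1, χ2, χM, hX⟩ := exists_Chars hp h24
  obtain ⟨ι, z, hι⟩ := exists_iota (p := p) (by lia)
  have hodd := odd_Lp hι hp h24
  have hcard := card_Lf hι hp
  obtain ⟨hb, h8⟩ := card_base hX hodd hcard
  have key : ∀ m, Nat.card (PC (ClassGroup (𝓞 (Lf p (m + 1))))) = 2 ^ (m + r) := by
    intro m
    induction m with
    | zero => rw [zero_add, zero_add, hr]; exact hb
    | succ m ih =>
      rw [card_succ hX hodd hcard m, ih]
      · ring
      · rw [ih, pow_add, hr]; exact h8.mul_left _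
  obtain ⟨a, ha, ha2, -⟩ := exists_a hX m
  have hA := adm_Lf hX m (hodd m) dvd_rfl ha ha2
  have h1 := hA.card (hcard m)
  have h3 : 3 ≤ r := by
    rw [← hr] at h8
    exact (Nat.pow_dvd_pow_iff_le_right (x := 2) (by norm_num)).1 (by simpa using h8)
  rw [key, show m + r = (m + 1 + r - 2) + 1 by lia, pow_succ'] at h1
  have h2 : 2 ^ (m + 1 + r - 2) = orderOf a := by lia
  rw [h2]
  exact hA.equiv (hcard m)

end Final


/-- for a prime `p ≡ 9 (mod 16)` with `2` a fourth power residue mod `p`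
and `2^r = h₂(-2p)`, the 2-class group of `L_{n,p}` is
`ℤ/2^{n+r-2}ℤ × ℤ/2ℤ` for all `n ≥ 1`. -/
theorem twoClassGroup_Lfield_prime_nine_mod_sixteen
    (p : ℕ) (hp : p.Prime) (hp16 : p % 16 = 9)
    (h24 : ∃ x : ZMod p, x ^ 4 = 2)
    (r : ℕ) (hr : 2 ^ r = h2 (-2 * (p : ℤ))) :
    ∀ n : ℕ, 1 ≤ n →
      Nonempty ((twoClassGroup (Lfield n (p : ℤ))) ≃*
        Multiplicative (ZMod (2 ^ (n + r - 2)) × ZMod 2)) := by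
  intro n hn
  haveI : Fact p.Prime := ⟨hp⟩
  obtain ⟨m, rfl⟩ : ∃ m, n = m + 1 := ⟨n - 1, by lia⟩
  exact final_aux hp16 h24 r hr m
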